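/- Let Ω ⊆ ℝⁿ be a C² domain whose boundary ∂Ω is disconnected, let a : [0,∞) → ℝ be C¹ with locally Lipschitz derivative, a(t) > 0 and (t·a(t))′ > 0 for all t ≥ 0, let f ∈ C¹(ℝ), and let u ∈ C³(Ω) ∩ C²(cl Ω) be a non-constant stable weak solution of Δ_a u + f(u) = 0 in Ω, with u and ⟨∇u, η⟩ locally constant on ∂Ω and with moderate energy growth in Ω. Let ∂₁Ω and ∂₂Ω be two distinct connected components of ∂Ω, suppose that for j = 1, 2 there exists a unit vector X_j ∈ ℝⁿ with ⟨η, X_j⟩ ≥ 0 everywhere on ∂_jΩ and ⟨η, X_j⟩ not identically zero on ∂_jΩ, and suppose ⟨∇u, η⟩ = 0 on ∂Ω ∖ (∂₁Ω ∪ ∂₂Ω). Then: (1) if crit(u) ≠ ∅, then ∇u ≠ 0 at every point of ∂₁Ω ∪ ∂₂Ω; (2) if moreover there exists Γ ⊆ crit(u) such that Ω ∖ Γ is disconnected, then ∂₁Ω and ∂₂Ω are parallel affine hyperplanes, ∂Ω = ∂₁Ω ∪ ∂₂Ω, there exist a unit vector e ∈ ℝⁿ and a function u₀ : ℝ → ℝ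 with u(x) = u₀(⟨x, e⟩) for all x ∈ Ω, and crit(u) is an affine hyperplane parallel to ∂₁Ω and ∂₂Ω. -/

import Mathlib

open MeasureTheory Set Metric Filter
open scoped RealInnerProductSpace Topology ENNReal

noncomputable section

variable {n : ℕ}

/-- The quasilinear operator matrix `A(p)` applied to a vector `v`:
`A(p)v = a(|p|) v + (a'(|p|)/|p|) ⟨p,v⟩ p` (with the second term vanishing at `p = 0`). -/
def Aop (a : ℝ → ℝ) (p v : EuclideanSpace ℝ (Fin n)) : EuclideanSpace ℝ (Fin n) :=
  a ‖p‖ • v + ((deriv a ‖p‖ / ‖p‖) * ⟪p, v⟫) • p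

/-- `λ₁(t) = a(t) + t·a'(t) = (t a(t))'`. -/
def lam1 (a : ℝ → ℝ) (t : ℝ) : ℝ := a t + t * deriv a t

/-- `λ₂(t) = a(t)`. -/
def lam2 (a : ℝ → ℝ) (t : ℝ) : ℝ := a t

/-- `λmax(t) = max{λ₁(t), λ₂(t)}`. -/
def lamMax (a : ℝ → ℝ) (t : ℝ) : ℝ := max (lam1 a t) (lam2 a t)

/-- A Lipschitz test function with compact support contained in `Ω`. -/
def IsTestOn (Ω : Set (EuclideanSpace ℝ (Fin n))) (φ : EuclideanSpace ℝ (Fin n) → ℝ) : Prop :=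
  (∃ K, LipschitzWith K φ) ∧ HasCompactSupport φ ∧ tsupport φ ⊆ Ω

/-- `u` is a weak solution of `div(a(|∇u|)∇u) + f(u) = 0` in `Ω`. -/
def IsWeakSolution (a f : ℝ → ℝ) (Ω : Set (EuclideanSpace ℝ (Fin n)))
    (u : EuclideanSpace ℝ (Fin n) → ℝ) : Prop :=
  ∀ φ : EuclideanSpace ℝ (Fin n) → ℝ, IsTestOn Ω φ →
    ∫ x in Ω, a ‖gradient u x‖ * ⟪gradient u x, gradient φ x⟫
      = ∫ x in Ω, f (u x) * φ x

/-- The stability inequality for a solution `u`. -/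
def IsStable (a f : ℝ → ℝ) (Ω : Set (EuclideanSpace ℝ (Fin n)))
    (u : EuclideanSpace ℝ (Fin n) → ℝ) : Prop :=
  ∀ φ : EuclideanSpace ℝ (Fin n) → ℝ, IsTestOn Ω φ →
    ∫ x in Ω, deriv f (u x) * φ x ^ 2
      ≤ ∫ x in Ω, ⟪Aop a (gradient u x) (gradient φ x), gradient φ x⟫

/-- `u` has moderate energy growth in `Ω₀`. -/
def ModerateEnergyGrowth (a : ℝ → ℝ) (u : EuclideanSpace ℝ (Fin n) → ℝ)
    (Ω₀ : Set (EuclideanSpace ℝ (Fin n))) : Prop :=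
  ∃ φ : ℕ → EuclideanSpace ℝ (Fin n) → ℝ,
    (∀ j, ∃ K, LipschitzWith K (φ j)) ∧
    (∀ j, HasCompactSupport (φ j)) ∧
    (∀ j x, 0 ≤ φ j x) ∧
    (∀ K : Set (EuclideanSpace ℝ (Fin n)), IsCompact K → K ⊆ closure Ω₀ →
      TendstoUniformlyOn (fun j => φ j) (fun _ => (1 : ℝ)) atTop K) ∧
    Tendsto (fun j => ∫ x in Ω₀, ‖gradient u x‖ ^ 2 *
        ⟪Aop a (gradient u x) (gradient (φ j) x), gradient (φ j) x⟫)
      atTop (nhds 0)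

/-- A `C^k` domain: nonempty, open, connected, with boundary locally given by a regular
`C^k` defining function. -/
def IsCkDomain (k : ℕ∞) (Ω : Set (EuclideanSpace ℝ (Fin n))) : Prop :=
  Ω.Nonempty ∧ IsOpen Ω ∧ IsConnected Ω ∧
    ∀ p ∈ frontier Ω, ∃ V : Set (EuclideanSpace ℝ (Fin n)),
      ∃ g : EuclideanSpace ℝ (Fin n) → ℝ,
        IsOpen V ∧ p ∈ V ∧ ContDiffOn ℝ k g V ∧ (∀ x ∈ V, gradient g x ≠ 0) ∧
        Ω ∩ V = {x ∈ V | g x < 0}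

/-- A `C^k` domain together with its interior unit normal field `η`. -/
def IsCkDomainWithNormal (k : ℕ∞) (Ω : Set (EuclideanSpace ℝ (Fin n)))
    (η : EuclideanSpace ℝ (Fin n) → EuclideanSpace ℝ (Fin n)) : Prop :=
  Ω.Nonempty ∧ IsOpen Ω ∧ IsConnected Ω ∧
    ∀ p ∈ frontier Ω, ∃ V : Set (EuclideanSpace ℝ (Fin n)),
      ∃ g : EuclideanSpace ℝ (Fin n) → ℝ,
        IsOpen V ∧ p ∈ V ∧ ContDiffOn ℝ k g V ∧ (∀ x ∈ V, gradient g x ≠ 0) ∧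
        Ω ∩ V = {x ∈ V | g x < 0} ∧
        η p = -(‖gradient g p‖⁻¹ • gradient g p)

/-- `a ∈ C^{1,1}_loc([0,∞))`: `C¹` on `[0,∞)` with locally Lipschitz derivative. -/
def C11Loc (a : ℝ → ℝ) : Prop :=
  ContDiffOn ℝ 1 a (Ici 0) ∧
    ∀ t ∈ Ici (0 : ℝ), ∃ V ∈ 𝓝[Ici (0 : ℝ)] t, ∃ K, LipschitzOnWith K (deriv a) V


abbrev Eu (n : ℕ) := EuclideanSpace ℝ (Fin n)


section

/-- The operator `A(p)` as a continuous linear map. -/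
def AL (a : ℝ → ℝ) (p : Eu n) : Eu n →L[ℝ] Eu n :=
  a ‖p‖ • ContinuousLinearMap.id ℝ (Eu n)
    + (deriv a ‖p‖ / ‖p‖) • (innerSL ℝ p).smulRight p

lemma AL_apply (a : ℝ → ℝ) (p v : Eu n) : AL a p v = Aop a p v := by
  simp [AL, Aop, smul_smul]

lemma AL_zero (a : ℝ → ℝ) : AL a (0 : Eu n) = a 0 • ContinuousLinearMap.id ℝ (Eu n) := by
  simp [AL]

lemma AL_symm (a : ℝ → ℝ) (p v w : Eu n) : ⟪AL a p v, w⟫ = ⟪v, AL a p w⟫ := by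
  simp only [AL_apply, Aop, inner_add_left, inner_add_right, inner_smul_left, inner_smul_right]
  simp only [RCLike.conj_to_real, real_inner_comm p w, real_inner_comm v p]
  rw [real_inner_comm p v]
  ring

/-- ellipticity function -/
def ell (a : ℝ → ℝ) (p : Eu n) : ℝ := min (a ‖p‖) (lam1 a ‖p‖)

lemma ell_pos {a : ℝ → ℝ} (hapos : ∀ t ≥ (0 : ℝ), 0 < a t) (hlam : ∀ t ≥ (0 : ℝ), 0 < lam1 a t)
    (p : Eu n) : 0 < ell a p :=
  lt_min (hapos _ (norm_nonneg _)) (hlam _ (norm_nonneg _))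

lemma ell_le (a : ℝ → ℝ) (p v : Eu n) : ell a p * ‖v‖ ^ 2 ≤ ⟪AL a p v, v⟫ := by
  have e : ⟪AL a p v, v⟫ = a ‖p‖ * ‖v‖ ^ 2 + (deriv a ‖p‖ / ‖p‖) * ⟪p, v⟫ ^ 2 := by
    simp only [AL_apply, Aop, inner_add_left, inner_smul_left, RCLike.conj_to_real,
      real_inner_self_eq_norm_sq]
    ring
  rw [e]
  by_cases hp : p = 0
  · subst hp
    simp only [ell, norm_zero, div_zero, zero_mul, add_zero]
    gcongr
    exact min_le_left _ _
  have hp' : 0 < ‖p‖ := norm_pos_iff.2 hp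
  have hcs : ⟪p, v⟫ ^ 2 ≤ ‖p‖ ^ 2 * ‖v‖ ^ 2 := by
    have := abs_real_inner_le_norm p v
    rw [← mul_pow, ← sq_abs]
    gcongr
  -- write s = ⟪p,v⟫^2/‖p‖^2
  set s := ⟪p, v⟫ ^ 2 / ‖p‖ ^ 2 with hs
  have hs0 : 0 ≤ s := by positivity
  have hs1 : s ≤ ‖v‖ ^ 2 := by
    rw [hs, div_le_iff₀ (by positivity)]; linarith
  have e2 : (deriv a ‖p‖ / ‖p‖) * ⟪p, v⟫ ^ 2 = ‖p‖ * deriv a ‖p‖ * s := by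
    rw [hs]; field_simp
  rw [e2]
  have h1 : ell a p ≤ a ‖p‖ := min_le_left _ _
  have h2 : ell a p ≤ a ‖p‖ + ‖p‖ * deriv a ‖p‖ := min_le_right _ _
  nlinarith

lemma C11_deriv_contOn {a : ℝ → ℝ} (ha : C11Loc a) : ContinuousOn (deriv a) (Ici 0) := by
  have : LocallyLipschitzOn (Ici 0) (deriv a) := by
    intro t ht
    obtain ⟨V, hV, K, hK⟩ := ha.2 t ht
    exact ⟨K, V, hV, hK⟩
  exact this.continuousOn

lemma C11_deriv_lip {a : ℝ → ℝ} (ha : C11Loc a) (R : ℝ) :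
    ∃ K : NNReal, LipschitzOnWith K (deriv a) (Icc 0 R) := by
  have : LocallyLipschitzOn (Icc 0 R) (deriv a) := by
    intro t ht
    obtain ⟨V, hV, K, hK⟩ := ha.2 t ht.1
    exact ⟨K, V, nhdsWithin_mono _ (fun x hx => hx.1) hV, hK⟩
  exact this.exists_lipschitzOnWith_of_compact isCompact_Icc

lemma C11_hasDeriv {a : ℝ → ℝ} (ha : C11Loc a) {t : ℝ} (ht : 0 < t) :
    HasDerivAt a (deriv a t) t := by
  have := (ha.1.contDiffAt (Ici_mem_nhds ht)).differentiableAt (by norm_num)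
  exact this.hasDerivAt

lemma C11_bound {a : ℝ → ℝ} (ha : C11Loc a) (R : ℝ) :
    ∃ M : ℝ, 0 ≤ M ∧ ∀ t ∈ Icc 0 R, |deriv a t| ≤ M := by
  obtain ⟨M, hM⟩ := isCompact_Icc.exists_bound_of_continuousOn
    ((C11_deriv_contOn ha).mono (fun x (hx : x ∈ Icc 0 R) => hx.1))
  exact ⟨max M 0, le_max_right _ _, fun t ht => (hM t ht).trans (le_max_left _ _)⟩

lemma C11_lip {a : ℝ → ℝ} (ha : C11Loc a) (R : ℝ) :
    ∃ M : ℝ, 0 ≤ M ∧ ∀ s ∈ Icc 0 R, ∀ t ∈ Icc 0 R, |a s - a t| ≤ M * |s - t| := by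
  obtain ⟨M, hM0, hM⟩ := C11_bound ha R
  refine ⟨M, hM0, ?_⟩
  have key : ∀ s ∈ Icc 0 R, ∀ t ∈ Icc 0 R, s ≤ t → |a t - a s| ≤ M * |t - s| := by
    intro s hs t ht hst
    have hc : ContinuousOn a (Icc s t) := ha.1.continuousOn.mono (fun x hx => hs.1.trans hx.1)
    have := image_norm_le_of_norm_deriv_right_le_deriv_boundary (f := fun x => a x - a s)
      (f' := deriv a) (a := s) (b := t) (B := fun x => M * (x - s)) (B' := fun _ => M)
      (hc.sub continuousOn_const) ?_ (by simp) ?_ ?_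
    · have h := this ⟨hst, le_rfl⟩
      rw [abs_of_nonneg (sub_nonneg.2 hst)]
      exact h
    · intro x hx
      rcases (hs.1.trans hx.1).eq_or_lt with h0 | h0
      · -- x = 0 : one sided derivative
        subst h0
        have hd : DifferentiableWithinAt ℝ a (Ici 0) 0 :=
          (ha.1.differentiableOn (by norm_num)) 0 self_mem_Ici
        have h1 := hasDerivWithinAt_Ici_of_tendsto_deriv (s := Ioi (0:ℝ)) (e := deriv a 0) (a := 0) (f := a)
          (fun y hy => (C11_hasDeriv ha hy).differentiableAt.differentiableWithinAt)
          ((ha.1.continuousOn 0 self_mem_Ici).mono Ioi_subset_Ici_self) self_mem_nhdsWithin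
          (((C11_deriv_contOn ha) 0 self_mem_Ici).mono Ioi_subset_Ici_self)
        exact h1.sub_const _
      · exact ((C11_hasDeriv ha h0).hasDerivWithinAt).sub_const _
    · intro x
      simpa using ((hasDerivAt_id x).sub_const s).const_mul M
    · intro x hx
      exact hM x ⟨hs.1.trans hx.1, hx.2.le.trans ht.2⟩
  intro s hs t ht
  rcases le_total s t with h | h
  · rw [abs_sub_comm, abs_sub_comm s t]; exact key s hs t ht h
  · exact key t ht s hs h

lemma rad_lip (p q v : Eu n) :
    ‖(⟪p, v⟫ / ‖p‖) • p - (⟪q, v⟫ / ‖q‖) • q‖ ≤ 3 * ‖p - q‖ * ‖v‖ := by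
  by_cases hp : p = 0
  · subst hp
    simp only [inner_zero_left, zero_div, zero_smul, zero_sub, norm_neg, norm_smul]
    by_cases hq : q = 0
    · subst hq; simp
    have hq' : 0 < ‖q‖ := norm_pos_iff.2 hq
    have : ‖⟪q, v⟫ / ‖q‖‖ * ‖q‖ = |⟪q, v⟫| := by
      rw [norm_div, norm_norm, div_mul_cancel₀ _ hq'.ne']; rfl
    rw [this]
    have := abs_real_inner_le_norm q v
    nlinarith [norm_nonneg q, norm_nonneg v, mul_nonneg (norm_nonneg q) (norm_nonneg v)]
  by_cases hq : q = 0
  · subst hq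
    simp only [inner_zero_left, zero_div, zero_smul, sub_zero, norm_smul]
    have hq' : 0 < ‖p‖ := norm_pos_iff.2 hp
    have : ‖⟪p, v⟫ / ‖p‖‖ * ‖p‖ = |⟪p, v⟫| := by
      rw [norm_div, norm_norm, div_mul_cancel₀ _ hq'.ne']; rfl
    rw [this]
    have := abs_real_inner_le_norm p v
    nlinarith [norm_nonneg p, norm_nonneg v, mul_nonneg (norm_nonneg p) (norm_nonneg v)]
  have hp' : 0 < ‖p‖ := norm_pos_iff.2 hp
  have hq' : 0 < ‖q‖ := norm_pos_iff.2 hq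
  have e : (⟪p, v⟫ / ‖p‖) • p - (⟪q, v⟫ / ‖q‖) • q
      = (⟪p, v⟫ / ‖p‖) • (p - q) + (⟪p - q, v⟫ / ‖q‖) • q
        + (⟪p, v⟫ * (‖q‖ - ‖p‖) / (‖p‖ * ‖q‖)) • q := by
    have : (⟪p, v⟫ * (‖q‖ - ‖p‖) / (‖p‖ * ‖q‖)) = ⟪p, v⟫ / ‖p‖ - ⟪p, v⟫ / ‖q‖ := by
      field_simp
    rw [this, inner_sub_left, sub_div, smul_sub, sub_smul, sub_smul]
    abel
  rw [e]
  have hpv := abs_real_inner_le_norm p v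
  have hpqv := abs_real_inner_le_norm (p - q) v
  have hpq := abs_norm_sub_norm_le q p
  rw [norm_sub_rev] at hpq
  have b1 : ‖(⟪p, v⟫ / ‖p‖) • (p - q)‖ ≤ ‖v‖ * ‖p - q‖ := by
    rw [norm_smul, norm_div, norm_norm]
    gcongr
    rw [div_le_iff₀ hp', Real.norm_eq_abs]; linarith
  have b2 : ‖(⟪p - q, v⟫ / ‖q‖) • q‖ ≤ ‖v‖ * ‖p - q‖ := by
    rw [norm_smul, norm_div, norm_norm, div_mul_cancel₀ _ hq'.ne', Real.norm_eq_abs]; linarith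
  have b3 : ‖(⟪p, v⟫ * (‖q‖ - ‖p‖) / (‖p‖ * ‖q‖)) • q‖ ≤ ‖v‖ * ‖p - q‖ := by
    rw [norm_smul, norm_div, norm_mul, norm_mul, norm_norm, norm_norm, Real.norm_eq_abs, Real.norm_eq_abs]
    rw [show |⟪p, v⟫| * |‖q‖ - ‖p‖| / (‖p‖ * ‖q‖) * ‖q‖ = |⟪p, v⟫| * |‖q‖ - ‖p‖| / ‖p‖ by
      field_simp]
    rw [div_le_iff₀ hp']
    calc |⟪p, v⟫| * |‖q‖ - ‖p‖| ≤ (‖p‖ * ‖v‖) * ‖p - q‖ := by gcongr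
      _ = _ := by ring
  calc _ ≤ _ := norm_add₃_le
    _ ≤ 3 * ‖p - q‖ * ‖v‖ := by linarith

lemma AL_lip {a : ℝ → ℝ} (ha : C11Loc a) (R : ℝ) :
    ∃ L : ℝ, 0 ≤ L ∧ ∀ p q : Eu n, ‖p‖ ≤ R → ‖q‖ ≤ R → ‖AL a p - AL a q‖ ≤ L * ‖p - q‖ := by
  obtain ⟨M1, hM10, hM1⟩ := C11_lip ha R
  obtain ⟨M2, hM20, hM2⟩ := C11_bound ha R
  obtain ⟨K, hK⟩ := C11_deriv_lip ha R
  refine ⟨M1 + K * |R| + 3 * M2, by positivity, ?_⟩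
  intro p q hp hq
  have hpI : ‖p‖ ∈ Icc 0 R := ⟨norm_nonneg _, hp⟩
  have hqI : ‖q‖ ∈ Icc 0 R := ⟨norm_nonneg _, hq⟩
  refine ContinuousLinearMap.opNorm_le_bound _ (by positivity) (fun v => ?_)
  have e : (AL a p - AL a q) v = (a ‖p‖ - a ‖q‖) • v
      + (deriv a ‖p‖ - deriv a ‖q‖) • ((⟪p, v⟫ / ‖p‖) • p)
      + deriv a ‖q‖ • ((⟪p, v⟫ / ‖p‖) • p - (⟪q, v⟫ / ‖q‖) • q) := by
    have h1 : (deriv a ‖p‖ / ‖p‖) * ⟪p, v⟫ = deriv a ‖p‖ * (⟪p, v⟫ / ‖p‖) := by ring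
    have h2 : (deriv a ‖q‖ / ‖q‖) * ⟪q, v⟫ = deriv a ‖q‖ * (⟪q, v⟫ / ‖q‖) := by ring
    rw [sub_apply, AL_apply, AL_apply, Aop, Aop, h1, h2]
    module
  rw [e]
  have hpq := abs_norm_sub_norm_le p q
  have b1 : ‖(a ‖p‖ - a ‖q‖) • v‖ ≤ M1 * ‖p - q‖ * ‖v‖ := by
    rw [norm_smul, Real.norm_eq_abs]
    gcongr
    exact (hM1 _ hpI _ hqI).trans (by gcongr)
  have b2 : ‖(deriv a ‖p‖ - deriv a ‖q‖) • ((⟪p, v⟫ / ‖p‖) • p)‖ ≤ K * |R| * ‖p - q‖ * ‖v‖ := by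
    have h1 : ‖(⟪p, v⟫ / ‖p‖) • p‖ ≤ |R| * ‖v‖ := by
      by_cases hp0 : p = 0
      · subst hp0; simp; positivity
      have hp' : 0 < ‖p‖ := norm_pos_iff.2 hp0
      rw [norm_smul, norm_div, norm_norm, div_mul_cancel₀ _ hp'.ne', Real.norm_eq_abs]
      exact (abs_real_inner_le_norm p v).trans (by gcongr; exact hp.trans (le_abs_self R))
    have h2 : ‖deriv a ‖p‖ - deriv a ‖q‖‖ ≤ K * ‖p - q‖ := by
      have := hK.dist_le_mul _ hpI _ hqI
      rw [dist_eq_norm, Real.dist_eq] at this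
      exact this.trans (by gcongr)
    rw [norm_smul]
    calc _ ≤ (K * ‖p - q‖) * (|R| * ‖v‖) := by gcongr
      _ = _ := by ring
  have b3 : ‖deriv a ‖q‖ • ((⟪p, v⟫ / ‖p‖) • p - (⟪q, v⟫ / ‖q‖) • q)‖
      ≤ 3 * M2 * ‖p - q‖ * ‖v‖ := by
    rw [norm_smul]
    calc _ ≤ M2 * (3 * ‖p - q‖ * ‖v‖) := by
          gcongr
          · exact hM2 _ hqI
          · exact rad_lip p q v
      _ = _ := by ring
  calc _ ≤ _ := norm_add₃_le
    _ ≤ _ := by linarith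

lemma AL_cont {a : ℝ → ℝ} (ha : C11Loc a) : Continuous (AL a : Eu n → _) := by
  rw [continuous_iff_continuousAt]
  intro p
  obtain ⟨L, hL0, hL⟩ := AL_lip (n := n) ha (‖p‖ + 1)
  rw [ContinuousAt, tendsto_iff_norm_sub_tendsto_zero]
  have h1 : Tendsto (fun q => L * ‖q - p‖) (𝓝 p) (𝓝 0) := by
    have : Continuous (fun q : Eu n => L * ‖q - p‖) := by fun_prop
    have h := this.tendsto p
    simpa using h
  refine squeeze_zero' (Eventually.of_forall fun q => norm_nonneg _) ?_ h1
  filter_upwards [Metric.ball_mem_nhds p one_pos] with q hq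
  apply hL
  · have := norm_sub_norm_le q p
    rw [mem_ball, dist_eq_norm] at hq
    linarith
  · linarith

lemma a_norm_cont {a : ℝ → ℝ} (ha : C11Loc a) : Continuous (fun p : Eu n => a ‖p‖) :=
  ha.1.continuousOn.comp_continuous continuous_norm (fun p => norm_nonneg p)

lemma ell_cont {a : ℝ → ℝ} (ha : C11Loc a) : Continuous (ell a : Eu n → ℝ) := by
  have h1 := a_norm_cont (n := n) ha
  have h2 : Continuous (fun p : Eu n => deriv a ‖p‖) :=
    (C11_deriv_contOn ha).comp_continuous continuous_norm (fun p => norm_nonneg p)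
  exact h1.min (h1.add (continuous_norm.mul h2))

lemma F_hasFDeriv {a : ℝ → ℝ} (ha : C11Loc a) (p : Eu n) :
    HasFDerivAt (fun p : Eu n => a ‖p‖ • p) (AL a p) p := by
  by_cases hp : p = 0
  · subst hp
    rw [AL_zero]
    rw [hasFDerivAt_iff_isLittleO_nhds_zero]
    simp only [zero_add, norm_zero, smul_zero, sub_zero, smul_apply,
      ContinuousLinearMap.id_apply, ← sub_smul]
    have h1 : Tendsto (fun h : Eu n => a ‖h‖ - a 0) (𝓝 0) (𝓝 0) := by
      have h0 : Continuous (fun h : Eu n => a ‖h‖ - a 0) :=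
        (a_norm_cont (n := n) ha).sub continuous_const
      have := h0.tendsto 0
      simpa using this
    have h2 : (fun h : Eu n => a ‖h‖ - a 0) =o[𝓝 0] (fun _ => (1 : ℝ)) := by
      rw [Asymptotics.isLittleO_one_iff]; exact h1
    have := h2.smul_isBigO (Asymptotics.isBigO_refl (fun h : Eu n => h) (𝓝 0))
    simpa using this
  · have hp' : 0 < ‖p‖ := norm_pos_iff.2 hp
    have hn : HasFDerivAt (fun q : Eu n => ‖q‖) ((1 / ‖p‖) • innerSL ℝ p) p := by
      have h1 : HasFDerivAt (fun q : Eu n => ‖q‖ ^ 2) (2 • innerSL ℝ p) p :=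
        (hasStrictFDerivAt_norm_sq p).hasFDerivAt
      have h2 := h1.sqrt (by positivity)
      have e : (fun q : Eu n => Real.sqrt (‖q‖ ^ 2)) = fun q => ‖q‖ := by
        ext q; exact Real.sqrt_sq (norm_nonneg q)
      rw [e] at h2
      refine h2.congr_fderiv ?_
      rw [Real.sqrt_sq hp'.le]
      refine ContinuousLinearMap.ext fun v => ?_
      simp only [smul_apply, innerSL_apply_apply, smul_eq_mul, nsmul_eq_mul, Nat.cast_ofNat]
      field_simp
    have h3 := (C11_hasDeriv ha hp').comp_hasFDerivAt p hn
    have h4 := h3.smul (hasFDerivAt_id p)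
    refine h4.congr_fderiv ?_
    refine ContinuousLinearMap.ext fun v => ?_
    rw [AL_apply, Aop]
    simp only [Function.comp, id, add_apply, smul_apply, ContinuousLinearMap.smulRight_apply, innerSL_apply_apply, ContinuousLinearMap.id_apply, smul_eq_mul]
    congr 2
    ring

end


section

/-! ### General helpers -/

lemma lip_of_cpt {O K : Set (Eu n)} {ψ : Eu n → ℝ} (hO : IsOpen O) (hK : IsCompact K) (hKO : K ⊆ O)
    (h0 : ∀ x ∉ K, ψ x = 0) (hL : LocallyLipschitzOn O ψ) : ∃ C, LipschitzWith C ψ := by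
  obtain ⟨δ, hδ, hδO⟩ := hK.exists_cthickening_subset_open hO hKO
  have hK' : IsCompact (cthickening δ K) := hK.cthickening
  obtain ⟨C1, hC1⟩ := (hL.mono hδO).exists_lipschitzOnWith_of_compact hK'
  obtain ⟨B, hB⟩ := hK.exists_bound_of_continuousOn (hL.continuousOn.mono hKO)
  have hB' : ∀ x, |ψ x| ≤ |B| := by
    intro x
    by_cases hx : x ∈ K
    · exact (hB x hx).trans (le_abs_self B)
    · rw [h0 x hx, abs_zero]; positivity
  have key : ∀ x y, x ∈ K → dist (ψ x) (ψ y) ≤ (C1 + |B| / δ) * dist x y := by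
    intro x y hx
    have hd := dist_nonneg (x := x) (y := y)
    by_cases hy : y ∈ cthickening δ K
    · calc _ ≤ C1 * dist x y := hC1.dist_le_mul _ (self_subset_cthickening K hx) _ hy
        _ ≤ _ := by
          gcongr
          have : 0 ≤ |B| / δ := by positivity
          linarith
    · have hyK : y ∉ K := fun h => hy (self_subset_cthickening K h)
      rw [h0 y hyK, Real.dist_eq, sub_zero]
      have h1 : δ ≤ dist x y := by
        by_contra! h
        exact hy (mem_cthickening_of_dist_le y x δ K hx (by rw [dist_comm]; exact h.le))
      calc |ψ x| ≤ |B| / δ * δ := by rw [div_mul_cancel₀ _ hδ.ne']; exact hB' x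
        _ ≤ |B| / δ * dist x y := by gcongr
        _ ≤ _ := by gcongr; simp
  refine ⟨C1 + Real.toNNReal (|B| / δ), LipschitzWith.of_dist_le_mul fun x y => ?_⟩
  have e : ((C1 + Real.toNNReal (|B| / δ) : NNReal) : ℝ) = C1 + |B| / δ := by
    rw [NNReal.coe_add, Real.coe_toNNReal _ (by positivity)]
  rw [e]
  by_cases hx : x ∈ K
  · exact key x y hx
  by_cases hy : y ∈ K
  · rw [dist_comm, dist_comm x y]; exact key y x hy
  rw [h0 x hx, h0 y hy, dist_self]; positivity

lemma test_of_cpt {O K : Set (Eu n)} {ψ : Eu n → ℝ} (hO : IsOpen O) (hK : IsCompact K) (hKO : K ⊆ O)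
    (h0 : ∀ x ∉ K, ψ x = 0) (hL : LocallyLipschitzOn O ψ) : IsTestOn O ψ := by
  have hs : tsupport ψ ⊆ K := closure_minimal (fun x hx => by
    by_contra h; exact hx (h0 x h)) hK.isClosed
  exact ⟨lip_of_cpt hO hK hKO h0 hL, hK.of_isClosed_subset (isClosed_tsupport ψ) hs, hs.trans hKO⟩

lemma IsTestOn.mono {O O' : Set (Eu n)} {ψ : Eu n → ℝ} (h : IsTestOn O ψ) (hO : O ⊆ O') :
    IsTestOn O' ψ := ⟨h.1, h.2.1, h.2.2.trans hO⟩

lemma grad_zero_of_nonneg {ψ : Eu n → ℝ} {x : Eu n} (h : ∀ᶠ y in 𝓝 x, 0 ≤ ψ y) (h0 : ψ x = 0) :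
    gradient ψ x = 0 := by
  have : IsLocalMin ψ x := by
    filter_upwards [h] with y hy
    rw [h0]; exact hy
  have := this.fderiv_eq_zero
  simp [gradient, this]

lemma hasGrad {ψ : Eu n → ℝ} {x : Eu n} (h : DifferentiableAt ℝ ψ x) :
    HasGradientAt ψ (gradient ψ x) x := h.hasGradientAt

lemma grad_of_hasFDeriv {ψ : Eu n → ℝ} {x v : Eu n} {L : Eu n →L[ℝ] ℝ} (h : HasFDerivAt ψ L x)
    (hv : ∀ w, L w = ⟪v, w⟫) : gradient ψ x = v := by
  apply ext_inner_right ℝ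
  intro w
  rw [inner_gradient_left, h.fderiv, hv]

lemma grad_mul {f g : Eu n → ℝ} {x : Eu n} (hf : DifferentiableAt ℝ f x) (hg : DifferentiableAt ℝ g x) :
    gradient (fun y => f y * g y) x = f x • gradient g x + g x • gradient f x := by
  refine grad_of_hasFDeriv (hf.hasFDerivAt.mul hg.hasFDerivAt) (fun w => ?_)
  simp [inner_add_left, inner_smul_left, inner_gradient_left]

lemma grad_add {f g : Eu n → ℝ} {x : Eu n} (hf : DifferentiableAt ℝ f x) (hg : DifferentiableAt ℝ g x) :
    gradient (fun y => f y + g y) x = gradient f x + gradient g x := by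
  refine grad_of_hasFDeriv (hf.hasFDerivAt.add hg.hasFDerivAt) (fun w => ?_)
  simp [inner_add_left, inner_gradient_left]

lemma grad_sub {f g : Eu n → ℝ} {x : Eu n} (hf : DifferentiableAt ℝ f x) (hg : DifferentiableAt ℝ g x) :
    gradient (fun y => f y - g y) x = gradient f x - gradient g x := by
  refine grad_of_hasFDeriv (hf.hasFDerivAt.sub hg.hasFDerivAt) (fun w => ?_)
  simp [inner_sub_left, inner_gradient_left]

lemma grad_const_mul {f : Eu n → ℝ} {x : Eu n} (c : ℝ) (hf : DifferentiableAt ℝ f x) :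
    gradient (fun y => c * f y) x = c • gradient f x := by
  refine grad_of_hasFDeriv (hf.hasFDerivAt.const_mul c) (fun w => ?_)
  simp [inner_smul_left, inner_gradient_left]

lemma grad_comp {f : Eu n → ℝ} {x : Eu n} {h : ℝ → ℝ} {h' : ℝ} (hh : HasDerivAt h h' (f x))
    (hf : DifferentiableAt ℝ f x) :
    gradient (fun y => h (f y)) x = h' • gradient f x := by
  refine grad_of_hasFDeriv (hh.comp_hasFDerivAt x hf.hasFDerivAt) (fun w => ?_)
  simp [inner_smul_left, inner_gradient_left]

lemma grad_norm_eq (f : Eu n → ℝ) (x : Eu n) : ‖gradient f x‖ = ‖fderiv ℝ f x‖ := by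
  simp [gradient]

lemma grad_norm_le {f : Eu n → ℝ} {K : NNReal} (hf : LipschitzWith K f) (x : Eu n) :
    ‖gradient f x‖ ≤ K := by
  rw [grad_norm_eq]; exact norm_fderiv_le_of_lipschitz ℝ hf

lemma grad_meas (f : Eu n → ℝ) : Measurable (gradient f) := by
  unfold gradient
  exact (InnerProductSpace.toDual ℝ (Eu n)).symm.continuous.measurable.comp (measurable_fderiv ℝ f)

lemma grad_zero_off {ψ : Eu n → ℝ} {x : Eu n} (h : x ∉ tsupport ψ) : gradient ψ x = 0 := by
  have h1 : ψ =ᶠ[𝓝 x] fun _ => 0 := notMem_tsupport_iff_eventuallyEq.1 h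
  rw [h1.gradient_eq]; simp

lemma intg {Ω K : Set (Eu n)} (hΩ : MeasurableSet Ω) (hK : IsCompact K) {g : Eu n → ℝ}
    (hm : AEStronglyMeasurable g (volume.restrict Ω)) (C : ℝ)
    (hb : ∀ x ∈ Ω, x ∈ K → ‖g x‖ ≤ C) (h0 : ∀ x ∈ Ω, x ∉ K → g x = 0) : IntegrableOn g Ω := by
  have hi : Integrable (K.indicator fun _ => C) (volume : Measure (Eu n)) :=
    (integrableOn_const (hK.measure_lt_top.ne)).integrable_indicator hK.measurableSet
  refine (hi.restrict (s := Ω)).mono' hm ?_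
  rw [ae_restrict_iff' hΩ]
  refine Eventually.of_forall fun x hx => ?_
  by_cases h : x ∈ K
  · rw [indicator_of_mem h]; exact hb x hx h
  · rw [indicator_of_notMem h, h0 x hx h, norm_zero]

/-- divergence bound -/
lemma div_bound {V : Eu n → Eu n} {ψ : Eu n → ℝ} {S : Set (Eu n)} {L : NNReal} {C : NNReal}
    (hV : LipschitzOnWith L V S) (hψ : LipschitzWith C ψ) (hc : HasCompactSupport ψ)
    (hψ0 : ∀ x, 0 ≤ ψ x) (hS : ∀ x, 0 < ψ x → x ∈ S) :
    |∫ x, ⟪V x, gradient ψ x⟫| ≤ n * L * ∫ x, ψ x := by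
  have hg0 : ∀ x ∉ S, gradient ψ x = 0 := fun x hx =>
    grad_zero_of_nonneg (Eventually.of_forall hψ0) (le_antisymm (not_lt.1 fun h => hx (hS x h)) (hψ0 x))
  have hext : ∀ i : Fin n, ∃ W : Eu n → ℝ, LipschitzWith L W ∧ EqOn (fun x => V x i) W S := by
    intro i
    have : LipschitzOnWith L (fun x => V x i) S := by
      refine LipschitzOnWith.of_dist_le_mul fun x hx y hy => ?_
      refine le_trans ?_ (hV.dist_le_mul x hx y hy)
      rw [dist_eq_norm, dist_eq_norm]
      exact PiLp.norm_apply_le (V x - V y) i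
    exact this.extend_real
  choose W hWL hWe using hext
  have hψcont := hψ.continuous
  have hψint : Integrable ψ := hψcont.integrable_of_hasCompactSupport hc
  set ei : Fin n → Eu n := fun i => EuclideanSpace.single i (1 : ℝ) with hei
  have hnei : ∀ i, ‖ei i‖ = 1 := fun i => by simp [ei]
  have hgi : ∀ x i, gradient ψ x i = fderiv ℝ ψ x (ei i) := by
    intro x i
    rw [← inner_gradient_left, EuclideanSpace.inner_single_right]
    simp
  -- integrability
  have hintg : ∀ i, Integrable (fun x => W i x * fderiv ℝ ψ x (ei i)) := by
    intro i
    have hcs : HasCompactSupport (fun x => fderiv ℝ ψ x (ei i)) := hc.fderiv_apply ℝ (ei i)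
    obtain ⟨B, hB⟩ := (hc.isCompact).exists_bound_of_continuousOn ((hWL i).continuous.continuousOn)
    rw [← integrableOn_univ]
    refine intg MeasurableSet.univ hc.isCompact ?_ (|B| * C) ?_ ?_
    · exact ((hWL i).continuous.aestronglyMeasurable).mul
        ((measurable_fderiv_apply_const ℝ ψ (ei i)).aestronglyMeasurable)
    · intro x _ hx
      rw [norm_mul]
      gcongr
      · exact (hB x hx).trans (le_abs_self B)
      · calc _ ≤ ‖fderiv ℝ ψ x‖ * ‖ei i‖ := ContinuousLinearMap.le_opNorm _ _
          _ ≤ C := by rw [hnei, mul_one]; exact norm_fderiv_le_of_lipschitz ℝ hψ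
    · intro x _ hx
      have := grad_zero_off hx
      rw [← hgi, this]; simp
  have e1 : ∀ x, ⟪V x, gradient ψ x⟫ = ∑ i, W i x * fderiv ℝ ψ x (ei i) := by
    intro x
    by_cases hx : x ∈ S
    · rw [PiLp.inner_apply]
      refine Finset.sum_congr rfl fun i _ => ?_
      have h1 : V x i = W i x := hWe i hx
      rw [← hgi, ← h1]
      simp [mul_comm]
    · have h2 := hg0 x hx
      rw [h2, inner_zero_right]
      symm
      refine Finset.sum_eq_zero fun i _ => ?_
      rw [← hgi, h2]; simp
  simp_rw [e1]
  rw [integral_finsetSum _ (fun i _ => hintg i)]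
  have b : ∀ i, |∫ x, W i x * fderiv ℝ ψ x (ei i)| ≤ L * ∫ x, ψ x := by
    intro i
    have h1 := LipschitzWith.integral_lineDeriv_mul_eq (μ := (volume : Measure (Eu n))) (hWL i) hψ hc (-ei i)
    rw [neg_neg] at h1
    have h2 : ∫ x, W i x * fderiv ℝ ψ x (ei i) = ∫ x, lineDeriv ℝ (W i) x (-ei i) * ψ x := by
      rw [h1]
      refine integral_congr_ae ?_
      filter_upwards [hψ.ae_differentiableAt (μ := (volume : Measure (Eu n)))] with x hx
      rw [hx.lineDeriv_eq_fderiv, mul_comm]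
    rw [h2, ← Real.norm_eq_abs, ← integral_const_mul]
    refine norm_integral_le_of_norm_le (hψint.const_mul _) (Eventually.of_forall fun x => ?_)
    rw [norm_mul, Real.norm_of_nonneg (hψ0 x)]
    gcongr
    · exact hψ0 x
    · calc _ ≤ L * ‖-ei i‖ := norm_lineDeriv_le_of_lipschitz ℝ (hWL i)
        _ = L := by rw [norm_neg, hnei, mul_one]
  calc _ ≤ ∑ i, |∫ x, W i x * fderiv ℝ ψ x (ei i)| := Finset.abs_sum_le_sum_abs _ _
    _ ≤ ∑ _i : Fin n, L * ∫ x, ψ x := Finset.sum_le_sum fun i _ => b i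
    _ = _ := by simp; ring

end


section

/-! ### The data and the linearized equation -/

/-- Bundle of the standing hypotheses. -/
structure Dat (Ω : Set (Eu n)) (η : Eu n → Eu n) (a f : ℝ → ℝ) (u : Eu n → ℝ)
    (Du : Eu n → Eu n) (H : Eu n → Eu n →L[ℝ] Eu n) : Prop where
  dom : IsCkDomainWithNormal 2 Ω η
  ha : C11Loc a
  hapos : ∀ t ≥ (0 : ℝ), 0 < a t
  hlam : ∀ t ≥ (0 : ℝ), 0 < lam1 a t
  hf : ContDiff ℝ 1 f
  hu3 : ContDiffOn ℝ 3 u Ω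
  hucl : ContinuousOn u (closure Ω)
  hDu : ∀ x ∈ Ω, Du x = gradient u x
  hDuc : ContinuousOn Du (closure Ω)
  hHc : ContinuousOn H (closure Ω)
  hH : ∀ x ∈ Ω, H x = fderiv ℝ (gradient u) x
  hnc : ¬ ∃ c : ℝ, ∀ x ∈ Ω, u x = c
  sol : IsWeakSolution a f Ω u
  stab : IsStable a f Ω u
  hulc : ∀ p ∈ frontier Ω, ∃ V ∈ 𝓝 p, ∀ q ∈ V ∩ frontier Ω,
      u q = u p ∧ ⟪Du q, η q⟫ = ⟪Du p, η p⟫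
  hmeg : ModerateEnergyGrowth a u Ω

lemma locLip_of_contDiffOn {F : Type*} [NormedAddCommGroup F] [NormedSpace ℝ F] {O : Set (Eu n)}
    {g : Eu n → F} (hO : IsOpen O)
    (hg : ContDiffOn ℝ 1 g O) : LocallyLipschitzOn O g := by
  intro x hx
  obtain ⟨K, t, ht, h⟩ := (hg.contDiffAt (hO.mem_nhds hx)).exists_lipschitzOnWith
  exact ⟨K, t, mem_nhdsWithin_of_mem_nhds ht, h⟩

namespace Dat
variable {Ω : Set (Eu n)} {η : Eu n → Eu n} {a f : ℝ → ℝ} {u : Eu n → ℝ}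
    {Du : Eu n → Eu n} {H : Eu n → Eu n →L[ℝ] Eu n}

lemma op (S : Dat Ω η a f u Du H) : IsOpen Ω := S.dom.2.1
lemma ms (S : Dat Ω η a f u Du H) : MeasurableSet Ω := S.op.measurableSet
lemma pre (S : Dat Ω η a f u Du H) : IsPreconnected Ω := S.dom.2.2.1.isPreconnected

lemma grad_C2 (S : Dat Ω η a f u Du H) : ContDiffOn ℝ 2 (gradient u) Ω := by
  have h : ContDiffOn ℝ 2 (fderiv ℝ u) Ω := S.hu3.fderiv_of_isOpen S.op (by norm_num)
  exact (InnerProductSpace.toDual ℝ (Eu n)).symm.contDiff.comp_contDiffOn h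

lemma Du_C2 (S : Dat Ω η a f u Du H) : ContDiffOn ℝ 2 Du Ω := S.grad_C2.congr S.hDu

lemma Du_eq (S : Dat Ω η a f u Du H) {x : Eu n} (hx : x ∈ Ω) : Du =ᶠ[𝓝 x] gradient u := by
  filter_upwards [S.op.mem_nhds hx] with y hy using S.hDu y hy

lemma hasD2 (S : Dat Ω η a f u Du H) {x : Eu n} (hx : x ∈ Ω) : HasFDerivAt Du (H x) x := by
  have h1 : DifferentiableAt ℝ (gradient u) x :=
    (S.grad_C2.contDiffAt (S.op.mem_nhds hx)).differentiableAt (by norm_num)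
  rw [S.hH x hx]
  exact h1.hasFDerivAt.congr_of_eventuallyEq (S.Du_eq hx)

lemma diffu (S : Dat Ω η a f u Du H) {x : Eu n} (hx : x ∈ Ω) : DifferentiableAt ℝ u x :=
  (S.hu3.contDiffAt (S.op.mem_nhds hx)).differentiableAt (by norm_num)

lemma hasD1 (S : Dat Ω η a f u Du H) {x : Eu n} (hx : x ∈ Ω) : HasFDerivAt u (innerSL ℝ (Du x)) x := by
  refine (S.diffu hx).hasFDerivAt.congr_fderiv ?_
  refine ContinuousLinearMap.ext fun w => ?_
  rw [S.hDu x hx, innerSL_apply_apply, inner_gradient_left]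

lemma Hsymm (S : Dat Ω η a f u Du H) {x : Eu n} (hx : x ∈ Ω) (v w : Eu n) :
    ⟪H x v, w⟫ = ⟪H x w, v⟫ := by
  have h0 := S.hu3.contDiffAt (S.op.mem_nhds hx)
  have hs := h0.isSymmSndFDerivAt (by simp; norm_num)
  have h1 : DifferentiableAt ℝ (fderiv ℝ u) x :=
    (h0.fderiv_right (m := 2) (by norm_num)).differentiableAt (by norm_num)
  have h2 : HasFDerivAt (gradient u) _ x :=
    ((InnerProductSpace.toDual ℝ (Eu n)).symm.toContinuousLinearEquiv.toContinuousLinearMap.hasFDerivAt).comp x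
      h1.hasFDerivAt
  rw [S.hH x hx, h2.fderiv]
  simp only [ContinuousLinearMap.comp_apply]
  have e : ∀ l : Eu n →L[ℝ] ℝ, ∀ w, ⟪(InnerProductSpace.toDual ℝ (Eu n)).symm l, w⟫ = l w := by
    intro l w; simp
  calc _ = fderiv ℝ (fderiv ℝ u) x v w := e _ _
    _ = fderiv ℝ (fderiv ℝ u) x w v := hs v w
    _ = _ := (e _ _).symm

lemma hasV (S : Dat Ω η a f u Du H) {x : Eu n} (hx : x ∈ Ω) (Y : Eu n) :
    HasFDerivAt (fun y => ⟪Du y, Y⟫) (innerSL ℝ (H x Y)) x := by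
  have h := (S.hasD2 hx).inner ℝ (hasFDerivAt_const Y x)
  refine h.congr_fderiv (ContinuousLinearMap.ext fun w => ?_)
  simp [fderivInnerCLM_apply, S.Hsymm hx w Y]

lemma gradV (S : Dat Ω η a f u Du H) {x : Eu n} (hx : x ∈ Ω) (Y : Eu n) :
    gradient (fun y => ⟪Du y, Y⟫) x = H x Y :=
  grad_of_hasFDeriv (S.hasV hx Y) (fun w => by simp)

lemma v_C1 (S : Dat Ω η a f u Du H) (Y : Eu n) : ContDiffOn ℝ 1 (fun y => ⟪Du y, Y⟫) Ω :=
  (S.Du_C2.of_le (by norm_num)).inner ℝ contDiffOn_const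

lemma v_LL (S : Dat Ω η a f u Du H) (Y : Eu n) : LocallyLipschitzOn Ω (fun y => ⟪Du y, Y⟫) :=
  locLip_of_contDiffOn S.op (S.v_C1 Y)

lemma M_contOn (S : Dat Ω η a f u Du H) : ContinuousOn (fun x => AL a (Du x)) (closure Ω) :=
  (AL_cont S.ha).comp_continuousOn S.hDuc

lemma c_contOn (S : Dat Ω η a f u Du H) : ContinuousOn (fun x => deriv f (u x)) (closure Ω) :=
  (S.hf.continuous_deriv le_rfl).comp_continuousOn S.hucl

lemma M_nonneg (S : Dat Ω η a f u Du H) (x v : Eu n) : 0 ≤ ⟪AL a (Du x) v, v⟫ :=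
  le_trans (mul_nonneg (ell_pos S.hapos S.hlam _).le (sq_nonneg _)) (ell_le a (Du x) v)

lemma aesm (S : Dat Ω η a f u Du H) {F : Type*} [NormedAddCommGroup F]
     {g : Eu n → F}
    (hg : ContinuousOn g (closure Ω)) : AEStronglyMeasurable g (volume.restrict Ω) :=
  (hg.mono subset_closure).aestronglyMeasurable S.ms

lemma sol' (S : Dat Ω η a f u Du H) {φ : Eu n → ℝ} (hφ : IsTestOn Ω φ) :
    ∫ x in Ω, ⟪a ‖Du x‖ • Du x, gradient φ x⟫ = ∫ x in Ω, f (u x) * φ x := by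
  rw [← S.sol φ hφ]
  refine setIntegral_congr_fun S.ms fun x hx => ?_
  simp only [S.hDu x hx, inner_smul_left, RCLike.conj_to_real]

lemma stab' (S : Dat Ω η a f u Du H) {φ : Eu n → ℝ} (hφ : IsTestOn Ω φ) :
    ∫ x in Ω, deriv f (u x) * φ x ^ 2 ≤ ∫ x in Ω, ⟪AL a (Du x) (gradient φ x), gradient φ x⟫ := by
  refine (S.stab φ hφ).trans (le_of_eq ?_)
  refine setIntegral_congr_fun S.ms fun x hx => ?_
  simp only [S.hDu x hx, AL_apply]

end Dat

/-- differentiation of translates under the integral sign. -/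
lemma deriv_translate {G : Type*} [NormedAddCommGroup G] [NormedSpace ℝ G]
    {Ω K : Set (Eu n)} (hΩ : IsOpen Ω) (hK : IsCompact K) (hKΩ : K ⊆ Ω)
    {T : Eu n → G} {T' : Eu n → Eu n →L[ℝ] G} (hT : ∀ x ∈ Ω, HasFDerivAt T (T' x) x)
    (hT' : ContinuousOn T' Ω) {g : Eu n → G →L[ℝ] ℝ} (hg : AEStronglyMeasurable g (volume.restrict K))
    {C : ℝ} (hgC : ∀ x ∈ K, ‖g x‖ ≤ C) (Y : Eu n) :
    HasDerivAt (fun h : ℝ => ∫ x in K, g x (T (x + h • Y))) (∫ x in K, g x (T' x Y)) 0 := by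
  obtain ⟨δ, hδ, hδO⟩ := hK.exists_cthickening_subset_open hΩ hKΩ
  obtain ⟨B, hB⟩ := hK.cthickening.exists_bound_of_continuousOn (hT'.mono hδO)
  have hε : 0 < δ / (‖Y‖ + 1) := by positivity
  have hmem : ∀ x ∈ K, ∀ h ∈ ball (0 : ℝ) (δ / (‖Y‖ + 1)), x + h • Y ∈ cthickening δ K := by
    intro x hx h hh
    refine mem_cthickening_of_dist_le _ x δ K hx ?_
    rw [dist_eq_norm, add_sub_cancel_left, norm_smul]
    rw [mem_ball_zero_iff, lt_div_iff₀ (by positivity)] at hh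
    nlinarith [norm_nonneg h, norm_nonneg Y]
  have hTc : ContinuousOn T Ω := fun x hx => (hT x hx).continuousAt.continuousWithinAt
  have hmeas : ∀ h ∈ ball (0 : ℝ) (δ / (‖Y‖ + 1)),
      AEStronglyMeasurable (fun x => g x (T (x + h • Y))) (volume.restrict K) := by
    intro h hh
    have : ContinuousOn (fun x => T (x + h • Y)) K :=
      hTc.comp (by fun_prop) (fun x hx => hδO (hmem x hx h hh))
    exact (ContinuousLinearMap.apply ℝ ℝ : G →L[ℝ] (G →L[ℝ] ℝ) →L[ℝ] ℝ).flip.aestronglyMeasurable_comp₂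
      hg (this.aestronglyMeasurable_of_isCompact hK hK.measurableSet)
  have hcfin : Integrable (fun _ : Eu n => C * (|B| * ‖Y‖)) (volume.restrict K) :=
    integrableOn_const (hK.measure_lt_top.ne)
  have h0 : (0 : ℝ) ∈ ball (0 : ℝ) (δ / (‖Y‖ + 1)) := mem_ball_self hε
  have key := hasDerivAt_integral_of_dominated_loc_of_deriv_le (μ := volume.restrict K)
    (F := fun h x => g x (T (x + h • Y))) (F' := fun h x => g x (T' (x + h • Y) Y))
    (x₀ := (0 : ℝ)) (s := ball (0 : ℝ) (δ / (‖Y‖ + 1))) (bound := fun _ => C * (|B| * ‖Y‖))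
    (ball_mem_nhds _ hε) ?_ ?_ ?_ ?_ hcfin ?_
  · have := key.2
    simpa using this
  · filter_upwards [ball_mem_nhds (0 : ℝ) hε] with h hh using hmeas h hh
  · obtain ⟨B2, hB2⟩ := hK.exists_bound_of_continuousOn (hTc.mono hKΩ)
    refine Integrable.mono' (g := fun _ => C * |B2|) (integrableOn_const (hK.measure_lt_top.ne)) (hmeas 0 h0) ?_
    rw [ae_restrict_iff' hK.measurableSet]
    refine Eventually.of_forall fun x hx => ?_
    simp only [zero_smul, add_zero]
    have := norm_nonneg (g x)
    calc _ ≤ ‖g x‖ * ‖T x‖ := ContinuousLinearMap.le_opNorm _ _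
      _ ≤ C * |B2| := by
        gcongr
        · exact this.trans (hgC x hx)
        · exact hgC x hx
        · exact (hB2 x hx).trans (le_abs_self _)
  · have : ContinuousOn (fun x => T' (x + (0 : ℝ) • Y) Y) K := by
      simp only [zero_smul, add_zero]
      exact (hT'.mono hKΩ).clm_apply continuousOn_const
    exact (ContinuousLinearMap.apply ℝ ℝ : G →L[ℝ] (G →L[ℝ] ℝ) →L[ℝ] ℝ).flip.aestronglyMeasurable_comp₂
      hg (this.aestronglyMeasurable_of_isCompact hK hK.measurableSet)
  · rw [ae_restrict_iff' hK.measurableSet]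
    refine Eventually.of_forall fun x hx h hh => ?_
    have := norm_nonneg (g x)
    calc _ ≤ ‖g x‖ * ‖T' (x + h • Y) Y‖ := ContinuousLinearMap.le_opNorm _ _
      _ ≤ C * (|B| * ‖Y‖) := by
        gcongr
        · exact this.trans (hgC x hx)
        · exact hgC x hx
        · refine (ContinuousLinearMap.le_opNorm _ _).trans ?_
          gcongr
          exact (hB _ (hmem x hx h hh)).trans (le_abs_self _)
  · rw [ae_restrict_iff' hK.measurableSet]
    refine Eventually.of_forall fun x hx h hh => ?_
    have h1 : HasDerivAt (fun h : ℝ => x + h • Y) Y h := by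
      simpa using ((hasDerivAt_id h).smul_const Y).const_add x
    have h2 := (hT _ (hδO (hmem x hx h hh))).comp_hasDerivAt h h1
    exact (g x).hasFDerivAt.comp_hasDerivAt h h2


lemma grad_translate (φ : Eu n → ℝ) (w x : Eu n) :
    gradient (fun y => φ (y - w)) x = gradient φ (x - w) := by
  simp only [gradient]
  rw [fderiv_comp_sub]

lemma setInt_of_supp {O K : Set (Eu n)} (hKO : K ⊆ O) {g : Eu n → ℝ} (h : ∀ x ∉ K, g x = 0) :
    ∫ x in O, g x = ∫ x in K, g x := by
  rw [setIntegral_eq_integral_of_forall_compl_eq_zero (s := K) (fun x hx => h x hx),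
    setIntegral_eq_integral_of_forall_compl_eq_zero (fun x hx => h x (fun hh => hx (hKO hh)))]

namespace Dat
variable {Ω : Set (Eu n)} {η : Eu n → Eu n} {a f : ℝ → ℝ} {u : Eu n → ℝ}
    {Du : Eu n → Eu n} {H : Eu n → Eu n →L[ℝ] Eu n}

lemma hasF (S : Dat Ω η a f u Du H) {x : Eu n} (hx : x ∈ Ω) :
    HasFDerivAt (fun y => a ‖Du y‖ • Du y) ((AL a (Du x)).comp (H x)) x :=
  (F_hasFDeriv S.ha (Du x)).comp x (S.hasD2 hx)

/-- The linearized equation. -/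
lemma lin (S : Dat Ω η a f u Du H) {φ : Eu n → ℝ} (hφ : IsTestOn Ω φ) (Y : Eu n) :
    ∫ x in Ω, ⟪AL a (Du x) (H x Y), gradient φ x⟫ = ∫ x in Ω, deriv f (u x) * ⟪Du x, Y⟫ * φ x := by
  obtain ⟨⟨C, hL⟩, hcs, hsub⟩ := hφ
  set K := tsupport φ with hKdef
  have hK : IsCompact K := hcs
  have hφ0 : ∀ x ∉ K, φ x = 0 := fun x hx => image_eq_zero_of_notMem_tsupport hx
  have hg0 : ∀ x ∉ K, gradient φ x = 0 := fun x hx => grad_zero_off hx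
  -- derivatives
  have d1 := deriv_translate S.op hK hsub (T := fun y => a ‖Du y‖ • Du y)
    (T' := fun x => (AL a (Du x)).comp (H x)) (fun x hx => S.hasF hx)
    ((S.M_contOn.mono subset_closure).clm_comp (S.hHc.mono subset_closure))
    (g := fun x => innerSL ℝ (gradient φ x))
    ((innerSL ℝ).continuous.measurable.comp (grad_meas φ)).aestronglyMeasurable
    (C := C) (fun x _ => by rw [innerSL_apply_norm]; exact grad_norm_le hL x) Y
  have d2 := deriv_translate S.op hK hsub (T := fun y => f (u y))
    (T' := fun x => deriv f (u x) • innerSL ℝ (Du x))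
    (fun x hx => ((S.hf.differentiable (by norm_num)).differentiableAt.hasDerivAt).comp_hasFDerivAt x (S.hasD1 hx))
    ((S.c_contOn.mono subset_closure).smul ((innerSL ℝ).continuous.comp_continuousOn (S.hDuc.mono subset_closure)))
    (g := fun x => φ x • ContinuousLinearMap.id ℝ ℝ)
    (hL.continuous.smul continuous_const).aestronglyMeasurable
    (C := (hK.exists_bound_of_continuousOn hL.continuous.continuousOn).choose)
    (fun x hx => by
      have := (hK.exists_bound_of_continuousOn hL.continuous.continuousOn).choose_spec x hx
      rw [norm_smul, ContinuousLinearMap.norm_id, mul_one]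
      exact this) Y
  obtain ⟨δ, hδ, hδO⟩ := hK.exists_cthickening_subset_open S.op hsub
  have hε : 0 < δ / (‖Y‖ + 1) := by positivity
  have hmem : ∀ x ∈ K, ∀ h ∈ ball (0 : ℝ) (δ / (‖Y‖ + 1)), x + h • Y ∈ Ω := by
    intro x hx h hh
    refine hδO (mem_cthickening_of_dist_le _ x δ K hx ?_)
    rw [dist_eq_norm, add_sub_cancel_left, norm_smul]
    rw [mem_ball_zero_iff, lt_div_iff₀ (by positivity)] at hh
    nlinarith [norm_nonneg h, norm_nonneg Y]
  have heq : (fun h : ℝ => ∫ x in K, (innerSL ℝ (gradient φ x)) (a ‖Du (x + h • Y)‖ • Du (x + h • Y)))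
      =ᶠ[𝓝 0] (fun h : ℝ => ∫ x in K, (φ x • ContinuousLinearMap.id ℝ ℝ) (f (u (x + h • Y)))) := by
    filter_upwards [ball_mem_nhds (0 : ℝ) hε] with h hh
    have ht : IsTestOn Ω (fun y => φ (y - h • Y)) := by
      have hK2 : IsCompact ((fun x => x + h • Y) '' K) := hK.image (by fun_prop)
      refine test_of_cpt S.op hK2 ?_ ?_ ?_
      · rintro _ ⟨x, hx, rfl⟩; exact hmem x hx h hh
      · intro x hx
        refine hφ0 _ fun hh => hx ⟨x - h • Y, hh, by simp⟩
      · have : LipschitzWith C (fun y => φ (y - h • Y)) := by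
          refine LipschitzWith.of_dist_le_mul fun x y => ?_
          have := hL.dist_le_mul (x - h • Y) (y - h • Y)
          simpa using this
        exact this.locallyLipschitz.locallyLipschitzOn
    have h1 := S.sol' ht
    simp only [grad_translate] at h1
    have mem' : ∀ x ∉ Ω, x - h • Y ∉ K := fun x hx hh' => hx (by simpa using hmem _ hh' h hh)
    rw [setIntegral_eq_integral_of_forall_compl_eq_zero
        (fun x hx => by rw [hg0 _ (mem' x hx), inner_zero_right]),
      setIntegral_eq_integral_of_forall_compl_eq_zero
        (fun x hx => by rw [hφ0 _ (mem' x hx), mul_zero]),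
      ← integral_add_right_eq_self _ (h • Y),
      ← integral_add_right_eq_self (fun x => f (u x) * _) (h • Y)] at h1
    simp only [add_sub_cancel_right] at h1
    rw [setIntegral_eq_integral_of_forall_compl_eq_zero
        (fun x hx => by rw [hg0 x hx]; simp),
      setIntegral_eq_integral_of_forall_compl_eq_zero
        (fun x hx => by rw [hφ0 x hx]; simp)]
    refine Eq.trans (integral_congr_ae (Eventually.of_forall fun x => ?_))
      (h1.trans (integral_congr_ae (Eventually.of_forall fun x => ?_)))
    · simp only [innerSL_apply_apply]; rw [real_inner_comm]
    · simp [mul_comm]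
  have h3 := (d1.congr_of_eventuallyEq heq.symm).unique d2
  rw [setInt_of_supp hsub (fun x hx => by rw [hg0 x hx, inner_zero_right]),
    setInt_of_supp hsub (fun x hx => by rw [hφ0 x hx, mul_zero])]
  refine Eq.trans (integral_congr_ae (Eventually.of_forall fun x => ?_))
      (h3.trans (integral_congr_ae (Eventually.of_forall fun x => ?_)))
  · simp only [innerSL_apply_apply]; rw [real_inner_comm]; rfl
  · simp [mul_comm]

end Dat

end


section

/-! ### Local Lipschitz calculus, strong maximum principle -/

lemma LL.comp {F : Type*} [NormedAddCommGroup F] {s : Set (Eu n)} {g : Eu n → F} {h : F → ℝ}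
    (hh : LocallyLipschitz h) (hg : LocallyLipschitzOn s g) : LocallyLipschitzOn s (fun x => h (g x)) := by
  intro x hx
  obtain ⟨K, t, ht, hK⟩ := hg hx
  obtain ⟨K', t', ht', hK'⟩ := hh (g x)
  refine ⟨K' * K, t ∩ g ⁻¹' t', ?_, ?_⟩
  · exact inter_mem ht (hg.continuousOn x hx ht')
  · exact hK'.comp (hK.mono inter_subset_left) (fun y hy => hy.2)

lemma LL.prod {s : Set (Eu n)} {g h : Eu n → ℝ} (hg : LocallyLipschitzOn s g)
    (hh : LocallyLipschitzOn s h) : LocallyLipschitzOn s (fun x => (g x, h x)) := by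
  intro x hx
  obtain ⟨K, t, ht, hK⟩ := hg hx
  obtain ⟨K', t', ht', hK'⟩ := hh hx
  exact ⟨max K K', t ∩ t', inter_mem ht ht', (hK.mono inter_subset_left).prodMk (hK'.mono inter_subset_right)⟩

lemma LL.mul {s : Set (Eu n)} {g h : Eu n → ℝ} (hg : LocallyLipschitzOn s g)
    (hh : LocallyLipschitzOn s h) : LocallyLipschitzOn s (fun x => g x * h x) := by
  have : LocallyLipschitz (fun p : ℝ × ℝ => p.1 * p.2) :=
    (contDiff_fst.mul contDiff_snd : ContDiff ℝ 1 (fun p : ℝ × ℝ => p.1 * p.2)).locallyLipschitz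
  exact LL.comp this (LL.prod hg hh)

lemma LL.sub {s : Set (Eu n)} {g h : Eu n → ℝ} (hg : LocallyLipschitzOn s g)
    (hh : LocallyLipschitzOn s h) : LocallyLipschitzOn s (fun x => g x - h x) := by
  have : LocallyLipschitz (fun p : ℝ × ℝ => p.1 - p.2) :=
    (contDiff_fst.sub contDiff_snd : ContDiff ℝ 1 (fun p : ℝ × ℝ => p.1 - p.2)).locallyLipschitz
  exact LL.comp this (LL.prod hg hh)

lemma LL.add {s : Set (Eu n)} {g h : Eu n → ℝ} (hg : LocallyLipschitzOn s g)
    (hh : LocallyLipschitzOn s h) : LocallyLipschitzOn s (fun x => g x + h x) := by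
  have : LocallyLipschitz (fun p : ℝ × ℝ => p.1 + p.2) :=
    (contDiff_fst.add contDiff_snd : ContDiff ℝ 1 (fun p : ℝ × ℝ => p.1 + p.2)).locallyLipschitz
  exact LL.comp this (LL.prod hg hh)

lemma LL.pos {s : Set (Eu n)} {g : Eu n → ℝ} (hg : LocallyLipschitzOn s g) :
    LocallyLipschitzOn s (fun x => max (g x) 0) := by
  have : LipschitzWith 1 (fun t : ℝ => max t 0) := LipschitzWith.id.max_const 0
  exact LL.comp this.locallyLipschitz hg

lemma LL.cd {s : Set (Eu n)} {g : Eu n → ℝ} (hg : ContDiff ℝ 1 g) : LocallyLipschitzOn s g :=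
  hg.locallyLipschitz.locallyLipschitzOn

lemma LL.const {s : Set (Eu n)} (c : ℝ) : LocallyLipschitzOn s (fun _ => c) := LL.cd contDiff_const

lemma LL.congr {s : Set (Eu n)} {g h : Eu n → ℝ} (hg : LocallyLipschitzOn s g)
    (e : ∀ x ∈ s, h x = g x) : LocallyLipschitzOn s h := by
  intro x hx
  obtain ⟨K, t, ht, hK⟩ := hg hx
  refine ⟨K, t ∩ s, inter_mem ht self_mem_nhdsWithin, ?_⟩
  intro y hy z hz
  rw [e y hy.2, e z hz.2]
  exact hK hy.1 hz.1

namespace Dat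
variable {Ω : Set (Eu n)} {η : Eu n → Eu n} {a f : ℝ → ℝ} {u : Eu n → ℝ}
    {Du : Eu n → Eu n} {H : Eu n → Eu n →L[ℝ] Eu n}

lemma bdd (_S : Dat Ω η a f u Du H) {F : Type*} [NormedAddCommGroup F] {g : Eu n → F}
    (hg : ContinuousOn g (closure Ω)) {K : Set (Eu n)} (hK : IsCompact K) :
    ∃ B, 0 ≤ B ∧ ∀ x ∈ closure Ω, x ∈ K → ‖g x‖ ≤ B := by
  obtain ⟨B, hB⟩ := (hK.inter_right isClosed_closure).exists_bound_of_continuousOn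
    (hg.mono (inter_subset_right : K ∩ closure Ω ⊆ _))
  exact ⟨max B 0, le_max_right _ _, fun x hx hxK => (hB x ⟨hxK, hx⟩).trans (le_max_left _ _)⟩

lemma int_M (S : Dat Ω η a f u Du H) {g1 g2 : Eu n → Eu n}
    (h1 : AEStronglyMeasurable g1 (volume.restrict Ω)) (h2 : AEStronglyMeasurable g2 (volume.restrict Ω))
    {K : Set (Eu n)} (hK : IsCompact K) (C1 C2 : ℝ) (hb1 : ∀ x ∈ Ω, x ∈ K → ‖g1 x‖ ≤ C1)
    (hb2 : ∀ x ∈ Ω, x ∈ K → ‖g2 x‖ ≤ C2) (h0 : ∀ x ∈ Ω, x ∉ K → g1 x = 0 ∨ g2 x = 0) :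
    IntegrableOn (fun x => ⟪AL a (Du x) (g1 x), g2 x⟫) Ω := by
  obtain ⟨B, hB0, hB⟩ := S.bdd S.M_contOn hK
  refine intg S.ms hK ?_ (B * C1 * C2) ?_ ?_
  · have e := (ContinuousLinearMap.apply ℝ (Eu n) : Eu n →L[ℝ] (Eu n →L[ℝ] Eu n) →L[ℝ] Eu n).flip.aestronglyMeasurable_comp₂
      (S.aesm S.M_contOn) h1
    exact e.inner h2
  · intro x hx hxK
    have n1 := norm_nonneg (g1 x)
    calc _ ≤ ‖AL a (Du x) (g1 x)‖ * ‖g2 x‖ := norm_inner_le_norm _ _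
      _ ≤ (‖AL a (Du x)‖ * ‖g1 x‖) * ‖g2 x‖ := by gcongr; exact ContinuousLinearMap.le_opNorm _ _
      _ ≤ _ := by
        have := n1.trans (hb1 x hx hxK)
        gcongr
        · exact hB x (subset_closure hx) hxK
        · exact hb1 x hx hxK
        · exact hb2 x hx hxK
  · intro x hx hxK
    rcases h0 x hx hxK with h | h <;> simp [h]

lemma int_c (S : Dat Ω η a f u Du H) {g : Eu n → ℝ}
    (h1 : AEStronglyMeasurable g (volume.restrict Ω))
    {K : Set (Eu n)} (hK : IsCompact K) (C1 : ℝ) (hb1 : ∀ x ∈ Ω, x ∈ K → ‖g x‖ ≤ C1)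
    (h0 : ∀ x ∈ Ω, x ∉ K → g x = 0) :
    IntegrableOn (fun x => deriv f (u x) * g x) Ω := by
  obtain ⟨B, hB0, hB⟩ := S.bdd S.c_contOn hK
  refine intg S.ms hK ((S.aesm S.c_contOn).mul h1) (B * C1) ?_ ?_
  · intro x hx hxK
    rw [norm_mul]
    gcongr
    · exact hB x (subset_closure hx) hxK
    · exact hb1 x hx hxK
  · intro x hx hxK; rw [h0 x hx hxK, mul_zero]

end Dat

/-- weak supersolution of the linearized equation on `O`. -/
def SupSol (Ω O : Set (Eu n)) (a f : ℝ → ℝ) (u : Eu n → ℝ) (Du : Eu n → Eu n) (w : Eu n → ℝ) : Prop :=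
  ∀ ψ : Eu n → ℝ, IsTestOn O ψ → (∀ x, 0 ≤ ψ x) →
    ∫ x in Ω, deriv f (u x) * w x * ψ x ≤ ∫ x in Ω, ⟪AL a (Du x) (gradient w x), gradient ψ x⟫

lemma gauss_grad (α : ℝ) (y x : Eu n) :
    HasFDerivAt (fun x => Real.exp (-α * ‖x - y‖ ^ 2))
      (innerSL ℝ ((-2 * α * Real.exp (-α * ‖x - y‖ ^ 2)) • (x - y))) x := by
  have h1 : HasFDerivAt (fun x : Eu n => ‖x - y‖ ^ 2) (2 • innerSL ℝ (x - y)) x := by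
    have h0 : HasFDerivAt (fun x : Eu n => x - y) (ContinuousLinearMap.id ℝ (Eu n)) x :=
      (hasFDerivAt_id x).sub_const y
    exact ((hasStrictFDerivAt_norm_sq (x - y)).hasFDerivAt.comp x h0).congr_fderiv
      (ContinuousLinearMap.ext fun w => rfl)
  have h2 := (h1.const_mul (-α)).exp
  refine h2.congr_fderiv (ContinuousLinearMap.ext fun w => ?_)
  simp [inner_smul_left]
  ring

lemma gauss_cd (α : ℝ) (y : Eu n) : ContDiff ℝ 1 (fun x => Real.exp (-α * ‖x - y‖ ^ 2)) := by
  have : ContDiff ℝ 1 (fun x : Eu n => ‖x - y‖ ^ 2) := (contDiff_norm_sq ℝ).comp (contDiff_id.sub contDiff_const)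
  exact (contDiff_const.mul this).exp

variable {Ω : Set (Eu n)} {η : Eu n → Eu n} {a f : ℝ → ℝ} {u : Eu n → ℝ}
    {Du : Eu n → Eu n} {H : Eu n → Eu n →L[ℝ] Eu n}

lemma ball_lemma (S : Dat Ω η a f u Du H) {O : Set (Eu n)} (hO : IsOpen O) (hOΩ : O ⊆ Ω)
    {w : Eu n → ℝ} (hw0 : ∀ x, 0 ≤ w x) (hwL : LocallyLipschitzOn O w) (hw : SupSol Ω O a f u Du w)
    {y : Eu n} {r R ε α lam M0 : ℝ} {L : NNReal} (hR0 : 0 ≤ R) (hR : closedBall y R ⊆ O) (hr : 0 < r) (hε : 0 < ε)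
    (hα : 0 < α) (hlam0 : 0 ≤ lam) (hwr : ∀ x ∈ closedBall y r, ε ≤ w x)
    (hV : LipschitzOnWith L (fun x => AL a (Du x) (x - y)) (closedBall y R))
    (hlam : ∀ x ∈ closedBall y R, lam * ‖x - y‖ ^ 2 ≤ ⟪AL a (Du x) (x - y), x - y⟫)
    (hM0 : ∀ x ∈ closedBall y R, |deriv f (u x)| ≤ M0)
    (hcond : 2 * α * (n * L) + M0 < 4 * α ^ 2 * lam * r ^ 2) :
    ∀ x ∈ closedBall y R, ε * (Real.exp (-α * ‖x - y‖ ^ 2) - Real.exp (-α * R ^ 2)) ≤ w x := by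
  set E : Eu n → ℝ := fun x => Real.exp (-α * ‖x - y‖ ^ 2) with hE
  set k : ℝ := Real.exp (-α * R ^ 2) with hk
  set φ : Eu n → ℝ := fun x => max (ε * (E x - k) - w x) 0 with hφ
  set K := closedBall y R with hKd
  have hK : IsCompact K := isCompact_closedBall y R
  have hEpos : ∀ x, 0 < E x := fun x => Real.exp_pos _
  have hkpos : 0 < k := Real.exp_pos _
  have hE1 : ∀ x, E x ≤ 1 := fun x => Real.exp_le_one_iff.2 (by nlinarith [sq_nonneg ‖x - y‖])
  have hφ0 : ∀ x, 0 ≤ φ x := fun x => le_max_right _ _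
  have hφpos : ∀ x, 0 < φ x → w x < ε * (E x - k) := by
    intro x hx
    by_contra! h
    have : φ x = 0 := max_eq_right (by linarith)
    linarith
  have hφK : ∀ x, 0 < φ x → x ∈ K := by
    intro x hx
    have h1 := hφpos x hx
    have h2 := hw0 x
    have h3 : k < E x := by
      by_contra! h
      nlinarith
    rw [hk, hE] at h3
    have h4 := Real.exp_lt_exp.1 h3
    have h5 : ‖x - y‖ ^ 2 < R ^ 2 := by nlinarith
    rw [hKd, mem_closedBall, dist_eq_norm]
    by_contra! h6
    nlinarith [norm_nonneg (x - y)]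
  have hφz : ∀ x ∉ K, φ x = 0 := fun x hx => le_antisymm (not_lt.1 fun h => hx (hφK x h)) (hφ0 x)
  have hφr : ∀ x, 0 < φ x → r ≤ ‖x - y‖ := by
    intro x hx
    by_contra! h
    have h1 := hwr x (by rw [mem_closedBall, dist_eq_norm]; exact h.le)
    have h2 := hφpos x hx
    have h3 := hE1 x
    nlinarith
  have hEL : LocallyLipschitzOn O E := LL.cd (gauss_cd α y)
  have hφL : LocallyLipschitzOn O φ :=
    LL.pos (LL.sub (LL.mul (LL.const ε) (LL.sub hEL (LL.const k))) hwL)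
  have hφt : IsTestOn O φ := test_of_cpt hO hK hR hφz hφL
  set ψ : Eu n → ℝ := fun x => E x * φ x with hψ
  have hψ0 : ∀ x, 0 ≤ ψ x := fun x => mul_nonneg (hEpos x).le (hφ0 x)
  have hψz : ∀ x ∉ K, ψ x = 0 := fun x hx => by simp [hψ, hφz x hx]
  have hψt : IsTestOn O ψ := test_of_cpt hO hK hR hψz (LL.mul hEL hφL)
  obtain ⟨⟨Cφ, hφLip⟩, hφcs, -⟩ := id hφt
  obtain ⟨⟨Cψ, hψLip⟩, hψcs, -⟩ := id hψt
  have hgφ0 : ∀ x, φ x = 0 → gradient φ x = 0 := fun x hx =>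
    grad_zero_of_nonneg (Eventually.of_forall hφ0) hx
  have hgψ0 : ∀ x, φ x = 0 → gradient ψ x = 0 := fun x hx =>
    grad_zero_of_nonneg (Eventually.of_forall hψ0) (by simp [hψ, hx])
  have hgE : ∀ x, gradient E x = (-2 * α * E x) • (x - y) := fun x =>
    grad_of_hasFDeriv (gauss_grad α y x) (fun w => by rw [innerSL_apply_apply])
  have hdE : ∀ x, DifferentiableAt ℝ E x := fun x => (gauss_grad α y x).differentiableAt
  -- pointwise a.e. identity
  have hae : ∀ᵐ x ∂(volume : Measure (Eu n)), ⟪AL a (Du x) (gradient w x), gradient φ x⟫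
      = ε * (-2 * α * ⟪AL a (Du x) (x - y), gradient ψ x⟫
          - 4 * α ^ 2 * ψ x * ⟪AL a (Du x) (x - y), x - y⟫)
        - ⟪AL a (Du x) (gradient φ x), gradient φ x⟫ := by
    filter_upwards [hφLip.ae_differentiableAt (μ := (volume : Measure (Eu n)))] with x hx
    rcases (hφ0 x).eq_or_lt with h0 | hpos
    · have h0' := h0.symm
      have e2 : ψ x = 0 := by simp [hψ, h0']
      rw [hgφ0 x h0', hgψ0 x h0', e2]
      simp
    · have hxO : x ∈ O := hR (hφK x hpos)
      have hwx := hφpos x hpos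
      have hev : w =ᶠ[𝓝 x] fun z => ε * (E z - k) - φ z := by
        have hc : ContinuousAt φ x := hφLip.continuous.continuousAt
        filter_upwards [hc.eventually (lt_mem_nhds hpos)] with z hz
        have : φ z = ε * (E z - k) - w z := by
          rcases max_choice (ε * (E z - k) - w z) 0 with h | h
          · exact h
          · exfalso
            have : φ z = 0 := h
            linarith
        rw [this]; ring
      have hd1 : DifferentiableAt ℝ (fun z => ε * (E z - k)) x :=
        ((hdE x).sub_const k).const_mul ε
      have g1 : gradient w x = ε • gradient E x - gradient φ x := by
        rw [hev.gradient_eq, grad_sub hd1 hx, grad_const_mul _ ((hdE x).sub_const k)]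
        congr 2
        simp [gradient, fderiv_sub_const]
      have g2 : gradient ψ x = E x • gradient φ x + φ x • gradient E x := grad_mul (hdE x) hx
      have e2 : ψ x = E x * φ x := rfl
      rw [g1, g2, hgE, e2]
      simp only [map_sub, map_smul, inner_sub_left, inner_add_right, inner_smul_left, inner_smul_right,
        RCLike.conj_to_real]
      ring
  have hM0' : ∀ x ∈ K, 0 ≤ M0 := fun x hx => (abs_nonneg _).trans (hM0 x hx)
  have hψc : Continuous ψ := hψLip.continuous
  have hψi : Integrable ψ := hψc.integrable_of_hasCompactSupport hψcs
  obtain ⟨B, hB⟩ := hK.exists_bound_of_continuousOn hψc.continuousOn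
  obtain ⟨B', hB'⟩ := hK.exists_bound_of_continuousOn (hwL.continuousOn.mono hR)
  obtain ⟨B2, hB2⟩ := hK.exists_bound_of_continuousOn hφLip.continuous.continuousOn
  have hq : ∀ x ∈ Ω, x ∈ K → ‖x - y‖ ≤ R := fun x _ hx => by
    rwa [hKd, mem_closedBall, dist_eq_norm] at hx
  have hqm : AEStronglyMeasurable (fun x : Eu n => x - y) (volume.restrict Ω) :=
    (continuous_id.sub continuous_const).aestronglyMeasurable
  have i1 : IntegrableOn (fun x => ⟪AL a (Du x) (x - y), gradient ψ x⟫) Ω :=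
    S.int_M hqm (grad_meas ψ).aestronglyMeasurable hK R Cψ hq (fun x _ _ => grad_norm_le hψLip x)
      (fun x _ hx => Or.inr (hgψ0 x (hφz x hx)))
  have i2 : IntegrableOn (fun x => ψ x * ⟪AL a (Du x) (x - y), x - y⟫) Ω := by
    have := S.int_M (g1 := fun x => ψ x • (x - y)) (hψc.aestronglyMeasurable.smul hqm) hqm hK (|B| * R) R
      (fun x hx hxK => by
        rw [norm_smul]
        gcongr
        · exact (hB x hxK).trans (le_abs_self _)
        · exact hq x hx hxK) hq (fun x _ hx => Or.inl (by simp [hψz x hx]))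
    refine this.congr_fun (fun x _ => ?_) S.ms
    simp only [map_smul, inner_smul_left, RCLike.conj_to_real]
  have i3 : IntegrableOn (fun x => ⟪AL a (Du x) (gradient φ x), gradient φ x⟫) Ω :=
    S.int_M (grad_meas φ).aestronglyMeasurable (grad_meas φ).aestronglyMeasurable hK Cφ Cφ
      (fun x _ _ => grad_norm_le hφLip x) (fun x _ _ => grad_norm_le hφLip x)
      (fun x _ hx => Or.inr (hgφ0 x (hφz x hx)))
  have i4 : IntegrableOn (fun x => ε * (-2 * α * ⟪AL a (Du x) (x - y), gradient ψ x⟫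
          - 4 * α ^ 2 * (ψ x * ⟪AL a (Du x) (x - y), x - y⟫))
        - ⟪AL a (Du x) (gradient φ x), gradient φ x⟫) Ω :=
    (((i1.const_mul _).sub (i2.const_mul _)).const_mul ε).sub i3
  have i5 : IntegrableOn (fun x => ε * (-2 * α * ⟪AL a (Du x) (x - y), gradient ψ x⟫
          - 4 * α ^ 2 * lam * r ^ 2 * ψ x)) Ω :=
    ((i1.const_mul _).sub (hψi.integrableOn.const_mul _)).const_mul ε
  have wm : AEStronglyMeasurable (fun x => w x * φ x) (volume.restrict Ω) := by
    have : ContinuousOn (fun x => w x * φ x) K :=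
      (hwL.continuousOn.mono hR).mul hφLip.continuous.continuousOn
    have h1 : AEStronglyMeasurable (fun x => w x * φ x) (volume.restrict K) :=
      this.aestronglyMeasurable_of_isCompact hK hK.measurableSet
    have h2 := (aestronglyMeasurable_indicator_iff hK.measurableSet).2 h1
    have e : K.indicator (fun x => w x * φ x) = fun x => w x * φ x := by
      refine indicator_eq_self.2 fun x hx => ?_
      by_contra h
      exact hx (by simp [hφz x h])
    rw [e] at h2
    exact h2.restrict
  have i6 : IntegrableOn (fun x => deriv f (u x) * (w x * φ x)) Ω :=
    S.int_c wm hK (|B'| * |B2|) (fun x _ hx => by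
      rw [norm_mul]
      gcongr
      · exact (hB' x hx).trans (le_abs_self _)
      · exact (hB2 x hx).trans (le_abs_self _)) (fun x _ hx => by simp [hφz x hx])
  have s1 : ∫ x in Ω, -(M0 * ε) * ψ x ≤ ∫ x in Ω, deriv f (u x) * w x * φ x := by
    simp only [mul_assoc (deriv f _)]
    refine setIntegral_mono_on (hψi.integrableOn.const_mul _) i6 S.ms fun x hx => ?_
    rcases (hφ0 x).eq_or_lt with h0 | hpos
    · have : ψ x = 0 := by simp [hψ, ← h0]
      simp [this, ← h0]
    · have hxK := hφK x hpos
      have h1 := hM0 x hxK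
      have h2 := (hφpos x hpos).le
      have h3 : w x ≤ ε * E x := h2.trans (by nlinarith)
      have h4 : |deriv f (u x) * w x| ≤ M0 * (ε * E x) := by
        rw [abs_mul, abs_of_nonneg (hw0 x)]
        exact mul_le_mul h1 h3 (hw0 x) (hM0' x hxK)
      have h5 := (abs_le.1 h4).1
      have e2 : ψ x = E x * φ x := rfl
      rw [e2]
      nlinarith
  have s2 : ∫ x in Ω, ⟪AL a (Du x) (gradient w x), gradient φ x⟫ ≤
      ∫ x in Ω, ε * (-2 * α * ⟪AL a (Du x) (x - y), gradient ψ x⟫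
          - 4 * α ^ 2 * lam * r ^ 2 * ψ x) := by
    have hae' := ae_restrict_of_ae (s := Ω) hae
    have i4' : IntegrableOn (fun x => ⟪AL a (Du x) (gradient w x), gradient φ x⟫) Ω := by
      refine i4.congr ?_
      filter_upwards [hae'] with x hx
      rw [hx]; ring
    refine integral_mono_ae i4' i5 ?_
    filter_upwards [hae'] with x hx
    simp only [hx]
    have h1 := S.M_nonneg x (gradient φ x)
    have h2 : lam * r ^ 2 * ψ x ≤ ψ x * ⟪AL a (Du x) (x - y), x - y⟫ := by
      rcases (hφ0 x).eq_or_lt with h0 | hpos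
      · have : ψ x = 0 := by simp [hψ, ← h0]
        simp [this]
      · have h3 := hlam x (hφK x hpos)
        have h4 := hφr x hpos
        have h5 : lam * r ^ 2 ≤ lam * ‖x - y‖ ^ 2 := by gcongr
        nlinarith [hψ0 x]
    have h6 : 0 ≤ ε * (4 * α ^ 2) := by positivity
    nlinarith
  have s3 := hw φ hφt hφ0
  have s4 : ∫ x in Ω, ⟪AL a (Du x) (x - y), gradient ψ x⟫ = ∫ x, ⟪AL a (Du x) (x - y), gradient ψ x⟫ :=
    setIntegral_eq_integral_of_forall_compl_eq_zero
      (fun x hx => by rw [hgψ0 x (hφz x (fun h => hx (hOΩ (hR h)))), inner_zero_right])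
  have s5 : ∫ x in Ω, ψ x = ∫ x, ψ x :=
    setIntegral_eq_integral_of_forall_compl_eq_zero (fun x hx => hψz x (fun h => hx (hOΩ (hR h))))
  have s6 := div_bound hV hψLip hψcs hψ0 (fun x hx => by
    by_contra h
    exact hx.ne' (hψz x h))
  rw [integral_const_mul, s5] at s1
  rw [integral_const_mul, integral_sub (i1.const_mul _) (hψi.integrableOn.const_mul _), integral_const_mul,
    integral_const_mul, s4, s5] at s2
  have s7 := (abs_le.1 s6).1
  have hint0 : 0 ≤ ∫ x, ψ x := integral_nonneg hψ0
  have hzero : ∫ x, ψ x = 0 := by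
    by_contra hne
    have hpos : 0 < ∫ x, ψ x := lt_of_le_of_ne hint0 (Ne.symm hne)
    have t1 := (s1.trans s3).trans s2
    have t2 : -(M0) * (∫ x, ψ x) ≤ -2 * α * (∫ x, ⟪AL a (Du x) (x - y), gradient ψ x⟫)
        - 4 * α ^ 2 * lam * r ^ 2 * (∫ x, ψ x) := by
      refine le_of_mul_le_mul_left ?_ hε
      linarith
    nlinarith
  intro x hx
  have h1 : ψ x = 0 := by
    by_contra hne
    have := hψc.integral_pos_of_hasCompactSupport_nonneg_nonzero (μ := volume) hψcs hψ0 hne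
    linarith
  have h2 : φ x = 0 := by
    rcases mul_eq_zero.1 h1 with h | h
    · exact absurd h (hEpos x).ne'
    · exact h
  have h3 : ε * (E x - k) - w x ≤ φ x := le_max_left _ _
  have : ε * (E x - k) ≤ w x := by linarith
  exact this


lemma ball_consts (S : Dat Ω η a f u Du H) {y : Eu n} {R : ℝ} (hR : 0 < R) (hb : ball y R ⊆ Ω) :
    ∃ (L : NNReal) (lam M0 : ℝ), 0 < lam ∧
      LipschitzOnWith L (fun x => AL a (Du x) (x - y)) (ball y R) ∧
      (∀ x ∈ ball y R, lam * ‖x - y‖ ^ 2 ≤ ⟪AL a (Du x) (x - y), x - y⟫) ∧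
      (∀ x ∈ ball y R, |deriv f (u x)| ≤ M0) := by
  set K := closedBall y R with hKd
  have hK : IsCompact K := isCompact_closedBall y R
  have hKcl : K ⊆ closure Ω := by
    rw [hKd, ← closure_ball y hR.ne']; exact closure_mono hb
  have hbK : ball y R ⊆ K := ball_subset_closedBall
  obtain ⟨BH, hBH0, hBH⟩ := S.bdd S.hHc hK
  obtain ⟨BD, hBD0, hBD⟩ := S.bdd S.hDuc hK
  obtain ⟨BM, hBM0, hBM⟩ := S.bdd S.M_contOn hK
  obtain ⟨Bc, hBc0, hBc⟩ := S.bdd S.c_contOn hK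
  obtain ⟨LA, hLA0, hLA⟩ := AL_lip (n := n) S.ha BD
  obtain ⟨x0, hx0, hmin⟩ := hK.exists_isMinOn ⟨y, mem_closedBall_self hR.le⟩
    (((ell_cont S.ha).comp_continuousOn S.hDuc).mono hKcl)
  have hDL : ∀ x ∈ ball y R, ∀ x' ∈ ball y R, ‖Du x - Du x'‖ ≤ BH * ‖x - x'‖ := by
    intro x hx x' hx'
    exact (convex_ball y R).norm_image_sub_le_of_norm_hasFDerivWithin_le
      (fun z hz => (S.hasD2 (hb hz)).hasFDerivWithinAt)
      (fun z hz => hBH z (hKcl (hbK hz)) (hbK hz)) hx' hx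
  refine ⟨⟨LA * BH * R + BM, by positivity⟩, ell a (Du x0), Bc, ell_pos S.hapos S.hlam _, ?_, ?_, ?_⟩
  · refine LipschitzOnWith.of_dist_le_mul fun x hx x' hx' => ?_
    rw [dist_eq_norm, dist_eq_norm]
    have e : AL a (Du x) (x - y) - AL a (Du x') (x' - y)
        = (AL a (Du x) - AL a (Du x')) (x - y) + AL a (Du x') (x - x') := by
      rw [_root_.sub_apply]
      simp only [map_sub]; abel
    rw [e]
    have h1 : ‖(AL a (Du x) - AL a (Du x')) (x - y)‖ ≤ (LA * (BH * ‖x - x'‖)) * R := by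
      refine (ContinuousLinearMap.le_opNorm _ _).trans ?_
      gcongr
      · exact (hLA _ _ (hBD x (hKcl (hbK hx)) (hbK hx)) (hBD x' (hKcl (hbK hx')) (hbK hx'))).trans
          (mul_le_mul_of_nonneg_left (hDL x hx x' hx') hLA0)
      · rw [mem_ball, dist_eq_norm] at hx; exact hx.le
    have h2 : ‖AL a (Du x') (x - x')‖ ≤ BM * ‖x - x'‖ := by
      refine (ContinuousLinearMap.le_opNorm _ _).trans ?_
      gcongr
      exact hBM x' (hKcl (hbK hx')) (hbK hx')
    refine (norm_add_le _ _).trans ((add_le_add h1 h2).trans (le_of_eq ?_))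
    change _ = (LA * BH * R + BM) * ‖x - x'‖
    ring
  · intro x hx
    refine le_trans ?_ (ell_le a (Du x) _)
    have : ell a (Du x0) ≤ ell a (Du x) := hmin (hbK hx)
    gcongr
  · intro x hx
    exact hBc x (hKcl (hbK hx)) (hbK hx)

lemma ball_lower (S : Dat Ω η a f u Du H) {O : Set (Eu n)} (hO : IsOpen O) (hOΩ : O ⊆ Ω)
    {w : Eu n → ℝ} (hw0 : ∀ x, 0 ≤ w x) (hwL : LocallyLipschitzOn O w) (hw : SupSol Ω O a f u Du w)
    {y : Eu n} {r R ε : ℝ} (hr : 0 < r) (hrR : r < R) (hR : ball y R ⊆ O) (hε : 0 < ε)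
    (hwr : ∀ x ∈ closedBall y r, ε ≤ w x) :
    ∃ α > 0, ∀ x ∈ ball y R, ε * (Real.exp (-α * ‖x - y‖ ^ 2) - Real.exp (-α * R ^ 2)) ≤ w x := by
  have hR0 : 0 < R := hr.trans hrR
  obtain ⟨L, lam, M0, hlam0, hV, hlam, hM0⟩ := ball_consts S hR0 (hR.trans hOΩ)
  have hM0' : 0 ≤ M0 := (abs_nonneg _).trans (hM0 y (mem_ball_self hR0))
  obtain ⟨α, hα, hcond⟩ : ∃ α : ℝ, 0 < α ∧ 2 * α * (n * L) + M0 < 4 * α ^ 2 * lam * r ^ 2 := by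
    set b : ℝ := 2 * (n * L) with hb
    have hb0 : 0 ≤ b := by positivity
    set q : ℝ := 4 * lam * r ^ 2 with hq
    have hq0 : 0 < q := by positivity
    refine ⟨(b + M0 + 1) / q + 1, by positivity, ?_⟩
    set α := (b + M0 + 1) / q + 1 with hα
    have h1 : α * q = b + M0 + 1 + q := by rw [hα]; field_simp
    have h2 : 1 ≤ α := by rw [hα]; have : 0 ≤ (b + M0 + 1) / q := by positivity
                          linarith
    have e1 : 2 * α * (n * L) = α * b := by rw [hb]; ring
    have e2 : 4 * α ^ 2 * lam * r ^ 2 = α * (α * q) := by rw [hq]; ring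
    rw [e1, e2, h1]
    nlinarith
  refine ⟨α, hα, fun x hx => ?_⟩
  rw [mem_ball, dist_eq_norm] at hx
  have key : ∀ R' : ℝ, ‖x - y‖ < R' → R' < R →
      ε * (Real.exp (-α * ‖x - y‖ ^ 2) - Real.exp (-α * R' ^ 2)) ≤ w x := by
    intro R' h1 h2
    have hsub : closedBall y R' ⊆ ball y R := closedBall_subset_ball h2
    exact ball_lemma S hO hOΩ hw0 hwL hw ((norm_nonneg _).trans h1.le) (hsub.trans hR) hr hε hα hlam0.le hwr
      (hV.mono hsub) (fun z hz => hlam z (hsub hz)) (fun z hz => hM0 z (hsub hz)) hcond x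
      (by rw [mem_closedBall, dist_eq_norm]; exact h1.le)
  have hc : Continuous (fun R' : ℝ => ε * (Real.exp (-α * ‖x - y‖ ^ 2) - Real.exp (-α * R' ^ 2))) := by
    fun_prop
  have ht : Tendsto (fun R' : ℝ => ε * (Real.exp (-α * ‖x - y‖ ^ 2) - Real.exp (-α * R' ^ 2))) (𝓝[<] R)
      (𝓝 (ε * (Real.exp (-α * ‖x - y‖ ^ 2) - Real.exp (-α * R ^ 2)))) :=
    (hc.tendsto R).mono_left nhdsWithin_le_nhds
  refine le_of_tendsto ht ?_
  filter_upwards [Ioo_mem_nhdsLT hx] with R' hR' using key R' hR'.1 hR'.2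

lemma smp (S : Dat Ω η a f u Du H) {O : Set (Eu n)} (hO : IsOpen O) (hOΩ : O ⊆ Ω) (hOc : IsPreconnected O)
    {w : Eu n → ℝ} (hw0 : ∀ x, 0 ≤ w x) (hwL : LocallyLipschitzOn O w) (hw : SupSol Ω O a f u Du w)
    {x₀ : Eu n} (hx₀ : x₀ ∈ O) (hwx : 0 < w x₀) : ∀ x ∈ O, 0 < w x := by
  have hc : ContinuousOn w O := hwL.continuousOn
  set P := {x ∈ O | 0 < w x} with hP
  have hPo : IsOpen P := by
    have := hc.isOpen_inter_preimage hO (isOpen_Ioi (a := (0 : ℝ)))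
    exact this
  have hsub : O ⊆ P := by
    refine hOc.subset_of_closure_inter_subset hPo ⟨x₀, hx₀, hx₀, hwx⟩ ?_
    rintro x ⟨hxc, hxO⟩
    obtain ⟨ρ, hρ, hρO⟩ := Metric.isOpen_iff.1 hO x hxO
    obtain ⟨y, hyP, hxy⟩ := Metric.mem_closure_iff.1 hxc (ρ / 4) (by positivity)
    have hb : ball y (ρ / 2) ⊆ O := by
      refine (ball_subset_ball' ?_).trans hρO
      rw [dist_comm]; linarith
    have hcy : ContinuousAt w y := hc.continuousAt (hO.mem_nhds hyP.1)
    have hev : ∀ᶠ z in 𝓝 y, w y / 2 < w z := hcy.eventually (lt_mem_nhds (by linarith [hyP.2]))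
    obtain ⟨r, hr, hrw⟩ := Metric.eventually_nhds_iff_ball.1 hev
    have hr' : 0 < min (r / 2) (ρ / 4) := by positivity
    obtain ⟨α, hα, h⟩ := ball_lower S hO hOΩ hw0 hwL hw hr' (R := ρ / 2)
      ((min_le_right _ _).trans_lt (by linarith)) hb (half_pos hyP.2) (fun z hz => (hrw z
        (closedBall_subset_ball ((min_le_left _ _).trans_lt (by linarith)) hz)).le)
    have hx2 : x ∈ ball y (ρ / 2) := by rw [mem_ball]; linarith
    refine ⟨hxO, lt_of_lt_of_le ?_ (h x hx2)⟩
    refine mul_pos (half_pos hyP.2) (sub_pos.2 (Real.exp_lt_exp.2 ?_))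
    rw [mem_ball, dist_eq_norm] at hx2
    have : ‖x - y‖ ^ 2 < (ρ / 2) ^ 2 := by gcongr
    nlinarith
  exact fun x hx => (hsub hx).2

end


section

/-! ### The key lemma: truncations of directional derivatives are solutions -/

variable {Ω : Set (Eu n)} {η : Eu n → Eu n} {a f : ℝ → ℝ} {u : Eu n → ℝ}
    {Du : Eu n → Eu n} {H : Eu n → Eu n →L[ℝ] Eu n}

/-- admissible truncation of `⟪Du, Y⟫`. -/
structure Adm (Ω : Set (Eu n)) (Du : Eu n → Eu n) (Y : Eu n) (z : Eu n → ℝ) : Prop where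
  cont : Continuous z
  nn : ∀ x, 0 ≤ z x
  off : ∀ x, x ∉ Ω → z x = 0
  val : ∀ x ∈ Ω, z x = 0 ∨ z x = ⟪Du x, Y⟫

lemma Adm.LL {Y : Eu n} {z : Eu n → ℝ} (hz : Adm Ω Du Y z) (S : Dat Ω η a f u Du H) :
    LocallyLipschitzOn Ω z := by
  intro x hx
  obtain ⟨K, t, ht, hK⟩ := S.v_LL Y hx
  rw [S.op.nhdsWithin_eq hx] at ht ⊢
  obtain ⟨ρ, hρ, hb⟩ := Metric.mem_nhds_iff.1 (inter_mem ht (S.op.mem_nhds hx))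
  have hK' : LipschitzOnWith K (fun y => ⟪Du y, Y⟫) (ball x ρ) := hK.mono (fun y hy => (hb hy).1)
  refine ⟨K, ball x ρ, ball_mem_nhds x hρ, ?_⟩
  have key : ∀ y ∈ ball x ρ, ∀ y' ∈ ball x ρ, z y - z y' ≤ K * dist y y' := by
    intro y hy y' hy'
    have hdist : 0 ≤ K * dist y y' := by positivity
    rcases (hz.nn y).eq_or_lt with h0 | hpos
    · have := hz.nn y'
      linarith
    have e1 : z y = ⟪Du y, Y⟫ := (hz.val y (hb hy).2).resolve_left hpos.ne'
    rcases (hz.nn y').eq_or_lt with h0' | hpos'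
    · -- first zero on the segment
      set γ : ℝ → Eu n := fun s => y + s • (y' - y) with hγ
      have hγc : Continuous γ := by fun_prop
      have hγb : ∀ s ∈ Icc (0 : ℝ) 1, γ s ∈ ball x ρ := fun s hs =>
        (convex_ball x ρ).add_smul_sub_mem hy hy' hs
      have hcpt : IsCompact (Icc (0 : ℝ) 1 ∩ {s | z (γ s) = 0}) :=
        isCompact_Icc.inter_right (isClosed_eq (hz.cont.comp hγc) continuous_const)
      obtain ⟨s0, ⟨hs0, hzs0⟩, hmin⟩ := hcpt.exists_isLeast ⟨1, ⟨zero_le_one, le_rfl⟩, by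
        show z (γ 1) = 0
        simp [hγ, ← h0']⟩
      have hs0' : z (γ s0) = 0 := hzs0
      have hs0pos : 0 < s0 := by
        rcases hs0.1.eq_or_lt with h | h
        · exfalso
          rw [← h] at hs0'
          simp [hγ] at hs0'
          linarith
        · exact h
      have hv0 : ⟪Du (γ s0), Y⟫ = 0 := by
        have hc1 : ContinuousAt (fun s => ⟪Du (γ s), Y⟫) s0 := by
          have h1 : ContinuousAt (fun y => ⟪Du y, Y⟫) (γ s0) :=
            hK'.continuousOn.continuousAt (isOpen_ball.mem_nhds (hγb s0 hs0))
          exact ContinuousAt.comp (f := γ) h1 hγc.continuousAt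
        have hc2 : ContinuousAt (fun s => z (γ s)) s0 := (hz.cont.comp hγc).continuousAt
        have t1 := hc1.tendsto.mono_left (nhdsWithin_le_nhds (s := Iio s0))
        have t2 := hc2.tendsto.mono_left (nhdsWithin_le_nhds (s := Iio s0))
        have heq : (fun s => z (γ s)) =ᶠ[𝓝[<] s0] (fun s => ⟪Du (γ s), Y⟫) := by
          filter_upwards [Ioo_mem_nhdsLT hs0pos] with s hs
          have hsI : s ∈ Icc (0 : ℝ) 1 := ⟨hs.1.le, hs.2.le.trans hs0.2⟩
          refine (hz.val _ (hb (hγb s hsI)).2).resolve_left fun h => ?_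
          exact absurd (hmin ⟨hsI, h⟩) (not_le.2 hs.2)
        have := tendsto_nhds_unique (t2.congr' heq) t1
        rw [← this]; exact hs0'
      have h1 := hK'.dist_le_mul y hy (γ s0) (hγb s0 hs0)
      rw [Real.dist_eq] at h1
      have h2 : dist y (γ s0) ≤ dist y y' := by
        rw [dist_eq_norm, dist_eq_norm, hγ]
        simp only [sub_add_cancel_left, norm_neg, norm_smul]
        rw [norm_sub_rev y y', Real.norm_of_nonneg hs0.1]
        nlinarith [norm_nonneg (y' - y), hs0.2]
      have h3 := le_abs_self (⟪Du y, Y⟫ - ⟪Du (γ s0), Y⟫)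
      have h4 : (K : ℝ) * dist y (γ s0) ≤ K * dist y y' := by gcongr
      have h5 : z y - z y' = ⟪Du y, Y⟫ := by rw [← h0', sub_zero, e1]
      rw [h5]
      simp only [hv0, sub_zero] at h1 h3
      linarith
    · have e2 : z y' = ⟪Du y', Y⟫ := (hz.val y' (hb hy').2).resolve_left hpos'.ne'
      have h1 := hK'.dist_le_mul y hy y' hy'
      rw [Real.dist_eq] at h1
      have h3 := le_abs_self (⟪Du y, Y⟫ - ⟪Du y', Y⟫)
      rw [e1, e2]
      exact h3.trans h1
  refine LipschitzOnWith.of_dist_le_mul fun y hy y' hy' => ?_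
  rw [Real.dist_eq, abs_le]
  have k1 := key y hy y' hy'
  have k2 := key y' hy' y hy
  rw [dist_comm] at k2
  constructor <;> linarith

lemma Adm.ev {Y : Eu n} {z : Eu n → ℝ} (hz : Adm Ω Du Y z) (S : Dat Ω η a f u Du H) {x : Eu n} {ε : ℝ}
    (hε : 0 ≤ ε) (hx : ε < z x) : x ∈ Ω ∧ ∀ᶠ y in 𝓝 x, ε < z y ∧ z y = ⟪Du y, Y⟫ := by
  have hxO : x ∈ Ω := by
    by_contra h
    have := hz.off x h
    linarith
  refine ⟨hxO, ?_⟩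
  filter_upwards [hz.cont.continuousAt.eventually (lt_mem_nhds hx), S.op.mem_nhds hxO] with y h1 h2
  exact ⟨h1, (hz.val y h2).resolve_left (by linarith)⟩

/-- truncated gradient -/
def hcut (z : Eu n → ℝ) (H : Eu n → Eu n →L[ℝ] Eu n) (Y : Eu n) (ε : ℝ) (x : Eu n) : Eu n :=
  open Classical in if ε < z x then H x Y else 0

lemma hcut_pos {z : Eu n → ℝ} {Y : Eu n} {ε : ℝ} {x : Eu n} (h : ε < z x) : hcut z H Y ε x = H x Y := by
  simp [hcut, h]
lemma hcut_neg {z : Eu n → ℝ} {Y : Eu n} {ε : ℝ} {x : Eu n} (h : ¬ ε < z x) : hcut z H Y ε x = 0 := by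
  simp [hcut, h]
lemma hcut_le (z : Eu n → ℝ) (Y : Eu n) (ε : ℝ) (x : Eu n) : ‖hcut z H Y ε x‖ ≤ ‖H x Y‖ := by
  by_cases h : ε < z x
  · rw [hcut_pos h]
  · rw [hcut_neg h]; simp

lemma hcut_meas {z : Eu n → ℝ} (hz : Continuous z) (S : Dat Ω η a f u Du H) (Y : Eu n) (ε : ℝ) :
    AEStronglyMeasurable (hcut z H Y ε) (volume.restrict Ω) := by
  have h1 : AEStronglyMeasurable (fun x => H x Y) (volume.restrict Ω) :=
    S.aesm (S.hHc.clm_apply continuousOn_const)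
  have h2 : MeasurableSet {x | ε < z x} := (isOpen_lt continuous_const hz).measurableSet
  have h3 := h1.indicator h2
  refine h3.congr (Eventually.of_forall fun x => ?_)
  by_cases h : ε < z x
  · rw [hcut_pos h, indicator_of_mem]; exact h
  · rw [hcut_neg h, indicator_of_notMem]; exact h

lemma Adm.grad {Y : Eu n} {z : Eu n → ℝ} (hz : Adm Ω Du Y z) (S : Dat Ω η a f u Du H) (x : Eu n) :
    gradient z x = hcut z H Y 0 x := by
  by_cases h : 0 < z x
  · obtain ⟨hxO, hev⟩ := hz.ev S le_rfl h
    have : z =ᶠ[𝓝 x] fun y => ⟪Du y, Y⟫ := hev.mono fun y hy => hy.2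
    rw [hcut_pos h, this.gradient_eq, S.gradV hxO]
  · rw [hcut_neg h]
    exact grad_zero_of_nonneg (Eventually.of_forall hz.nn) (le_antisymm (not_lt.1 h) (hz.nn x))

/-- positive part `(z - ε)⁺` times `φ` is a test function -/
lemma Adm.test {Y : Eu n} {z : Eu n → ℝ} (hz : Adm Ω Du Y z) (S : Dat Ω η a f u Du H) {ε : ℝ} (hε : 0 < ε)
    {φ : Eu n → ℝ} {C : NNReal} (hφ : LipschitzWith C φ) (hc : HasCompactSupport φ) :
    IsTestOn Ω (fun x => max (z x - ε) 0 * φ x) := by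
  have hK : IsCompact (tsupport φ ∩ {x | ε ≤ z x}) :=
    IsCompact.inter_right hc (isClosed_le continuous_const hz.cont)
  refine test_of_cpt S.op hK ?_ ?_ ?_
  · rintro x ⟨-, hx⟩
    by_contra h
    have h1 := hz.off x h
    have h2 : ε ≤ z x := hx
    linarith
  · intro x hx
    by_cases h1 : x ∈ tsupport φ
    · have h2 : z x < ε := by
        by_contra! h
        exact hx ⟨h1, h⟩
      show max (z x - ε) 0 * φ x = 0
      rw [max_eq_right (by linarith), zero_mul]
    · show max (z x - ε) 0 * φ x = 0
      rw [image_eq_zero_of_notMem_tsupport h1, mul_zero]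
  · exact LL.mul (LL.pos (LL.sub (hz.LL S) (LL.const ε))) hφ.locallyLipschitz.locallyLipschitzOn

lemma Adm.grad_test {Y : Eu n} {z : Eu n → ℝ} (hz : Adm Ω Du Y z) (S : Dat Ω η a f u Du H) {ε : ℝ} (hε : 0 < ε)
    {φ : Eu n → ℝ} (hφ0 : ∀ x, 0 ≤ φ x) {x : Eu n} (hd : DifferentiableAt ℝ φ x) :
    gradient (fun x => max (z x - ε) 0 * φ x) x
      = max (z x - ε) 0 • gradient φ x + φ x • hcut z H Y ε x := by
  by_cases h : ε < z x
  · obtain ⟨hxO, hev⟩ := hz.ev S hε.le h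
    have e : (fun x => max (z x - ε) 0 * φ x) =ᶠ[𝓝 x] fun y => (⟪Du y, Y⟫ - ε) * φ y := by
      filter_upwards [hev] with y hy
      rw [max_eq_left (by linarith [hy.1]), hy.2]
    have hdv := (S.hasV hxO Y).differentiableAt
    rw [e.gradient_eq, grad_mul (hdv.sub_const ε) hd, hcut_pos h, max_eq_left (by linarith),
      hev.self_of_nhds.2]
    congr 2
    rw [← S.gradV hxO Y]
    simp [gradient, fderiv_sub_const]
  · rw [hcut_neg h, max_eq_right (by linarith [not_lt.1 h])]
    simp only [zero_smul, smul_zero, add_zero]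
    exact grad_zero_of_nonneg (Eventually.of_forall fun y => mul_nonneg (le_max_right _ _) (hφ0 y))
      (by rw [max_eq_right (by linarith [not_lt.1 h]), zero_mul])

end


section

variable {Ω : Set (Eu n)} {η : Eu n → Eu n} {a f : ℝ → ℝ} {u : Eu n → ℝ}
    {Du : Eu n → Eu n} {H : Eu n → Eu n →L[ℝ] Eu n}

lemma IsTestOn.add {O : Set (Eu n)} {φ ψ : Eu n → ℝ} (h1 : IsTestOn O φ) (h2 : IsTestOn O ψ) :
    IsTestOn O (fun x => φ x + ψ x) := by
  obtain ⟨⟨C1, l1⟩, c1, s1⟩ := h1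
  obtain ⟨⟨C2, l2⟩, c2, s2⟩ := h2
  refine ⟨⟨C1 + C2, l1.add l2⟩, c1.add c2, ?_⟩
  exact (tsupport_add φ ψ).trans (union_subset s1 s2)

lemma IsTestOn.const_mul {O : Set (Eu n)} {φ : Eu n → ℝ} (h1 : IsTestOn O φ) (t : ℝ) :
    IsTestOn O (fun x => t * φ x) := by
  obtain ⟨⟨C1, l1⟩, c1, s1⟩ := h1
  refine ⟨⟨‖t‖₊ * C1, ?_⟩, c1.mul_left, ?_⟩
  · exact (lipschitzWith_smul t).comp l1
  · exact (tsupport_mul_subset_right (f := fun _ => t) (g := φ)).trans s1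

lemma sq_test {φ : Eu n → ℝ} {C : NNReal} (hφ : LipschitzWith C φ) (hc : HasCompactSupport φ) :
    (∃ C', LipschitzWith C' (fun x => φ x * φ x)) ∧ HasCompactSupport (fun x => φ x * φ x) := by
  have h := test_of_cpt (O := univ) (ψ := fun x => φ x * φ x) isOpen_univ (K := tsupport φ) hc (subset_univ _)
    (fun x hx => by rw [image_eq_zero_of_notMem_tsupport hx, mul_zero])
    (LL.mul hφ.locallyLipschitz.locallyLipschitzOn hφ.locallyLipschitz.locallyLipschitzOn)
  exact ⟨h.1, h.2.1⟩

lemma M_amgm (S : Dat Ω η a f u Du H) (x v w : Eu n) :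
    2 * ⟪AL a (Du x) v, w⟫ ≤ ⟪AL a (Du x) v, v⟫ + ⟪AL a (Du x) w, w⟫ := by
  have h := S.M_nonneg x (v - w)
  simp only [map_sub, inner_sub_left, inner_sub_right] at h
  have h2 : ⟪AL a (Du x) w, v⟫ = ⟪AL a (Du x) v, w⟫ := by rw [AL_symm, real_inner_comm]
  linarith

set_option maxHeartbeats 2000000 in
lemma Adm.ineq {Y : Eu n} {z : Eu n → ℝ} (hz : Adm Ω Du Y z) (S : Dat Ω η a f u Du H) {ε : ℝ} (hε : 0 < ε)
    {φ : Eu n → ℝ} {C : NNReal} (hφ : LipschitzWith C φ) (hc : HasCompactSupport φ) (hφ0 : ∀ x, 0 ≤ φ x)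
    {ψ : Eu n → ℝ} (hψ : IsTestOn Ω ψ) (t : ℝ) :
    0 ≤ 2 * ‖Y‖ ^ 2 * (∫ x in Ω, ‖Du x‖ ^ 2 * ⟪AL a (Du x) (gradient φ x), gradient φ x⟫)
      + ε * (∫ x in Ω, |deriv f (u x)| * |⟪Du x, Y⟫| * φ x ^ 2)
      + 2 * t * (∫ x in Ω, (φ x * ⟪AL a (Du x) (hcut z H Y ε x), gradient ψ x⟫
          - deriv f (u x) * max (z x - ε) 0 * φ x * ψ x))
      + t ^ 2 * (∫ x in Ω, (2 * ⟪AL a (Du x) (gradient ψ x), gradient ψ x⟫ - deriv f (u x) * ψ x ^ 2)) := by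
  obtain ⟨⟨Cψ, lψ⟩, cψ, sψ⟩ := id hψ
  set ζ : Eu n → ℝ := fun x => max (z x - ε) 0 with hζ
  have hζc : Continuous ζ := (hz.cont.sub continuous_const).max continuous_const
  set h := hcut z H Y ε with hh
  set g : Eu n → ℝ := fun x => ζ x * φ x + t * ψ x with hg
  have hgt : IsTestOn Ω g := (hz.test S hε hφ hc).add (hψ.const_mul t)
  obtain ⟨⟨C2, lφ2⟩, cφ2⟩ := sq_test hφ hc
  set k : Eu n → ℝ := fun x => ζ x * (φ x * φ x) with hk
  have hkt : IsTestOn Ω k := hz.test S hε lφ2 cφ2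
  obtain ⟨⟨Cg, lg⟩, cg, sg⟩ := id hgt
  obtain ⟨⟨Ck, lk⟩, ck, sk⟩ := id hkt
  have Kφ : IsCompact (tsupport φ) := hc
  have Kψ : IsCompact (tsupport ψ) := cψ
  have zφ : ∀ x, x ∉ tsupport φ → φ x = 0 := fun x hx => image_eq_zero_of_notMem_tsupport hx
  have zψ : ∀ x, x ∉ tsupport ψ → ψ x = 0 := fun x hx => image_eq_zero_of_notMem_tsupport hx
  obtain ⟨BD, hBD0, hBD⟩ := S.bdd S.hDuc Kφ
  obtain ⟨BHψ, -, hBHψ⟩ := S.bdd (S.hHc.clm_apply (continuousOn_const (c := Y))) Kψ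
  obtain ⟨BHk, -, hBHk⟩ := S.bdd (S.hHc.clm_apply (continuousOn_const (c := Y))) (K := tsupport k) ck
  have vc : ContinuousOn (fun x => ⟪Du x, Y⟫) (closure Ω) := S.hDuc.inner continuousOn_const
  have bm : ∀ {p : Eu n → ℝ}, ContinuousOn p (closure Ω) → (K : Set (Eu n)) → IsCompact K →
      (∀ x, x ∉ K → p x = 0) → IntegrableOn (fun x => deriv f (u x) * p x) Ω := by
    intro p hp K hK h0
    obtain ⟨B, hB0, hB⟩ := S.bdd hp hK
    exact S.int_c (S.aesm hp) hK B (fun x hx hxK => hB x (subset_closure hx) hxK) (fun x _ hx => h0 x hx)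
  -- integrability
  have J1 : IntegrableOn (fun x => ‖Du x‖ ^ 2 * ⟪AL a (Du x) (gradient φ x), gradient φ x⟫) Ω := by
    have := S.int_M (g1 := fun x => ‖Du x‖ ^ 2 • gradient φ x) (g2 := gradient φ)
      ((S.aesm (S.hDuc.norm.pow 2)).smul (grad_meas φ).aestronglyMeasurable)
      (grad_meas φ).aestronglyMeasurable Kφ (BD ^ 2 * C) C
      (fun x hx hxK => by
        rw [norm_smul, norm_pow, norm_norm]
        gcongr
        · exact hBD x (subset_closure hx) hxK
        · exact grad_norm_le hφ x) (fun x _ _ => grad_norm_le hφ x)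
      (fun x _ hx => Or.inr (grad_zero_off hx))
    refine this.congr_fun (fun x _ => ?_) S.ms
    simp only [map_smul, inner_smul_left, RCLike.conj_to_real]
  have J3 : IntegrableOn (fun x => |deriv f (u x)| * |⟪Du x, Y⟫| * φ x ^ 2) Ω := by
    have := (bm (p := fun x => ⟪Du x, Y⟫ * φ x ^ 2) (vc.mul (hφ.continuous.pow 2).continuousOn) _ Kφ
      (fun x hx => by simp [zφ x hx])).abs
    refine IntegrableOn.congr_fun this (fun x _ => ?_) S.ms
    simp only [abs_mul, abs_of_nonneg (sq_nonneg (φ x))]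
    ring
  have J4a : IntegrableOn (fun x => φ x * ⟪AL a (Du x) (h x), gradient ψ x⟫) Ω := by
    obtain ⟨Bφ, hBφ⟩ := Kψ.exists_bound_of_continuousOn hφ.continuous.continuousOn
    have := S.int_M (g1 := fun x => φ x • h x) (g2 := gradient ψ)
      (hφ.continuous.aestronglyMeasurable.smul (hcut_meas hz.cont S Y ε))
      (grad_meas ψ).aestronglyMeasurable Kψ (|Bφ| * BHψ) Cψ
      (fun x hx hxK => by
        rw [norm_smul]
        gcongr
        · exact (hBφ x hxK).trans (le_abs_self _)
        · exact (hcut_le z Y ε x).trans (hBHψ x (subset_closure hx) hxK))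
      (fun x _ _ => grad_norm_le lψ x)
      (fun x _ hx => Or.inr (grad_zero_off hx))
    refine this.congr_fun (fun x _ => ?_) S.ms
    simp only [map_smul, inner_smul_left, RCLike.conj_to_real]
  have J4b : IntegrableOn (fun x => deriv f (u x) * ζ x * φ x * ψ x) Ω := by
    have := bm (p := fun x => ζ x * φ x * ψ x)
      ((hζc.mul hφ.continuous).mul lψ.continuous).continuousOn _ Kψ (fun x hx => by simp [zψ x hx])
    refine this.congr_fun (fun x _ => ?_) S.ms
    ring
  have J4 := J4a.sub J4b
  have J5 : IntegrableOn (fun x => 2 * ⟪AL a (Du x) (gradient ψ x), gradient ψ x⟫ - deriv f (u x) * ψ x ^ 2) Ω := by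
    refine ((S.int_M (grad_meas ψ).aestronglyMeasurable (grad_meas ψ).aestronglyMeasurable Kψ Cψ Cψ
      (fun x _ _ => grad_norm_le lψ x) (fun x _ _ => grad_norm_le lψ x)
      (fun x _ hx => Or.inr (grad_zero_off hx))).const_mul 2).sub
      (bm (lψ.continuous.pow 2).continuousOn _ Kψ (fun x hx => by simp [zψ x hx]))
  have J2a : IntegrableOn (fun x => ⟪AL a (Du x) (H x Y), gradient k x⟫) Ω :=
    S.int_M (S.aesm (S.hHc.clm_apply continuousOn_const)) (grad_meas k).aestronglyMeasurable (K := tsupport k) ck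
      BHk Ck (fun x hx hxK => hBHk x (subset_closure hx) hxK) (fun x _ _ => grad_norm_le lk x)
      (fun x _ hx => Or.inr (grad_zero_off hx))
  have J2b : IntegrableOn (fun x => deriv f (u x) * ⟪Du x, Y⟫ * k x) Ω := by
    have := bm (p := fun x => ⟪Du x, Y⟫ * k x) (vc.mul lk.continuous.continuousOn) (tsupport k) ck
      (fun x hx => by simp [image_eq_zero_of_notMem_tsupport hx])
    refine this.congr_fun (fun x _ => ?_) S.ms
    ring
  have J6a : IntegrableOn (fun x => ⟪AL a (Du x) (gradient g x), gradient g x⟫) Ω :=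
    S.int_M (grad_meas g).aestronglyMeasurable (grad_meas g).aestronglyMeasurable (K := tsupport g) cg Cg Cg
      (fun x _ _ => grad_norm_le lg x) (fun x _ _ => grad_norm_le lg x)
      (fun x _ hx => Or.inr (grad_zero_off hx))
  have J6b : IntegrableOn (fun x => deriv f (u x) * g x ^ 2) Ω :=
    bm (lg.continuous.pow 2).continuousOn (tsupport g) cg (fun x hx => by simp [image_eq_zero_of_notMem_tsupport hx])
  have hstab : 0 ≤ ∫ x in Ω, (⟪AL a (Du x) (gradient g x), gradient g x⟫ - deriv f (u x) * g x ^ 2) := by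
    rw [integral_sub J6a J6b]
    linarith [S.stab' hgt]
  have hlin : ∫ x in Ω, (⟪AL a (Du x) (H x Y), gradient k x⟫ - deriv f (u x) * ⟪Du x, Y⟫ * k x) = 0 := by
    rw [integral_sub J2a J2b, S.lin hkt Y, sub_self]
  have hle : ∀ᵐ x ∂(volume.restrict Ω), (⟪AL a (Du x) (gradient g x), gradient g x⟫ - deriv f (u x) * g x ^ 2)
      ≤ 2 * ‖Y‖ ^ 2 * (‖Du x‖ ^ 2 * ⟪AL a (Du x) (gradient φ x), gradient φ x⟫)
        + ε * (|deriv f (u x)| * |⟪Du x, Y⟫| * φ x ^ 2)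
        + 2 * t * (φ x * ⟪AL a (Du x) (h x), gradient ψ x⟫ - deriv f (u x) * ζ x * φ x * ψ x)
        + t ^ 2 * (2 * ⟪AL a (Du x) (gradient ψ x), gradient ψ x⟫ - deriv f (u x) * ψ x ^ 2)
        + (⟪AL a (Du x) (H x Y), gradient k x⟫ - deriv f (u x) * ⟪Du x, Y⟫ * k x) := by
    rw [ae_restrict_iff' S.ms]
    filter_upwards [hφ.ae_differentiableAt (μ := (volume : Measure (Eu n))),
      lψ.ae_differentiableAt (μ := (volume : Measure (Eu n))),
      (hz.test S hε hφ hc).1.choose_spec.ae_differentiableAt (μ := (volume : Measure (Eu n)))] with x d1 d2 d3 hxO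
    have e1 : gradient g x = ζ x • gradient φ x + φ x • h x + t • gradient ψ x := by
      have := grad_add d3 (d2.const_mul t)
      rw [hg]
      refine this.trans ?_
      rw [hz.grad_test S hε hφ0 d1, grad_const_mul t d2]
    have e2 : gradient k x = (2 * ζ x * φ x) • gradient φ x + (φ x ^ 2) • h x := by
      have := hz.grad_test S hε (φ := fun x => φ x * φ x) (fun x => mul_self_nonneg _) (d1.mul d1)
      refine this.trans ?_
      rw [grad_mul d1 d1, ← hh, ← two_smul ℝ (φ x • gradient φ x), smul_smul, smul_smul, ← sq]
      congr 2
      simp only [hζ]; ring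
    have hG := S.M_nonneg x (gradient φ x)
    have hP := S.M_nonneg x (gradient ψ x)
    have hz0 : 0 ≤ ζ x := le_max_right _ _
    have habs : ζ x ≤ |⟪Du x, Y⟫| := by
      have h1 : ζ x ≤ z x := max_le (by linarith) (hz.nn x)
      rcases hz.val x hxO with h2 | h2
      · exact h1.trans (h2.le.trans (abs_nonneg _))
      · exact h1.trans (h2.le.trans (le_abs_self _))
    have habs2 : ζ x ^ 2 ≤ ‖Y‖ ^ 2 * ‖Du x‖ ^ 2 := by
      have h1 : ζ x ≤ ‖Du x‖ * ‖Y‖ := habs.trans (abs_real_inner_le_norm _ _)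
      calc ζ x ^ 2 ≤ (‖Du x‖ * ‖Y‖) ^ 2 := by gcongr
        _ = _ := by ring
    have a1 : ζ x ^ 2 * ⟪AL a (Du x) (gradient φ x), gradient φ x⟫
        ≤ ‖Y‖ ^ 2 * (‖Du x‖ ^ 2 * ⟪AL a (Du x) (gradient φ x), gradient φ x⟫) := by
      rw [← mul_assoc]; gcongr
    have a2 : ε * (deriv f (u x) * ζ x * φ x ^ 2) ≤ ε * (|deriv f (u x)| * |⟪Du x, Y⟫| * φ x ^ 2) := by
      gcongr
      exact le_abs_self _
    have a3 := M_amgm S x (ζ x • gradient φ x) (t • gradient ψ x)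
    have hsw : ⟪AL a (Du x) (gradient φ x), h x⟫ = ⟪AL a (Du x) (h x), gradient φ x⟫ := by
      rw [AL_symm, real_inner_comm]
    have hsw2 : ⟪AL a (Du x) (gradient ψ x), h x⟫ = ⟪AL a (Du x) (h x), gradient ψ x⟫ := by
      rw [AL_symm, real_inner_comm]
    have hsw3 : ⟪AL a (Du x) (gradient ψ x), gradient φ x⟫ = ⟪AL a (Du x) (gradient φ x), gradient ψ x⟫ := by
      rw [AL_symm, real_inner_comm]
    have e3 : ⟪AL a (Du x) (H x Y), gradient k x⟫ - deriv f (u x) * ⟪Du x, Y⟫ * k x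
        = 2 * ζ x * φ x * ⟪AL a (Du x) (h x), gradient φ x⟫ + φ x ^ 2 * ⟪AL a (Du x) (h x), h x⟫
          - deriv f (u x) * (ζ x ^ 2 + ε * ζ x) * φ x ^ 2 := by
      rw [e2]
      by_cases hc' : ε < z x
      · rw [hh, hcut_pos hc']
        have e4 : ⟪Du x, Y⟫ = ζ x + ε := by
          rw [← (hz.val x hxO).resolve_left (by linarith)]
          simp only [hζ]; rw [max_eq_left (by linarith)]; ring
        simp only [hk, e4, inner_add_right, inner_smul_right]
        ring
      · have e4 : ζ x = 0 := max_eq_right (by linarith [not_lt.1 hc'])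
        rw [hh, hcut_neg hc']
        simp [hk, e4]
    rw [e3, e1]
    simp only [map_add, map_smul, inner_add_left, inner_add_right, inner_smul_left, inner_smul_right,
      RCLike.conj_to_real] at a3 ⊢
    rw [hsw, hsw2, hsw3]
    simp only [hg]
    nlinarith
  have := hstab.trans (integral_mono_ae (J6a.sub J6b)
    (((((J1.const_mul (2 * ‖Y‖ ^ 2)).add (J3.const_mul ε)).add (J4.const_mul (2 * t))).add
      (J5.const_mul (t ^ 2))).add (J2a.sub J2b)) hle)
  refine this.trans (le_of_eq ?_)
  have i1 := J1.const_mul (2 * ‖Y‖ ^ 2)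
  have i3 := J3.const_mul ε
  have i4 := J4.const_mul (2 * t)
  have i5 := J5.const_mul (t ^ 2)
  have A := integral_add (((i1.add i3).add i4).add i5) (J2a.sub J2b)
  have B := integral_add ((i1.add i3).add i4) i5
  have C' := integral_add (i1.add i3) i4
  have D := integral_add i1 i3
  simp only [integral_const_mul] at B C' D
  simp only [Pi.add_apply, Pi.sub_apply] at A B C' D ⊢
  rw [A, hlin, B, C', D, add_zero]

end


section

variable {Ω : Set (Eu n)} {η : Eu n → Eu n} {a f : ℝ → ℝ} {u : Eu n → ℝ}
    {Du : Eu n → Eu n} {H : Eu n → Eu n →L[ℝ] Eu n}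

lemma quad_zero {B C : ℝ} (h : ∀ t : ℝ, 0 ≤ 2 * t * B + t ^ 2 * C) : B = 0 := by
  by_contra hB
  have h1 := h (-B / (|C| + 1))
  have hd : 0 < |C| + 1 := by positivity
  have e : 2 * (-B / (|C| + 1)) * B + (-B / (|C| + 1)) ^ 2 * C
      = B ^ 2 * (C - 2 * (|C| + 1)) / (|C| + 1) ^ 2 := by
    field_simp; ring
  rw [e] at h1
  have hB2 : 0 < B ^ 2 := by positivity
  have : B ^ 2 * (C - 2 * (|C| + 1)) / (|C| + 1) ^ 2 < 0 := by
    refine div_neg_of_neg_of_pos ?_ (by positivity)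
    nlinarith [le_abs_self C, abs_nonneg C]
  linarith

lemma Dat.meg' (S : Dat Ω η a f u Du H) : ∃ φ : ℕ → Eu n → ℝ,
    (∀ j, ∃ K, LipschitzWith K (φ j)) ∧ (∀ j, HasCompactSupport (φ j)) ∧ (∀ j x, 0 ≤ φ j x) ∧
    (∀ K : Set (Eu n), IsCompact K → K ⊆ closure Ω →
      TendstoUniformlyOn (fun j => φ j) (fun _ => (1 : ℝ)) atTop K) ∧
    Tendsto (fun j => ∫ x in Ω, ‖Du x‖ ^ 2 *
        ⟪AL a (Du x) (gradient (φ j) x), gradient (φ j) x⟫) atTop (nhds 0) := by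
  obtain ⟨φ, h1, h2, h3, h4, h5⟩ := S.hmeg
  refine ⟨φ, h1, h2, h3, h4, h5.congr fun j => ?_⟩
  refine setIntegral_congr_fun S.ms fun x hx => ?_
  simp only [S.hDu x hx, AL_apply]

set_option maxHeartbeats 1000000 in
lemma Adm.weak {Y : Eu n} {z : Eu n → ℝ} (hz : Adm Ω Du Y z) (S : Dat Ω η a f u Du H)
    {ψ : Eu n → ℝ} (hψ : IsTestOn Ω ψ) :
    ∫ x in Ω, ⟪AL a (Du x) (gradient z x), gradient ψ x⟫ = ∫ x in Ω, deriv f (u x) * z x * ψ x := by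
  obtain ⟨⟨Cψ, lψ⟩, cψ, sψ⟩ := id hψ
  obtain ⟨φ, hφL, hφc, hφ0, hφ1, hφ2⟩ := S.meg'
  choose C hφL using hφL
  have Kψ : IsCompact (tsupport ψ) := cψ
  have zψ : ∀ x, x ∉ tsupport ψ → ψ x = 0 := fun x hx => image_eq_zero_of_notMem_tsupport hx
  set Cj : ℕ → ℝ := fun j => ∫ x in Ω, |deriv f (u x)| * |⟪Du x, Y⟫| * φ j x ^ 2 with hCj
  have hCj0 : ∀ j, 0 ≤ Cj j := fun j => integral_nonneg fun x => by positivity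
  set ε : ℕ → ℝ := fun j => 1 / (((j : ℝ) + 1) * (1 + Cj j)) with hε
  have hε0 : ∀ j, 0 < ε j := fun j => by
    have := hCj0 j
    positivity
  have hεle : ∀ j, ε j ≤ 1 / ((j : ℝ) + 1) := fun j => by
    have := hCj0 j
    simp only [hε]
    apply one_div_le_one_div_of_le (by positivity)
    nlinarith [(Nat.cast_nonneg j : (0 : ℝ) ≤ j)]
  have hεC : ∀ j, ε j * Cj j ≤ 1 / ((j : ℝ) + 1) := fun j => by
    have := hCj0 j
    simp only [hε]
    rw [div_mul_eq_mul_div, one_mul, div_le_div_iff₀ (by positivity) (by positivity)]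
    nlinarith [(Nat.cast_nonneg j : (0 : ℝ) ≤ j)]
  have hεt : Tendsto ε atTop (𝓝 0) := squeeze_zero (fun j => (hε0 j).le) hεle tendsto_one_div_add_atTop_nhds_zero_nat
  have hεCt : Tendsto (fun j => ε j * Cj j) atTop (𝓝 0) :=
    squeeze_zero (fun j => mul_nonneg (hε0 j).le (hCj0 j)) hεC tendsto_one_div_add_atTop_nhds_zero_nat
  obtain ⟨BH, hBH0, hBH⟩ := S.bdd (S.hHc.clm_apply (continuousOn_const (c := Y))) Kψ
  obtain ⟨BM, hBM0, hBM⟩ := S.bdd S.M_contOn Kψ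
  obtain ⟨Bc, hBc0, hBc⟩ := S.bdd S.c_contOn Kψ
  obtain ⟨Bz, hBz⟩ := Kψ.exists_bound_of_continuousOn hz.cont.continuousOn
  obtain ⟨Bψ, hBψ⟩ := Kψ.exists_bound_of_continuousOn lψ.continuous.continuousOn
  have mM : ∀ e, AEStronglyMeasurable (fun x => ⟪AL a (Du x) (hcut z H Y e x), gradient ψ x⟫) (volume.restrict Ω) := by
    intro e
    have h1 := (ContinuousLinearMap.apply ℝ (Eu n) : Eu n →L[ℝ] (Eu n →L[ℝ] Eu n) →L[ℝ] Eu n).flip.aestronglyMeasurable_comp₂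
      (S.aesm S.M_contOn) (hcut_meas hz.cont S Y e)
    exact h1.inner (grad_meas ψ).aestronglyMeasurable
  have bMh : ∀ e x, x ∈ Ω → x ∈ tsupport ψ → |⟪AL a (Du x) (hcut z H Y e x), gradient ψ x⟫| ≤ BM * BH * Cψ := by
    intro e x hx hxK
    calc _ ≤ ‖AL a (Du x) (hcut z H Y e x)‖ * ‖gradient ψ x‖ := abs_real_inner_le_norm _ _
      _ ≤ (‖AL a (Du x)‖ * ‖hcut z H Y e x‖) * ‖gradient ψ x‖ := by
        gcongr; exact ContinuousLinearMap.le_opNorm _ _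
      _ ≤ _ := by
        gcongr
        · exact hBM x (subset_closure hx) hxK
        · exact (hcut_le z Y e x).trans (hBH x (subset_closure hx) hxK)
        · exact grad_norm_le lψ x
  have bc : ∀ e x, 0 ≤ e → x ∈ Ω → x ∈ tsupport ψ → |deriv f (u x) * max (z x - e) 0| ≤ Bc * |Bz| := by
    intro e x he hx hxK
    rw [abs_mul]
    gcongr
    · exact hBc x (subset_closure hx) hxK
    · refine (max_le (by linarith) (hz.nn x)).trans ?_
      exact (le_abs_self (z x)).trans (hBz x hxK)
  set Bj : ℕ → ℝ := fun j => ∫ x in Ω, (φ j x * ⟪AL a (Du x) (hcut z H Y (ε j) x), gradient ψ x⟫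
          - deriv f (u x) * max (z x - ε j) 0 * φ j x * ψ x) with hBj
  set B : ℝ := ∫ x in Ω, (⟪AL a (Du x) (hcut z H Y 0 x), gradient ψ x⟫ - deriv f (u x) * z x * ψ x) with hB
  have hBt : Tendsto Bj atTop (𝓝 B) := by
    refine tendsto_integral_filter_of_dominated_convergence
      ((tsupport ψ).indicator fun _ => 2 * (BM * BH * Cψ) + Bc * |Bz| * 2 * |Bψ|) ?_ ?_ ?_ ?_
    · refine Eventually.of_forall fun j => ?_
      refine ((hφL j).continuous.aestronglyMeasurable.mul (mM _)).sub ?_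
      refine ((AEStronglyMeasurable.mul (S.aesm S.c_contOn) ?_).mul (hφL j).continuous.aestronglyMeasurable).mul
        lψ.continuous.aestronglyMeasurable
      exact ((hz.cont.sub continuous_const).max continuous_const).aestronglyMeasurable
    · have hu := hφ1 (tsupport ψ) cψ (sψ.trans subset_closure)
      rw [Metric.tendstoUniformlyOn_iff] at hu
      filter_upwards [hu 1 one_pos] with j hj
      rw [ae_restrict_iff' S.ms]
      refine Eventually.of_forall fun x hx => ?_
      by_cases hxK : x ∈ tsupport ψ
      · rw [indicator_of_mem hxK]
        have h1 := hj x hxK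
        rw [Real.dist_eq, abs_lt] at h1
        have h2 : |φ j x| ≤ 2 := by rw [abs_of_nonneg (hφ0 j x)]; linarith [h1.1]
        have h3 := bMh (ε j) x hx hxK
        have h4 := bc (ε j) x (hε0 j).le hx hxK
        refine (norm_sub_le _ _).trans (add_le_add ?_ ?_)
        · rw [norm_mul]
          exact mul_le_mul h2 h3 (norm_nonneg _) (by norm_num)
        · rw [norm_mul, norm_mul]
          have h5 : ‖ψ x‖ ≤ |Bψ| := (hBψ x hxK).trans (le_abs_self _)
          gcongr
          · exact h4
          · exact h2
      · rw [indicator_of_notMem hxK, grad_zero_off hxK, zψ x hxK]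
        simp
    · exact ((integrable_indicator_iff Kψ.measurableSet).2 (integrableOn_const Kψ.measure_lt_top.ne)).integrableOn
    · rw [ae_restrict_iff' S.ms]
      refine Eventually.of_forall fun x hx => ?_
      have hφx : Tendsto (fun j => φ j x) atTop (𝓝 1) :=
        (hφ1 {x} isCompact_singleton (singleton_subset_iff.2 (subset_closure hx))).tendsto_at (mem_singleton x)
      have t1 : Tendsto (fun j => max (z x - ε j) 0) atTop (𝓝 (z x)) := by
        have := ((tendsto_const_nhds (x := z x)).sub hεt).max (tendsto_const_nhds (x := (0 : ℝ)))
        simpa [max_eq_left (hz.nn x)] using this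
      have t2 : Tendsto (fun j => ⟪AL a (Du x) (hcut z H Y (ε j) x), gradient ψ x⟫) atTop
          (𝓝 ⟪AL a (Du x) (hcut z H Y 0 x), gradient ψ x⟫) := by
        refine tendsto_const_nhds.congr' ?_
        rcases (hz.nn x).eq_or_lt with h0 | hpos
        · refine Eventually.of_forall fun j => ?_
          have n1 : ¬ (0 : ℝ) < z x := by rw [← h0]; exact lt_irrefl _
          have n2 : ¬ ε j < z x := by rw [← h0]; exact (hε0 j).le.not_gt
          beta_reduce
          rw [hcut_neg n1, hcut_neg n2]
        · filter_upwards [hεt.eventually (gt_mem_nhds hpos)] with j hj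
          rw [hcut_pos hpos, hcut_pos hj]
      have := (hφx.mul t2).sub ((((tendsto_const_nhds (x := deriv f (u x))).mul t1).mul hφx).mul
        (tendsto_const_nhds (x := ψ x)))
      simpa using this
  have hB0 : B = 0 := by
    refine quad_zero (C := ∫ x in Ω, (2 * ⟪AL a (Du x) (gradient ψ x), gradient ψ x⟫ - deriv f (u x) * ψ x ^ 2))
      fun t => ?_
    have hlim := (((hφ2.const_mul (2 * ‖Y‖ ^ 2)).add hεCt).add (hBt.const_mul (2 * t))).add
      (tendsto_const_nhds (x := t ^ 2 * ∫ x in Ω, (2 * ⟪AL a (Du x) (gradient ψ x), gradient ψ x⟫ - deriv f (u x) * ψ x ^ 2)))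
    simp only [mul_zero, zero_add] at hlim
    exact ge_of_tendsto' hlim fun j => hz.ineq S (hε0 j) (hφL j) (hφc j) (hφ0 j) hψ t
  have iM : IntegrableOn (fun x => ⟪AL a (Du x) (hcut z H Y 0 x), gradient ψ x⟫) Ω :=
    S.int_M (hcut_meas hz.cont S Y 0) (grad_meas ψ).aestronglyMeasurable Kψ BH Cψ
      (fun x hx hxK => (hcut_le z Y 0 x).trans (hBH x (subset_closure hx) hxK))
      (fun x _ _ => grad_norm_le lψ x) (fun x _ hx => Or.inr (grad_zero_off hx))
  have ic : IntegrableOn (fun x => deriv f (u x) * z x * ψ x) Ω := by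
    have := S.int_c (g := fun x => z x * ψ x) (hz.cont.mul lψ.continuous).aestronglyMeasurable Kψ (|Bz| * |Bψ|)
      (fun x _ hxK => by
        rw [norm_mul]
        gcongr
        · exact (hBz x hxK).trans (le_abs_self _)
        · exact (hBψ x hxK).trans (le_abs_self _)) (fun x _ hx => by simp [zψ x hx])
    refine IntegrableOn.congr_fun this (fun x _ => ?_) S.ms
    ring
  rw [hB, integral_sub iM ic] at hB0
  simp only [hz.grad S]
  linarith

lemma Adm.zero {Y : Eu n} {z : Eu n → ℝ} (hz : Adm Ω Du Y z) (S : Dat Ω η a f u Du H)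
    {x₀ : Eu n} (hx₀ : x₀ ∈ Ω) (h0 : z x₀ = 0) : ∀ x, z x = 0 := by
  intro x
  by_cases hx : x ∈ Ω
  · by_contra hne
    have := smp S S.op le_rfl S.pre hz.nn (hz.LL S) (fun ψ hψ _ => (hz.weak S hψ).ge) hx
      (lt_of_le_of_ne (hz.nn x) (Ne.symm hne)) x₀ hx₀
    linarith
  · exact hz.off x hx

/-- a nonnegative directional derivative on an open connected set is positive or zero -/
lemma Dat.v_smp (S : Dat Ω η a f u Du H) {O : Set (Eu n)} (hO : IsOpen O) (hOΩ : O ⊆ Ω) (hOc : IsPreconnected O)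
    {Y : Eu n} (h0 : ∀ x ∈ O, 0 ≤ ⟪Du x, Y⟫) {x₀ : Eu n} (hx₀ : x₀ ∈ O) (hwx : 0 < ⟪Du x₀, Y⟫) :
    ∀ x ∈ O, 0 < ⟪Du x, Y⟫ := by
  have hw : SupSol Ω O a f u Du (fun x => |⟪Du x, Y⟫|) := by
    intro ψ hψ _
    refine le_of_eq ?_
    have h1 := S.lin (hψ.mono hOΩ) Y
    have hz : ∀ x, x ∉ O → ψ x = 0 := fun x hx => image_eq_zero_of_notMem_tsupport fun h => hx (hψ.2.2 h)
    have hg : ∀ x, x ∉ O → gradient ψ x = 0 := fun x hx => grad_zero_off fun h => hx (hψ.2.2 h)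
    refine Eq.trans (setIntegral_congr_fun S.ms fun x _ => ?_)
      (h1.symm.trans (setIntegral_congr_fun S.ms fun x _ => ?_))
    · by_cases hx : x ∈ O
      · simp only [abs_of_nonneg (h0 x hx)]
      · simp only [hz x hx, mul_zero]
    · by_cases hx : x ∈ O
      · have e : (fun x => |⟪Du x, Y⟫|) =ᶠ[𝓝 x] fun x => ⟪Du x, Y⟫ := by
          filter_upwards [hO.mem_nhds hx] with y hy using abs_of_nonneg (h0 y hy)
        simp only [e.gradient_eq, S.gradV (hOΩ hx)]
      · simp only [hg x hx, inner_zero_right]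
  have := smp S hO hOΩ hOc (w := fun x => |⟪Du x, Y⟫|) (fun x => abs_nonneg _)
    (LL.congr ((S.v_LL Y).mono hOΩ) (fun x hx => abs_of_nonneg (h0 x hx))) hw hx₀ (abs_pos.2 hwx.ne')
  intro x hx
  have h2 := this x hx
  rwa [abs_of_nonneg (h0 x hx)] at h2

end


section

/-! ### Boundary geometry -/

variable {Ω : Set (Eu n)} {η : Eu n → Eu n} {a f : ℝ → ℝ} {u : Eu n → ℝ}
    {Du : Eu n → Eu n} {H : Eu n → Eu n →L[ℝ] Eu n}

/-- local description of the boundary at `p` with normal `ν` -/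
structure Chart (Ω : Set (Eu n)) (p ν : Eu n) (r K : ℝ) : Prop where
  hr : 0 < r
  hK : 0 < K
  unit : ‖ν‖ = 1
  ins : ∀ y, ‖y - p‖ ≤ r → y ≠ p → K * ‖y - p‖ ^ 2 ≤ ⟪y - p, ν⟫ → y ∈ Ω
  out : ∀ y, ‖y - p‖ ≤ r → ⟪y - p, ν⟫ ≤ -(K * ‖y - p‖ ^ 2) → y ∉ Ω
  up : ∀ x (t : ℝ), ‖x - p‖ < r → ‖x + t • ν - p‖ < r → 0 < t → x ∈ closure Ω → x + t • ν ∈ Ω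

lemma exists_chart (hdom : IsCkDomainWithNormal 2 Ω η) {p : Eu n} (hp : p ∈ frontier Ω) :
    ∃ r K, Chart Ω p (η p) r K := by
  obtain ⟨-, hO, -, hb⟩ := hdom
  obtain ⟨V, g, hV, hpV, hg, hg0, hΩV, hη⟩ := hb p hp
  have hpΩ : p ∉ Ω := fun h => by
    rw [hO.frontier_eq] at hp; exact hp.2 h
  have hcl : ∀ x ∈ V, x ∈ closure Ω → g x ≤ 0 := by
    intro x hxV hx
    have hgx : ContinuousAt g x := hg.continuousOn.continuousAt (hV.mem_nhds hxV)
    by_contra! h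
    obtain ⟨y, hy1, hy2⟩ := mem_closure_iff_nhds.1 hx _
      (inter_mem (hgx.eventually (lt_mem_nhds h)) (hV.mem_nhds hxV))
    have : y ∈ Ω ∩ V := ⟨hy2, hy1.2⟩
    rw [hΩV] at this
    exact absurd this.2 (not_lt.2 (le_of_lt hy1.1))
  have hmem : ∀ x ∈ V, (x ∈ Ω ↔ g x < 0) := by
    intro x hx
    constructor
    · intro h
      have : x ∈ Ω ∩ V := ⟨h, hx⟩
      rw [hΩV] at this; exact this.2
    · intro h
      have : x ∈ {x ∈ V | g x < 0} := ⟨hx, h⟩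
      rw [← hΩV] at this; exact this.1
  have hgp : g p = 0 := le_antisymm (hcl p hpV (frontier_subset_closure hp))
    (not_lt.1 fun h => hpΩ ((hmem p hpV).2 h))
  set m := ‖gradient g p‖ with hm
  have hm0 : 0 < m := norm_pos_iff.2 (hg0 p hpV)
  set ν := η p with hν
  have hgrad : gradient g p = -(m • ν) := by
    rw [hη, smul_neg, neg_neg, smul_smul, mul_inv_cancel₀ hm0.ne', one_smul]
  have hunit : ‖ν‖ = 1 := by
    rw [hη, norm_neg, norm_smul, norm_inv, norm_norm]
    exact inv_mul_cancel₀ hm0.ne'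
  have hgp2 : ContDiffAt ℝ 2 g p := hg.contDiffAt (hV.mem_nhds hpV)
  have hfd : ContDiffAt ℝ 1 (fderiv ℝ g) p := hgp2.fderiv_right (by norm_num)
  obtain ⟨K0, s, hs, hlip⟩ := hfd.exists_lipschitzOnWith
  have hcont : ∀ᶠ x in 𝓝 p, (fderiv ℝ g x) ν < 0 := by
    have hc : ContinuousAt (fun x => (fderiv ℝ g x) ν) p := hfd.continuousAt.clm_apply continuousAt_const
    refine hc.eventually (gt_mem_nhds ?_)
    show (fderiv ℝ g p) ν < 0
    rw [← inner_gradient_left, hgrad, inner_neg_left, inner_smul_left, real_inner_self_eq_norm_sq, hunit]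
    simp [hm0]
  obtain ⟨r, hr, hrs⟩ := Metric.mem_nhds_iff.1 (inter_mem (inter_mem hs (hV.mem_nhds hpV)) hcont)
  have hd : ∀ x ∈ ball p r, HasFDerivAt g (fderiv ℝ g x) x := fun x hx =>
    ((hg.contDiffAt (hV.mem_nhds (hrs hx).1.2)).differentiableAt (by norm_num)).hasFDerivAt
  have hquad : ∀ y ∈ ball p r, |g y + m * ⟪y - p, ν⟫| ≤ K0 * ‖y - p‖ ^ 2 := by
    intro y hy
    have hy' : ‖y - p‖ < r := by rwa [mem_ball, dist_eq_norm] at hy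
    have hsub : closedBall p ‖y - p‖ ⊆ ball p r := closedBall_subset_ball hy'
    have := (convex_closedBall p ‖y - p‖).norm_image_sub_le_of_norm_hasFDerivWithin_le'
      (f := g) (f' := fun x => fderiv ℝ g x) (φ := fderiv ℝ g p) (C := K0 * ‖y - p‖) (x := p) (y := y)
      (fun x hx => (hd x (hsub hx)).hasFDerivWithinAt)
      (fun x hx => by
        have h1 := hlip.dist_le_mul x (hrs (hsub hx)).1.1 p (mem_of_mem_nhds hs)
        rw [dist_eq_norm, dist_eq_norm] at h1
        refine h1.trans ?_
        gcongr
        rwa [mem_closedBall, dist_eq_norm] at hx)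
      (mem_closedBall_self (norm_nonneg _)) (by rw [mem_closedBall, dist_eq_norm])
    rw [hgp, ← inner_gradient_left, hgrad, inner_neg_left, inner_smul_left, Real.norm_eq_abs] at this
    simp only [RCLike.conj_to_real, sub_zero, sub_neg_eq_add] at this
    rw [real_inner_comm] at this
    refine this.trans (le_of_eq (by ring))
  refine ⟨r / 2, (K0 + 1) / m, by positivity, by positivity, hunit, ?_, ?_, ?_⟩
  · intro y hy hne h
    have hyb : y ∈ ball p r := by rw [mem_ball, dist_eq_norm]; linarith
    rw [hmem y (hrs hyb).1.2]
    have h1 := (abs_le.1 (hquad y hyb)).2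
    rw [div_mul_eq_mul_div, div_le_iff₀ hm0] at h
    have : 0 < ‖y - p‖ ^ 2 := by
      have := norm_pos_iff.2 (sub_ne_zero.2 hne)
      positivity
    nlinarith
  · intro y hy h
    have hyb : y ∈ ball p r := by rw [mem_ball, dist_eq_norm]; linarith
    rw [hmem y (hrs hyb).1.2]
    have h1 := (abs_le.1 (hquad y hyb)).1
    have h' : (K0 + 1) / m * ‖y - p‖ ^ 2 ≤ - ⟪y - p, ν⟫ := by linarith
    rw [div_mul_eq_mul_div, div_le_iff₀ hm0] at h'
    nlinarith [sq_nonneg ‖y - p‖]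
  · intro x t hx hxt ht hxc
    have hsub : ∀ τ ∈ Icc (0 : ℝ) t, x + τ • ν ∈ ball p r := by
      intro τ hτ
      have h1 : x ∈ ball p r := by rw [mem_ball, dist_eq_norm]; linarith
      have h2 : x + t • ν ∈ ball p r := by rw [mem_ball, dist_eq_norm]; linarith
      have := (convex_ball p r).add_smul_sub_mem h1 h2 (t := τ / t)
        ⟨by have := hτ.1; positivity, by rw [div_le_one ht]; exact hτ.2⟩
      rwa [add_sub_cancel_left, smul_smul, div_mul_cancel₀ _ ht.ne'] at this
    have hγ : ∀ τ, HasDerivAt (fun τ : ℝ => x + τ • ν) ν τ := fun τ => by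
      simpa using ((hasDerivAt_id τ).smul_const ν).const_add x
    have hder : ∀ τ ∈ Icc (0 : ℝ) t, HasDerivAt (fun τ : ℝ => g (x + τ • ν)) ((fderiv ℝ g (x + τ • ν)) ν) τ :=
      fun τ hτ => (hd _ (hsub τ hτ)).comp_hasDerivAt τ (hγ τ)
    have hanti : StrictAntiOn (fun τ : ℝ => g (x + τ • ν)) (Icc 0 t) := by
      refine strictAntiOn_of_deriv_neg (convex_Icc 0 t)
        (fun τ hτ => (hder τ hτ).continuousAt.continuousWithinAt) ?_
      intro τ hτ
      rw [interior_Icc] at hτ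
      have hτ' := Ioo_subset_Icc_self hτ
      rw [(hder τ hτ').deriv]
      exact (hrs (hsub τ hτ')).2
    have h1 := hanti (left_mem_Icc.2 ht.le) (right_mem_Icc.2 ht.le) ht
    simp only [zero_smul, add_zero] at h1
    have hxb := hsub 0 (left_mem_Icc.2 ht.le)
    rw [zero_smul, add_zero] at hxb
    rw [hmem _ (hrs (hsub t (right_mem_Icc.2 ht.le))).1.2]
    exact h1.trans_le (hcl x (hrs hxb).1.2 hxc)

/-- exit lemma -/
lemma exit_lemma (hO : IsOpen Ω) {x w : Eu n} {T : ℝ} (hT : 0 ≤ T) (hx : x ∈ Ω) (hxT : x + T • w ∉ Ω) :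
    ∃ t, 0 < t ∧ t ≤ T ∧ x + t • w ∈ frontier Ω ∧ ∀ τ, 0 ≤ τ → τ < t → x + τ • w ∈ Ω := by
  have hc : Continuous (fun s : ℝ => x + s • w) := by fun_prop
  have hcpt : IsCompact (Icc (0 : ℝ) T ∩ (fun s : ℝ => x + s • w) ⁻¹' Ωᶜ) :=
    isCompact_Icc.inter_right (hO.isClosed_compl.preimage hc)
  obtain ⟨t, ⟨ht, hto⟩, hmin⟩ := hcpt.exists_isLeast ⟨T, ⟨hT, le_rfl⟩, hxT⟩
  have hto' : x + t • w ∉ Ω := hto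
  have ht0 : 0 < t := by
    rcases ht.1.eq_or_lt with h | h
    · rw [← h, zero_smul, add_zero] at hto'; exact absurd hx hto'
    · exact h
  have hin : ∀ τ, 0 ≤ τ → τ < t → x + τ • w ∈ Ω := by
    intro τ h1 h2
    by_contra h
    exact absurd (hmin ⟨⟨h1, h2.le.trans ht.2⟩, h⟩) (not_le.2 h2)
  refine ⟨t, ht0, ht.2, ?_, hin⟩
  rw [hO.frontier_eq]
  refine ⟨?_, hto'⟩
  have ht' : Tendsto (fun s : ℝ => x + s • w) (𝓝[<] t) (𝓝 (x + t • w)) :=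
    (hc.tendsto t).mono_left nhdsWithin_le_nhds
  refine mem_closure_of_tendsto ht' ?_
  filter_upwards [Ioo_mem_nhdsLT ht0] with s hs using hin s hs.1.le hs.2

/-- near `p`, moving along `-ν` exits quickly -/
lemma Chart.exit {p ν : Eu n} {r K : ℝ} (hC : Chart Ω p ν r K) (hO : IsOpen Ω) {δ : ℝ} (hδ : 0 < δ) (h1 : 3 * δ ≤ r)
    (h2 : 9 * K * δ ≤ 1) {x : Eu n} (hx : x ∈ Ω) (hxp : ‖x - p‖ ≤ δ) :
    ∃ t, 0 < t ∧ t ≤ 2 * δ ∧ x + t • (-ν) ∈ frontier Ω ∧ ∀ τ, 0 ≤ τ → τ < t → x + τ • (-ν) ∈ Ω := by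
  have hK := hC.hK
  refine exit_lemma hO (by positivity) hx (hC.out _ ?_ ?_)
  · calc ‖x + (2 * δ) • (-ν) - p‖ = ‖(x - p) + (2 * δ) • (-ν)‖ := by congr 1; abel
      _ ≤ ‖x - p‖ + ‖(2 * δ) • (-ν)‖ := norm_add_le _ _
      _ ≤ δ + 2 * δ := by
        rw [norm_smul, norm_neg, hC.unit, mul_one, Real.norm_of_nonneg (by positivity)]; linarith
      _ ≤ r := by linarith
  · have e : x + (2 * δ) • (-ν) - p = (x - p) + (2 * δ) • (-ν) := by abel
    have n1 : ‖x + (2 * δ) • (-ν) - p‖ ≤ 3 * δ := by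
      rw [e]
      refine (norm_add_le _ _).trans ?_
      rw [norm_smul, norm_neg, hC.unit, mul_one, Real.norm_of_nonneg (by positivity)]; linarith
    have n2 : K * ‖x + (2 * δ) • (-ν) - p‖ ^ 2 ≤ K * (3 * δ) ^ 2 := by gcongr
    have n3 : ⟪x - p, ν⟫ ≤ δ := (real_inner_le_norm _ _).trans (by rw [hC.unit, mul_one]; exact hxp)
    have n4 : ⟪x + (2 * δ) • (-ν) - p, ν⟫ = ⟪x - p, ν⟫ - 2 * δ := by
      rw [e, inner_add_left, smul_neg, inner_neg_left, inner_smul_left, real_inner_self_eq_norm_sq, hC.unit]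
      simp; ring
    rw [n4]
    nlinarith

/-- interior ball -/
lemma Chart.iball {p ν : Eu n} {r K : ℝ} (hC : Chart Ω p ν r K) {R : ℝ} (hR : 0 < R) (h1 : 2 * R ≤ r) (h2 : 2 * K * R ≤ 1) :
    ball (p + R • ν) R ⊆ Ω := by
  intro y hy
  rw [mem_ball, dist_eq_norm] at hy
  have e : y - (p + R • ν) = (y - p) - R • ν := by abel
  have h3 : ‖y - (p + R • ν)‖ ^ 2 < R ^ 2 := by gcongr
  have hν2 : ‖R • ν‖ ^ 2 = R ^ 2 := by
    rw [norm_smul, hC.unit, mul_one, Real.norm_of_nonneg hR.le]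
  have h4 : ‖y - p‖ ^ 2 < 2 * R * ⟪y - p, ν⟫ := by
    rw [e, @norm_sub_sq_real, inner_smul_right, hν2] at h3
    linarith
  have h5 : ‖y - p‖ ≤ r := by
    have : ‖y - p‖ ≤ ‖y - (p + R • ν)‖ + ‖R • ν‖ := by
      have := norm_add_le (y - (p + R • ν)) (R • ν)
      rwa [e, sub_add_cancel, ← e] at this
    rw [norm_smul, hC.unit, mul_one, Real.norm_of_nonneg hR.le] at this
    linarith
  have h6 : 0 < ⟪y - p, ν⟫ := by
    by_contra! h
    nlinarith [sq_nonneg ‖y - p‖]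
  refine hC.ins y h5 (fun h => ?_) ?_
  · rw [h, sub_self, inner_zero_left] at h6; exact lt_irrefl _ h6
  · have hK := hC.hK
    nlinarith

/-- `Ω` is locally connected near boundary points -/
lemma Chart.lconn {p ν : Eu n} {r K : ℝ} (hC : Chart Ω p ν r K) {ε : ℝ} (hε : 0 < ε) :
    ∃ ρ > 0, ∃ W, IsPreconnected W ∧ W ⊆ Ω ∧ W ⊆ ball p ε ∧ Ω ∩ ball p ρ ⊆ W := by
  have hr := hC.hr
  have hK := hC.hK
  set T : ℝ := min (min (r / 4) (ε / 4)) (1 / (8 * K)) with hTd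
  have hT : 0 < T := by positivity
  have hT1 : T ≤ r / 4 := (min_le_left _ _).trans (min_le_left _ _)
  have hT2 : T ≤ ε / 4 := (min_le_left _ _).trans (min_le_right _ _)
  have hT3 : 8 * K * T ≤ 1 := by
    have : T ≤ 1 / (8 * K) := min_le_right _ _
    rw [le_div_iff₀ (by positivity)] at this
    linarith
  set B := ball (p + T • ν) (T / 2) with hB
  have nb : ∀ y ∈ B, ‖y - p‖ ≤ 3 / 2 * T ∧ T / 2 ≤ ⟪y - p, ν⟫ := by
    intro y hy
    rw [hB, mem_ball, dist_eq_norm] at hy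
    have e : y - p = (y - (p + T • ν)) + T • ν := by abel
    constructor
    · rw [e]
      refine (norm_add_le _ _).trans ?_
      rw [norm_smul, hC.unit, mul_one, Real.norm_of_nonneg hT.le]
      linarith
    · rw [e, inner_add_left, inner_smul_left, real_inner_self_eq_norm_sq, hC.unit]
      have := abs_real_inner_le_norm (y - (p + T • ν)) ν
      rw [hC.unit, mul_one] at this
      have := (abs_le.1 this).1
      simp; linarith
  have hBΩ : B ⊆ Ω := by
    intro y hy
    obtain ⟨h1, h2⟩ := nb y hy
    refine hC.ins y (by linarith) (fun h => ?_) ?_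
    · rw [h, sub_self, inner_zero_left] at h2; linarith
    · have : K * ‖y - p‖ ^ 2 ≤ K * (3 / 2 * T) ^ 2 := by gcongr
      nlinarith
  have hBε : B ⊆ ball p ε := by
    intro y hy
    rw [mem_ball, dist_eq_norm]
    linarith [(nb y hy).1]
  set Sg : Eu n → Set (Eu n) := fun x => (fun τ : ℝ => x + τ • ν) '' Icc 0 T with hSg
  have hx' : ∀ x ∈ Ω ∩ ball p (T / 2), ∀ τ ∈ Icc (0 : ℝ) T, ‖x + τ • ν - p‖ ≤ 3 / 2 * T := by
    intro x hx τ hτ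
    have hxp : ‖x - p‖ < T / 2 := by have := hx.2; rwa [mem_ball, dist_eq_norm] at this
    have e : x + τ • ν - p = (x - p) + τ • ν := by abel
    rw [e]
    refine (norm_add_le _ _).trans ?_
    rw [norm_smul, hC.unit, mul_one, Real.norm_of_nonneg hτ.1]
    linarith [hτ.2]
  refine ⟨T / 2, by positivity, B ∪ ⋃ x ∈ Ω ∩ ball p (T / 2), Sg x, ?_, ?_, ?_, ?_⟩
  · refine isPreconnected_of_forall (p + T • ν) ?_
    rintro y (hy | hy)
    · exact ⟨B, subset_union_left, mem_ball_self (by positivity), hy, (convex_ball _ _).isPreconnected⟩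
    · rw [mem_iUnion₂] at hy
      obtain ⟨x, hx, hy⟩ := hy
      refine ⟨B ∪ Sg x, union_subset_union_right _ (subset_iUnion₂_of_subset x hx subset_rfl), Or.inl
        (mem_ball_self (by positivity)), Or.inr hy, ?_⟩
      refine IsPreconnected.union (x + T • ν) ?_ ⟨T, ⟨hT.le, le_rfl⟩, rfl⟩ (convex_ball _ _).isPreconnected
        (isPreconnected_Icc.image _ (by fun_prop))
      rw [hB, mem_ball, dist_eq_norm]
      have := hx.2
      rw [mem_ball, dist_eq_norm] at this
      have e : x + T • ν - (p + T • ν) = x - p := by abel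
      rwa [e]
  · refine union_subset hBΩ (iUnion₂_subset fun x hx => ?_)
    rintro _ ⟨τ, hτ, rfl⟩
    rcases hτ.1.eq_or_lt with h | h
    · simp only [← h, zero_smul, add_zero]; exact hx.1
    · refine hC.up x τ ?_ ?_ h (subset_closure hx.1)
      · have := hx.2
        rw [mem_ball, dist_eq_norm] at this
        linarith
      · linarith [hx' x hx τ hτ]
  · refine union_subset hBε (iUnion₂_subset fun x hx => ?_)
    rintro _ ⟨τ, hτ, rfl⟩
    rw [mem_ball, dist_eq_norm]
    linarith [hx' x hx τ hτ]
  · intro x hx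
    refine Or.inr (mem_iUnion₂.2 ⟨x, hx, 0, ⟨le_rfl, hT.le⟩, by simp⟩)

end


section

/-! ### Boundary consequences -/

variable {Ω : Set (Eu n)} {η : Eu n → Eu n} {a f : ℝ → ℝ} {u : Eu n → ℝ}
    {Du : Eu n → Eu n} {H : Eu n → Eu n →L[ℝ] Eu n}

lemma seg_mono {h : Eu n → ℝ} {G : Eu n → Eu n} (hh : ContinuousOn h (closure Ω))
    (hG : ∀ x ∈ Ω, HasFDerivAt h (innerSL ℝ (G x)) x) {x w : Eu n} {T : ℝ} (hT : 0 < T)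
    (hin : ∀ τ, 0 < τ → τ < T → x + τ • w ∈ Ω) (hpos : ∀ τ, 0 < τ → τ < T → 0 < ⟪G (x + τ • w), w⟫) :
    h x < h (x + T • w) := by
  have hc : Continuous (fun τ : ℝ => x + τ • w) := by fun_prop
  have hcl : ∀ τ ∈ Icc (0 : ℝ) T, x + τ • w ∈ closure Ω := by
    intro τ hτ
    have h1 : τ ∈ closure (Ioo (0 : ℝ) T) := by rwa [closure_Ioo hT.ne]
    have h2 := image_closure_subset_closure_image (s := Ioo (0 : ℝ) T) hc (mem_image_of_mem _ h1)
    refine closure_mono ?_ h2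
    rintro _ ⟨s, hs, rfl⟩
    exact hin s hs.1 hs.2
  have hm : StrictMonoOn (fun τ : ℝ => h (x + τ • w)) (Icc 0 T) := by
    refine strictMonoOn_of_deriv_pos (convex_Icc 0 T) (hh.comp hc.continuousOn hcl) ?_
    intro τ hτ
    rw [interior_Icc] at hτ
    have hγ : HasDerivAt (fun τ : ℝ => x + τ • w) w τ := by
      simpa using ((hasDerivAt_id τ).smul_const w).const_add x
    have := (hG _ (hin τ hτ.1 hτ.2)).comp_hasDerivAt τ hγ
    have e : deriv (fun τ : ℝ => h (x + τ • w)) τ = ⟪G (x + τ • w), w⟫ := by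
      rw [innerSL_apply_apply] at this
      exact this.deriv
    rw [e]
    exact hpos τ hτ.1 hτ.2
  have := hm (left_mem_Icc.2 hT.le) (right_mem_Icc.2 hT.le) hT
  simpa using this

set_option maxHeartbeats 1000000 in
/-- a function locally constant on the boundary has normal gradient there -/
lemma Chart.normal_grad {p ν : Eu n} {r K : ℝ} (hC : Chart Ω p ν r K) (hO : IsOpen Ω) (hp : p ∈ frontier Ω)
    {h : Eu n → ℝ} {G : Eu n → Eu n} (hh : ContinuousOn h (closure Ω))
    (hG : ∀ x ∈ Ω, HasFDerivAt h (innerSL ℝ (G x)) x) (hGc : ContinuousOn G (closure Ω))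
    (hconst : ∃ V ∈ 𝓝 p, ∀ q ∈ V ∩ frontier Ω, h q = h p) : G p = ⟪G p, ν⟫ • ν := by
  obtain ⟨V, hV, hVc⟩ := hconst
  by_contra hne
  set T := G p - ⟪G p, ν⟫ • ν with hT
  have hT0 : T ≠ 0 := sub_ne_zero.2 hne
  have hνν : ⟪ν, ν⟫ = 1 := by rw [real_inner_self_eq_norm_sq, hC.unit]; norm_num
  have hTν : ⟪T, ν⟫ = 0 := by
    rw [hT, inner_sub_left, inner_smul_left, hνν]; simp
  have hGT : ⟪G p, T⟫ = ‖T‖ ^ 2 := by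
    have : G p = T + ⟪G p, ν⟫ • ν := by rw [hT]; abel
    calc ⟪G p, T⟫ = ⟪T + ⟪G p, ν⟫ • ν, T⟫ := by rw [← this]
      _ = ‖T‖ ^ 2 := by
        rw [inner_add_left, inner_smul_left, real_inner_comm T ν, hTν, real_inner_self_eq_norm_sq, mul_zero, add_zero]
  have hn : 0 < ‖T‖ := norm_pos_iff.2 hT0
  clear_value T
  set g := ⟪G p, ν⟫ with hg
  set k := ‖T‖ ^ 2 / (2 * (|g| + 1)) with hk
  have hk0 : 0 < k := by positivity
  have hkg : k * |g| ≤ ‖T‖ ^ 2 / 2 := by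
    have : k * (2 * (|g| + 1)) = ‖T‖ ^ 2 := by rw [hk]; field_simp
    nlinarith
  have hgab := abs_le.1 (show |k * g| ≤ ‖T‖ ^ 2 / 2 by rw [abs_mul, abs_of_pos hk0]; exact hkg)
  clear_value k
  have hp1 : 0 < ⟪G p, T + k • ν⟫ := by
    rw [inner_add_right, inner_smul_right, hGT, ← hg]
    nlinarith [sq_pos_of_pos hn]
  have hp2 : 0 < ⟪G p, T - k • ν⟫ := by
    rw [inner_sub_right, inner_smul_right, hGT, ← hg]
    nlinarith [sq_pos_of_pos hn]
  have hpc := frontier_subset_closure hp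
  have hev : ∀ᶠ y in 𝓝[closure Ω] p, 0 < ⟪G y, T + k • ν⟫ ∧ 0 < ⟪G y, T - k • ν⟫ ∧ y ∈ V := by
    have c1 : ContinuousWithinAt (fun y => ⟪G y, T + k • ν⟫) (closure Ω) p :=
      ContinuousWithinAt.inner (hGc p hpc) continuousWithinAt_const
    have c2 : ContinuousWithinAt (fun y => ⟪G y, T - k • ν⟫) (closure Ω) p :=
      ContinuousWithinAt.inner (hGc p hpc) continuousWithinAt_const
    exact (c1.eventually (lt_mem_nhds hp1)).and ((c2.eventually (lt_mem_nhds hp2)).and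
      (mem_nhdsWithin_of_mem_nhds hV))
  obtain ⟨ε, hε, hεs⟩ := Metric.mem_nhdsWithin_iff.1 hev
  have hK := hC.hK
  have hr := hC.hr
  set L := ‖T‖ + k with hL
  have hL0 : 0 < L := by positivity
  clear_value L
  set s : ℝ := min (min (ε / (8 * L)) (r / (8 * L))) (k / (8 * K * L ^ 2)) with hs
  have hs0 : 0 < s := by positivity
  have hs1 : 8 * (s * L) ≤ ε := by
    have : s ≤ ε / (8 * L) := (min_le_left _ _).trans (min_le_left _ _)
    rw [le_div_iff₀ (by positivity)] at this; linarith
  have hs2 : 8 * (s * L) ≤ r := by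
    have : s ≤ r / (8 * L) := (min_le_left _ _).trans (min_le_right _ _)
    rw [le_div_iff₀ (by positivity)] at this; linarith
  have hs3 : 8 * K * L ^ 2 * s ≤ k := by
    have : s ≤ k / (8 * K * L ^ 2) := min_le_right _ _
    rw [le_div_iff₀ (by positivity)] at this; linarith
  clear_value s
  have hsL : 0 < s * L := by positivity
  have hkν : ‖k • ν‖ = k := by rw [norm_smul, hC.unit, mul_one, Real.norm_of_nonneg hk0.le]
  have hw1 : ‖T + k • ν‖ ≤ L := (norm_add_le _ _).trans (by rw [hkν, hL])
  have hw2 : ‖T - k • ν‖ ≤ L := (norm_sub_le _ _).trans (by rw [hkν, hL])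
  -- first segment
  have hin1 : ∀ τ, 0 < τ → τ ≤ s → p + τ • (T + k • ν) ∈ Ω ∧ ‖p + τ • (T + k • ν) - p‖ ≤ s * L := by
    intro τ h1 h2
    have n1 : ‖p + τ • (T + k • ν) - p‖ ≤ τ * L := by
      rw [add_sub_cancel_left, norm_smul, Real.norm_of_nonneg h1.le]; gcongr
    have n1' : ‖p + τ • (T + k • ν) - p‖ ≤ s * L := n1.trans (by gcongr)
    have n2 : ⟪p + τ • (T + k • ν) - p, ν⟫ = τ * k := by
      rw [add_sub_cancel_left, inner_smul_left, inner_add_left, hTν, inner_smul_left, hνν]; simp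
    refine ⟨hC.ins _ (by linarith) (fun h => ?_) ?_, n1'⟩
    · rw [h, sub_self, inner_zero_left] at n2
      nlinarith
    · rw [n2]
      have : K * ‖p + τ • (T + k • ν) - p‖ ^ 2 ≤ K * (τ * L) ^ 2 := by gcongr
      have h3 : K * (τ * L) ^ 2 = τ * (K * L ^ 2 * τ) := by ring
      have h4 : K * L ^ 2 * τ ≤ k := by
        have : K * L ^ 2 * τ ≤ K * L ^ 2 * s := by gcongr
        have : 0 < K * L ^ 2 * s := by positivity
        nlinarith
      have : τ * (K * L ^ 2 * τ) ≤ τ * k := by gcongr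
      linarith
  have lt1 : h p < h (p + s • (T + k • ν)) := by
    refine seg_mono hh hG hs0 (fun τ h1 h2 => (hin1 τ h1 h2.le).1) fun τ h1 h2 => ?_
    obtain ⟨m1, m2⟩ := hin1 τ h1 h2.le
    exact (hεs ⟨by rw [mem_ball, dist_eq_norm]; linarith, subset_closure m1⟩).1
  set x₁ := p + s • (T + k • ν) with hx₁
  obtain ⟨m1, m2⟩ := hin1 s hs0 le_rfl
  have nb2 : ∀ τ, 0 ≤ τ → τ ≤ 3 * s → ‖x₁ + τ • (T - k • ν) - p‖ ≤ 4 * (s * L) := by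
    intro τ h1 h2
    have e : x₁ + τ • (T - k • ν) - p = (x₁ - p) + τ • (T - k • ν) := by abel
    rw [e]
    refine (norm_add_le _ _).trans ?_
    rw [norm_smul, Real.norm_of_nonneg h1]
    have : τ * ‖T - k • ν‖ ≤ 3 * s * L := by gcongr
    linarith
  have hout : x₁ + (3 * s) • (T - k • ν) ∉ Ω := by
    have n1 := nb2 (3 * s) (by positivity) le_rfl
    refine hC.out _ (by linarith) ?_
    have n2 : ⟪x₁ + (3 * s) • (T - k • ν) - p, ν⟫ = - (2 * s * k) := by
      have e : x₁ + (3 * s) • (T - k • ν) - p = s • (T + k • ν) + (3 * s) • (T - k • ν) := by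
        rw [hx₁]; abel
      rw [e, inner_add_left, inner_smul_left, inner_smul_left, inner_add_left, inner_sub_left, hTν,
        inner_smul_left, hνν]
      simp; ring
    rw [n2]
    have : K * ‖x₁ + (3 * s) • (T - k • ν) - p‖ ^ 2 ≤ K * (4 * (s * L)) ^ 2 := by gcongr
    have h3 : K * (4 * (s * L)) ^ 2 = 2 * s * (8 * K * L ^ 2 * s) := by ring
    have : 2 * s * (8 * K * L ^ 2 * s) ≤ 2 * s * k := by gcongr
    linarith
  obtain ⟨t, ht0, ht1, htf, hin⟩ := exit_lemma hO (by positivity) m1 hout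
  have lt2 : h x₁ < h (x₁ + t • (T - k • ν)) := by
    refine seg_mono hh hG ht0 (fun τ h1 h2 => hin τ h1.le h2) fun τ h1 h2 => ?_
    exact (hεs ⟨by rw [mem_ball, dist_eq_norm]; linarith [nb2 τ h1.le (h2.le.trans ht1)],
      subset_closure (hin τ h1.le h2)⟩).2.1
  have hq : h (x₁ + t • (T - k • ν)) = h p := by
    refine hVc _ ⟨(hεs ⟨?_, frontier_subset_closure htf⟩).2.2, htf⟩
    rw [mem_ball, dist_eq_norm]; linarith [nb2 t ht0.le ht1]
  linarith

namespace Dat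
lemma cd (S : Dat Ω η a f u Du H) : IsOpen Ω := S.op

lemma unitη (S : Dat Ω η a f u Du H) {p : Eu n} (hp : p ∈ frontier Ω) : ‖η p‖ = 1 := by
  obtain ⟨r, K, hC⟩ := exists_chart S.dom hp
  exact hC.unit

lemma Du_normal (S : Dat Ω η a f u Du H) {p : Eu n} (hp : p ∈ frontier Ω) : Du p = ⟪Du p, η p⟫ • η p := by
  obtain ⟨r, K, hC⟩ := exists_chart S.dom hp
  refine hC.normal_grad S.op hp S.hucl (fun x hx => S.hasD1 hx) S.hDuc ?_
  obtain ⟨V, hV, h⟩ := S.hulc p hp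
  exact ⟨V, hV, fun q hq => (h q hq).1⟩

lemma Du_ne_iff (S : Dat Ω η a f u Du H) {p : Eu n} (hp : p ∈ frontier Ω) : Du p = 0 ↔ ⟪Du p, η p⟫ = 0 := by
  constructor
  · intro h; rw [h, inner_zero_left]
  · intro h; rw [S.Du_normal hp, h, zero_smul]

/-- the normal is an eigenvector of the Hessian -/
lemma H_normal (S : Dat Ω η a f u Du H) {p : Eu n} (hp : p ∈ frontier Ω) (h0 : ⟪Du p, η p⟫ ≠ 0) :
    H p (η p) = ⟪H p (η p), η p⟫ • η p := by
  obtain ⟨r, K, hC⟩ := exists_chart S.dom hp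
  have hc : ContinuousOn (fun x => H x (Du x)) (closure Ω) := S.hHc.clm_apply S.hDuc
  have hc2 : ContinuousOn (fun x => (2 : ℝ) • H x (Du x)) (closure Ω) := by
    have := (continuousOn_const (c := (2 : ℝ))).smul hc
    exact this
  have key := hC.normal_grad S.op hp (h := fun x => ⟪Du x, Du x⟫) (G := fun x => (2 : ℝ) • H x (Du x))
    (S.hDuc.inner S.hDuc) (fun x hx => by
      refine ((S.hasD2 hx).inner ℝ (S.hasD2 hx)).congr_fderiv (ContinuousLinearMap.ext fun w => ?_)
      simp only [ContinuousLinearMap.comp_apply, ContinuousLinearMap.prod_apply, fderivInnerCLM_apply,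
        innerSL_apply_apply, inner_smul_left, RCLike.conj_to_real]
      rw [real_inner_comm, S.Hsymm hx w (Du x)]; ring) hc2 (by
      obtain ⟨V, hV, h⟩ := S.hulc p hp
      refine ⟨V, hV, fun q hq => ?_⟩
      have e : ∀ q ∈ frontier Ω, ⟪Du q, Du q⟫ = ⟪Du q, η q⟫ ^ 2 := by
        intro q hq
        have h1 := S.Du_normal hq
        have h2 := S.unitη hq
        set c := ⟪Du q, η q⟫
        rw [h1, inner_smul_left, inner_smul_right, real_inner_self_eq_norm_sq, h2]; simp; ring
      rw [e q hq.2, e p hp, (h q hq).2])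
  have h1 := S.Du_normal hp
  set c := ⟪Du p, η p⟫ with hcdef
  rw [h1, map_smul, smul_smul, inner_smul_left, RCLike.conj_to_real] at key
  rw [mul_smul (2 * c)] at key
  exact smul_right_injective (Eu n) (mul_ne_zero two_ne_zero h0) key

/-- sign of `u - u p` near the boundary -/
lemma sign_near (S : Dat Ω η a f u Du H) {p : Eu n} (hp : p ∈ frontier Ω) {s : ℝ} (h0 : 0 < s * ⟪Du p, η p⟫) :
    ∃ ρ > 0, ∀ x ∈ Ω ∩ ball p ρ, 0 < s * (u x - u p) := by
  obtain ⟨r, K, hC⟩ := exists_chart S.dom hp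
  have hpc := frontier_subset_closure hp
  obtain ⟨V, hV, hVc⟩ := S.hulc p hp
  have hev : ∀ᶠ y in 𝓝[closure Ω] p, 0 < s * ⟪Du y, η p⟫ ∧ y ∈ V := by
    have c1 : ContinuousWithinAt (fun y => s * ⟪Du y, η p⟫) (closure Ω) p :=
      (ContinuousWithinAt.inner (S.hDuc p hpc) continuousWithinAt_const).const_mul s
    exact (c1.eventually (lt_mem_nhds h0)).and (mem_nhdsWithin_of_mem_nhds hV)
  obtain ⟨ε, hε, hεs⟩ := Metric.mem_nhdsWithin_iff.1 hev
  have hK := hC.hK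
  have hr := hC.hr
  set δ : ℝ := min (min (ε / 4) (r / 3)) (1 / (9 * K)) with hδ
  have hδ0 : 0 < δ := by positivity
  have h1 : δ ≤ ε / 4 := (min_le_left _ _).trans (min_le_left _ _)
  have h2 : δ ≤ r / 3 := (min_le_left _ _).trans (min_le_right _ _)
  have h3 : 9 * K * δ ≤ 1 := by
    have : δ ≤ 1 / (9 * K) := min_le_right _ _
    rw [le_div_iff₀ (by positivity)] at this; linarith
  refine ⟨δ, hδ0, fun x hx => ?_⟩
  have hxp : ‖x - p‖ ≤ δ := by have := hx.2; rw [mem_ball, dist_eq_norm] at this; exact this.le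
  obtain ⟨t, ht0, ht1, htf, hin⟩ := hC.exit S.op hδ0 (by linarith) h3 hx.1 hxp
  have nb : ∀ τ, 0 ≤ τ → τ ≤ t → ‖x + τ • (-η p) - p‖ < ε := by
    intro τ a1 a2
    have e : x + τ • (-η p) - p = (x - p) + τ • (-η p) := by abel
    rw [e]
    refine (norm_add_le _ _).trans_lt ?_
    rw [norm_smul, norm_neg, hC.unit, mul_one, Real.norm_of_nonneg a1]
    linarith
  have := seg_mono (h := fun x => -s * u x) (G := fun x => (-s) • Du x) (continuousOn_const.mul S.hucl)
    (fun x hx => by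
      refine ((S.hasD1 hx).const_mul (-s)).congr_fderiv (ContinuousLinearMap.ext fun w => ?_)
      simp [inner_smul_left]) ht0 (fun τ a1 a2 => hin τ a1.le a2) (fun τ a1 a2 => by
      have := (hεs ⟨by rw [mem_ball, dist_eq_norm]; exact nb τ a1.le a2.le, subset_closure (hin τ a1.le a2)⟩).1
      rw [inner_smul_left, inner_neg_right, RCLike.conj_to_real]; linarith)
  have hq : u (x + t • (-η p)) = u p :=
    (hVc _ ⟨(hεs ⟨by rw [mem_ball, dist_eq_norm]; exact nb t ht0.le le_rfl, frontier_subset_closure htf⟩).2, htf⟩).1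
  simp only [hq] at this
  linarith

/-- constancy along boundary components -/
lemma comp_const (S : Dat Ω η a f u Du H) {p q : Eu n} (hp : p ∈ frontier Ω)
    (hq : q ∈ connectedComponentIn (frontier Ω) p) : u q = u p ∧ ⟪Du q, η q⟫ = ⟪Du p, η p⟫ := by
  have hsub := connectedComponentIn_subset (frontier Ω) p
  refine (isPreconnected_connectedComponentIn (F := frontier Ω) (x := p)).induction₂
    (fun p q => u q = u p ∧ ⟪Du q, η q⟫ = ⟪Du p, η p⟫) ?_ ?_ ?_
    (mem_connectedComponentIn hp) hq
  · intro x hx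
    obtain ⟨V, hV, h⟩ := S.hulc x (hsub hx)
    filter_upwards [mem_nhdsWithin_of_mem_nhds hV, self_mem_nhdsWithin] with y hy hy2
    exact h y ⟨hy, hsub hy2⟩
  · intro x y z _ _ _ h1 h2
    exact ⟨h2.1.trans h1.1, h2.2.trans h1.2⟩
  · intro x y _ _ h1
    exact ⟨h1.1.symm, h1.2.symm⟩
end Dat

end


section

/-! ### Admissible functions and part (1) -/

variable {Ω : Set (Eu n)} {η : Eu n → Eu n} {a f : ℝ → ℝ} {u : Eu n → ℝ}
    {Du : Eu n → Eu n} {H : Eu n → Eu n →L[ℝ] Eu n}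

open Classical in
lemma Dat.adm_mk (S : Dat Ω η a f u Du H) {C : Set (Eu n)} (hC : IsOpen C) (hCΩ : C ⊆ Ω) {Y : Eu n}
    (hb : ∀ x ∈ closure C, x ∉ C → ⟪Du x, Y⟫ ≤ 0) :
    Adm Ω Du Y (fun x => if x ∈ C then max ⟪Du x, Y⟫ 0 else 0) := by
  refine ⟨?_, ?_, ?_, ?_⟩
  · rw [continuous_iff_continuousAt]
    intro x
    by_cases hx : x ∈ C
    · have h1 : ContinuousAt (fun y => max ⟪Du y, Y⟫ 0) x :=
        ((S.v_C1 Y).continuousOn.continuousAt (S.op.mem_nhds (hCΩ hx))).max continuousAt_const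
      refine h1.congr ?_
      filter_upwards [hC.mem_nhds hx] with y hy
      simp [hy]
    by_cases hxc : x ∈ closure C
    · have hz : ⟪Du x, Y⟫ ≤ 0 := hb x hxc hx
      have hxΩ : x ∈ closure Ω := closure_mono hCΩ hxc
      have hc : ContinuousWithinAt (fun y => max ⟪Du y, Y⟫ 0) (closure Ω) x :=
        (ContinuousWithinAt.inner (S.hDuc x hxΩ) continuousWithinAt_const).max continuousWithinAt_const
      rw [Metric.continuousAt_iff]
      intro ε hε
      obtain ⟨δ, hδ, h⟩ := Metric.continuousWithinAt_iff.1 hc ε hε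
      refine ⟨δ, hδ, fun y hy => ?_⟩
      rw [if_neg hx]
      by_cases hyC : y ∈ C
      · rw [if_pos hyC]
        have := h (subset_closure (hCΩ hyC)) hy
        rwa [max_eq_right hz] at this
      · rw [if_neg hyC, dist_self]; exact hε
    · refine (continuousAt_const (y := (0 : ℝ))).congr ?_
      filter_upwards [isClosed_closure.isOpen_compl.mem_nhds hxc] with y hy
      rw [if_neg (fun h => hy (subset_closure h))]
  · intro x
    split_ifs
    · exact le_max_right _ _
    · exact le_rfl
  · intro x hx
    rw [if_neg (fun h => hx (hCΩ h))]
  · intro x hx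
    split_ifs
    · rcases le_total ⟪Du x, Y⟫ 0 with h | h
      · left; exact max_eq_right h
      · right; exact max_eq_left h
    · left; rfl

lemma Dat.nonpos (S : Dat Ω η a f u Du H) {C : Set (Eu n)} (hC : IsOpen C) (hCΩ : C ⊆ Ω) {Y : Eu n}
    (hb : ∀ x ∈ closure C, x ∉ C → ⟪Du x, Y⟫ ≤ 0) {x₀ : Eu n} (hx₀ : x₀ ∈ Ω) (h0 : Du x₀ = 0) :
    ∀ x ∈ C, ⟪Du x, Y⟫ ≤ 0 := by
  classical
  intro x hx
  have := (S.adm_mk hC hCΩ hb).zero S hx₀ (by simp [h0]) x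
  simp only [if_pos hx] at this
  exact max_eq_right_iff.1 this

lemma Dat.exists_Du_ne (S : Dat Ω η a f u Du H) : ∃ x ∈ Ω, Du x ≠ 0 := by
  by_contra! h
  refine S.hnc ?_
  obtain ⟨x₀, hx₀⟩ := S.dom.1
  refine ⟨u x₀, fun x hx => ?_⟩
  refine S.op.is_const_of_fderiv_eq_zero S.pre
    (fun y hy => (S.hasD1 hy).differentiableAt.differentiableWithinAt) (fun y hy => ?_) hx hx₀
  rw [(S.hasD1 hy).fderiv, h y hy]; simp

lemma Dat.part1 (S : Dat Ω η a f u Du H) {p₁ p₂ X₂ : Eu n} (hp₁ : p₁ ∈ frontier Ω) (hp₂ : p₂ ∈ frontier Ω)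
    (htr2 : ∀ p ∈ connectedComponentIn (frontier Ω) p₂, 0 ≤ ⟪η p, X₂⟫)
    (htr2' : ∃ p ∈ connectedComponentIn (frontier Ω) p₂, ⟪η p, X₂⟫ ≠ 0)
    (hrest : ∀ p ∈ frontier Ω, p ∉ connectedComponentIn (frontier Ω) p₁ →
      p ∉ connectedComponentIn (frontier Ω) p₂ → ⟪Du p, η p⟫ = 0)
    {x₀ : Eu n} (hx₀ : x₀ ∈ Ω) (h0 : Du x₀ = 0) : ⟪Du p₁, η p₁⟫ ≠ 0 := by
  intro hc1
  have hz : ∀ p ∈ frontier Ω, p ∉ connectedComponentIn (frontier Ω) p₂ → Du p = 0 := by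
    intro p hp hp2
    rw [S.Du_ne_iff hp]
    by_cases h : p ∈ connectedComponentIn (frontier Ω) p₁
    · rw [(S.comp_const hp₁ h).2, hc1]
    · exact hrest p hp h hp2
  set c := ⟪Du p₂, η p₂⟫ with hc
  have hf : ∀ p ∈ connectedComponentIn (frontier Ω) p₂, Du p = c • η p := by
    intro p hp
    have h1 := S.Du_normal (connectedComponentIn_subset _ _ hp)
    rwa [(S.comp_const hp₂ hp).2] at h1
  have key : ∀ Y : Eu n, (∀ p ∈ connectedComponentIn (frontier Ω) p₂, c * ⟪η p, Y⟫ ≤ 0) →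
      ∀ x ∈ Ω, ⟪Du x, Y⟫ ≤ 0 := by
    intro Y hY
    refine S.nonpos S.op le_rfl (fun x hx hxn => ?_) hx₀ h0
    have hxf : x ∈ frontier Ω := by rw [S.op.frontier_eq]; exact ⟨hx, hxn⟩
    by_cases h : x ∈ connectedComponentIn (frontier Ω) p₂
    · rw [hf x h, inner_smul_left]; exact hY x h
    · rw [hz x hxf h, inner_zero_left]
  by_cases hc0 : c = 0
  · obtain ⟨x, hx, hne⟩ := S.exists_Du_ne
    have := key (Du x) (fun p _ => by rw [hc0, zero_mul]) x hx
    rw [real_inner_self_eq_norm_sq] at this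
    have h2 := norm_pos_iff.2 hne
    nlinarith
  · have h1 : ∀ x ∈ Ω, 0 ≤ ⟪Du x, c • X₂⟫ := by
      intro x hx
      have := key (-(c • X₂)) (fun p hp => by
        rw [inner_neg_right, inner_smul_right]
        have := mul_nonneg (sq_nonneg c) (htr2 p hp)
        nlinarith) x hx
      rw [inner_neg_right] at this; linarith
    have h2 : ∀ x ∈ Ω, ⟪Du x, c • X₂⟫ = 0 := by
      intro x hx
      by_contra hne
      have := S.v_smp S.op le_rfl S.pre h1 hx (lt_of_le_of_ne (h1 x hx) (Ne.symm hne)) x₀ hx₀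
      rw [h0, inner_zero_left] at this
      exact lt_irrefl _ this
    obtain ⟨p, hp, hne⟩ := htr2'
    have hpf := connectedComponentIn_subset _ _ hp
    have h3 : ⟪Du p, c • X₂⟫ = 0 := by
      have hcl : EqOn (fun x => ⟪Du x, c • X₂⟫) (fun _ => 0) (closure Ω) := by
        refine EqOn.of_subset_closure (s := Ω) (fun x hx => h2 x hx) ?_ continuousOn_const subset_closure le_rfl
        exact S.hDuc.inner continuousOn_const
      exact hcl (frontier_subset_closure hpf)
    rw [hf p hp, inner_smul_left, inner_smul_right] at h3
    simp [hc0, hne] at h3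

end


section

/-! ### Traces, divergence, Carleman estimate -/

/-- trace of an endomorphism -/
def tr (L : Eu n →L[ℝ] Eu n) : ℝ := ∑ i, ⟪L (EuclideanSpace.basisFun (Fin n) ℝ i), EuclideanSpace.basisFun (Fin n) ℝ i⟫

lemma tr_add (L M : Eu n →L[ℝ] Eu n) : tr (L + M) = tr L + tr M := by
  simp only [tr, add_apply, inner_add_left, Finset.sum_add_distrib]

lemma tr_sub (L M : Eu n →L[ℝ] Eu n) : tr (L - M) = tr L - tr M := by
  simp only [tr, sub_apply, inner_sub_left, Finset.sum_sub_distrib]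

lemma tr_smul (c : ℝ) (L : Eu n →L[ℝ] Eu n) : tr (c • L) = c * tr L := by
  simp only [tr, smul_apply, inner_smul_left, Finset.mul_sum, RCLike.conj_to_real]

lemma tr_zero : tr (0 : Eu n →L[ℝ] Eu n) = 0 := by
  simp [tr]

lemma tr_id : tr (ContinuousLinearMap.id ℝ (Eu n)) = n := by
  simp [tr]

lemma tr_rank (α β : Eu n) : tr ((innerSL ℝ α).smulRight β) = ⟪α, β⟫ := by
  rw [← OrthonormalBasis.sum_inner_mul_inner (EuclideanSpace.basisFun (Fin n) ℝ) α β]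
  unfold tr
  refine Finset.sum_congr rfl fun i _ => ?_
  rw [ContinuousLinearMap.smulRight_apply, innerSL_apply_apply, inner_smul_left, RCLike.conj_to_real,
    real_inner_comm β]

lemma tr_abs_le (L : Eu n →L[ℝ] Eu n) : |tr L| ≤ n * ‖L‖ := by
  unfold tr
  refine (Finset.abs_sum_le_sum_abs _ _).trans ?_
  have : ∀ i ∈ (Finset.univ : Finset (Fin n)), |⟪L (EuclideanSpace.basisFun (Fin n) ℝ i), EuclideanSpace.basisFun (Fin n) ℝ i⟫| ≤ ‖L‖ := by
    intro i _
    refine (abs_real_inner_le_norm _ _).trans ?_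
    have h1 : ‖EuclideanSpace.basisFun (Fin n) ℝ i‖ = 1 := (EuclideanSpace.basisFun (Fin n) ℝ).norm_eq_one i
    have := L.le_opNorm (EuclideanSpace.basisFun (Fin n) ℝ i)
    rw [h1, mul_one] at this ⊢
    exact this
  refine (Finset.sum_le_sum this).trans ?_
  simp

lemma tr_cont : Continuous (tr : (Eu n →L[ℝ] Eu n) → ℝ) := by
  unfold tr
  fun_prop

lemma int_fderiv_zero {g : Eu n → ℝ} (hg : ContDiff ℝ 1 g) (hc : HasCompactSupport g) (v : Eu n) :
    ∫ x, fderiv ℝ g x v = 0 := by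
  have hi : Integrable (fun x => fderiv ℝ g x v) :=
    ((hg.continuous_fderiv (by norm_num)).clm_apply continuous_const).integrable_of_hasCompactSupport
      (hc.fderiv_apply ℝ v)
  have := integral_mul_fderiv_eq_neg_fderiv_mul_of_integrable (f := fun _ : Eu n => (1 : ℝ)) (g := g) (v := v)
    (μ := volume) (by simp) (by simpa using hi)
    (by simpa using hg.continuous.integrable_of_hasCompactSupport hc) (by fun_prop) (fun x _ => hg.differentiable (by norm_num) x)
  simpa using this

lemma div_int {Z : Eu n → Eu n} (hZ : ContDiff ℝ 1 Z) (hc : HasCompactSupport Z) :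
    Integrable (fun x => tr (fderiv ℝ Z x)) ∧ ∫ x, tr (fderiv ℝ Z x) = 0 := by
  have hcc : Continuous (fderiv ℝ Z) := hZ.continuous_fderiv (by norm_num)
  refine ⟨(tr_cont.comp hcc).integrable_of_hasCompactSupport ((hc.fderiv ℝ).comp_left tr_zero), ?_⟩
  unfold tr
  rw [integral_finsetSum]
  · refine Finset.sum_eq_zero fun i _ => ?_
    set e := EuclideanSpace.basisFun (Fin n) ℝ i
    have h1 : ∀ x, ⟪fderiv ℝ Z x e, e⟫ = fderiv ℝ (fun x => ⟪Z x, e⟫) x e := by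
      intro x
      have h := (((hZ.differentiable (by norm_num)) x).hasFDerivAt).inner ℝ (hasFDerivAt_const e x)
      rw [h.fderiv]
      simp [fderivInnerCLM_apply]
    simp_rw [h1]
    refine int_fderiv_zero (hZ.inner ℝ contDiff_const) ?_ e
    exact hc.comp_left (g := fun z => ⟪z, e⟫) (by simp)
  · intro i _
    refine Continuous.integrable_of_hasCompactSupport (by fun_prop) ?_
    exact (hc.fderiv ℝ).comp_left (g := fun L : Eu n →L[ℝ] Eu n => ⟪L (EuclideanSpace.basisFun (Fin n) ℝ i), EuclideanSpace.basisFun (Fin n) ℝ i⟫) (by simp)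

/-- `h` has gradient `α` at `x` -/
abbrev HasGr (h : Eu n → ℝ) (α x : Eu n) : Prop := HasFDerivAt h (innerSL ℝ α) x

lemma HasGr.mul' {h k : Eu n → ℝ} {α β x : Eu n} (hh : HasGr h α x) (hk : HasGr k β x) :
    HasGr (fun y => h y * k y) (h x • β + k x • α) x := by
  refine (HasFDerivAt.mul hh hk).congr_fderiv (ContinuousLinearMap.ext fun w => ?_)
  simp only [add_apply, smul_apply, innerSL_apply_apply, inner_add_left, inner_smul_left, RCLike.conj_to_real, smul_eq_mul]

lemma HasGr.add' {h k : Eu n → ℝ} {α β x : Eu n} (hh : HasGr h α x) (hk : HasGr k β x) :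
    HasGr (fun y => h y + k y) (α + β) x := by
  refine (HasFDerivAt.add hh hk).congr_fderiv (ContinuousLinearMap.ext fun w => ?_)
  simp only [add_apply, innerSL_apply_apply, inner_add_left]

lemma HasGr.cmul {h : Eu n → ℝ} {α x : Eu n} (c : ℝ) (hh : HasGr h α x) :
    HasGr (fun y => c * h y) (c • α) x := by
  refine (HasFDerivAt.const_mul hh c).congr_fderiv (ContinuousLinearMap.ext fun w => ?_)
  simp only [smul_apply, innerSL_apply_apply, inner_smul_left, RCLike.conj_to_real, smul_eq_mul]

lemma HasGr.cst (c : ℝ) (x : Eu n) : HasGr (fun _ => c) 0 x := by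
  refine (hasFDerivAt_const c x).congr_fderiv (ContinuousLinearMap.ext fun w => ?_)
  simp

lemma HasGr.inner' {V W : Eu n → Eu n} {L M : Eu n →L[ℝ] Eu n} {x α : Eu n} (hV : HasFDerivAt V L x)
    (hW : HasFDerivAt W M x) (hα : ∀ w, ⟪V x, M w⟫ + ⟪L w, W x⟫ = ⟪α, w⟫) : HasGr (fun y => ⟪V y, W y⟫) α x := by
  refine (hV.inner ℝ hW).congr_fderiv (ContinuousLinearMap.ext fun w => ?_)
  simp only [ContinuousLinearMap.comp_apply, ContinuousLinearMap.prod_apply, fderivInnerCLM_apply,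
        innerSL_apply_apply]
  exact hα w

lemma HasGr.smulV {h : Eu n → ℝ} {V : Eu n → Eu n} {L : Eu n →L[ℝ] Eu n} {x α : Eu n} (hh : HasGr h α x)
    (hV : HasFDerivAt V L x) :
    HasFDerivAt (fun y => h y • V y) (h x • L + (innerSL ℝ α).smulRight (V x)) x := hh.smul hV

end


section

/-- auxiliary scalar fields for the Carleman estimate -/
def cs (y x : Eu n) : ℝ := ⟪x - y, x - y⟫
def cm (σ : ℝ) (y x : Eu n) : ℝ := σ - cs y x
def cE (σ b τ : ℝ) (y x : Eu n) : ℝ := 4 * τ ^ 2 * (cm σ y x * (cm σ y x * cs y x)) + τ * b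
def cG (σ b : ℝ) (y x : Eu n) : ℝ := (4 + 2 * n) * cs y x + (b - 2 * n * σ)
def ch1 (σ b : ℝ) (y : Eu n) (v : Eu n → ℝ) (g : Eu n → Eu n) (x : Eu n) : ℝ :=
  -4 * (cm σ y x * ⟪x - y, g x⟫) + cG σ b y x * v x
def ch2 (σ b τ : ℝ) (y : Eu n) (v : Eu n → ℝ) (g : Eu n → Eu n) (x : Eu n) : ℝ :=
  2 * (cm σ y x * ⟪g x, g x⟫) + (-(4 + 2 * n)) * (v x * v x) + (-2) * (cm σ y x * cE σ b τ y x * (v x * v x))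
def cZ (σ b τ : ℝ) (y : Eu n) (v : Eu n → ℝ) (g : Eu n → Eu n) (x : Eu n) : Eu n :=
  ch1 σ b y v g x • g x + ch2 σ b τ y v g x • (x - y)
def cζ (σ b τ : ℝ) (y x : Eu n) : ℝ :=
  - cE σ b τ y x * (4 * cs y x + b) - n * (4 + 2 * n)
    - 2 * (-24 * τ ^ 2 * cm σ y x ^ 2 * cs y x + 8 * τ ^ 2 * cm σ y x ^ 3 - 2 * τ * b) * cs y x

lemma has_q (y x : Eu n) : HasFDerivAt (fun x : Eu n => x - y) (ContinuousLinearMap.id ℝ (Eu n)) x :=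
  (hasFDerivAt_id x).sub_const y

lemma has_cs (y x : Eu n) : HasGr (cs y) ((2 : ℝ) • (x - y)) x := by
  refine HasGr.inner' (has_q y x) (has_q y x) fun w => ?_
  simp only [ContinuousLinearMap.id_apply, inner_smul_left, RCLike.conj_to_real, real_inner_comm (x - y) w]
  ring

lemma has_cm (σ : ℝ) (y x : Eu n) : HasGr (cm σ y) ((-2 : ℝ) • (x - y)) x := by
  have := (HasGr.cst σ x).add' ((has_cs y x).cmul (-1))
  refine (this.congr_of_eventuallyEq (Eventually.of_forall fun z => ?_)).congr_fderiv
    (ContinuousLinearMap.ext fun w => ?_)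
  · simp only [cm]; ring
  · simp only [innerSL_apply_apply, inner_add_left, inner_smul_left, RCLike.conj_to_real, inner_zero_left]; ring

set_option maxHeartbeats 1000000 in
lemma carl_div (σ b τ : ℝ) (y : Eu n) {v : Eu n → ℝ} {g : Eu n → Eu n} {L : Eu n →L[ℝ] Eu n} {x : Eu n}
    (hv : HasGr v (g x) x) (hg : HasFDerivAt g L x) (hL : ∀ ξ ζ, ⟪L ξ, ζ⟫ = ⟪L ζ, ξ⟫) :
    tr (fderiv ℝ (cZ σ b τ y v g) x) = ch1 σ b y v g x * (tr L + cE σ b τ y x * v x)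
      + (8 * ⟪x - y, g x⟫ ^ 2 + (b - 4 * cm σ y x) * ⟪g x, g x⟫ + cζ σ b τ y x * v x ^ 2) := by
  have hs := has_cs y x
  have hm := has_cm σ y x
  have hP : HasGr (fun x => ⟪x - y, g x⟫) (g x + L (x - y)) x := by
    refine HasGr.inner' (has_q y x) hg fun w => ?_
    simp only [ContinuousLinearMap.id_apply, inner_add_left]
    rw [real_inner_comm, hL w, real_inner_comm (g x) w]; ring
  have hN : HasGr (fun x => ⟪g x, g x⟫) ((2 : ℝ) • L (g x)) x := by
    refine HasGr.inner' hg hg fun w => ?_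
    simp only [inner_smul_left, RCLike.conj_to_real]
    rw [real_inner_comm, hL w]; ring
  have hE : HasGr (cE σ b τ y) _ x := ((hm.mul' (hm.mul' hs)).cmul (4 * τ ^ 2)).add' (HasGr.cst (τ * b) x)
  have hG : HasGr (cG σ b y) _ x := (hs.cmul (4 + 2 * n)).add' (HasGr.cst (b - 2 * n * σ) x)
  have h1 : HasGr (ch1 σ b y v g) _ x := ((hm.mul' hP).cmul (-4)).add' (hG.mul' hv)
  have h2 : HasGr (ch2 σ b τ y v g) _ x :=
    (((hm.mul' hN).cmul 2).add' ((hv.mul' hv).cmul (-(4 + 2 * n)))).add' (((hm.mul' hE).mul' (hv.mul' hv)).cmul (-2))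
  have hZ : HasFDerivAt (cZ σ b τ y v g) _ x := (h1.smulV hg).add (h2.smulV (has_q y x))
  rw [hZ.fderiv]
  simp only [tr_add, tr_smul, tr_rank, tr_id, inner_add_left, inner_smul_left, RCLike.conj_to_real, inner_zero_left]
  have e1 : ⟪L (x - y), g x⟫ = ⟪L (g x), x - y⟫ := hL _ _
  have e2 : ⟪g x, x - y⟫ = ⟪x - y, g x⟫ := real_inner_comm _ _
  have e3 : ⟪x - y, x - y⟫ = cs y x := rfl
  have e4 : cm σ y x = σ - cs y x := rfl
  rw [e1, e2, e3]
  simp only [ch1, ch2, cζ, cE, cG, e4]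
  ring

/-- derivative of `exp (τ m²/2)` -/
lemma has_ω (σ τ : ℝ) (y x : Eu n) : HasGr (fun x => Real.exp (τ / 2 * (cm σ y x * cm σ y x)))
    ((Real.exp (τ / 2 * (cm σ y x * cm σ y x)) * (-2 * τ * cm σ y x)) • (x - y)) x := by
  have hm := has_cm σ y x
  have := ((hm.mul' hm).cmul (τ / 2)).exp
  refine this.congr_fderiv (ContinuousLinearMap.ext fun w => ?_)
  simp only [smul_apply, innerSL_apply_apply, inner_add_left, inner_smul_left, RCLike.conj_to_real, smul_eq_mul]
  ring

end


section

def cω (σ τ : ℝ) (y x : Eu n) : ℝ := Real.exp (τ / 2 * (cm σ y x * cm σ y x))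
def cV (σ τ : ℝ) (y : Eu n) (w : Eu n → ℝ) (gw : Eu n → Eu n) (x : Eu n) : Eu n :=
  gw x - (2 * τ * (cm σ y x * w x)) • (x - y)
def cv (σ τ : ℝ) (y : Eu n) (w : Eu n → ℝ) (x : Eu n) : ℝ := cω σ τ y x * w x
def cg (σ τ : ℝ) (y : Eu n) (w : Eu n → ℝ) (gw : Eu n → Eu n) (x : Eu n) : Eu n :=
  cω σ τ y x • cV σ τ y w gw x

set_option maxHeartbeats 1000000 in
lemma carl_conj (σ b τ : ℝ) (y : Eu n) {w : Eu n → ℝ} {gw : Eu n → Eu n} {Hw : Eu n →L[ℝ] Eu n} {x : Eu n}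
    (hw : HasGr w (gw x) x) (hgw : HasFDerivAt gw Hw x) (hs : ∀ ξ ζ, ⟪Hw ξ, ζ⟫ = ⟪Hw ζ, ξ⟫) :
    HasGr (cv σ τ y w) (cg σ τ y w gw x) x ∧ ∃ L, HasFDerivAt (cg σ τ y w gw) L x ∧
      (∀ ξ ζ, ⟪L ξ, ζ⟫ = ⟪L ζ, ξ⟫) ∧
      tr L + cE σ b τ y x * cv σ τ y w x - τ * ch1 σ b y (cv σ τ y w) (cg σ τ y w gw) x = cω σ τ y x * tr Hw := by
  have hω : HasGr (cω σ τ y) ((cω σ τ y x * (-2 * τ * cm σ y x)) • (x - y)) x := has_ω σ τ y x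
  have hm := has_cm σ y x
  constructor
  · refine (hω.mul' hw).congr_fderiv (ContinuousLinearMap.ext fun z => ?_)
    simp only [innerSL_apply_apply, inner_add_left, inner_smul_left, inner_sub_left, RCLike.conj_to_real, cg, cV]
    ring
  have hk := (hm.mul' hw).cmul (2 * τ)
  have hV : HasFDerivAt (cV σ τ y w gw) _ x := hgw.sub (hk.smulV (has_q y x))
  have hg : HasFDerivAt (cg σ τ y w gw) _ x := hω.smulV hV
  refine ⟨_, hg, ?_, ?_⟩
  · intro ξ ζ
    simp only [add_apply, sub_apply, smul_apply, ContinuousLinearMap.smulRight_apply, ContinuousLinearMap.id_apply,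
      innerSL_apply_apply, inner_add_left, inner_smul_left, inner_sub_left, RCLike.conj_to_real, cV]
    rw [hs ξ ζ, real_inner_comm ξ ζ]
    ring
  · simp only [tr_add, tr_sub, tr_smul, tr_rank, tr_id, cV, cv, cg, ch1, cE, cG]
    have e3 : cs y x = ⟪x - y, x - y⟫ := rfl
    have e4 : cm σ y x = σ - cs y x := rfl
    rw [e4, e3]
    generalize x - y = q
    simp only [inner_add_left, inner_smul_left, inner_sub_right,
      inner_smul_right, RCLike.conj_to_real]
    rw [real_inner_comm q (gw x)]
    ring

set_option maxHeartbeats 2000000 in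
lemma carl_num {r τ κ s m : ℝ} (hr : 0 < r) (hτ1 : 1 ≤ τ) (hτ : 4 * (9 * r ^ 4 + n * (4 + 2 * n)) ≤ τ * r ^ 8)
    (hκ0 : 0 < κ) (hκ1 : κ ≤ 2 * r ^ 2) (hκ2 : κ * (5 / 2 * r ^ 6 + 1) ≤ 2 * r ^ 8)
    (hm : m = 3 / 2 * r ^ 2 - s) (hs1 : r ^ 2 ≤ s) (hs2 : s ≤ 5 / 4 * r ^ 2) {P N W z G : ℝ}
    (hN : 0 ≤ N) (hW : 0 ≤ W)
    (hz : z = - (4 * τ ^ 2 * (m * (m * s)) + τ * (3 * r ^ 2)) * (4 * s + 3 * r ^ 2) - n * (4 + 2 * n)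
      - 2 * (-24 * τ ^ 2 * m ^ 2 * s + 8 * τ ^ 2 * m ^ 3 - 2 * τ * (3 * r ^ 2)) * s)
    (hG : G ≤ 2 * N + 8 * τ ^ 2 * m ^ 2 * W * s) :
    τ * κ * (G + W) ≤ 4 * τ * (8 * P ^ 2 + (3 * r ^ 2 - 4 * m) * N + z * W) := by
  have hr2 : 0 < r ^ 2 := by positivity
  have hm1 : r ^ 2 / 4 ≤ m := by linarith
  have hm2 : m ≤ r ^ 2 / 2 := by linarith
  have hs0 : 0 < s := by linarith
  have hm0 : 0 < m := by linarith
  have e : z = τ ^ 2 * (m ^ 2 * s) * (32 * s - 12 * r ^ 2 - 16 * m) - 9 * r ^ 4 * τ - n * (4 + 2 * n) := by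
    rw [hz]; ring
  have a1 : r ^ 6 / 16 ≤ m ^ 2 * s := by
    have : (r ^ 2 / 4) ^ 2 * r ^ 2 ≤ m ^ 2 * s := by gcongr
    calc r ^ 6 / 16 = (r ^ 2 / 4) ^ 2 * r ^ 2 := by ring
      _ ≤ _ := this
  have a2 : m ^ 2 * s ≤ 5 / 16 * r ^ 6 := by
    have : m ^ 2 * s ≤ (r ^ 2 / 2) ^ 2 * (5 / 4 * r ^ 2) := by gcongr
    calc m ^ 2 * s ≤ _ := this
      _ = _ := by ring
  have a3 : τ ^ 2 * (r ^ 6 / 16) * (12 * r ^ 2) ≤ τ ^ 2 * (m ^ 2 * s) * (32 * s - 12 * r ^ 2 - 16 * m) := by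
    have : 12 * r ^ 2 ≤ 32 * s - 12 * r ^ 2 - 16 * m := by linarith
    gcongr
  have hn : (0 : ℝ) ≤ n * (4 + 2 * n) := by positivity
  have a4 : 9 * r ^ 4 * τ + n * (4 + 2 * n) ≤ τ ^ 2 * r ^ 8 / 4 := by
    have h1 : (n : ℝ) * (4 + 2 * n) ≤ n * (4 + 2 * n) * τ := le_mul_of_one_le_right hn hτ1
    have h2 := mul_le_mul_of_nonneg_right hτ (by linarith : (0 : ℝ) ≤ τ)
    linarith [h1, h2]
  have a5 : τ ^ 2 * r ^ 8 / 2 ≤ z := by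
    rw [e]; linarith
  have b1 : τ ^ 2 * r ^ 8 / 2 * W ≤ z * W := by gcongr
  have b2 : r ^ 2 * N ≤ (3 * r ^ 2 - 4 * m) * N := by
    have : r ^ 2 ≤ 3 * r ^ 2 - 4 * m := by linarith
    gcongr
  have b3 : G + W ≤ 2 * N + τ ^ 2 * (5 / 2 * r ^ 6 + 1) * W := by
    have h1 : 8 * τ ^ 2 * m ^ 2 * W * s = 8 * τ ^ 2 * W * (m ^ 2 * s) := by ring
    have h2 : 8 * τ ^ 2 * W * (m ^ 2 * s) ≤ 8 * τ ^ 2 * W * (5 / 16 * r ^ 6) := by gcongr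
    have h3 : 1 * W ≤ τ ^ 2 * W := by
      gcongr; nlinarith
    linarith
  have b4 : κ * (G + W) ≤ 4 * (8 * P ^ 2 + (3 * r ^ 2 - 4 * m) * N + z * W) := by
    have h1 : κ * (G + W) ≤ κ * (2 * N + τ ^ 2 * (5 / 2 * r ^ 6 + 1) * W) := by gcongr
    have h2 : κ * (2 * N) ≤ 4 * r ^ 2 * N := by linarith [mul_le_mul_of_nonneg_right hκ1 hN]
    have h3 : κ * (5 / 2 * r ^ 6 + 1) * (τ ^ 2 * W) ≤ 2 * r ^ 8 * (τ ^ 2 * W) := by gcongr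
    linarith [sq_nonneg P]
  calc τ * κ * (G + W) = τ * (κ * (G + W)) := by ring
    _ ≤ τ * (4 * (8 * P ^ 2 + (3 * r ^ 2 - 4 * m) * N + z * W)) := by gcongr
    _ = _ := by ring

end


section

lemma inner_amgm (p q : Eu n) : ⟪p + q, p + q⟫ ≤ 2 * ⟪p, p⟫ + 2 * ⟪q, q⟫ := by
  have h := real_inner_self_nonneg (x := p - q)
  simp only [inner_add_left, inner_add_right, inner_sub_left, inner_sub_right] at h ⊢
  rw [real_inner_comm q p] at h ⊢
  linarith

lemma cs_eq (y x : Eu n) : cs y x = ‖x - y‖ ^ 2 := by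
  rw [cs, real_inner_self_eq_norm_sq]

set_option maxHeartbeats 2000000 in
/-- pointwise Carleman inequality -/
lemma carl_pt {r τ κ : ℝ} (hr : 0 < r) (hτ1 : 1 ≤ τ) (hτ : 4 * (9 * r ^ 4 + n * (4 + 2 * n)) ≤ τ * r ^ 8)
    (hκ0 : 0 < κ) (hκ1 : κ ≤ 2 * r ^ 2) (hκ2 : κ * (5 / 2 * r ^ 6 + 1) ≤ 2 * r ^ 8)
    (y : Eu n) {w : Eu n → ℝ} {gw : Eu n → Eu n} {Hw : Eu n →L[ℝ] Eu n} {x : Eu n}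
    (hw : HasGr w (gw x) x) (hgw : HasFDerivAt gw Hw x) (hs : ∀ ξ ζ, ⟪Hw ξ, ζ⟫ = ⟪Hw ζ, ξ⟫)
    (h0 : ¬ (r ^ 2 ≤ cs y x ∧ cs y x ≤ 5 / 4 * r ^ 2) → w x = 0 ∧ gw x = 0) :
    τ * κ * (cω (3 / 2 * r ^ 2) τ y x ^ 2 * (⟪gw x, gw x⟫ + w x ^ 2)) ≤
      cω (3 / 2 * r ^ 2) τ y x ^ 2 * (tr Hw) ^ 2 + 4 * τ * tr (fderiv ℝ (cZ (3 / 2 * r ^ 2) (3 * r ^ 2) τ y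
        (cv (3 / 2 * r ^ 2) τ y w) (cg (3 / 2 * r ^ 2) τ y w gw)) x) := by
  obtain ⟨h1, L, h2, h3, h4⟩ := carl_conj (3 / 2 * r ^ 2) (3 * r ^ 2) τ y hw hgw hs
  have h5 := carl_div (3 / 2 * r ^ 2) (3 * r ^ 2) τ y h1 h2 h3
  rw [h5]
  by_cases hx : r ^ 2 ≤ cs y x ∧ cs y x ≤ 5 / 4 * r ^ 2
  · have hW : 0 ≤ cv (3 / 2 * r ^ 2) τ y w x ^ 2 := sq_nonneg _
    have hN : 0 ≤ ⟪cg (3 / 2 * r ^ 2) τ y w gw x, cg (3 / 2 * r ^ 2) τ y w gw x⟫ := real_inner_self_nonneg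
    have hG : cω (3 / 2 * r ^ 2) τ y x ^ 2 * ⟪gw x, gw x⟫ ≤
        2 * ⟪cg (3 / 2 * r ^ 2) τ y w gw x, cg (3 / 2 * r ^ 2) τ y w gw x⟫ +
          8 * τ ^ 2 * cm (3 / 2 * r ^ 2) y x ^ 2 * cv (3 / 2 * r ^ 2) τ y w x ^ 2 * cs y x := by
      have e : gw x = cV (3 / 2 * r ^ 2) τ y w gw x + (2 * τ * (cm (3 / 2 * r ^ 2) y x * w x)) • (x - y) := by
        simp [cV]
      have := inner_amgm (cV (3 / 2 * r ^ 2) τ y w gw x) ((2 * τ * (cm (3 / 2 * r ^ 2) y x * w x)) • (x - y))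
      rw [← e] at this
      have h6 := mul_le_mul_of_nonneg_left this (sq_nonneg (cω (3 / 2 * r ^ 2) τ y x))
      refine h6.trans (le_of_eq ?_)
      simp only [cg, cv, inner_smul_left, inner_smul_right, RCLike.conj_to_real]
      rw [show ⟪x - y, x - y⟫ = cs y x from rfl]
      ring
    have := carl_num (n := n) (P := ⟪x - y, cg (3 / 2 * r ^ 2) τ y w gw x⟫) (z := cζ (3 / 2 * r ^ 2) (3 * r ^ 2) τ y x)
      hr hτ1 hτ hκ0 hκ1 hκ2 (m := cm (3 / 2 * r ^ 2) y x) (s := cs y x) rfl hx.1 hx.2 hN hW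
      (by simp only [cζ, cE]) hG
    have e2 : cω (3 / 2 * r ^ 2) τ y x ^ 2 * (⟪gw x, gw x⟫ + w x ^ 2) = cω (3 / 2 * r ^ 2) τ y x ^ 2 * ⟪gw x, gw x⟫
      + cv (3 / 2 * r ^ 2) τ y w x ^ 2 := by simp only [cv]; ring
    rw [e2]
    have e3 : cω (3 / 2 * r ^ 2) τ y x ^ 2 * (tr Hw) ^ 2 = (cω (3 / 2 * r ^ 2) τ y x * tr Hw) ^ 2 := by ring
    rw [e3, ← h4]
    have := sq_nonneg (tr L + cE (3 / 2 * r ^ 2) (3 * r ^ 2) τ y x * cv (3 / 2 * r ^ 2) τ y w x +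
      τ * ch1 (3 / 2 * r ^ 2) (3 * r ^ 2) y (cv (3 / 2 * r ^ 2) τ y w) (cg (3 / 2 * r ^ 2) τ y w gw) x)
    generalize tr L + cE (3 / 2 * r ^ 2) (3 * r ^ 2) τ y x * cv (3 / 2 * r ^ 2) τ y w x = S at *
    generalize ch1 (3 / 2 * r ^ 2) (3 * r ^ 2) y (cv (3 / 2 * r ^ 2) τ y w) (cg (3 / 2 * r ^ 2) τ y w gw) x = h at *
    linarith
  · obtain ⟨a1, a2⟩ := h0 hx
    have b1 : cv (3 / 2 * r ^ 2) τ y w x = 0 := by simp [cv, a1]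
    have b2 : cg (3 / 2 * r ^ 2) τ y w gw x = 0 := by simp [cg, cV, a1, a2]
    have b3 : ch1 (3 / 2 * r ^ 2) (3 * r ^ 2) y (cv (3 / 2 * r ^ 2) τ y w) (cg (3 / 2 * r ^ 2) τ y w gw) x = 0 := by
      simp [ch1, b1, b2]
    rw [b1, b2, b3, a1, a2]
    simp only [inner_zero_right]
    have : 0 ≤ cω (3 / 2 * r ^ 2) τ y x ^ 2 * tr Hw ^ 2 := by positivity
    simpa using this

lemma cs_cd (y : Eu n) : ContDiff ℝ 1 (cs y) := by
  unfold cs; exact (contDiff_id.sub contDiff_const).inner ℝ (contDiff_id.sub contDiff_const)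

lemma cω_cd (σ τ : ℝ) (y : Eu n) : ContDiff ℝ 1 (cω σ τ y) := by
  have := cs_cd y
  unfold cω cm; fun_prop

set_option maxHeartbeats 2000000 in
/-- Carleman estimate -/
lemma carleman {r τ κ : ℝ} (hr : 0 < r) (hτ1 : 1 ≤ τ) (hτ : 4 * (9 * r ^ 4 + n * (4 + 2 * n)) ≤ τ * r ^ 8)
    (hκ0 : 0 < κ) (hκ1 : κ ≤ 2 * r ^ 2) (hκ2 : κ * (5 / 2 * r ^ 6 + 1) ≤ 2 * r ^ 8)
    (y : Eu n) {w : Eu n → ℝ} {gw : Eu n → Eu n} {Hw : Eu n → Eu n →L[ℝ] Eu n} (hwc : ContDiff ℝ 1 w)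
    (hgc : ContDiff ℝ 1 gw)
    (hw : ∀ x, HasGr w (gw x) x) (hgw : ∀ x, HasFDerivAt gw (Hw x) x) (hs : ∀ x ξ ζ, ⟪Hw x ξ, ζ⟫ = ⟪Hw x ζ, ξ⟫)
    (h0 : ∀ x, ¬ (r ^ 2 ≤ cs y x ∧ cs y x ≤ 5 / 4 * r ^ 2) → w x = 0 ∧ gw x = 0) :
    τ * κ * ∫ x, cω (3 / 2 * r ^ 2) τ y x ^ 2 * (⟪gw x, gw x⟫ + w x ^ 2) ≤
      ∫ x, cω (3 / 2 * r ^ 2) τ y x ^ 2 * (tr (Hw x)) ^ 2 := by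
  have hK : IsCompact (closedBall y (2 * r)) := isCompact_closedBall _ _
  have hout : ∀ x, x ∉ closedBall y (2 * r) → w x = 0 ∧ gw x = 0 := by
    intro x hx
    refine h0 x fun h => hx ?_
    have := h.2
    rw [cs_eq] at this
    rw [mem_closedBall, dist_eq_norm]
    exact abs_le_of_sq_le_sq' (by nlinarith) (by positivity) |>.2
  have hωc := cω_cd (3 / 2 * r ^ 2) τ y
  have hvc : ContDiff ℝ 1 (cv (3 / 2 * r ^ 2) τ y w) := by unfold cv; fun_prop
  have hcmc : ContDiff ℝ 1 (cm (3 / 2 * r ^ 2) y) := contDiff_const.sub (cs_cd y)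
  have hcsc : ContDiff ℝ 1 (cs y) := cs_cd y
  have hgc' : ContDiff ℝ 1 (cg (3 / 2 * r ^ 2) τ y w gw) := by unfold cg cV; fun_prop
  have hZ : ContDiff ℝ 1 (cZ (3 / 2 * r ^ 2) (3 * r ^ 2) τ y
        (cv (3 / 2 * r ^ 2) τ y w) (cg (3 / 2 * r ^ 2) τ y w gw)) := by
    have k1 : ContDiff ℝ 1 (fun x => ⟪x - y, cg (3 / 2 * r ^ 2) τ y w gw x⟫) :=
      (contDiff_id.sub contDiff_const).inner ℝ hgc'
    have k2 : ContDiff ℝ 1 (fun x => ⟪cg (3 / 2 * r ^ 2) τ y w gw x, cg (3 / 2 * r ^ 2) τ y w gw x⟫) :=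
      hgc'.inner ℝ hgc'
    unfold cZ ch1 ch2 cE cG; fun_prop
  have hZc : HasCompactSupport (cZ (3 / 2 * r ^ 2) (3 * r ^ 2) τ y
        (cv (3 / 2 * r ^ 2) τ y w) (cg (3 / 2 * r ^ 2) τ y w gw)) := by
    refine HasCompactSupport.intro hK fun x hx => ?_
    obtain ⟨a1, a2⟩ := hout x hx
    simp [cZ, ch1, ch2, cv, cg, cV, a1, a2]
  obtain ⟨i1, i2⟩ := div_int hZ hZc
  have hHc : Continuous Hw := by
    have : Hw = fderiv ℝ gw := funext fun x => (hgw x).fderiv.symm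
    rw [this]; exact hgc.continuous_fderiv (by norm_num)
  have hgC : HasCompactSupport gw := HasCompactSupport.intro hK fun x hx => (hout x hx).2
  have hHs : HasCompactSupport Hw := by
    have : Hw = fderiv ℝ gw := funext fun x => (hgw x).fderiv.symm
    rw [this]; exact hgC.fderiv ℝ
  have j1 : Integrable (fun x => cω (3 / 2 * r ^ 2) τ y x ^ 2 * (⟪gw x, gw x⟫ + w x ^ 2)) := by
    refine Continuous.integrable_of_hasCompactSupport ?_ (HasCompactSupport.intro hK fun x hx => ?_)
    · have := hgc.continuous; have := hwc.continuous; have := hωc.continuous; fun_prop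
    · simp [(hout x hx).1, (hout x hx).2]
  have j2 : Integrable (fun x => cω (3 / 2 * r ^ 2) τ y x ^ 2 * (tr (Hw x)) ^ 2) := by
    refine Continuous.integrable_of_hasCompactSupport ?_ ?_
    · have := hωc.continuous; have := tr_cont.comp hHc
      exact (hωc.continuous.pow 2).mul (this.pow 2)
    · refine hHs.mono fun x hx => ?_
      contrapose! hx
      have : Hw x = 0 := by simpa using hx
      simp [this, tr_zero]
  have key := integral_mono (j1.const_mul (τ * κ)) (j2.add (i1.const_mul (4 * τ))) fun x =>
    carl_pt hr hτ1 hτ hκ0 hκ1 hκ2 y (hw x) (hgw x) (hs x) (h0 x)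
  rw [integral_const_mul] at key
  refine key.trans (le_of_eq ?_)
  refine (integral_add j2 (i1.const_mul (4 * τ))).trans ?_
  rw [integral_const_mul, i2]; ring

end


section

lemma grad_cd {χ : Eu n → ℝ} (h : ContDiff ℝ 2 χ) : ContDiff ℝ 1 (gradient χ) := by
  have : gradient χ = fun x => (InnerProductSpace.toDual ℝ (Eu n)).symm (fderiv ℝ χ x) := rfl
  rw [this]
  exact (InnerProductSpace.toDual ℝ (Eu n)).symm.contDiff.comp (h.fderiv_right (m := 1) (by norm_num))

lemma hasGr_gradient {χ : Eu n → ℝ} {x : Eu n} (h : DifferentiableAt ℝ χ x) : HasGr χ (gradient χ x) x :=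
  h.hasGradientAt.hasFDerivAt

lemma cd_of_tsupport {F : Type*} [NormedAddCommGroup F] [NormedSpace ℝ F] {g : Eu n → F}
    (h : ∀ x ∈ tsupport g, ContDiffAt ℝ 1 g x) : ContDiff ℝ 1 g := by
  rw [contDiff_iff_contDiffAt]
  intro x
  by_cases hx : x ∈ tsupport g
  · exact h x hx
  · exact contDiffAt_const.congr_of_eventuallyEq (notMem_tsupport_iff_eventuallyEq.1 hx)

/-- symmetry of the derivative of a gradient -/
lemma gr_symm {w : Eu n → ℝ} {gw : Eu n → Eu n} {Hw : Eu n →L[ℝ] Eu n} {x : Eu n} (hw : ∀ x, HasGr w (gw x) x)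
    (hg : HasFDerivAt gw Hw x) (ξ ζ : Eu n) : ⟪Hw ξ, ζ⟫ = ⟪Hw ζ, ξ⟫ := by
  have h2 : HasFDerivAt (fun x => innerSL ℝ (gw x)) ((innerSL ℝ).comp Hw) x :=
    (innerSL ℝ).hasFDerivAt.comp x hg
  have := second_derivative_symmetric hw h2 ξ ζ
  simpa using this

set_option maxHeartbeats 2000000 in
/-- unique continuation across a sphere from a Carleman estimate -/
lemma uc_step {O : Set (Eu n)} (hO : IsOpen O) {z : Eu n → ℝ} {Dz : Eu n → Eu n}
    {y : Eu n} {r r₁ r₂ K : ℝ} (hr : 0 < r) (hr₁ : r₁ ^ 2 = 9 / 8 * r ^ 2) (hr₂ : r₂ ^ 2 = 5 / 4 * r ^ 2)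
    (hr₁0 : 0 < r₁) (hr₂0 : 0 < r₂)
    (hball : closedBall y r₂ ⊆ O) (hz : ContDiffOn ℝ 1 z O) (hDz : ContDiffOn ℝ 1 Dz O)
    (hg : ∀ x ∈ O, HasGr z (Dz x) x) (hK : 0 ≤ K)
    (hineq : ∀ x ∈ ball y r₁, (tr (fderiv ℝ Dz x)) ^ 2 ≤ K * (⟪Dz x, Dz x⟫ + z x ^ 2))
    (hin : ∀ x ∈ ball y r, z x = 0 ∧ Dz x = 0) :
    ∀ x ∈ ball y r₁, z x = 0 := by
  have hr12 : r₁ < r₂ := by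
    refine lt_of_pow_lt_pow_left₀ 2 hr₂0.le ?_
    rw [hr₁, hr₂]; have : 0 < r ^ 2 := by positivity
    linarith
  let χ : ContDiffBump y := ⟨r₁, r₂, hr₁0, hr12⟩
  have hχc : ContDiff ℝ 2 χ := χ.contDiff
  have hχ1 : ContDiff ℝ 1 χ := χ.contDiff
  have hχd : ∀ x, HasGr χ (gradient χ x) x := fun x => hasGr_gradient (hχ1.differentiable (by norm_num) x)
  have hts : tsupport χ = closedBall y r₂ := χ.tsupport_eq
  have hgχ := grad_cd hχc
  set w : Eu n → ℝ := fun x => χ x * z x with hw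
  set gw : Eu n → Eu n := fun x => χ x • Dz x + z x • gradient χ x with hgw
  have hoff : ∀ x, x ∉ closedBall y r₂ → χ x = 0 ∧ gradient χ x = 0 := by
    intro x hx
    rw [← hts] at hx
    exact ⟨image_eq_zero_of_notMem_tsupport hx, grad_zero_off hx⟩
  have hoffw : ∀ x, x ∉ closedBall y r₂ → w x = 0 ∧ gw x = 0 := by
    intro x hx
    obtain ⟨a1, a2⟩ := hoff x hx
    exact ⟨by simp [hw, a1], by simp [hgw, a1, a2]⟩
  have htw : tsupport w ⊆ closedBall y r₂ := closure_minimal (fun x hx => by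
    by_contra h; exact hx (hoffw x h).1) isClosed_closedBall
  have htg : tsupport gw ⊆ closedBall y r₂ := closure_minimal (fun x hx => by
    by_contra h; exact hx (hoffw x h).2) isClosed_closedBall
  have hwc : ContDiff ℝ 1 w := cd_of_tsupport fun x hx => by
    have := hz.contDiffAt (hO.mem_nhds (hball (htw hx)))
    exact hχ1.contDiffAt.mul this
  have hgc : ContDiff ℝ 1 gw := cd_of_tsupport fun x hx => by
    have h1 := hz.contDiffAt (hO.mem_nhds (hball (htg hx)))
    have h2 := hDz.contDiffAt (hO.mem_nhds (hball (htg hx)))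
    exact (hχ1.contDiffAt.smul h2).add (h1.smul hgχ.contDiffAt)
  have hwg : ∀ x, HasGr w (gw x) x := by
    intro x
    by_cases hx : x ∈ O
    · exact (hχd x).mul' (hg x hx)
    · have hx2 : x ∉ closedBall y r₂ := fun h => hx (hball h)
      rw [(hoffw x hx2).2]
      refine (HasGr.cst 0 x).congr_of_eventuallyEq ?_
      filter_upwards [isClosed_closedBall.isOpen_compl.mem_nhds hx2] with t ht
      exact (hoffw t ht).1
  have hgd : ∀ x, HasFDerivAt gw (fderiv ℝ gw x) x := fun x => (hgc.differentiable (by norm_num) x).hasFDerivAt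
  have hsym := fun x => gr_symm hwg (hgd x)
  have hin' : ∀ x ∈ ball y r, w x = 0 ∧ gw x = 0 := by
    intro x hx
    obtain ⟨a1, a2⟩ := hin x hx
    exact ⟨by simp [hw, a1], by simp [hgw, a1, a2]⟩
  have h0 : ∀ x, ¬ (r ^ 2 ≤ cs y x ∧ cs y x ≤ 5 / 4 * r ^ 2) → w x = 0 ∧ gw x = 0 := by
    intro x hx
    by_cases h : x ∈ ball y r
    · exact hin' x h
    · refine hoffw x fun h2 => hx ?_
      rw [mem_ball, dist_eq_norm, not_lt] at h
      rw [mem_closedBall, dist_eq_norm] at h2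
      rw [cs_eq, ← hr₂]
      exact ⟨by gcongr, by gcongr⟩
  -- agreement on the inner ball
  have hone : ∀ x ∈ ball y r₁, w x = z x ∧ gw x = Dz x ∧ fderiv ℝ gw x = fderiv ℝ Dz x := by
    have k0 : ∀ x ∈ ball y r₁, w x = z x ∧ gw x = Dz x := by
      intro x hx
      have h1 : (χ : Eu n → ℝ) =ᶠ[𝓝 x] fun _ => 1 := χ.eventuallyEq_one_of_mem_ball hx
      have h2 : χ x = 1 := h1.eq_of_nhds
      have h3 : gradient χ x = 0 := by
        unfold gradient
        rw [h1.fderiv_eq]; simp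
      exact ⟨by simp [hw, h2], by simp [hgw, h2, h3]⟩
    intro x hx
    refine ⟨(k0 x hx).1, (k0 x hx).2, Filter.EventuallyEq.fderiv_eq ?_⟩
    filter_upwards [isOpen_ball.mem_nhds hx] with t ht using (k0 t ht).2
  have hKc : IsCompact (closedBall y r₂) := isCompact_closedBall _ _
  have hHc : Continuous (fun x => tr (fderiv ℝ gw x)) := tr_cont.comp (hgc.continuous_fderiv (by norm_num))
  have hH0 : ∀ x, x ∉ closedBall y r₂ → tr (fderiv ℝ gw x) = 0 := by
    intro x hx
    have : fderiv ℝ gw x = 0 := by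
      by_contra h
      exact hx (htg (support_fderiv_subset ℝ h))
    rw [this, tr_zero]
  clear_value w gw
  have j0 : Integrable (fun x => tr (fderiv ℝ gw x) ^ 2) :=
    (hHc.pow 2).integrable_of_hasCompactSupport (HasCompactSupport.intro hKc fun x hx => by simp [hH0 x hx])
  set B := ∫ x, tr (fderiv ℝ gw x) ^ 2 with hB
  obtain ⟨κ, hκ0, hκ1, hκ2⟩ : ∃ κ : ℝ, 0 < κ ∧ κ ≤ 2 * r ^ 2 ∧ κ * (5 / 2 * r ^ 6 + 1) ≤ 2 * r ^ 8 := by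
    have : 0 < 5 / 2 * r ^ 6 + 1 := by positivity
    refine ⟨min (2 * r ^ 2) (2 * r ^ 8 / (5 / 2 * r ^ 6 + 1)), by positivity, min_le_left _ _, ?_⟩
    calc _ ≤ (2 * r ^ 8 / (5 / 2 * r ^ 6 + 1)) * (5 / 2 * r ^ 6 + 1) := by gcongr; exact min_le_right _ _
      _ = _ := by field_simp
  -- the main inequality for large τ
  have main : ∀ τ : ℝ, 1 ≤ τ → 4 * (9 * r ^ 4 + n * (4 + 2 * n)) ≤ τ * r ^ 8 → 2 * K ≤ τ * κ →
      τ * κ / 2 * ∫ x in ball y r₁, w x ^ 2 ≤ B := by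
    intro τ hτ1 hτ2 hτ3
    have hωc := (cω_cd (3 / 2 * r ^ 2) τ y).continuous
    have car := carleman hr hτ1 hτ2 hκ0 hκ1 hκ2 y hwc hgc hwg hgd hsym h0
    have j1 : Integrable (fun x => cω (3 / 2 * r ^ 2) τ y x ^ 2 * (⟪gw x, gw x⟫ + w x ^ 2)) := by
      refine Continuous.integrable_of_hasCompactSupport ?_ (HasCompactSupport.intro hKc fun x hx => ?_)
      · have := hgc.continuous; have := hwc.continuous; fun_prop
      · simp [(hoffw x hx).1, (hoffw x hx).2]
    have j2 : Integrable (fun x => cω (3 / 2 * r ^ 2) τ y x ^ 2 * (tr (fderiv ℝ gw x)) ^ 2) := by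
      refine Continuous.integrable_of_hasCompactSupport ?_ (HasCompactSupport.intro hKc fun x hx => ?_)
      · fun_prop
      · simp [hH0 x hx]
    have jw : Integrable (fun x => w x ^ 2) := by
      refine Continuous.integrable_of_hasCompactSupport ?_ (HasCompactSupport.intro hKc fun x hx => ?_)
      · have := hwc.continuous; fun_prop
      · simp [(hoffw x hx).1]
    set I := ∫ x, cω (3 / 2 * r ^ 2) τ y x ^ 2 * (⟪gw x, gw x⟫ + w x ^ 2) with hI
    set E := Real.exp (τ * (3 / 8 * r ^ 2) ^ 2) with hE
    have hE0 : 0 < E := Real.exp_pos _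
    have hω2 : ∀ x, cω (3 / 2 * r ^ 2) τ y x ^ 2 = Real.exp (τ * cm (3 / 2 * r ^ 2) y x ^ 2) := by
      intro x
      rw [cω, ← Real.exp_nat_mul]; congr 1; push_cast; ring
    have hrr : 0 < r ^ 2 := by positivity
    have u1 : ∫ x, cω (3 / 2 * r ^ 2) τ y x ^ 2 * (tr (fderiv ℝ gw x)) ^ 2 ≤ K * I + E * B := by
      rw [hI, hB, ← integral_const_mul, ← integral_const_mul, ← integral_add (j1.const_mul K) (j0.const_mul E)]
      refine integral_mono j2 ((j1.const_mul K).add (j0.const_mul E)) fun x => ?_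
      show cω (3 / 2 * r ^ 2) τ y x ^ 2 * (tr (fderiv ℝ gw x)) ^ 2 ≤
        K * (cω (3 / 2 * r ^ 2) τ y x ^ 2 * (⟪gw x, gw x⟫ + w x ^ 2)) + E * (tr (fderiv ℝ gw x)) ^ 2
      have p1 : 0 ≤ E * (tr (fderiv ℝ gw x)) ^ 2 := by positivity
      have p2 : 0 ≤ K * (cω (3 / 2 * r ^ 2) τ y x ^ 2 * (⟪gw x, gw x⟫ + w x ^ 2)) := by
        have := real_inner_self_nonneg (x := gw x); positivity
      by_cases hx : x ∈ ball y r₁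
      · obtain ⟨a1, a2, a3⟩ := hone x hx
        have := hineq x hx
        rw [← a1, ← a2, ← a3] at this
        have := mul_le_mul_of_nonneg_left this (sq_nonneg (cω (3 / 2 * r ^ 2) τ y x))
        linarith
      · by_cases hx2 : x ∈ closedBall y r₂
        · have : cω (3 / 2 * r ^ 2) τ y x ^ 2 ≤ E := by
            rw [hω2, hE]
            rw [mem_ball, dist_eq_norm, not_lt] at hx
            rw [mem_closedBall, dist_eq_norm] at hx2
            have q1 : 9 / 8 * r ^ 2 ≤ cs y x := by rw [cs_eq, ← hr₁]; gcongr
            have q2 : cs y x ≤ 5 / 4 * r ^ 2 := by rw [cs_eq, ← hr₂]; gcongr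
            have q3 : 0 ≤ cm (3 / 2 * r ^ 2) y x := by unfold cm; linarith
            have q4 : cm (3 / 2 * r ^ 2) y x ≤ 3 / 8 * r ^ 2 := by unfold cm; linarith
            gcongr
          have := mul_le_mul_of_nonneg_right this (sq_nonneg (tr (fderiv ℝ gw x)))
          linarith
        · rw [hH0 x hx2]; simpa using p2
    have u2 : E * ∫ x in ball y r₁, w x ^ 2 ≤ I := by
      have s1 : ∫ x in ball y r₁, cω (3 / 2 * r ^ 2) τ y x ^ 2 * (⟪gw x, gw x⟫ + w x ^ 2) ≤ I := by
        refine setIntegral_le_integral j1 (Eventually.of_forall fun x => ?_)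
        have := real_inner_self_nonneg (x := gw x)
        show 0 ≤ cω (3 / 2 * r ^ 2) τ y x ^ 2 * (⟪gw x, gw x⟫ + w x ^ 2)
        positivity
      refine le_trans ?_ s1
      rw [← integral_const_mul]
      refine setIntegral_mono_on (jw.const_mul E).integrableOn j1.integrableOn measurableSet_ball fun x hx => ?_
      have : E ≤ cω (3 / 2 * r ^ 2) τ y x ^ 2 := by
        rw [hω2, hE]
        rw [mem_ball, dist_eq_norm] at hx
        have q1 : cs y x ≤ 9 / 8 * r ^ 2 := by rw [cs_eq, ← hr₁]; gcongr
        have q4 : 3 / 8 * r ^ 2 ≤ cm (3 / 2 * r ^ 2) y x := by unfold cm; linarith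
        gcongr
      have h5 := real_inner_self_nonneg (x := gw x)
      have : E * w x ^ 2 ≤ cω (3 / 2 * r ^ 2) τ y x ^ 2 * w x ^ 2 := by gcongr
      have : 0 ≤ cω (3 / 2 * r ^ 2) τ y x ^ 2 * ⟪gw x, gw x⟫ := by positivity
      linarith
    have hI0 : 0 ≤ I := by
      refine le_trans ?_ u2
      have : 0 ≤ ∫ x in ball y r₁, w x ^ 2 := integral_nonneg fun x => sq_nonneg _
      positivity
    have u3 : τ * κ / 2 * I ≤ E * B := by nlinarith
    have u4 : τ * κ / 2 * (E * ∫ x in ball y r₁, w x ^ 2) ≤ τ * κ / 2 * I := by gcongr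
    have u5 : E * (τ * κ / 2 * ∫ x in ball y r₁, w x ^ 2) ≤ E * B := by linarith
    exact le_of_mul_le_mul_left u5 hE0
  have hc0 : 0 ≤ ∫ x in ball y r₁, w x ^ 2 := integral_nonneg fun x => sq_nonneg _
  have hc : ∫ x in ball y r₁, w x ^ 2 = 0 := by
    by_contra hne
    have hpos : 0 < ∫ x in ball y r₁, w x ^ 2 := lt_of_le_of_ne hc0 (Ne.symm hne)
    set c := ∫ x in ball y r₁, w x ^ 2
    have l1 : Tendsto (fun τ : ℝ => τ * r ^ 8) atTop atTop := tendsto_id.atTop_mul_const (by positivity)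
    have l2 : Tendsto (fun τ : ℝ => τ * κ) atTop atTop := tendsto_id.atTop_mul_const (by positivity)
    have l3 : Tendsto (fun τ : ℝ => τ * κ / 2 * c) atTop atTop := (l2.atTop_div_const (by norm_num)).atTop_mul_const hpos
    obtain ⟨τ, t1, t2, t3, t4⟩ := ((eventually_ge_atTop (1 : ℝ)).and ((l1.eventually_ge_atTop _).and
      ((l2.eventually_ge_atTop _).and (l3.eventually_gt_atTop B)))).exists
    exact absurd (main τ t1 t2 t3) (not_le.2 t4)
  have jw : IntegrableOn (fun x => w x ^ 2) (ball y r₁) :=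
    ((hwc.continuous.pow 2).integrable_of_hasCompactSupport
      (HasCompactSupport.intro hKc fun x hx => by simp [(hoffw x hx).1])).integrableOn
  have hae := (integral_eq_zero_iff_of_nonneg (fun x => sq_nonneg _) jw).1 hc
  have := Measure.eqOn_open_of_ae_eq hae isOpen_ball (hwc.continuous.pow 2).continuousOn continuousOn_const
  intro x hx
  have h6 : w x ^ 2 = 0 := this hx
  rw [← (hone x hx).1]
  exact pow_eq_zero_iff (two_ne_zero) |>.1 h6

end


section

variable {Ω : Set (Eu n)} {η : Eu n → Eu n} {a f : ℝ → ℝ} {u : Eu n → ℝ} {Du : Eu n → Eu n} {H : Eu n → Eu n →L[ℝ] Eu n}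

set_option maxHeartbeats 1000000 in
/-- pointwise form of the equation -/
lemma Dat.pde (S : Dat Ω η a f u Du H) {x : Eu n} (hx : x ∈ Ω) :
    tr ((AL a (Du x)).comp (H x)) = - f (u x) := by
  have hDFc : ContinuousOn (fun x => (AL a (Du x)).comp (H x)) Ω :=
    (S.M_contOn.clm_comp S.hHc).mono subset_closure
  have htc : ContinuousOn (fun x => tr ((AL a (Du x)).comp (H x))) Ω := tr_cont.comp_continuousOn hDFc
  have hfc : ContinuousOn (fun x => f (u x)) Ω := S.hf.continuous.comp_continuousOn (S.hucl.mono subset_closure)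
  have hFc : ∀ x ∈ Ω, ContDiffAt ℝ 1 (fun y => a ‖Du y‖ • Du y) x := by
    intro x hx
    exact contDiffAt_one_iff.2 ⟨_, Ω, S.op.mem_nhds hx, hDFc, fun y hy => S.hasF hy⟩
  have key : ∀ᵐ x ∂(volume : Measure (Eu n)), x ∈ Ω → tr ((AL a (Du x)).comp (H x)) + f (u x) = 0 := by
    refine S.op.ae_eq_zero_of_integral_contDiff_smul_eq_zero
      ((htc.add hfc).locallyIntegrableOn S.ms) fun φ hφ hc hsub => ?_
    have hφ1 : ContDiff ℝ 1 φ := hφ.of_le (by exact_mod_cast le_top)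
    have hKc : IsCompact (tsupport φ) := hc
    have htest : IsTestOn Ω φ := test_of_cpt S.op hKc hsub (fun x hx => image_eq_zero_of_notMem_tsupport hx)
      (locLip_of_contDiffOn S.op hφ1.contDiffOn)
    have hZt : tsupport (fun y => φ y • (a ‖Du y‖ • Du y)) ⊆ tsupport φ := tsupport_smul_subset_left _ _
    have hZ : ContDiff ℝ 1 (fun y => φ y • (a ‖Du y‖ • Du y)) := cd_of_tsupport fun x hx =>
      hφ1.contDiffAt.smul (hFc x (hsub (hZt hx)))
    obtain ⟨i1, i2⟩ := div_int hZ (HasCompactSupport.of_support_subset_isCompact hKc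
      (subset_closure.trans hZt))
    have hpt : ∀ x, tr (fderiv ℝ (fun y => φ y • (a ‖Du y‖ • Du y)) x) =
        φ x * tr ((AL a (Du x)).comp (H x)) + ⟪a ‖Du x‖ • Du x, gradient φ x⟫ := by
      intro x
      by_cases hx : x ∈ tsupport φ
      · have h1 := (hasGr_gradient (hφ1.differentiable (by norm_num) x)).smulV (S.hasF (hsub hx))
        rw [h1.fderiv, tr_add, tr_smul, tr_rank, real_inner_comm]
      · have e : fderiv ℝ (fun y => φ y • (a ‖Du y‖ • Du y)) x = 0 := by
          by_contra h
          exact hx (hZt (support_fderiv_subset ℝ h))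
        rw [e, grad_zero_off hx, image_eq_zero_of_notMem_tsupport hx]; simp [tr_zero]
    have hoff : ∀ x, x ∉ Ω → φ x = 0 := fun x hx => image_eq_zero_of_notMem_tsupport fun h => hx (hsub h)
    have hg2 : ∫ x, ⟪a ‖Du x‖ • Du x, gradient φ x⟫ = ∫ x, φ x * f (u x) := by
      have := S.sol' htest
      rw [setIntegral_eq_integral_of_forall_compl_eq_zero (fun x hx => by
          rw [grad_zero_off fun h => hx (hsub h), inner_zero_right]),
        setIntegral_eq_integral_of_forall_compl_eq_zero (fun x hx => by rw [hoff x hx, mul_zero])] at this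
      rw [this]
      exact integral_congr_ae (Eventually.of_forall fun x => mul_comm _ _)
    have cphi : ∀ g : Eu n → ℝ, ContinuousOn g Ω → Integrable (fun x => φ x * g x) := by
      intro g hg
      have : Continuous (fun x => φ x * g x) := by
        rw [continuous_iff_continuousAt]
        intro x
        by_cases hx : x ∈ tsupport φ
        · exact hφ1.continuous.continuousAt.mul (hg.continuousAt (S.op.mem_nhds (hsub hx)))
        · refine continuousAt_const.congr (f := fun _ => (0 : ℝ)) ?_
          filter_upwards [notMem_tsupport_iff_eventuallyEq.1 hx] with y hy
          simp [hy]
      exact this.integrable_of_hasCompactSupport hc.mul_right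
    have k1 := cphi _ htc
    have k2 := cphi _ hfc
    have k3 : Integrable (fun x => ⟪a ‖Du x‖ • Du x, gradient φ x⟫) := by
      have := i1.sub k1
      refine this.congr (Eventually.of_forall fun x => ?_)
      show tr (fderiv ℝ (fun y => φ y • (a ‖Du y‖ • Du y)) x) - φ x * tr ((AL a (Du x)).comp (H x)) = _
      rw [hpt]; ring
    have e1 : ∫ x, tr (fderiv ℝ (fun y => φ y • (a ‖Du y‖ • Du y)) x) =
        (∫ x, φ x * tr ((AL a (Du x)).comp (H x))) + ∫ x, φ x * f (u x) := by
      rw [← hg2]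
      exact (integral_congr_ae (Eventually.of_forall hpt)).trans (integral_add k1 k3)
    rw [i2, ← integral_add k1 k2] at e1
    refine Eq.trans (integral_congr_ae (Eventually.of_forall fun x => ?_)) e1.symm
    simp only [smul_eq_mul]; ring
  have h2 := Measure.eqOn_open_of_ae_eq (U := Ω) (g := fun _ => (0 : ℝ)) (μ := volume)
    ((ae_restrict_iff' S.ms).2 key) S.op (htc.add hfc) continuousOn_const hx
  have h3 : tr ((AL a (Du x)).comp (H x)) + f (u x) = 0 := h2
  linarith

set_option maxHeartbeats 1000000 in
lemma Dat.uc_ball (S : Dat Ω η a f u Du H) {y : Eu n} {r r₁ r₂ : ℝ} (hr : 0 < r) (hr₁ : r₁ ^ 2 = 9 / 8 * r ^ 2)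
    (hr₂ : r₂ ^ 2 = 5 / 4 * r ^ 2) (hr₁0 : 0 < r₁) (hr₂0 : 0 < r₂) (hb : closedBall y r₂ ⊆ Ω)
    (h0 : ∀ x ∈ ball y r, Du x = 0) : ∀ x ∈ ball y r₁, Du x = 0 := by
  have hr12 : r₁ < r₂ := by
    refine lt_of_pow_lt_pow_left₀ 2 hr₂0.le ?_
    rw [hr₁, hr₂]; have : 0 < r ^ 2 := by positivity
    linarith
  have hrr : r < r₂ := by
    refine lt_of_pow_lt_pow_left₀ 2 hr₂0.le ?_
    rw [hr₂]; have : 0 < r ^ 2 := by positivity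
    linarith
  have hby : ball y r ⊆ Ω := (ball_subset_closedBall.trans (closedBall_subset_closedBall hrr.le)).trans hb
  have hb1 : ball y r₁ ⊆ closedBall y r₂ := ball_subset_closedBall.trans (closedBall_subset_closedBall hr12.le)
  have hyb : y ∈ ball y r := mem_ball_self hr
  have hyΩ := hby hyb
  have hKcl : closedBall y r₂ ⊆ closure Ω := hb.trans subset_closure
  have hucon : ∀ x ∈ ball y r, u x = u y := by
    intro x hx
    refine isOpen_ball.is_const_of_fderiv_eq_zero (𝕜 := ℝ) (convex_ball y r).isPreconnected
      (fun t ht => (S.diffu (hby ht)).differentiableWithinAt) (fun t ht => ?_) hx hyb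
    rw [(S.hasD1 (hby ht)).fderiv, h0 t ht]; simp
  have hfc : f (u y) = 0 := by
    have h1 := S.pde hyΩ
    have h2 : H y = 0 := by
      have : HasFDerivAt Du (0 : Eu n →L[ℝ] Eu n) y := (hasFDerivAt_const 0 y).congr_of_eventuallyEq (by
        filter_upwards [isOpen_ball.mem_nhds hyb] with t ht using h0 t ht)
      exact (S.hasD2 hyΩ).unique this
    rw [h2, ContinuousLinearMap.comp_zero, tr_zero] at h1
    linarith
  have hKc : IsCompact (closedBall y r₂) := isCompact_closedBall _ _
  obtain ⟨R, hR0, hR⟩ := S.bdd S.hDuc hKc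
  obtain ⟨B, hB0, hB⟩ := S.bdd S.hHc hKc
  obtain ⟨U, hU0, hU⟩ := S.bdd S.hucl hKc
  obtain ⟨L, hL0, hL⟩ := AL_lip S.ha (n := n) R
  obtain ⟨Cf, hCf⟩ := (isCompact_Icc (a := -U) (b := U)).exists_bound_of_continuousOn
    (S.hf.continuous_deriv le_rfl).continuousOn
  have huI : ∀ x ∈ closedBall y r₂, u x ∈ Icc (-U) U := fun x hx => abs_le.1 (by
    have := hU x (hKcl hx) hx; rwa [Real.norm_eq_abs] at this)
  have hyK : y ∈ closedBall y r₂ := mem_closedBall_self hr₂0.le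
  have hCf0 : 0 ≤ Cf := (norm_nonneg _).trans (hCf _ (huI y hyK))
  have hflip : ∀ x ∈ closedBall y r₂, |f (u x)| ≤ Cf * |u x - u y| := by
    intro x hx
    have := (convex_Icc (-U) U).norm_image_sub_le_of_norm_deriv_le (f := f) (C := Cf)
      (fun t _ => (S.hf.differentiable (by norm_num)) t) hCf (huI y hyK) (huI x hx)
    simpa [hfc] using this
  have ha0 : 0 < a 0 := S.hapos 0 le_rfl
  have htr : ∀ x ∈ closedBall y r₂, |tr (H x)| ≤ (Cf / a 0) * |u x - u y| + (n * L * B / a 0) * ‖Du x‖ := by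
    intro x hx
    have e1 : a 0 * tr (H x) = - f (u x) - tr ((AL a (Du x) - AL a 0).comp (H x)) := by
      rw [← S.pde (hb hx), ← tr_sub, AL_zero, ← ContinuousLinearMap.sub_comp, sub_sub_cancel, ← tr_smul]
      rfl
    have e2 : |tr ((AL a (Du x) - AL a 0).comp (H x))| ≤ n * L * B * ‖Du x‖ := by
      refine (tr_abs_le _).trans ?_
      have q1 : ‖(AL a (Du x) - AL a 0).comp (H x)‖ ≤ (L * ‖Du x‖) * B := by
        refine (ContinuousLinearMap.opNorm_comp_le _ _).trans ?_
        have := hL (Du x) 0 (hR x (hKcl hx) hx) (by simpa using hR0)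
        rw [sub_zero] at this
        exact mul_le_mul this (hB x (hKcl hx) hx) (norm_nonneg _) (by positivity)
      calc (n : ℝ) * _ ≤ n * ((L * ‖Du x‖) * B) := by gcongr
        _ = _ := by ring
    have e3 : a 0 * |tr (H x)| ≤ Cf * |u x - u y| + n * L * B * ‖Du x‖ := by
      have e0 : a 0 * |tr (H x)| = |a 0 * tr (H x)| := by rw [abs_mul, abs_of_pos ha0]
      rw [e0, e1]
      refine (abs_sub _ _).trans ?_
      rw [abs_neg]
      exact add_le_add (hflip x hx) e2
    have e4 : |tr (H x)| ≤ (Cf * |u x - u y| + n * L * B * ‖Du x‖) / a 0 := by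
      rw [le_div_iff₀ ha0]; linarith
    refine e4.trans (le_of_eq (by ring))
  have hz0 := uc_step S.op (z := fun x => u x - u y) (Dz := Du) (K := (Cf / a 0) ^ 2 + (n * L * B / a 0) ^ 2)
    hr hr₁ hr₂ hr₁0 hr₂0 hb ((S.hu3.of_le (by norm_num)).sub contDiffOn_const)
    (S.Du_C2.of_le (by norm_num)) (fun x hx => by
      have := (S.hasD1 hx).sub_const (u y)
      exact this) (by positivity) (fun x hx => by
      rw [(S.hasD2 (hb (hb1 hx))).fderiv, real_inner_self_eq_norm_sq, ← sq_abs (tr (H x)), ← sq_abs (u x - u y)]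
      have h1 := htr x (hb1 hx)
      generalize Cf / a 0 = A at *
      generalize n * L * B / a 0 = B' at *
      have h2 : |tr (H x)| ^ 2 ≤ (A * |u x - u y| + B' * ‖Du x‖) ^ 2 := by gcongr
      nlinarith [sq_nonneg (A * ‖Du x‖ - B' * |u x - u y|)])
    (fun x hx => ⟨by simp [hucon x hx], h0 x hx⟩)
  intro x hx
  have h1 : HasFDerivAt u (0 : Eu n →L[ℝ] ℝ) x := (hasFDerivAt_const (u y) x).congr_of_eventuallyEq (by
    filter_upwards [isOpen_ball.mem_nhds hx] with t ht
    have : u t - u y = 0 := hz0 t ht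
    linarith)
  have h2 := (S.hasD1 (hb (hb1 hx))).unique h1
  have h3 : ⟪Du x, Du x⟫ = 0 := by
    have := congrArg (fun L : Eu n →L[ℝ] ℝ => L (Du x)) h2
    simpa only [innerSL_apply_apply, zero_apply] using this
  exact inner_self_eq_zero.1 h3

set_option maxHeartbeats 1000000 in
/-- The critical set has empty interior. -/
lemma Dat.crit_dense (S : Dat Ω η a f u Du H) {O : Set (Eu n)} (hO : IsOpen O) (hOΩ : O ⊆ Ω) (hne : O.Nonempty) :
    ∃ x ∈ O, Du x ≠ 0 := by
  by_contra! hcon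
  set T : Set (Eu n) := interior {x | x ∈ Ω ∧ Du x = 0} with hT
  have hOT : O ⊆ T := interior_maximal (fun x hx => ⟨hOΩ hx, hcon x hx⟩) hO
  have hTT : ∀ x ∈ T, Du x = 0 := fun x hx => (interior_subset hx).2
  have hsub : Ω ⊆ T := by
    refine S.pre.subset_of_closure_inter_subset isOpen_interior ?_ ?_
    · obtain ⟨x, hx⟩ := hne
      exact ⟨x, hOΩ hx, hOT hx⟩
    · rintro p ⟨hpT, hpΩ⟩
      obtain ⟨δ, hδ, hδΩ⟩ := Metric.isOpen_iff.1 S.op p hpΩ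
      obtain ⟨y, hyT, hy⟩ := Metric.mem_closure_iff.1 hpT (δ / 8) (by linarith)
      obtain ⟨r0, hr0, hr0T⟩ := Metric.isOpen_iff.1 (isOpen_interior (s := {x | x ∈ Ω ∧ Du x = 0})) y hyT
      set ρ := Real.sqrt (9 / 8) with hρ
      have hρ2 : ρ ^ 2 = 9 / 8 := Real.sq_sqrt (by norm_num)
      have hρ1 : 1 < ρ := by
        rw [hρ]; exact Real.lt_sqrt_of_sq_lt (by norm_num)
      set ρ' := Real.sqrt (5 / 4) with hρ'
      have hρ'2 : ρ' ^ 2 = 5 / 4 := Real.sq_sqrt (by norm_num)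
      have hρ'0 : 0 < ρ' := Real.sqrt_pos.2 (by norm_num)
      have hρ'1 : ρ' < 3 / 2 := by nlinarith
      have ind : ∀ k : ℕ, ∀ x ∈ ball y (min (δ / 4) (ρ ^ k * r0)), Du x = 0 := by
        intro k
        induction k with
        | zero =>
          intro x hx
          refine hTT x (hr0T (ball_subset_ball ?_ hx))
          simp
        | succ k ih =>
          set rk := min (δ / 4) (ρ ^ k * r0) with hrk
          have hrk0 : 0 < rk := lt_min (by linarith) (by positivity)
          have hrkδ : rk ≤ δ / 4 := min_le_left _ _
          have := S.uc_ball (r₁ := ρ * rk) (r₂ := ρ' * rk) hrk0 (by rw [mul_pow, hρ2]) (by rw [mul_pow, hρ'2])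
            (by positivity) (by positivity) (fun x hx => hδΩ (by
              rw [mem_closedBall] at hx
              rw [mem_ball]
              have := dist_triangle x y p
              rw [dist_comm p y] at hy
              nlinarith)) ih
          intro x hx
          refine this x (ball_subset_ball ?_ hx)
          rw [hrk, mul_min_of_nonneg _ _ (by linarith : 0 ≤ ρ)]
          refine min_le_min ?_ (le_of_eq (by ring))
          nlinarith
      obtain ⟨k, hk⟩ := pow_unbounded_of_one_lt (δ / 4 / r0) hρ1
      have hkk : min (δ / 4) (ρ ^ k * r0) = δ / 4 := min_eq_left (by
        rw [div_lt_iff₀ hr0] at hk; exact hk.le)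
      have h1 := ind k
      rw [hkk] at h1
      refine mem_interior.2 ⟨ball y (δ / 4), fun x hx => ⟨hδΩ ?_, h1 x hx⟩, isOpen_ball, ?_⟩
      · rw [mem_ball] at hx ⊢
        have := dist_triangle x y p
        rw [dist_comm p y] at hy
        linarith
      · rw [mem_ball]; linarith
  obtain ⟨x, hx, hxn⟩ := S.exists_Du_ne
  exact hxn (hTT x (hsub hx))

end


section

variable {Ω : Set (Eu n)} {η : Eu n → Eu n} {a f : ℝ → ℝ} {u : Eu n → ℝ} {Du : Eu n → Eu n} {H : Eu n → Eu n →L[ℝ] Eu n}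

lemma Dat.Hsymm_cl (S : Dat Ω η a f u Du H) {x : Eu n} (hx : x ∈ closure Ω) (v w : Eu n) :
    ⟪H x v, w⟫ = ⟪H x w, v⟫ := by
  have hcl : EqOn (fun x => ⟪H x v, w⟫) (fun x => ⟪H x w, v⟫) (closure Ω) := by
    refine EqOn.of_subset_closure (s := Ω) (fun x hx => S.Hsymm hx v w) ?_ ?_ subset_closure le_rfl
    · exact (S.hHc.clm_apply continuousOn_const).inner continuousOn_const
    · exact (S.hHc.clm_apply continuousOn_const).inner continuousOn_const
  exact hcl hx

lemma Dat.supsol_abs (S : Dat Ω η a f u Du H) {O : Set (Eu n)} (hO : IsOpen O) (hOΩ : O ⊆ Ω)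
    {Y : Eu n} (h0 : ∀ x ∈ O, 0 ≤ ⟪Du x, Y⟫) : SupSol Ω O a f u Du (fun x => |⟪Du x, Y⟫|) := by
  intro ψ hψ _
  refine le_of_eq ?_
  have h1 := S.lin (hψ.mono hOΩ) Y
  have hz : ∀ x, x ∉ O → ψ x = 0 := fun x hx => image_eq_zero_of_notMem_tsupport fun h => hx (hψ.2.2 h)
  have hg : ∀ x, x ∉ O → gradient ψ x = 0 := fun x hx => grad_zero_off fun h => hx (hψ.2.2 h)
  refine Eq.trans (setIntegral_congr_fun S.ms fun x _ => ?_)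
    (h1.symm.trans (setIntegral_congr_fun S.ms fun x _ => ?_))
  · by_cases hx : x ∈ O
    · simp only [abs_of_nonneg (h0 x hx)]
    · simp only [hz x hx, mul_zero]
  · by_cases hx : x ∈ O
    · have e : (fun x => |⟪Du x, Y⟫|) =ᶠ[𝓝 x] fun x => ⟪Du x, Y⟫ := by
        filter_upwards [hO.mem_nhds hx] with y hy using abs_of_nonneg (h0 y hy)
      simp only [e.gradient_eq, S.gradV (hOΩ hx)]
    · simp only [hg x hx, inner_zero_right]

set_option maxHeartbeats 1000000 in
/-- Hopf lemma at a boundary point -/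
lemma Dat.hopf (S : Dat Ω η a f u Du H) {C : Set (Eu n)} (hC : IsOpen C) (hCΩ : C ⊆ Ω) {Y : Eu n}
    (hv : ∀ x ∈ C, 0 < ⟪Du x, Y⟫) {p : Eu n} (hp : p ∈ frontier Ω) {ρ : ℝ} (hρ : 0 < ρ)
    (hρC : Ω ∩ ball p ρ ⊆ C) (hc : ⟪Du p, η p⟫ ≠ 0) : ⟪η p, Y⟫ ≠ 0 := by
  intro hY
  obtain ⟨r, K, ch⟩ := exists_chart S.dom hp
  have hr := ch.hr
  have hK := ch.hK
  have hpc := frontier_subset_closure hp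
  set ν := η p with hν
  have hν1 : ‖ν‖ = 1 := ch.unit
  have hνν : ⟪ν, ν⟫ = 1 := by rw [real_inner_self_eq_norm_sq, hν1]; norm_num
  set R : ℝ := min (min (r / 2) (ρ / 2)) (1 / (2 * K)) with hRd
  have hR0 : 0 < R := by positivity
  have hR1 : 2 * R ≤ r := by have : R ≤ r / 2 := (min_le_left _ _).trans (min_le_left _ _); linarith
  have hR2 : 2 * R ≤ ρ := by have : R ≤ ρ / 2 := (min_le_left _ _).trans (min_le_right _ _); linarith
  have hR3 : 2 * K * R ≤ 1 := by
    have : R ≤ 1 / (2 * K) := min_le_right _ _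
    rw [le_div_iff₀ (by positivity)] at this; linarith
  clear_value R
  set y := p + R • ν with hy
  have hyp : ‖y - p‖ = R := by rw [hy, add_sub_cancel_left, norm_smul, hν1, mul_one, Real.norm_of_nonneg hR0.le]
  have hbC : ball y R ⊆ C := by
    intro x hx
    refine hρC ⟨ch.iball hR0 hR1 hR3 hx, ?_⟩
    rw [mem_ball, dist_eq_norm] at hx ⊢
    calc ‖x - p‖ ≤ ‖x - y‖ + ‖y - p‖ := norm_sub_le_norm_sub_add_norm_sub _ _ _
      _ < ρ := by linarith
  have hcb : closedBall y (R / 2) ⊆ ball y R := closedBall_subset_ball (by linarith)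
  obtain ⟨x₀, hx₀, hmin⟩ := (isCompact_closedBall y (R / 2)).exists_isMinOn ⟨y, mem_closedBall_self (by linarith)⟩
    (f := fun x => ⟪Du x, Y⟫) ((S.hDuc.inner continuousOn_const).mono
      ((hcb.trans hbC).trans (hCΩ.trans subset_closure)))
  set ε := ⟪Du x₀, Y⟫ with hε
  have hε0 : 0 < ε := hv x₀ (hbC (hcb hx₀))
  obtain ⟨α, hα, hlow⟩ := ball_lower S hC hCΩ (w := fun x => |⟪Du x, Y⟫|) (fun x => abs_nonneg _)
    (LL.congr ((S.v_LL Y).mono hCΩ) (fun x hx => abs_of_nonneg (hv x hx).le))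
    (S.supsol_abs hC hCΩ fun x hx => (hv x hx).le) (r := R / 2) (R := R) (y := y) (ε := ε) (by linarith) (by linarith) hbC
    hε0 (fun x hx => (hmin hx).trans (le_abs_self _))
  -- upper bound
  set δ := ε * (Real.exp (-α * R ^ 2) * (α * R)) with hδ
  have hδ0 : 0 < δ := by positivity
  have hHν : ⟪H p Y, ν⟫ = 0 := by
    rw [S.Hsymm_cl hpc, S.H_normal hp hc, inner_smul_left, hY, mul_zero]
  have hev : ∀ᶠ x in 𝓝[closure Ω] p, ⟪H x Y, ν⟫ < δ := by
    have c1 : ContinuousWithinAt (fun x => ⟪H x Y, ν⟫) (closure Ω) p :=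
      ContinuousWithinAt.inner ((S.hHc p hpc).clm_apply continuousWithinAt_const) continuousWithinAt_const
    exact c1.eventually (gt_mem_nhds (by show ⟪H p Y, ν⟫ < δ; rw [hHν]; exact hδ0))
  obtain ⟨ε', hε', hεs⟩ := Metric.mem_nhdsWithin_iff.1 hev
  set t := min (ε' / 2) (R / 2) with ht
  have ht0 : 0 < t := by positivity
  have ht1 : t ≤ ε' / 2 := min_le_left _ _
  have ht2 : t ≤ R / 2 := min_le_right _ _
  clear_value t
  have hin : ∀ τ, 0 < τ → τ ≤ t → p + τ • ν ∈ ball y R := by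
    intro τ a1 a2
    rw [mem_ball, dist_eq_norm, hy, show p + τ • ν - (p + R • ν) = (τ - R) • ν by rw [sub_smul]; abel, norm_smul, hν1, mul_one,
      Real.norm_eq_abs, abs_lt]
    constructor <;> linarith
  have hup := seg_mono (Ω := Ω) (h := fun x => δ * ⟪x, ν⟫ - ⟪Du x, Y⟫) (G := fun x => δ • ν - H x Y) (x := p) (w := ν) (T := t)
    ((continuousOn_const.mul (continuousOn_id.inner continuousOn_const)).sub (S.hDuc.inner continuousOn_const))
    (fun x hx => by
      have h1 : HasFDerivAt (fun x : Eu n => ⟪x, ν⟫) (innerSL ℝ ν) x := by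
        refine ((innerSL ℝ ν).hasFDerivAt (x := x)).congr_of_eventuallyEq (Eventually.of_forall fun z => ?_)
        rw [innerSL_apply_apply]; exact real_inner_comm _ _
      refine ((h1.const_mul δ).sub (S.hasV hx Y)).congr_fderiv (ContinuousLinearMap.ext fun w => ?_)
      simp [inner_sub_left, inner_smul_left]) ht0
    (fun τ a1 a2 => hCΩ (hbC (hin τ a1 a2.le))) (fun τ a1 a2 => by
      have h2 : ⟪H (p + τ • ν) Y, ν⟫ < δ := hεs ⟨by
        rw [mem_ball, dist_eq_norm, add_sub_cancel_left, norm_smul, hν1, mul_one, Real.norm_of_nonneg a1.le]; linarith,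
        subset_closure (hCΩ (hbC (hin τ a1 a2.le)))⟩
      rw [inner_sub_left, inner_smul_left, hνν]; simp; exact h2)
  have hDp : ⟪Du p, Y⟫ = 0 := by rw [S.Du_normal hp, inner_smul_left, hY, mul_zero]
  simp only [hDp, inner_add_left, inner_smul_left, RCLike.conj_to_real, hνν] at hup
  have hlow' := hlow _ (hin t ht0 le_rfl)
  rw [abs_of_pos (hv _ (hbC (hin t ht0 le_rfl)))] at hlow'
  have e1 : ‖p + t • ν - y‖ ^ 2 = (R - t) ^ 2 := by
    rw [hy, show p + t • ν - (p + R • ν) = (t - R) • ν by rw [sub_smul]; abel, norm_smul, hν1, mul_one,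
      Real.norm_eq_abs, sq_abs]; ring
  rw [e1] at hlow'
  have e2 : Real.exp (-α * R ^ 2) * (α * R * t) ≤ Real.exp (-α * (R - t) ^ 2) - Real.exp (-α * R ^ 2) := by
    have : Real.exp (-α * (R - t) ^ 2) = Real.exp (-α * R ^ 2) * Real.exp (α * (2 * R * t - t ^ 2)) := by
      rw [← Real.exp_add]; congr 1; ring
    rw [this]
    have h3 := Real.add_one_le_exp (α * (2 * R * t - t ^ 2))
    have h4 : α * R * t ≤ Real.exp (α * (2 * R * t - t ^ 2)) - 1 := by
      have : R * t ≤ 2 * R * t - t ^ 2 := by nlinarith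
      have : α * (R * t) ≤ α * (2 * R * t - t ^ 2) := by gcongr
      linarith
    have := mul_le_mul_of_nonneg_left h4 (Real.exp_pos (-α * R ^ 2)).le
    linarith
  have e3 := mul_le_mul_of_nonneg_left e2 hε0.le
  have e4 : ε * (Real.exp (-α * R ^ 2) * (α * R * t)) = δ * t := by rw [hδ]; ring
  linarith

end


section

variable {Ω : Set (Eu n)} {η : Eu n → Eu n} {a f : ℝ → ℝ} {u : Eu n → ℝ} {Du : Eu n → Eu n} {H : Eu n → Eu n →L[ℝ] Eu n}

/-! ### The divergence-free field of two directional derivatives -/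

/-- the field `v₁ ∇v - v ∇v₁`. -/
def wf (Du : Eu n → Eu n) (H : Eu n → Eu n →L[ℝ] Eu n) (Y₁ Y : Eu n) (x : Eu n) : Eu n :=
  ⟪Du x, Y₁⟫ • H x Y - ⟪Du x, Y⟫ • H x Y₁

lemma Dat.wf_cont (S : Dat Ω η a f u Du H) (Y₁ Y : Eu n) : ContinuousOn (wf Du H Y₁ Y) (closure Ω) := by
  have h1 : ContinuousOn (fun x => ⟪Du x, Y₁⟫ • H x Y) (closure Ω) := by
    have := ContinuousOn.smul (ContinuousOn.inner (𝕜 := ℝ) S.hDuc (continuousOn_const (c := Y₁))) (S.hHc.clm_apply (continuousOn_const (c := Y)))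
    exact this
  have h2 : ContinuousOn (fun x => ⟪Du x, Y⟫ • H x Y₁) (closure Ω) := by
    have := ContinuousOn.smul (ContinuousOn.inner (𝕜 := ℝ) S.hDuc (continuousOn_const (c := Y))) (S.hHc.clm_apply (continuousOn_const (c := Y₁)))
    exact this
  exact h1.sub h2

lemma Dat.v_mul_test (S : Dat Ω η a f u Du H) {ζ : Eu n → ℝ} (hζ : IsTestOn Ω ζ) (Y : Eu n) :
    IsTestOn Ω (fun x => ⟪Du x, Y⟫ * ζ x) := by
  obtain ⟨⟨C, l⟩, c, s⟩ := hζ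
  exact test_of_cpt S.op (K := tsupport ζ) c s (fun x hx => by rw [image_eq_zero_of_notMem_tsupport hx, mul_zero])
    (LL.mul (S.v_LL Y) l.locallyLipschitz.locallyLipschitzOn)

lemma Dat.W_int (S : Dat Ω η a f u Du H) (Y₁ Y : Eu n) {ζ : Eu n → ℝ} (hζ : IsTestOn Ω ζ) :
    ∫ x in Ω, ⟪AL a (Du x) (wf Du H Y₁ Y x), gradient ζ x⟫ = 0 := by
  have h1 := S.lin (S.v_mul_test hζ Y₁) Y
  have h2 := S.lin (S.v_mul_test hζ Y) Y₁
  have i : ∀ Z Z' : Eu n, IntegrableOn (fun x => ⟪AL a (Du x) (H x Z), gradient (fun x => ⟪Du x, Z'⟫ * ζ x) x⟫) Ω := by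
    intro Z Z'
    obtain ⟨⟨C, l⟩, c, s⟩ := S.v_mul_test hζ Z'
    have K : IsCompact (tsupport (fun x => ⟪Du x, Z'⟫ * ζ x)) := c
    obtain ⟨B, -, hB⟩ := S.bdd (S.hHc.clm_apply (continuousOn_const (c := Z))) K
    exact S.int_M (S.aesm (S.hHc.clm_apply continuousOn_const)) (grad_meas _).aestronglyMeasurable K B C
      (fun x hx hxK => hB x (subset_closure hx) hxK) (fun x _ _ => grad_norm_le l x)
      (fun x _ hx => Or.inr (grad_zero_off hx))
  obtain ⟨⟨C, l⟩, c, s⟩ := id hζ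
  have e : ∫ x in Ω, ⟪AL a (Du x) (wf Du H Y₁ Y x), gradient ζ x⟫ =
      ∫ x in Ω, (⟪AL a (Du x) (H x Y), gradient (fun x => ⟪Du x, Y₁⟫ * ζ x) x⟫
        - ⟪AL a (Du x) (H x Y₁), gradient (fun x => ⟪Du x, Y⟫ * ζ x) x⟫) := by
    refine integral_congr_ae ?_
    rw [Filter.EventuallyEq, ae_restrict_iff' S.ms]
    filter_upwards [l.ae_differentiableAt (μ := (volume : Measure (Eu n)))] with x d hx
    have g : ∀ Z, gradient (fun x => ⟪Du x, Z⟫ * ζ x) x = ⟪Du x, Z⟫ • gradient ζ x + ζ x • H x Z := by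
      intro Z
      refine (grad_mul (S.hasV hx Z).differentiableAt d).trans ?_
      rw [S.gradV hx]
    rw [g, g, wf]
    have hs : ⟪AL a (Du x) (H x Y), H x Y₁⟫ = ⟪AL a (Du x) (H x Y₁), H x Y⟫ := by
      rw [AL_symm, real_inner_comm]
    simp only [map_sub, map_smul, inner_sub_left, inner_smul_left, inner_add_right, inner_smul_right, RCLike.conj_to_real]
    rw [hs]; ring
  rw [e, integral_sub (i _ _) (i _ _), h1, h2, sub_eq_zero]
  refine setIntegral_congr_fun S.ms fun x _ => ?_
  ring

/-- the field is tangential at the boundary -/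
lemma Dat.W_normal (S : Dat Ω η a f u Du H) (Y₁ Y : Eu n) {p : Eu n} (hp : p ∈ frontier Ω) (h0 : ⟪Du p, η p⟫ ≠ 0) :
    ⟪AL a (Du p) (wf Du H Y₁ Y p), Du p⟫ = 0 := by
  have hpc := frontier_subset_closure hp
  have h1 : ∃ l : ℝ, AL a (Du p) (Du p) = l • Du p := by
    refine ⟨a ‖Du p‖ + deriv a ‖Du p‖ / ‖Du p‖ * ⟪Du p, Du p⟫, ?_⟩
    rw [AL_apply, Aop, add_smul]
  obtain ⟨l, hl⟩ := h1
  have h2 : ∀ Z, ⟪η p, H p Z⟫ = ⟪H p (η p), η p⟫ * ⟪η p, Z⟫ := by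
    intro Z
    rw [real_inner_comm, S.Hsymm_cl hpc]
    conv_lhs => rw [S.H_normal hp h0]
    rw [inner_smul_left]; simp
  have h3 : ∀ Z, ⟪Du p, Z⟫ = ⟪Du p, η p⟫ * ⟪η p, Z⟫ := by
    intro Z
    conv_lhs => rw [S.Du_normal hp]
    rw [inner_smul_left]; simp
  rw [AL_symm, hl, inner_smul_right, real_inner_comm, h3, wf, inner_sub_right, inner_smul_right, inner_smul_right,
    h2, h2, h3 Y, h3 Y₁]
  ring

end


section

variable {Ω : Set (Eu n)} {η : Eu n → Eu n} {a f : ℝ → ℝ} {u : Eu n → ℝ} {Du : Eu n → Eu n} {H : Eu n → Eu n →L[ℝ] Eu n}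

lemma bump_exists {K N : Set (Eu n)} (hK : IsCompact K) (hN : IsOpen N) (hKN : K ⊆ N) :
    ∃ (χ : Eu n → ℝ) (U : Set (Eu n)), ContDiff ℝ 1 χ ∧ HasCompactSupport χ ∧ tsupport χ ⊆ N ∧ IsOpen U ∧ K ⊆ U ∧
      (∀ x ∈ U, χ x = 1) ∧ (∀ x, 0 ≤ χ x) ∧ ∀ x, χ x ≤ 1 := by
  obtain ⟨L, hL, hKL, hLN⟩ := exists_compact_between hK hN hKN
  obtain ⟨χ, h1, h0, hI⟩ := exists_contMDiffMap_one_nhds_of_subset_interior (n := 1) (modelWithCornersSelf ℝ (Eu n))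
    hK.isClosed hKL
  have hs : tsupport χ ⊆ L := closure_minimal (fun x hx => by by_contra h; exact hx (h0 x h)) hL.isClosed
  obtain ⟨U, hU, hKU, hU1⟩ := eventually_nhdsSet_iff_exists.1 h1
  exact ⟨χ, U, χ.contMDiff.contDiff, hL.of_isClosed_subset (isClosed_tsupport _) hs, hs.trans hLN, hU, hKU, hU1,
    fun x => (hI x).1, fun x => (hI x).2⟩

lemma Dat.int_cl (S : Dat Ω η a f u Du H) {g : Eu n → ℝ} (hg : ContinuousOn g (closure Ω)) {K : Set (Eu n)} (hK : IsCompact K)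
    (h0 : ∀ x ∈ Ω, x ∉ K → g x = 0) : IntegrableOn g Ω := by
  obtain ⟨B, _, hB⟩ := S.bdd hg hK
  exact intg S.ms hK (S.aesm hg) B (fun x hx hxK => hB x (subset_closure hx) hxK) h0

/-- smooth cut-off along the levels of `u`. -/
def kap (Ω : Set (Eu n)) (u : Eu n → ℝ) (s b δ : ℝ) : Eu n → ℝ :=
  Ω.indicator fun x => Real.smoothTransition (s * (u x - b) / δ - 1)

lemma kap_mem {s b δ : ℝ} (x : Eu n) : 0 ≤ kap Ω u s b δ x ∧ kap Ω u s b δ x ≤ 1 := by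
  unfold kap
  by_cases hx : x ∈ Ω
  · rw [indicator_of_mem hx]; exact ⟨Real.smoothTransition.nonneg _, Real.smoothTransition.le_one _⟩
  · rw [indicator_of_notMem hx]; simp

lemma kap_zero {s b δ : ℝ} (hδ : 0 < δ) {x : Eu n} (hx : x ∈ Ω → s * (u x - b) < δ) : kap Ω u s b δ x = 0 := by
  unfold kap
  by_cases h : x ∈ Ω
  · rw [indicator_of_mem h]
    refine Real.smoothTransition.zero_of_nonpos ?_
    have := (div_lt_one hδ).2 (hx h)
    linarith
  · rw [indicator_of_notMem h]

lemma Dat.kap_C1 (S : Dat Ω η a f u Du H) {s b δ : ℝ} : ContDiffOn ℝ 1 (kap Ω u s b δ) Ω := by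
  have h1 : ContDiffOn ℝ 1 u Ω := S.hu3.of_le (by norm_num)
  have h2 : ContDiffOn ℝ 1 (fun x => s * (u x - b) / δ - 1) Ω :=
    ((contDiffOn_const.mul (h1.sub contDiffOn_const)).div_const δ).sub contDiffOn_const
  have h3 : ContDiff ℝ 1 Real.smoothTransition := Real.smoothTransition.contDiff (n := 1)
  exact (h3.comp_contDiffOn h2).congr fun x hx => by simp [kap, hx]

lemma Dat.kap_grad (S : Dat Ω η a f u Du H) (s b : ℝ) {δ : ℝ} (hδ : 0 < δ) {x : Eu n} (hx : x ∈ Ω) :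
    ∃ t : ℝ, 0 ≤ t ∧ (2 * δ < s * (u x - b) → t = 0) ∧ gradient (kap Ω u s b δ) x = (t * s) • Du x := by
  have h3 : ContDiff ℝ 1 Real.smoothTransition := Real.smoothTransition.contDiff (n := 1)
  set q := s * (u x - b) / δ - 1 with hq
  refine ⟨deriv Real.smoothTransition q / δ, div_nonneg (Real.smoothTransition.monotone.deriv_nonneg) hδ.le, ?_, ?_⟩
  · intro h
    have : 1 < q := by
      have := (lt_div_iff₀ hδ).2 h
      linarith
    have e : Real.smoothTransition =ᶠ[𝓝 q] fun _ => 1 := by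
      filter_upwards [lt_mem_nhds this] with y hy using Real.smoothTransition.one_of_one_le hy.le
    rw [e.deriv_eq]; simp
  · have hd : HasDerivAt Real.smoothTransition (deriv Real.smoothTransition q) q :=
      (h3.differentiable (by norm_num)).differentiableAt.hasDerivAt
    have h1 : HasFDerivAt (fun y => s * (u y - b) / δ - 1) ((s / δ) • innerSL ℝ (Du x)) x := by
      have := (((S.hasD1 hx).sub_const b).const_mul s).mul_const (δ⁻¹) |>.sub_const 1
      refine this.congr_fderiv (ContinuousLinearMap.ext fun w => ?_)
      simp; ring
    have h2 := hd.comp_hasFDerivAt x h1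
    have h4 : HasFDerivAt (kap Ω u s b δ) (deriv Real.smoothTransition q • (s / δ) • innerSL ℝ (Du x)) x := by
      refine h2.congr_of_eventuallyEq ?_
      filter_upwards [S.op.mem_nhds hx] with y hy
      simp [kap, hy]
    refine grad_of_hasFDeriv h4 fun w => ?_
    simp only [smul_apply, innerSL_apply_apply, inner_smul_left, smul_eq_mul, RCLike.conj_to_real]
    ring

end


section

variable {Ω : Set (Eu n)} {η : Eu n → Eu n} {a f : ℝ → ℝ} {u : Eu n → ℝ} {Du : Eu n → Eu n} {H : Eu n → Eu n →L[ℝ] Eu n}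

set_option maxHeartbeats 1000000 in
/-- the field is weakly divergence free up to the boundary -/
lemma Dat.W_weak (S : Dat Ω η a f u Du H) (Y₁ Y : Eu n) {C N K : Set (Eu n)} {s b B₀ B₁ : ℝ} {ζ : Eu n → ℝ}
    (hC : IsOpen C) (hCΩ : C ⊆ Ω) (hN : IsOpen N) (hs : s * s = 1) (hNu : ∀ x ∈ N, x ∈ Ω → 0 < s * (u x - b))
    (hNb : ∀ x ∈ N, x ∈ frontier Ω → u x = b) (hK : IsCompact K)
    (hKC : ∀ x ∈ K, x ∈ C ∨ (x ∈ frontier Ω ∧ x ∈ N ∧ ⟪Du x, η x⟫ ≠ 0))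
    (h0 : ∀ x, x ∉ K → ζ x = 0) (h0' : ∀ x, x ∉ C → ζ x = 0) (hL : LocallyLipschitzOn C ζ)
    (hd : ∀ᵐ x, x ∈ C → DifferentiableAt ℝ ζ x) (hB0 : ∀ x, |ζ x| ≤ B₀) (hB1 : ∀ x ∈ C, ‖gradient ζ x‖ ≤ B₁) :
    ∫ x in Ω, ⟪AL a (Du x) (wf Du H Y₁ Y x), gradient ζ x⟫ = 0 := by
  set W : Eu n → Eu n := fun x => AL a (Du x) (wf Du H Y₁ Y x) with hW
  have hWc : ContinuousOn W (closure Ω) := S.M_contOn.clm_apply (S.wf_cont Y₁ Y)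
  have hWn : ∀ p ∈ frontier Ω, ⟪Du p, η p⟫ ≠ 0 → ⟪W p, Du p⟫ = 0 := fun p hp hp0 => S.W_normal Y₁ Y hp hp0
  have hWi : ∀ {ξ : Eu n → ℝ}, IsTestOn Ω ξ → ∫ x in Ω, ⟪W x, gradient ξ x⟫ = 0 := fun h => S.W_int Y₁ Y h
  clear_value W
  have hfD : ∀ x ∈ C, x ∉ frontier Ω := fun x hx h => by
    rw [S.op.frontier_eq] at h; exact h.2 (hCΩ hx)
  have hB00 : 0 ≤ B₀ := (abs_nonneg _).trans (hB0 0)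
  have hKcl : K ⊆ closure Ω := fun x hx => by
    rcases hKC x hx with h | h
    · exact subset_closure (hCΩ h)
    · exact frontier_subset_closure h.1
  have hz : ∀ x ∈ Ω, x ∉ C → ζ =ᶠ[𝓝 x] fun _ => 0 := by
    intro x hx hxC
    have hxK : x ∉ K := fun h => by
      rcases hKC x h with h | h
      · exact hxC h
      · have := h.1; rw [S.op.frontier_eq] at this; exact this.2 hx
    filter_upwards [hK.isClosed.isOpen_compl.mem_nhds hxK] with y hy using h0 y hy
  have hd' : ∀ᵐ x, x ∈ Ω → DifferentiableAt ℝ ζ x := by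
    filter_upwards [hd] with x hx hxΩ
    by_cases h : x ∈ C
    · exact hx h
    · exact (differentiableAt_const (0 : ℝ)).congr_of_eventuallyEq (hz x hxΩ h)
  have hgb : ∀ x ∈ Ω, ‖gradient ζ x‖ ≤ |B₁| := by
    intro x hx
    by_cases h : x ∈ C
    · exact (hB1 x h).trans (le_abs_self _)
    · rw [(hz x hx h).gradient_eq]; simp
  have hg0 : ∀ x, x ∉ K → gradient ζ x = 0 := by
    intro x hx
    have : ζ =ᶠ[𝓝 x] fun _ => 0 := by
      filter_upwards [hK.isClosed.isOpen_compl.mem_nhds hx] with y hy using h0 y hy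
    rw [this.gradient_eq]; simp
  -- cut-off near the boundary part
  obtain ⟨χ, U, cχ, sχ, tχ, hU, hKU, hU1, χ0, χ1⟩ := bump_exists (K := K ∩ frontier Ω) (N := N)
    (hK.inter_right isClosed_frontier) hN (fun x hx => by
      rcases hKC x hx.1 with h | h
      · exact absurd hx.2 (hfD x h)
      · exact h.2.1)
  have Kχ : IsCompact (tsupport χ) := sχ
  have cgχ : Continuous (gradient χ) := by
    have := (InnerProductSpace.toDual ℝ (Eu n)).symm.continuous.comp (cχ.continuous_fderiv (by norm_num))
    exact this
  have dχ : ∀ x, DifferentiableAt ℝ χ x := fun x => (cχ.differentiable (by norm_num)).differentiableAt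
  have zχ : ∀ x, x ∉ tsupport χ → χ x = 0 := fun x hx => image_eq_zero_of_notMem_tsupport hx
  set κ := kap Ω u s b with hκ
  have κm : ∀ δ x, 0 ≤ κ δ x ∧ κ δ x ≤ 1 := fun δ x => kap_mem x
  have κC : ∀ δ, ContDiffOn ℝ 1 (κ δ) Ω := fun δ => S.kap_C1
  have κg : ∀ {δ : ℝ}, 0 < δ → ∀ {x}, x ∈ Ω →
    ∃ t : ℝ, 0 ≤ t ∧ (2 * δ < s * (u x - b) → t = 0) ∧ gradient (κ δ) x = (t * s) • Du x := fun hδ x hx => S.kap_grad s b hδ hx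
  have κ0 : ∀ {δ : ℝ}, 0 < δ → ∀ {x}, (x ∈ Ω → s * (u x - b) < δ) → κ δ x = 0 := fun hδ x hx => kap_zero hδ hx
  have κ1 : ∀ x ∈ Ω, 0 < s * (u x - b) → ∀ᶠ k : ℕ in atTop, κ (1 / ((k : ℝ) + 1)) x = 1 := by
    intro x hx hpos
    have ht : Tendsto (fun k : ℕ => 1 / ((k : ℝ) + 1)) atTop (𝓝 0) := tendsto_one_div_add_atTop_nhds_zero_nat
    filter_upwards [ht.eventually (gt_mem_nhds (show (0:ℝ) < s * (u x - b) / 2 by linarith))] with k hk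
    rw [hκ, kap, indicator_of_mem hx]
    refine Real.smoothTransition.one_of_one_le ?_
    have hp : (0 : ℝ) < 1 / ((k : ℝ) + 1) := by positivity
    have : 2 ≤ s * (u x - b) / (1 / ((k : ℝ) + 1)) := by
      rw [le_div_iff₀ hp]; linarith
    linarith
  have κd : ∀ δ, ∀ x ∈ Ω, DifferentiableAt ℝ (κ δ) x := fun δ x hx =>
    ((κC δ).contDiffAt (S.op.mem_nhds hx)).differentiableAt (by norm_num)
  clear_value κ
  set kp : ℝ → Eu n → ℝ := fun δ x => 1 - χ x * (1 - κ δ x) with hkp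
  have kpm : ∀ δ x, |kp δ x| ≤ 1 := by
    intro δ x
    have h1 := κm δ x
    have h2 := χ0 x
    have h3 := χ1 x
    simp only [hkp]
    rw [abs_le]
    constructor <;> nlinarith
  have hclosed : ∀ δ : ℝ, IsClosed (closure Ω ∩ {x | δ ≤ s * (u x - b)}) := by
    intro δ
    exact (continuousOn_const.mul (S.hucl.sub continuousOn_const)).preimage_isClosed_of_isClosed isClosed_closure isClosed_Ici
  -- the two test functions
  have T1 : ∀ {δ : ℝ}, 0 < δ → IsTestOn C (fun x => ζ x * kp δ x) := by
    intro δ hδ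
    refine test_of_cpt hC (K := K ∩ (Uᶜ ∪ (closure Ω ∩ {x | δ ≤ s * (u x - b)})))
      (hK.inter_right (hU.isClosed_compl.union (hclosed δ))) ?_ ?_ ?_
    · rintro x ⟨hxK, hx⟩
      rcases hKC x hxK with h | h
      · exact h
      · exfalso
        rcases hx with hx | hx
        · exact hx (hKU ⟨hxK, h.1⟩)
        · have := hx.2
          simp only [mem_setOf_eq, hNb x h.2.1 h.1, sub_self, mul_zero] at this
          linarith
    · intro x hx
      by_cases hxK : x ∈ K
      · by_cases hxC : x ∈ C
        · have hxU : x ∈ U := by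
            by_contra h; exact hx ⟨hxK, Or.inl h⟩
          have hlt : s * (u x - b) < δ := by
            by_contra h; exact hx ⟨hxK, Or.inr ⟨hKcl hxK, not_lt.1 h⟩⟩
          simp only [hkp, hU1 x hxU, κ0 hδ (fun _ => hlt)]; ring
        · simp [h0' x hxC]
      · simp [h0 x hxK]
    · refine LL.mul hL (locLip_of_contDiffOn hC ?_)
      exact contDiffOn_const.sub (cχ.contDiffOn.mul (contDiffOn_const.sub ((κC δ).mono hCΩ)))
  have T2 : ∀ {δ : ℝ}, 0 < δ → IsTestOn Ω (fun x => χ x * κ δ x) := by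
    intro δ hδ
    refine test_of_cpt S.op (K := tsupport χ ∩ (closure Ω ∩ {x | δ ≤ s * (u x - b)}))
      (Kχ.inter_right (hclosed δ)) ?_ ?_ ?_
    · rintro x ⟨hxK, hx⟩
      by_contra hn
      have hxf : x ∈ frontier Ω := by rw [S.op.frontier_eq]; exact ⟨hx.1, hn⟩
      have := hx.2
      simp only [mem_setOf_eq, hNb x (tχ hxK) hxf, sub_self, mul_zero] at this
      linarith
    · intro x hx
      by_cases hxK : x ∈ tsupport χ
      · rw [κ0 hδ, mul_zero]
        intro hxO
        by_contra h; exact hx ⟨hxK, subset_closure hxO, not_lt.1 h⟩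
      · simp [zχ x hxK]
    · exact LL.mul (LL.cd cχ) (locLip_of_contDiffOn S.op (κC δ))
  obtain ⟨BW, hBW0, hBW⟩ := S.bdd hWc hK
  -- integrability
  have mκ : ∀ δ, AEStronglyMeasurable (κ δ) (volume.restrict Ω) := fun δ => (κC δ).continuousOn.aestronglyMeasurable S.ms
  have mχ : AEStronglyMeasurable χ (volume.restrict Ω) := cχ.continuous.aestronglyMeasurable
  have mkp : ∀ δ, AEStronglyMeasurable (kp δ) (volume.restrict Ω) := fun δ =>
    aestronglyMeasurable_const.sub (mχ.mul (aestronglyMeasurable_const.sub (mκ δ)))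
  have mζ : AEStronglyMeasurable ζ (volume.restrict Ω) := by
    have h1 : AEStronglyMeasurable ζ (volume.restrict C) := hL.continuousOn.aestronglyMeasurable hC.measurableSet
    have h2 : ζ = C.indicator ζ := by
      ext x; by_cases h : x ∈ C
      · rw [indicator_of_mem h]
      · rw [indicator_of_notMem h, h0' x h]
    have h3 := (aestronglyMeasurable_indicator_iff hC.measurableSet).2 h1
    rw [← h2] at h3
    exact h3.restrict
  have mW := S.aesm hWc
  have mW1 : AEStronglyMeasurable (fun x => ⟪W x, gradient ζ x⟫) (volume.restrict Ω) := mW.inner (grad_meas ζ).aestronglyMeasurable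
  have mW2 : AEStronglyMeasurable (fun x => ⟪W x, gradient χ x⟫) (volume.restrict Ω) := mW.inner (grad_meas χ).aestronglyMeasurable
  have bW1 : ∀ x ∈ Ω, x ∈ K → |⟪W x, gradient ζ x⟫| ≤ BW * |B₁| := fun x hx hxK =>
    (abs_real_inner_le_norm _ _).trans (mul_le_mul (hBW x (subset_closure hx) hxK) (hgb x hx) (norm_nonneg _) hBW0)
  obtain ⟨Bχ, hBχ⟩ := hK.exists_bound_of_continuousOn cgχ.continuousOn
  have bW2 : ∀ x ∈ Ω, x ∈ K → |⟪W x, gradient χ x⟫| ≤ BW * |Bχ| := fun x hx hxK =>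
    (abs_real_inner_le_norm _ _).trans (mul_le_mul (hBW x (subset_closure hx) hxK) ((hBχ x hxK).trans (le_abs_self _)) (norm_nonneg _) hBW0)
  have I1 : ∀ δ, IntegrableOn (fun x => kp δ x * ⟪W x, gradient ζ x⟫) Ω := fun δ =>
    intg S.ms hK ((mkp δ).mul mW1) (1 * (BW * |B₁|)) (fun x hx hxK => by
      rw [norm_mul]; exact mul_le_mul (kpm δ x) (bW1 x hx hxK) (norm_nonneg _) zero_le_one)
      (fun x _ hx => by rw [hg0 x hx, inner_zero_right, mul_zero])
  have b2 : ∀ δ x, |ζ x * (1 - κ δ x)| ≤ B₀ := fun δ x => by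
    rw [abs_mul]
    have : |1 - κ δ x| ≤ 1 := by have := κm δ x; rw [abs_le]; constructor <;> linarith
    calc _ ≤ B₀ * 1 := mul_le_mul (hB0 x) this (abs_nonneg _) hB00
      _ = _ := mul_one _
  have I2 : ∀ δ, IntegrableOn (fun x => ζ x * (1 - κ δ x) * ⟪W x, gradient χ x⟫) Ω := fun δ =>
    intg S.ms hK ((mζ.mul (aestronglyMeasurable_const.sub (mκ δ))).mul mW2) (B₀ * (BW * |Bχ|)) (fun x hx hxK => by
      rw [norm_mul]; exact mul_le_mul (b2 δ x) (bW2 x hx hxK) (norm_nonneg _) hB00)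
      (fun x _ hx => by rw [h0 x hx, zero_mul, zero_mul])
  -- the energy identity
  have hKz : ∀ {δ : ℝ} x, x ∉ K → gradient (fun y => ζ y * kp δ y) x = 0 := by
    intro δ x hx
    have : (fun y => ζ y * kp δ y) =ᶠ[𝓝 x] fun _ => 0 := by
      filter_upwards [hK.isClosed.isOpen_compl.mem_nhds hx] with y hy
      rw [h0 y hy, zero_mul]
    rw [this.gradient_eq]; simp
  have I0 : ∀ {δ : ℝ}, 0 < δ → IntegrableOn (fun x => ⟪W x, gradient (fun y => ζ y * kp δ y) x⟫) Ω := by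
    intro δ hδ
    obtain ⟨L, hLip⟩ := (T1 hδ).1
    refine intg S.ms hK (mW.inner (grad_meas _).aestronglyMeasurable) (BW * L) (fun x hx hxK => ?_) (fun x _ hx => ?_)
    · exact (abs_real_inner_le_norm _ _).trans (mul_le_mul (hBW x (subset_closure hx) hxK) (grad_norm_le hLip x) (norm_nonneg _) hBW0)
    · rw [hKz x hx, inner_zero_right]
  set F3 : ℝ → Eu n → ℝ := fun δ x => ⟪W x, gradient (fun y => ζ y * kp δ y) x⟫ - kp δ x * ⟪W x, gradient ζ x⟫
    + ζ x * (1 - κ δ x) * ⟪W x, gradient χ x⟫ with hF3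
  have I3 : ∀ {δ : ℝ}, 0 < δ → IntegrableOn (F3 δ) Ω := fun hδ => ((I0 hδ).sub (I1 _)).add (I2 _)
  have E3 : ∀ {δ : ℝ}, 0 < δ → ∫ x in Ω, F3 δ x = - (∫ x in Ω, kp δ x * ⟪W x, gradient ζ x⟫)
      + ∫ x in Ω, ζ x * (1 - κ δ x) * ⟪W x, gradient χ x⟫ := by
    intro δ hδ
    simp only [hF3]
    have i1 : IntegrableOn (fun x => ⟪W x, gradient (fun y => ζ y * kp δ y) x⟫ - kp δ x * ⟪W x, gradient ζ x⟫) Ω := (I0 hδ).sub (I1 _)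
    rw [integral_add i1 (I2 _), integral_sub (I0 hδ) (I1 _), hWi ((T1 hδ).mono hCΩ), zero_sub]
  have P3 : ∀ {δ : ℝ}, 0 < δ → ∀ᵐ x, x ∈ Ω → F3 δ x = ζ x * χ x * ⟪W x, gradient (κ δ) x⟫ := by
    intro δ hδ
    filter_upwards [hd'] with x hx hxΩ
    have d1 : DifferentiableAt ℝ (fun y => 1 - κ δ y) x := (differentiableAt_const _).sub (κd δ x hxΩ)
    have d2 : DifferentiableAt ℝ (fun y => χ y * (1 - κ δ y)) x := (dχ x).mul d1
    have d3 : DifferentiableAt ℝ (kp δ) x := (differentiableAt_const _).sub d2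
    have g1 : gradient (fun y => 1 - κ δ y) x = - gradient (κ δ) x := by
      have := grad_sub (f := fun _ : Eu n => (1:ℝ)) (differentiableAt_const _) (κd δ x hxΩ)
      rw [this]; simp
    have g3 : gradient (kp δ) x = - (χ x • (- gradient (κ δ) x) + (1 - κ δ x) • gradient χ x) := by
      have := grad_sub (f := fun _ : Eu n => (1:ℝ)) (differentiableAt_const _) d2
      rw [grad_mul (dχ x) d1, g1] at this
      refine this.trans ?_
      simp
    have g4 := grad_mul (hx hxΩ) d3
    simp only [hF3]
    rw [g4, g3]
    simp only [inner_add_right, inner_smul_right, inner_neg_right]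
    ring
  set A : Eu n → Eu n := fun x => a ‖Du x‖ • Du x with hA
  have hAc : ContinuousOn A (closure Ω) := by
    have h1 : ContinuousOn (fun x => a ‖Du x‖) (closure Ω) := (a_norm_cont S.ha).comp_continuousOn S.hDuc
    have := ContinuousOn.smul h1 S.hDuc
    exact this
  have hAsol : ∀ {ξ : Eu n → ℝ}, IsTestOn Ω ξ → ∫ x in Ω, ⟪A x, gradient ξ x⟫ = ∫ x in Ω, f (u x) * ξ x := fun h => S.sol' h
  have hAQ : ∀ x, Du x ≠ 0 → 0 < ⟪A x, Du x⟫ := by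
    intro x hx
    simp only [hA, inner_smul_left, RCLike.conj_to_real, real_inner_self_eq_norm_sq]
    have := S.hapos ‖Du x‖ (norm_nonneg _)
    have := norm_pos_iff.2 hx
    positivity
  have hAQ0 : ∀ x, 0 ≤ ⟪A x, Du x⟫ := by
    intro x
    by_cases h : Du x = 0
    · rw [h, inner_zero_right]
    · exact (hAQ x h).le
  clear_value A
  obtain ⟨BA, hBA0, hBA⟩ := S.bdd hAc Kχ
  have hfu : ContinuousOn (fun x => f (u x)) (closure Ω) := S.hf.continuous.comp_continuousOn S.hucl
  have gχ0 : ∀ x, x ∉ tsupport χ → gradient χ x = 0 := fun x hx => grad_zero_off hx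
  have mA := S.aesm hAc
  have Ia : IntegrableOn (fun x => |f (u x)| * χ x) Ω := S.int_cl (hfu.abs.mul cχ.continuous.continuousOn) Kχ
    (fun x _ hx => by rw [zχ x hx, mul_zero])
  have Ib : IntegrableOn (fun x => |⟪A x, gradient χ x⟫|) Ω :=
    S.int_cl (ContinuousOn.abs (ContinuousOn.inner (𝕜 := ℝ) hAc cgχ.continuousOn)) Kχ
    (fun x _ hx => by rw [gχ0 x hx, inner_zero_right, abs_zero])
  set M₂ := ∫ x in Ω, (|f (u x)| * χ x + |⟪A x, gradient χ x⟫|) with hM₂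
  have hM₂0 : 0 ≤ M₂ := integral_nonneg fun x => add_nonneg (mul_nonneg (abs_nonneg _) (χ0 x)) (abs_nonneg _)
  have hsabs : |s| = 1 := by
    have : |s| * |s| = 1 := by rw [← abs_mul, hs, abs_one]
    nlinarith [abs_nonneg s]
  set P : ℝ → Eu n → ℝ := fun δ x => s * ⟪A x, gradient (fun y => χ y * κ δ y) x⟫ - s * (κ δ x * ⟪A x, gradient χ x⟫) with hP
  have Ic : ∀ δ, IntegrableOn (fun x => s * (κ δ x * ⟪A x, gradient χ x⟫)) Ω := by
    intro δ
    refine ((Ib.mono' ((mκ δ).mul (mA.inner (grad_meas _).aestronglyMeasurable)) (Eventually.of_forall fun x => ?_))).const_mul s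
    rw [Pi.mul_apply, norm_mul]
    calc _ ≤ 1 * |⟪A x, gradient χ x⟫| := by
          refine mul_le_mul_of_nonneg_right ?_ (abs_nonneg _)
          rw [Real.norm_of_nonneg (κm δ x).1]; exact (κm δ x).2
      _ = _ := one_mul _
  have Id : ∀ {δ : ℝ}, 0 < δ → IntegrableOn (fun x => s * ⟪A x, gradient (fun y => χ y * κ δ y) x⟫) Ω := by
    intro δ hδ
    obtain ⟨L, hLip⟩ := (T2 hδ).1
    refine Integrable.const_mul (intg S.ms Kχ (mA.inner (grad_meas _).aestronglyMeasurable) (BA * L) (fun x hx hxK => ?_) (fun x _ hx => ?_)) s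
    · exact (abs_real_inner_le_norm _ _).trans (mul_le_mul (hBA x (subset_closure hx) hxK) (grad_norm_le hLip x) (norm_nonneg _) hBA0)
    · have : (fun y => χ y * κ δ y) =ᶠ[𝓝 x] fun _ => 0 := by
        filter_upwards [(isClosed_tsupport χ).isOpen_compl.mem_nhds hx] with y hy
        rw [zχ y hy, zero_mul]
      rw [this.gradient_eq]; simp
  have IP : ∀ {δ : ℝ}, 0 < δ → IntegrableOn (P δ) Ω := fun hδ => (Id hδ).sub (Ic _)
  have Ie : ∀ δ, IntegrableOn (fun x => s * (f (u x) * (χ x * κ δ x))) Ω := by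
    intro δ
    refine (Ia.mono' ((S.aesm hfu).mul (mχ.mul (mκ δ))) (Eventually.of_forall fun x => ?_)).const_mul s
    simp only [Pi.mul_apply, norm_mul, Real.norm_eq_abs, abs_of_nonneg (χ0 x), abs_of_nonneg (κm δ x).1]
    refine mul_le_mul_of_nonneg_left ?_ (abs_nonneg _)
    calc χ x * κ δ x ≤ χ x * 1 := mul_le_mul_of_nonneg_left (κm δ x).2 (χ0 x)
      _ = _ := mul_one _
  have EP : ∀ {δ : ℝ}, 0 < δ → ∫ x in Ω, P δ x ≤ M₂ := by
    intro δ hδ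
    have e1 : ∫ x in Ω, P δ x = ∫ x in Ω, (s * (f (u x) * (χ x * κ δ x)) - s * (κ δ x * ⟪A x, gradient χ x⟫)) := by
      simp only [hP]
      rw [integral_sub (Id hδ) (Ic _), integral_sub (Ie _) (Ic _), integral_const_mul, hAsol (T2 hδ), ← integral_const_mul s fun x => f (u x) * (χ x * κ δ x)]
    rw [e1]
    refine integral_mono ((Ie _).sub (Ic _)) (Ia.add Ib) fun x => ?_
    have k1 : s * (f (u x) * (χ x * κ δ x)) ≤ |f (u x)| * χ x := by
      refine (le_abs_self _).trans ?_
      rw [abs_mul, abs_mul, abs_mul, hsabs, one_mul, abs_of_nonneg (χ0 x), abs_of_nonneg (κm δ x).1]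
      refine mul_le_mul_of_nonneg_left ?_ (abs_nonneg _)
      calc χ x * κ δ x ≤ χ x * 1 := mul_le_mul_of_nonneg_left (κm δ x).2 (χ0 x)
        _ = _ := mul_one _
    have k2 : -(s * (κ δ x * ⟪A x, gradient χ x⟫)) ≤ |⟪A x, gradient χ x⟫| := by
      refine (neg_le_abs _).trans ?_
      rw [abs_mul, abs_mul, hsabs, one_mul, abs_of_nonneg (κm δ x).1]
      calc _ ≤ 1 * |⟪A x, gradient χ x⟫| := mul_le_mul_of_nonneg_right (κm δ x).2 (abs_nonneg _)
        _ = _ := one_mul _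
    simp only
    linarith
  -- smallness of the boundary layer
  have key : ∀ ε > 0, ∃ δ₀ > 0, ∀ δ, 0 < δ → δ < δ₀ → |∫ x in Ω, F3 δ x| ≤ ε * M₂ := by
    intro ε hε
    set Z := K ∩ tsupport χ with hZ
    have hZcl : Z ⊆ closure Ω := fun x hx => hKcl hx.1
    set g : Eu n → ℝ := fun x => B₀ * |⟪W x, Du x⟫| - ε * ⟪A x, Du x⟫ with hg
    have hgc : ContinuousOn g Z := by
      have h1 : ContinuousOn (fun x => ⟪W x, Du x⟫) Z := ContinuousOn.inner (𝕜 := ℝ) (hWc.mono hZcl) (S.hDuc.mono hZcl)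
      have h2 : ContinuousOn (fun x => ⟪A x, Du x⟫) Z := ContinuousOn.inner (𝕜 := ℝ) (hAc.mono hZcl) (S.hDuc.mono hZcl)
      exact (continuousOn_const.mul h1.abs).sub (continuousOn_const.mul h2)
    have hZK : IsCompact Z := hK.inter_right (isClosed_tsupport χ)
    have hEc : IsCompact (Z ∩ {x | 0 ≤ g x}) := hZK.of_isClosed_subset
      (hgc.preimage_isClosed_of_isClosed hZK.isClosed isClosed_Ici) inter_subset_left
    obtain ⟨m, hm, hmE⟩ := hEc.exists_forall_le' (f := fun x => s * (u x - b)) (a := 0)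
      ((continuousOn_const.mul (S.hucl.sub continuousOn_const)).mono (inter_subset_left.trans hZcl)) (by
        rintro x ⟨hxZ, hxg⟩
        rcases hKC x hxZ.1 with h | h
        · exact hNu x (tχ hxZ.2) (hCΩ h)
        · exfalso
          have hD : Du x ≠ 0 := fun h' => h.2.2 (by rw [h', inner_zero_left])
          have h1 := hAQ x hD
          have h2 := hWn x h.1 h.2.2
          have h3 : 0 ≤ g x := hxg
          simp only [hg, h2, abs_zero, mul_zero] at h3
          nlinarith)
    refine ⟨m / 2, by linarith, fun δ hδ hδm => ?_⟩
    calc |∫ x in Ω, F3 δ x| ≤ ∫ x in Ω, ε * P δ x := by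
          rw [← Real.norm_eq_abs]
          refine norm_integral_le_of_norm_le ((IP hδ).const_mul ε) ?_
          refine (ae_restrict_iff' S.ms).2 ?_
          filter_upwards [P3 hδ] with x hx hxΩ
          rw [hx hxΩ]
          obtain ⟨t, t0, t1, tg⟩ := κg hδ hxΩ
          have hPx : P δ x = χ x * t * ⟪A x, Du x⟫ := by
            simp only [hP]
            rw [grad_mul (dχ x) (κd δ x hxΩ), tg]
            simp only [inner_add_right, inner_smul_right]
            linear_combination (χ x * t * ⟪A x, Du x⟫) * hs
          rw [hPx, tg, inner_smul_right, Real.norm_eq_abs, abs_mul, abs_mul, abs_mul, abs_mul, hsabs, mul_one, abs_of_nonneg (χ0 x), abs_of_nonneg t0]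
          have hχt : 0 ≤ χ x * t := mul_nonneg (χ0 x) t0
          by_cases hxK : x ∈ K
          · by_cases hxχ : x ∈ tsupport χ
            · by_cases hxg : 0 ≤ g x
              · have : t = 0 := t1 (lt_of_lt_of_le (by linarith) (hmE x ⟨⟨hxK, hxχ⟩, hxg⟩))
                rw [this]; simp
              · have h1 : B₀ * |⟪W x, Du x⟫| ≤ ε * ⟪A x, Du x⟫ := by
                  have := not_le.1 hxg
                  simp only [hg] at this; linarith
                calc |ζ x| * χ x * (t * |⟪W x, Du x⟫|) = χ x * t * (|ζ x| * |⟪W x, Du x⟫|) := by ring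
                  _ ≤ χ x * t * (B₀ * |⟪W x, Du x⟫|) :=
                    mul_le_mul_of_nonneg_left (mul_le_mul_of_nonneg_right (hB0 x) (abs_nonneg _)) hχt
                  _ ≤ χ x * t * (ε * ⟪A x, Du x⟫) := mul_le_mul_of_nonneg_left h1 hχt
                  _ = _ := by ring
            · rw [zχ x hxχ]; simp
          · rw [h0 x hxK]; simp only [abs_zero, zero_mul]
            exact mul_nonneg hε.le (mul_nonneg hχt (hAQ0 x))
      _ = ε * ∫ x in Ω, P δ x := integral_const_mul _ _
      _ ≤ ε * M₂ := mul_le_mul_of_nonneg_left (EP hδ) hε.le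
  -- passing to the limit
  set dl : ℕ → ℝ := fun k => 1 / ((k : ℝ) + 1) with hdl
  have hdl0 : ∀ k, 0 < dl k := fun k => by simp only [hdl]; positivity
  have hdlt : Tendsto dl atTop (𝓝 0) := tendsto_one_div_add_atTop_nhds_zero_nat
  have hκk : ∀ x ∈ Ω, χ x = 0 ∨ ∀ᶠ k : ℕ in atTop, κ (dl k) x = 1 := by
    intro x hx
    by_cases h : x ∈ tsupport χ
    · exact Or.inr (κ1 x hx (hNu x (tχ h) hx))
    · exact Or.inl (zχ x h)
  have Iζ : IntegrableOn (fun x => |⟪W x, gradient ζ x⟫|) Ω :=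
    (intg S.ms hK mW1 (BW * |B₁|) (fun x hx hxK => bW1 x hx hxK)
      (fun x _ hx => by rw [hg0 x hx, inner_zero_right])).abs
  have L1 : Tendsto (fun k => ∫ x in Ω, kp (dl k) x * ⟪W x, gradient ζ x⟫) atTop (𝓝 (∫ x in Ω, ⟪W x, gradient ζ x⟫)) := by
    refine tendsto_integral_of_dominated_convergence (fun x => |⟪W x, gradient ζ x⟫|) (fun k => (I1 _).aestronglyMeasurable) Iζ
      (fun k => Eventually.of_forall fun x => ?_) ((ae_restrict_iff' S.ms).2 (Eventually.of_forall fun x hx => ?_))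
    · rw [norm_mul]
      calc _ ≤ 1 * |⟪W x, gradient ζ x⟫| := mul_le_mul_of_nonneg_right (kpm _ x) (abs_nonneg _)
        _ = _ := one_mul _
    · refine Tendsto.congr' (f₁ := fun _ => ⟪W x, gradient ζ x⟫) ?_ tendsto_const_nhds
      rcases hκk x hx with h | h
      · exact Eventually.of_forall fun k => by simp [hkp, h]
      · filter_upwards [h] with k hk
        simp [hkp, hk]
  have L2 : Tendsto (fun k => ∫ x in Ω, ζ x * (1 - κ (dl k) x) * ⟪W x, gradient χ x⟫) atTop (𝓝 (∫ x in Ω, (0:ℝ))) := by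
    have Iχ : IntegrableOn (fun x => B₀ * |⟪W x, gradient χ x⟫|) Ω :=
      (S.int_cl (ContinuousOn.abs (ContinuousOn.inner (𝕜 := ℝ) hWc cgχ.continuousOn)) Kχ
        (fun x _ hx => by rw [gχ0 x hx, inner_zero_right, abs_zero])).const_mul B₀
    refine tendsto_integral_of_dominated_convergence (fun x => B₀ * |⟪W x, gradient χ x⟫|) (fun k => (I2 _).aestronglyMeasurable) Iχ
      (fun k => Eventually.of_forall fun x => ?_) ((ae_restrict_iff' S.ms).2 (Eventually.of_forall fun x hx => ?_))
    · rw [norm_mul]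
      exact mul_le_mul_of_nonneg_right (b2 _ x) (abs_nonneg _)
    · refine Tendsto.congr' (f₁ := fun _ => (0:ℝ)) ?_ tendsto_const_nhds
      by_cases h' : x ∈ tsupport χ
      · filter_upwards [κ1 x hx (hNu x (tχ h') hx)] with k hk
        have hk' : κ (dl k) x = 1 := hk
        simp [hk']
      · exact Eventually.of_forall fun k => by simp [gχ0 x h']
  rw [integral_zero] at L2
  have L3 : Tendsto (fun k => ∫ x in Ω, F3 (dl k) x) atTop (𝓝 0) := by
    rw [Metric.tendsto_nhds]
    intro r hr
    obtain ⟨δ₀, hδ₀, hk⟩ := key (r / (2 * (M₂ + 1))) (by positivity)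
    filter_upwards [hdlt.eventually (gt_mem_nhds hδ₀)] with k hkk
    rw [dist_zero_right, Real.norm_eq_abs]
    refine (hk _ (hdl0 k) hkk).trans_lt ?_
    rw [div_mul_eq_mul_div, div_lt_iff₀ (by positivity)]
    nlinarith
  have L4 := L1.neg.add L2
  rw [add_zero] at L4
  have L5 := tendsto_nhds_unique (L3.congr fun k => E3 (hdl0 k)) L4
  have L6 : ∫ x in Ω, ⟪W x, gradient ζ x⟫ = 0 := by linarith
  rw [hW] at L6
  exact L6

end


section

variable {Ω : Set (Eu n)} {η : Eu n → Eu n} {a f : ℝ → ℝ} {u : Eu n → ℝ} {Du : Eu n → Eu n} {H : Eu n → Eu n →L[ℝ] Eu n}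

lemma st_deriv : ∃ L : ℝ, 0 ≤ L ∧ (∀ t, |deriv Real.smoothTransition t| ≤ L) ∧
    (∀ t, t < 0 → deriv Real.smoothTransition t = 0) ∧ ∀ t, 1 < t → deriv Real.smoothTransition t = 0 := by
  have h3 : ContDiff ℝ 1 Real.smoothTransition := Real.smoothTransition.contDiff (n := 1)
  have hc : Continuous (deriv Real.smoothTransition) := h3.continuous_deriv le_rfl
  have z0 : ∀ t, t < 0 → deriv Real.smoothTransition t = 0 := by
    intro t ht
    have e : Real.smoothTransition =ᶠ[𝓝 t] fun _ => 0 := by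
      filter_upwards [gt_mem_nhds ht] with y hy using Real.smoothTransition.zero_of_nonpos (le_of_lt hy)
    rw [e.deriv_eq]; simp
  have z1 : ∀ t, 1 < t → deriv Real.smoothTransition t = 0 := by
    intro t ht
    have e : Real.smoothTransition =ᶠ[𝓝 t] fun _ => 1 := by
      filter_upwards [lt_mem_nhds ht] with y hy using Real.smoothTransition.one_of_one_le (le_of_lt hy)
    rw [e.deriv_eq]; simp
  obtain ⟨L, hL⟩ := (isCompact_Icc (a := (0:ℝ)) (b := 1)).exists_bound_of_continuousOn hc.continuousOn
  refine ⟨|L|, abs_nonneg _, fun t => ?_, z0, z1⟩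
  by_cases h : t ∈ Icc (0:ℝ) 1
  · exact (hL t h).trans (le_abs_self _)
  · rcases lt_or_ge t 0 with h1 | h1
    · rw [z0 t h1, abs_zero]; exact abs_nonneg _
    · rw [z1 t (by by_contra h2; exact h ⟨h1, not_lt.1 h2⟩), abs_zero]; exact abs_nonneg _

lemma grad_mul_le {h Φ : Eu n → ℝ} {x : Eu n} {L : NNReal} {B : ℝ} (hh : DifferentiableAt ℝ h x) (hΦ : LipschitzWith L Φ)
    (hB : ∀ y, |Φ y| ≤ B) : ‖gradient (fun y => h y * Φ y) x‖ ≤ (‖gradient h x‖ + 1) * B + |h x| * L := by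
  have hB0 : 0 ≤ B := (abs_nonneg _).trans (hB x)
  rw [grad_norm_eq, grad_norm_eq]
  refine norm_fderiv_le_of_lip' ℝ (by positivity) ?_
  filter_upwards [hh.hasFDerivAt.isLittleO.def zero_lt_one] with y hy
  have h1 : |h y - h x| ≤ (‖fderiv ℝ h x‖ + 1) * ‖y - x‖ := by
    have h2 := (fderiv ℝ h x).le_opNorm (y - x)
    have h3 := norm_add_le (h y - h x - fderiv ℝ h x (y - x)) (fderiv ℝ h x (y - x))
    rw [sub_add_cancel] at h3
    rw [← Real.norm_eq_abs]
    linarith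
  have h2 : |Φ y - Φ x| ≤ L * ‖y - x‖ := by
    have := hΦ.dist_le_mul y x
    rwa [Real.dist_eq, dist_eq_norm] at this
  have e : h y * Φ y - h x * Φ x = (h y - h x) * Φ y + h x * (Φ y - Φ x) := by ring
  rw [Real.norm_eq_abs, e]
  refine (abs_add_le _ _).trans ?_
  rw [abs_mul, abs_mul]
  calc _ ≤ ((‖fderiv ℝ h x‖ + 1) * ‖y - x‖) * B + |h x| * (L * ‖y - x‖) :=
        add_le_add (mul_le_mul h1 (hB y) (abs_nonneg _) (by positivity)) (mul_le_mul_of_nonneg_left h2 (abs_nonneg _))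
    _ = _ := by ring

/-- cut-off away from critical points -/
def th (Du : Eu n → Eu n) (ε : ℝ) (x : Eu n) : ℝ := Real.smoothTransition (‖Du x‖ ^ 2 / ε ^ 2 - 1)

lemma th_nonneg {ε : ℝ} (x : Eu n) : 0 ≤ th Du ε x := Real.smoothTransition.nonneg _
lemma th_le {ε : ℝ} (x : Eu n) : th Du ε x ≤ 1 := Real.smoothTransition.le_one _

lemma th_zero {ε : ℝ} (hε : 0 < ε) {x : Eu n} (hx : ‖Du x‖ ≤ ε) : th Du ε x = 0 := by
  refine Real.smoothTransition.zero_of_nonpos ?_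
  have : ‖Du x‖ ^ 2 / ε ^ 2 ≤ 1 := by
    rw [div_le_one (by positivity)]
    exact pow_le_pow_left₀ (norm_nonneg _) hx 2
  linarith

lemma th_one {ε : ℝ} (hε : 0 < ε) {x : Eu n} (hx : 2 * ε ^ 2 ≤ ‖Du x‖ ^ 2) : th Du ε x = 1 := by
  refine Real.smoothTransition.one_of_one_le ?_
  have : 2 ≤ ‖Du x‖ ^ 2 / ε ^ 2 := by
    rw [le_div_iff₀ (by positivity)]; exact hx
  linarith

lemma Dat.th_C1 (S : Dat Ω η a f u Du H) {ε : ℝ} : ContDiffOn ℝ 1 (th Du ε) Ω := by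
  have h1 : ContDiffOn ℝ 1 Du Ω := S.Du_C2.of_le (by norm_num)
  have h3 : ContDiff ℝ 1 Real.smoothTransition := Real.smoothTransition.contDiff (n := 1)
  exact h3.comp_contDiffOn (((h1.norm_sq ℝ).div_const _).sub contDiffOn_const)

lemma Dat.th_grad (S : Dat Ω η a f u Du H) {ε : ℝ} {x : Eu n} (hx : x ∈ Ω) :
    gradient (th Du ε) x = (deriv Real.smoothTransition (‖Du x‖ ^ 2 / ε ^ 2 - 1) * (2 / ε ^ 2)) • H x (Du x) := by
  have h3 : ContDiff ℝ 1 Real.smoothTransition := Real.smoothTransition.contDiff (n := 1)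
  have hd := (h3.differentiable (by norm_num)).differentiableAt.hasDerivAt (x := ‖Du x‖ ^ 2 / ε ^ 2 - 1)
  have h1 : HasFDerivAt (fun y => ‖Du y‖ ^ 2 / ε ^ 2 - 1) ((2 / ε ^ 2) • innerSL ℝ (H x (Du x))) x := by
    have := ((S.hasD2 hx).norm_sq).mul_const ((ε ^ 2)⁻¹) |>.sub_const 1
    refine this.congr_fderiv (ContinuousLinearMap.ext fun w => ?_)
    simp only [smul_apply, innerSL_apply_apply, smul_eq_mul, ContinuousLinearMap.comp_apply, nsmul_eq_mul]
    rw [real_inner_comm, S.Hsymm hx w (Du x)]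
    simp
    ring
  have h2 := hd.comp_hasFDerivAt x h1
  refine grad_of_hasFDeriv h2 fun w => ?_
  simp only [smul_apply, innerSL_apply_apply, inner_smul_left, smul_eq_mul, RCLike.conj_to_real]
  ring

/-- bound for the gradient of the cut-off -/
lemma Dat.th_bound (S : Dat Ω η a f u Du H) : ∃ L : ℝ, 0 ≤ L ∧ ∀ ε > 0, ∀ x ∈ Ω,
    (2 * ε ^ 2 < ‖Du x‖ ^ 2 → gradient (th Du ε) x = 0) ∧ ‖Du x‖ * ‖gradient (th Du ε) x‖ ≤ L * ‖H x‖ ∧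
    ‖gradient (th Du ε) x‖ ≤ L * ‖H x‖ / ε := by
  obtain ⟨L, hL0, hL, z0, z1⟩ := st_deriv
  refine ⟨4 * L, by linarith, fun ε hε x hx => ?_⟩
  have hε2 : 0 < ε ^ 2 := by positivity
  have hz : 2 * ε ^ 2 < ‖Du x‖ ^ 2 → gradient (th Du ε) x = 0 := by
    intro h
    rw [S.th_grad hx, z1, zero_mul, zero_smul]
    have := (lt_div_iff₀ hε2).2 h
    linarith
  have hn : ‖gradient (th Du ε) x‖ ≤ L * (2 / ε ^ 2) * (‖H x‖ * ‖Du x‖) := by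
    rw [S.th_grad hx, norm_smul, norm_mul, Real.norm_of_nonneg (show 0 ≤ 2 / ε ^ 2 by positivity)]
    exact mul_le_mul (mul_le_mul_of_nonneg_right (hL _) (by positivity)) ((H x).le_opNorm _) (norm_nonneg _) (by positivity)
  have hH := norm_nonneg (H x)
  refine ⟨hz, ?_, ?_⟩
  · by_cases h : 2 * ε ^ 2 < ‖Du x‖ ^ 2
    · rw [hz h, norm_zero, mul_zero]; positivity
    · have h' := not_lt.1 h
      calc ‖Du x‖ * ‖gradient (th Du ε) x‖ ≤ ‖Du x‖ * (L * (2 / ε ^ 2) * (‖H x‖ * ‖Du x‖)) :=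
            mul_le_mul_of_nonneg_left hn (norm_nonneg _)
        _ = (L * ‖H x‖ * (2 / ε ^ 2)) * ‖Du x‖ ^ 2 := by ring
        _ ≤ (L * ‖H x‖ * (2 / ε ^ 2)) * (2 * ε ^ 2) := mul_le_mul_of_nonneg_left h' (by positivity)
        _ = 4 * L * ‖H x‖ := by field_simp; ring
  · by_cases h : 2 * ε ^ 2 < ‖Du x‖ ^ 2
    · rw [hz h, norm_zero]; positivity
    · have h' : ‖Du x‖ ≤ 2 * ε := by
        refine abs_le_of_sq_le_sq' ?_ (by linarith) |>.2
        nlinarith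
      calc ‖gradient (th Du ε) x‖ ≤ L * (2 / ε ^ 2) * (‖H x‖ * ‖Du x‖) := hn
        _ ≤ L * (2 / ε ^ 2) * (‖H x‖ * (2 * ε)) := by gcongr
        _ = 4 * L * ‖H x‖ / ε := by field_simp; ring

lemma Dat.sig (S : Dat Ω η a f u Du H) {x Y₁ : Eu n} (Y : Eu n) (hx : x ∈ Ω) (h : ⟪Du x, Y₁⟫ ≠ 0) :
    DifferentiableAt ℝ (fun y => ⟪Du y, Y⟫ / ⟪Du y, Y₁⟫) x ∧
    gradient (fun y => ⟪Du y, Y⟫ / ⟪Du y, Y₁⟫) x = (1 / ⟪Du x, Y₁⟫ ^ 2) • wf Du H Y₁ Y x := by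
  have h2 := (hasDerivAt_inv h).comp_hasFDerivAt x (S.hasV hx Y₁)
  have h1 : HasFDerivAt (fun y => ⟪Du y, Y⟫ / ⟪Du y, Y₁⟫) _ x := (S.hasV hx Y).mul h2
  refine ⟨h1.differentiableAt, grad_of_hasFDeriv h1 fun w => ?_⟩
  simp only [wf, smul_apply, add_apply, innerSL_apply_apply, inner_smul_left, inner_sub_left, smul_eq_mul, RCLike.conj_to_real, Function.comp_apply]
  field_simp
  ring

/-- one nodal domain together with its boundary component -/
structure Side (Ω : Set (Eu n)) (η : Eu n → Eu n) (u : Eu n → ℝ) (Du : Eu n → Eu n) (C B : Set (Eu n)) (s b : ℝ)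
    (Y₁ : Eu n) : Prop where
  op : IsOpen C
  sub : C ⊆ Ω
  pre : IsPreconnected C
  Dne : ∀ x ∈ C, Du x ≠ 0
  cl : ∀ x ∈ closure C, Du x ≠ 0 → x ∈ C ∨ x ∈ B
  Bsub : B ⊆ frontier Ω
  near : ∀ p ∈ B, ∃ ρ > 0, Ω ∩ ball p ρ ⊆ C
  ub : ∀ p ∈ B, u p = b
  ss : s * s = 1
  sg : ∀ p ∈ B, 0 < s * ⟪Du p, η p⟫
  vC : ∀ x ∈ C, 0 < ⟪Du x, Y₁⟫
  vB : ∀ x ∈ B, 0 < ⟪Du x, Y₁⟫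

variable {C B : Set (Eu n)} {s b : ℝ} {Y₁ : Eu n}

lemma Side.nbhd (D : Side Ω η u Du C B s b Y₁) (S : Dat Ω η a f u Du H) : ∃ N, IsOpen N ∧ B ⊆ N ∧
    (∀ x ∈ N, x ∈ Ω → 0 < s * (u x - b)) ∧ ∀ x ∈ N, x ∈ frontier Ω → u x = b := by
  have h : ∀ p ∈ B, ∃ ρ > 0, (∀ x ∈ ball p ρ, x ∈ Ω → 0 < s * (u x - b)) ∧ ∀ x ∈ ball p ρ, x ∈ frontier Ω → u x = b := by
    intro p hp
    have hpf := D.Bsub hp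
    obtain ⟨ρ, hρ, h1⟩ := S.sign_near hpf (D.sg p hp)
    obtain ⟨V, hV, h2⟩ := S.hulc p hpf
    obtain ⟨r, hr, hrV⟩ := Metric.mem_nhds_iff.1 hV
    rw [D.ub p hp] at h1
    refine ⟨min ρ r, lt_min hρ hr, fun x hx hxΩ => h1 x ⟨hxΩ, ball_subset_ball (min_le_left _ _) hx⟩, fun x hx hxf => ?_⟩
    rw [(h2 x ⟨hrV (ball_subset_ball (min_le_right _ _) hx), hxf⟩).1, D.ub p hp]
  choose! r hr h1 h2 using h
  refine ⟨⋃ p ∈ B, ball p (r p), isOpen_biUnion fun _ _ => isOpen_ball, fun p hp => mem_biUnion hp (mem_ball_self (hr p hp)), ?_, ?_⟩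
  · intro x hx
    obtain ⟨p, hp, hx⟩ := mem_iUnion₂.1 hx
    exact h1 p hp x hx
  · intro x hx
    obtain ⟨p, hp, hx⟩ := mem_iUnion₂.1 hx
    exact h2 p hp x hx

end


section

variable {Ω : Set (Eu n)} {η : Eu n → Eu n} {a f : ℝ → ℝ} {u : Eu n → ℝ} {Du : Eu n → Eu n} {H : Eu n → Eu n →L[ℝ] Eu n}

variable {C B : Set (Eu n)} {s b : ℝ} {Y₁ : Eu n}

lemma Dat.en_int (S : Dat Ω η a f u Du H) {φ : Eu n → ℝ} {Lφ : NNReal} (hφ : LipschitzWith Lφ φ)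
    (hc : HasCompactSupport φ) : IntegrableOn (fun x => ‖Du x‖ ^ 2 * ⟪AL a (Du x) (gradient φ x), gradient φ x⟫) Ω := by
  obtain ⟨BD, hBD0, hBD⟩ := S.bdd S.hDuc hc
  have mD := S.aesm S.hDuc
  have mg : AEStronglyMeasurable (gradient φ) (volume.restrict Ω) := (grad_meas φ).aestronglyMeasurable
  have h1 : AEStronglyMeasurable (fun x => ‖Du x‖ ^ 2 • gradient φ x) (volume.restrict Ω) := (mD.norm.pow 2).smul mg
  have := S.int_M h1 mg hc (BD ^ 2 * Lφ) Lφ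
    (fun x hx hxK => by
      rw [norm_smul, Real.norm_of_nonneg (by positivity)]
      exact mul_le_mul (pow_le_pow_left₀ (norm_nonneg _) (hBD x (subset_closure hx) hxK) 2) (grad_norm_le hφ x) (norm_nonneg _) (by positivity))
    (fun x _ _ => grad_norm_le hφ x) (fun x _ hx => Or.inr (grad_zero_off hx))
  refine this.congr_fun (fun x _ => ?_) S.ms
  simp only [map_smul, inner_smul_left, RCLike.conj_to_real]

lemma Dat.th_en_bd (S : Dat Ω η a f u Du H) (Y : Eu n) {φ : Eu n → ℝ} {Lφ : NNReal} (hφ : LipschitzWith Lφ φ)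
    (hc : HasCompactSupport φ) : ∃ R : ℝ, 0 ≤ R ∧ ∀ ε > 0,
      (∀ x ∈ Ω, x ∈ tsupport φ → |⟪AL a (Du x) ((⟪Du x, Y⟫ * φ x) • gradient (th Du ε) x), (⟪Du x, Y⟫ * φ x) • gradient (th Du ε) x⟫| ≤ R) ∧
      IntegrableOn (fun x => ⟪AL a (Du x) ((⟪Du x, Y⟫ * φ x) • gradient (th Du ε) x), (⟪Du x, Y⟫ * φ x) • gradient (th Du ε) x⟫) Ω := by
  obtain ⟨L, hL0, hL⟩ := S.th_bound
  obtain ⟨BH, hBH0, hBH⟩ := S.bdd S.hHc hc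
  obtain ⟨BM, hBM0, hBM⟩ := S.bdd S.M_contOn hc
  obtain ⟨Bφ, hBφ⟩ := hc.exists_bound_of_continuousOn hφ.continuous.continuousOn
  have key : ∀ ε > 0, ∀ x ∈ Ω, x ∈ tsupport φ → ‖(⟪Du x, Y⟫ * φ x) • gradient (th Du ε) x‖ ≤ ‖Y‖ * |Bφ| * (L * BH) := by
    intro ε hε x hx hxK
    rw [norm_smul, norm_mul]
    have h1 := abs_real_inner_le_norm (Du x) Y
    calc |⟪Du x, Y⟫| * ‖φ x‖ * ‖gradient (th Du ε) x‖ ≤ (‖Du x‖ * ‖Y‖) * |Bφ| * ‖gradient (th Du ε) x‖ := by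
          refine mul_le_mul_of_nonneg_right (mul_le_mul h1 ((hBφ x hxK).trans (le_abs_self _)) (norm_nonneg _) (by positivity)) (norm_nonneg _)
      _ = ‖Y‖ * |Bφ| * (‖Du x‖ * ‖gradient (th Du ε) x‖) := by ring
      _ ≤ ‖Y‖ * |Bφ| * (L * ‖H x‖) := mul_le_mul_of_nonneg_left (hL ε hε x hx).2.1 (by positivity)
      _ ≤ _ := by
        refine mul_le_mul_of_nonneg_left (mul_le_mul_of_nonneg_left (hBH x (subset_closure hx) hxK) hL0) (by positivity)
  set Q := ‖Y‖ * |Bφ| * (L * BH) with hQ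
  have hQ0 : 0 ≤ Q := by positivity
  refine ⟨BM * Q * Q, by positivity, fun ε hε => ⟨fun x hx hxK => ?_, ?_⟩⟩
  · refine (abs_real_inner_le_norm _ _).trans ?_
    refine mul_le_mul (((AL a (Du x)).le_opNorm _).trans ?_) (key ε hε x hx hxK) (norm_nonneg _) (by positivity)
    exact mul_le_mul (hBM x (subset_closure hx) hxK) (key ε hε x hx hxK) (norm_nonneg _) hBM0
  · have mV : AEStronglyMeasurable (fun x => ⟪Du x, Y⟫ * φ x) (volume.restrict Ω) :=
      (S.aesm (ContinuousOn.inner (𝕜 := ℝ) S.hDuc continuousOn_const)).mul hφ.continuous.aestronglyMeasurable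
    have mg : AEStronglyMeasurable (fun x => (⟪Du x, Y⟫ * φ x) • gradient (th Du ε) x) (volume.restrict Ω) :=
      mV.smul (grad_meas _).aestronglyMeasurable
    exact S.int_M mg mg hc Q Q (key ε hε) (key ε hε) (fun x _ hx => Or.inl (by
      rw [image_eq_zero_of_notMem_tsupport hx, mul_zero, zero_smul]))

set_option maxHeartbeats 1000000 in
lemma Side.ineq (D : Side Ω η u Du C B s b Y₁) (S : Dat Ω η a f u Du H) (Y : Eu n) {φ : Eu n → ℝ} {Lφ : NNReal} (hφ : LipschitzWith Lφ φ)
    (hc : HasCompactSupport φ) {ε : ℝ} (hε : 0 < ε) :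
    IntegrableOn (fun x => (φ x * th Du ε x) ^ 2 * (⟪AL a (Du x) (wf Du H Y₁ Y x), wf Du H Y₁ Y x⟫ / ⟪Du x, Y₁⟫ ^ 2)) C ∧
    (1 / 2) * ∫ x in C, (φ x * th Du ε x) ^ 2 * (⟪AL a (Du x) (wf Du H Y₁ Y x), wf Du H Y₁ Y x⟫ / ⟪Du x, Y₁⟫ ^ 2) ≤
      4 * ‖Y‖ ^ 2 * (∫ x in Ω, ‖Du x‖ ^ 2 * ⟪AL a (Du x) (gradient φ x), gradient φ x⟫) +
      4 * ∫ x in C, ⟪AL a (Du x) ((⟪Du x, Y⟫ * φ x) • gradient (th Du ε) x), (⟪Du x, Y⟫ * φ x) • gradient (th Du ε) x⟫ := by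
  obtain ⟨N, hN, hBN, hNu, hNb⟩ := D.nbhd S
  have hCcl : closure C ⊆ closure Ω := closure_mono D.sub
  set K := tsupport φ ∩ (closure C ∩ {x | ε ≤ ‖Du x‖}) with hK
  have hKc : IsCompact K := hc.inter_right
    (((S.hDuc.mono hCcl).norm).preimage_isClosed_of_isClosed isClosed_closure isClosed_Ici)
  have hKCB : ∀ x ∈ K, x ∈ C ∨ x ∈ B := fun x hx => D.cl x hx.2.1 (fun h => by
    have : ε ≤ ‖Du x‖ := hx.2.2
    rw [h, norm_zero] at this; linarith)
  have hKcl : K ⊆ closure Ω := fun x hx => hCcl hx.2.1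
  set V : Eu n → ℝ := fun x => ⟪Du x, Y⟫ with hV
  set V₁ : Eu n → ℝ := fun x => ⟪Du x, Y₁⟫ with hV₁
  have cV : ContinuousOn V (closure Ω) := ContinuousOn.inner (𝕜 := ℝ) S.hDuc continuousOn_const
  have cV₁ : ContinuousOn V₁ (closure Ω) := ContinuousOn.inner (𝕜 := ℝ) S.hDuc continuousOn_const
  obtain ⟨m, hm, hmK⟩ := hKc.exists_forall_le' (f := V₁) (a := 0) (cV₁.mono hKcl)
    (fun x hx => (hKCB x hx).elim (D.vC x) (D.vB x))
  obtain ⟨BV, hBV0, hBV⟩ := S.bdd cV hKc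
  obtain ⟨BH, hBH0, hBH⟩ := S.bdd S.hHc hKc
  obtain ⟨Bw, hBw0, hBw⟩ := S.bdd (S.wf_cont Y₁ Y) hKc
  obtain ⟨BM, hBM0, hBM⟩ := S.bdd S.M_contOn hKc
  obtain ⟨L, hL0, hL⟩ := S.th_bound
  obtain ⟨⟨LΦ, hΦL⟩, hΦc⟩ := sq_test hφ hc
  obtain ⟨BΦ, hBΦ⟩ := hΦL.continuous.bounded_above_of_compact_support hΦc
  have hBΦ0 : 0 ≤ BΦ := (norm_nonneg _).trans (hBΦ 0)
  set σ : Eu n → ℝ := fun y => V y / V₁ y with hσ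
  set θ := th Du ε with hθ
  have V1C : ∀ x ∈ C, 0 < V₁ x := D.vC
  have dσ : ∀ x ∈ C, DifferentiableAt ℝ σ x ∧ gradient σ x = (1 / V₁ x ^ 2) • wf Du H Y₁ Y x := fun x hx =>
    S.sig Y (D.sub hx) (V1C x hx).ne'
  have θC : ContDiffOn ℝ 1 θ Ω := S.th_C1
  have dθ : ∀ x ∈ Ω, DifferentiableAt ℝ θ x := fun x hx => (θC.contDiffAt (S.op.mem_nhds hx)).differentiableAt (by norm_num)
  have θ0 : ∀ x, 0 ≤ θ x := fun x => th_nonneg x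
  have θ1 : ∀ x, θ x ≤ 1 := fun x => th_le x
  have θz : ∀ x, ‖Du x‖ ≤ ε → θ x = 0 := fun x hx => th_zero hε hx
  have θg : ∀ x ∈ Ω, ‖gradient θ x‖ ≤ L * ‖H x‖ / ε := fun x hx => (hL ε hε x hx).2.2
  set h : Eu n → ℝ := fun x => σ x * (θ x * θ x) with hh
  set Φ : Eu n → ℝ := fun x => φ x * φ x with hΦ
  set ζ : Eu n → ℝ := C.indicator fun x => h x * Φ x with hζ
  have σC : ContDiffOn ℝ 1 σ C := (((S.v_C1 Y).mono D.sub).div ((S.v_C1 Y₁).mono D.sub) fun x hx => (V1C x hx).ne')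
  have hC1 : ContDiffOn ℝ 1 h C := σC.mul ((θC.mono D.sub).mul (θC.mono D.sub))
  have dθ2 : ∀ x ∈ Ω, gradient (fun y => θ y * θ y) x = (2 * θ x) • gradient θ x := by
    intro x hx
    rw [grad_mul (dθ x hx) (dθ x hx), ← add_smul]; ring_nf
  have gh : ∀ x ∈ C, gradient h x = (2 * σ x * θ x) • gradient θ x + (θ x * θ x / V₁ x ^ 2) • wf Du H Y₁ Y x := by
    intro x hx
    have hx' := D.sub hx
    have g1 := grad_mul (g := fun y => θ y * θ y) (dσ x hx).1 ((dθ x hx').mul (dθ x hx'))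
    refine g1.trans ?_
    rw [dθ2 x hx', (dσ x hx).2, smul_smul, smul_smul]
    ring_nf
  have dh : ∀ x ∈ C, DifferentiableAt ℝ h x := fun x hx => (hC1.contDiffAt (D.op.mem_nhds hx)).differentiableAt (by norm_num)
  have hζe : ∀ x ∈ C, ζ =ᶠ[𝓝 x] fun y => h y * Φ y := by
    intro x hx
    filter_upwards [D.op.mem_nhds hx] with y hy
    rw [hζ, indicator_of_mem hy]
  have ζ0' : ∀ x, x ∉ C → ζ x = 0 := fun x hx => indicator_of_notMem hx _
  have hΦ0 : ∀ x, x ∉ tsupport φ → Φ x = 0 := fun x hx => by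
    simp only [hΦ]; rw [image_eq_zero_of_notMem_tsupport hx, mul_zero]
  have ζ0 : ∀ x, x ∉ K → ζ x = 0 := by
    intro x hx
    by_cases hxC : x ∈ C
    · rw [hζ, indicator_of_mem hxC]
      by_cases hxφ : x ∈ tsupport φ
      · have : θ x = 0 := θz x (by
          by_contra hn
          exact hx ⟨hxφ, subset_closure hxC, (not_le.1 hn).le⟩)
        simp [hh, this]
      · rw [hΦ0 x hxφ, mul_zero]
    · exact ζ0' x hxC
  have bσ : ∀ x ∈ K, |σ x| ≤ BV / m := by
    intro x hx
    rw [hσ, abs_div, abs_of_pos (hm.trans_le (hmK x hx))]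
    exact div_le_div₀ hBV0 (hBV x (hKcl hx) hx) hm (hmK x hx)
  have θθ : ∀ x, θ x * θ x ≤ 1 := fun x => by have := θ0 x; have := θ1 x; nlinarith
  have bh : ∀ x ∈ K, |h x| ≤ BV / m := by
    intro x hx
    rw [hh, abs_mul, abs_of_nonneg (mul_self_nonneg (θ x))]
    calc _ ≤ BV / m * 1 := mul_le_mul (bσ x hx) (θθ x) (mul_self_nonneg _) (by positivity)
      _ = _ := mul_one _
  have bgh : ∀ x ∈ C, x ∈ K → ‖gradient h x‖ ≤ 2 * (BV / m) * (L * BH / ε) + 1 / m ^ 2 * Bw := by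
    intro x hx hxK
    rw [gh x hx]
    refine (norm_add_le _ _).trans (add_le_add ?_ ?_)
    · rw [norm_smul, norm_mul, norm_mul, Real.norm_eq_abs, Real.norm_eq_abs, Real.norm_eq_abs, abs_two, abs_of_nonneg (θ0 x)]
      refine mul_le_mul ?_ ((θg x (D.sub hx)).trans ?_) (norm_nonneg _) (by positivity)
      · calc 2 * |σ x| * θ x ≤ 2 * (BV / m) * 1 := mul_le_mul (by linarith [bσ x hxK]) (θ1 x) (θ0 x) (by positivity)
          _ = _ := mul_one _
      · have := hBH x (hKcl hxK) hxK
        gcongr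
    · rw [norm_smul]
      refine mul_le_mul ?_ (hBw x (hKcl hxK) hxK) (norm_nonneg _) (by positivity)
      rw [Real.norm_of_nonneg (div_nonneg (mul_self_nonneg _) (sq_nonneg _))]
      exact div_le_div₀ zero_le_one (θθ x) (by positivity) (pow_le_pow_left₀ hm.le (hmK x hxK) 2)
  set B₁ := (2 * (BV / m) * (L * BH / ε) + 1 / m ^ 2 * Bw + 1) * BΦ + BV / m * LΦ with hB₁
  have hB₁0 : 0 ≤ B₁ := by positivity
  have gζ0 : ∀ x, x ∉ K → gradient ζ x = 0 := by
    intro x hx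
    have : ζ =ᶠ[𝓝 x] fun _ => 0 := by
      filter_upwards [hKc.isClosed.isOpen_compl.mem_nhds hx] with y hy using ζ0 y hy
    rw [this.gradient_eq]; simp
  have bgζ : ∀ x ∈ C, ‖gradient ζ x‖ ≤ B₁ := by
    intro x hx
    by_cases hxK : x ∈ K
    · rw [(hζe x hx).gradient_eq]
      refine (grad_mul_le (dh x hx) hΦL hBΦ).trans ?_
      refine add_le_add (mul_le_mul_of_nonneg_right (by linarith [bgh x hx hxK]) hBΦ0) (mul_le_mul_of_nonneg_right (bh x hxK) LΦ.2)
    · rw [gζ0 x hxK, norm_zero]; exact hB₁0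
  have hae : ∀ᵐ x : Eu n, DifferentiableAt ℝ φ x := hφ.ae_differentiableAt
  have hmain := S.W_weak Y₁ Y (C := C) (N := N) (K := K) (s := s) (b := b) (B₀ := BV / m * BΦ) (B₁ := B₁) (ζ := ζ) D.op D.sub hN
    D.ss hNu hNb hKc (fun x hx => (hKCB x hx).imp id fun hB => ⟨D.Bsub hB, hBN hB, fun h0 => by
      have := D.sg x hB; rw [h0, mul_zero] at this; exact lt_irrefl _ this⟩) ζ0 ζ0'
    (LL.congr (LL.mul (locLip_of_contDiffOn D.op hC1) hΦL.locallyLipschitz.locallyLipschitzOn) fun x hx => by rw [hζ, indicator_of_mem hx])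
    (by
      filter_upwards [hae] with x hx hxC
      exact ((dh x hxC).mul (hx.mul hx)).congr_of_eventuallyEq (hζe x hxC))
    (fun x => by
      by_cases hxK : x ∈ K
      · by_cases hxC : x ∈ C
        · rw [hζ, indicator_of_mem hxC, abs_mul]
          exact mul_le_mul (bh x hxK) (hBΦ x) (abs_nonneg _) (by positivity)
        · rw [ζ0' x hxC, abs_zero]; positivity
      · rw [ζ0 x hxK, abs_zero]; positivity)
    bgζ
  have hKCΩ : ∀ x ∈ Ω, x ∉ C → x ∉ K := fun x hx hxC hxK => by
    rcases hKCB x hxK with h1 | h1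
    · exact hxC h1
    · have := D.Bsub h1
      rw [S.op.frontier_eq] at this; exact this.2 hx
  have e0 : ∫ x in C, ⟪AL a (Du x) (wf Du H Y₁ Y x), gradient ζ x⟫ = 0 := by
    rw [← hmain]
    refine (setIntegral_eq_of_subset_of_forall_diff_eq_zero S.ms D.sub fun x hx => ?_).symm
    rw [gζ0 x (hKCΩ x hx.1 hx.2), inner_zero_right]
  have mres : volume.restrict C ≤ volume.restrict Ω := Measure.restrict_mono D.sub le_rfl
  have mw := ((S.aesm (S.wf_cont Y₁ Y)).mono_measure mres)
  have mMw := ((S.aesm (S.M_contOn.clm_apply (S.wf_cont Y₁ Y))).mono_measure mres)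
  have bMw : ∀ x ∈ K, ‖AL a (Du x) (wf Du H Y₁ Y x)‖ ≤ BM * Bw := fun x hx =>
    ((AL a (Du x)).le_opNorm _).trans (mul_le_mul (hBM x (hKcl hx) hx) (hBw x (hKcl hx) hx) (norm_nonneg _) hBM0)
  have IZ : IntegrableOn (fun x => ⟪AL a (Du x) (wf Du H Y₁ Y x), gradient ζ x⟫) C := by
    refine intg D.op.measurableSet hKc (mMw.inner (grad_meas _).aestronglyMeasurable) (BM * Bw * B₁) (fun x hx hxK => ?_)
      (fun x _ hx => by rw [gζ0 x hx, inner_zero_right])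
    exact (abs_real_inner_le_norm _ _).trans (mul_le_mul (bMw x hxK) (bgζ x hx) (norm_nonneg _) (by positivity))
  have cC : ContinuousOn V₁ C := cV₁.mono (subset_closure.trans hCcl)
  have IG : IntegrableOn (fun x => (φ x * θ x) ^ 2 * (⟪AL a (Du x) (wf Du H Y₁ Y x), wf Du H Y₁ Y x⟫ / ⟪Du x, Y₁⟫ ^ 2)) C := by
    have c1 : ContinuousOn (fun x => ⟪AL a (Du x) (wf Du H Y₁ Y x), wf Du H Y₁ Y x⟫) C :=
      (ContinuousOn.inner (𝕜 := ℝ) (S.M_contOn.clm_apply (S.wf_cont Y₁ Y)) (S.wf_cont Y₁ Y)).mono (subset_closure.trans hCcl)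
    have c2 : ContinuousOn (fun x => (φ x * θ x) ^ 2) C := (hφ.continuous.continuousOn.mul (θC.continuousOn.mono D.sub)).pow 2
    have c3 := c2.mul (c1.div (cC.pow 2) fun x hx => pow_ne_zero 2 (V1C x hx).ne')
    refine intg D.op.measurableSet hKc (c3.aestronglyMeasurable D.op.measurableSet) (BΦ * (BM * Bw * Bw / m ^ 2)) (fun x hx hxK => ?_)
      (fun x hx hxK => ?_)
    · rw [norm_mul]
      refine mul_le_mul ?_ ?_ (norm_nonneg _) hBΦ0
      · have : (φ x * θ x) ^ 2 = (φ x * φ x) * (θ x * θ x) := by ring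
        rw [this, norm_mul]
        calc _ ≤ BΦ * 1 := mul_le_mul (hBΦ x) (by rw [Real.norm_of_nonneg (mul_self_nonneg _)]; exact θθ x) (norm_nonneg _) hBΦ0
          _ = _ := mul_one _
      · rw [norm_div, Real.norm_of_nonneg (sq_nonneg ⟪Du x, Y₁⟫)]
        refine div_le_div₀ (by positivity) ?_ (by positivity) (pow_le_pow_left₀ hm.le (hmK x hxK) 2)
        exact (abs_real_inner_le_norm _ _).trans (mul_le_mul (bMw x hxK) (hBw x (hKcl hxK) hxK) (norm_nonneg _) (by positivity))
    · have : φ x * θ x = 0 := by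
        by_cases hxφ : x ∈ tsupport φ
        · rw [θz x (by
            by_contra hn
            exact hxK ⟨hxφ, subset_closure hx, (not_le.1 hn).le⟩), mul_zero]
        · rw [image_eq_zero_of_notMem_tsupport hxφ, zero_mul]
      rw [this]; simp
  have IE := S.en_int hφ hc
  have IEC := IE.mono_set D.sub
  obtain ⟨R, _, hR⟩ := S.th_en_bd Y hφ hc
  have IR := (hR ε hε).2.mono_set D.sub
  refine ⟨IG, ?_⟩
  have hpt : ∀ᵐ x ∂(volume.restrict C), (1 / 2) * ((φ x * θ x) ^ 2 * (⟪AL a (Du x) (wf Du H Y₁ Y x), wf Du H Y₁ Y x⟫ / ⟪Du x, Y₁⟫ ^ 2))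
      - (4 * ‖Y‖ ^ 2 * (‖Du x‖ ^ 2 * ⟪AL a (Du x) (gradient φ x), gradient φ x⟫) +
        4 * ⟪AL a (Du x) ((⟪Du x, Y⟫ * φ x) • gradient θ x), (⟪Du x, Y⟫ * φ x) • gradient θ x⟫)
      ≤ ⟪AL a (Du x) (wf Du H Y₁ Y x), gradient ζ x⟫ := by
    refine (ae_restrict_iff' D.op.measurableSet).2 ?_
    filter_upwards [hae] with x hx hxC
    have gΦ : gradient Φ x = (2 * φ x) • gradient φ x := by
      have := grad_mul hx hx
      refine this.trans ?_
      rw [← add_smul]; ring_nf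
    have gζ : gradient ζ x = h x • gradient Φ x + Φ x • gradient h x := by
      rw [(hζe x hxC).gradient_eq]
      exact grad_mul (dh x hxC) (hx.mul hx)
    rw [gζ, gΦ, gh x hxC]
    have hv : ⟪Du x, Y₁⟫ = V₁ x := rfl
    have hvy : ⟪Du x, Y⟫ = V x := rfl
    have hv0 := (V1C x hxC).ne'
    have hCS : V x ^ 2 ≤ ‖Du x‖ ^ 2 * ‖Y‖ ^ 2 := by
      rw [← mul_pow, ← sq_abs (V x)]
      exact pow_le_pow_left₀ (abs_nonneg _) (abs_real_inner_le_norm _ _) 2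
    have a1 := M_amgm S x ((φ x * θ x / V₁ x) • wf Du H Y₁ Y x) ((-2 * V x) • (θ x • gradient φ x + φ x • gradient θ x))
    have a2 := M_amgm S x (θ x • gradient φ x) (φ x • gradient θ x)
    have n1 := S.M_nonneg x (gradient φ x)
    have n2 := S.M_nonneg x (gradient θ x)
    have sy : ⟪AL a (Du x) (gradient θ x), gradient φ x⟫ = ⟪AL a (Du x) (gradient φ x), gradient θ x⟫ := by
      rw [AL_symm, real_inner_comm]
    rw [hv, hvy]
    simp only [map_add, map_smul, inner_add_left, inner_add_right, inner_smul_left, inner_smul_right, RCLike.conj_to_real, sy] at a1 a2 ⊢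
    simp only [hh, hΦ, hσ]
    generalize ⟪AL a (Du x) (wf Du H Y₁ Y x), wf Du H Y₁ Y x⟫ = G at *
    generalize ⟪AL a (Du x) (gradient φ x), gradient φ x⟫ = P at *
    generalize ⟪AL a (Du x) (gradient θ x), gradient θ x⟫ = T at *
    generalize ⟪AL a (Du x) (gradient φ x), gradient θ x⟫ = Q at *
    generalize ⟪AL a (Du x) (wf Du H Y₁ Y x), gradient φ x⟫ = WP at *
    generalize ⟪AL a (Du x) (wf Du H Y₁ Y x), gradient θ x⟫ = WT at *
    have t1 := θθ x
    have t0 := θ0 x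
    generalize θ x = t at *
    generalize φ x = p at *
    generalize V x = v at *
    generalize ‖Du x‖ ^ 2 = d at *
    generalize ‖Y‖ ^ 2 = y at *
    have k1 : v ^ 2 * (2 * (t * (p * Q))) ≤ v ^ 2 * (t * (t * P) + p * (p * T)) :=
      mul_le_mul_of_nonneg_left (by linarith) (sq_nonneg v)
    have k2 : v ^ 2 * (t * t) * P ≤ d * y * P := by
      refine mul_le_mul_of_nonneg_right ?_ n1
      calc v ^ 2 * (t * t) ≤ v ^ 2 * 1 := mul_le_mul_of_nonneg_left t1 (sq_nonneg v)
        _ ≤ _ := by linarith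
    have e1 : p * t / V₁ x * (p * t / V₁ x * G) = (p * t) ^ 2 * (G / V₁ x ^ 2) := by field_simp
    have e2 : ∀ A, v / V₁ x * (t * t) * (2 * p * A) = (p * t / V₁ x) * (2 * v * (t * A)) := fun A => by ring
    have e3 : ∀ A, p * p * (2 * (v / V₁ x) * t * A) = (p * t / V₁ x) * (2 * v * (p * A)) := fun A => by ring
    have e4 : p * p * (t * t / V₁ x ^ 2 * G) = (p * t) ^ 2 * (G / V₁ x ^ 2) := by ring
    rw [e1] at a1
    rw [e2, mul_add, e3, e4]
    nlinarith [a1, k1, k2]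
  have hI := integral_mono_ae ((IG.const_mul (1 / 2)).sub ((IEC.const_mul (4 * ‖Y‖ ^ 2)).add (IR.const_mul 4))) IZ hpt
  have hI2 : (1 / 2) * (∫ x in C, (φ x * θ x) ^ 2 * (⟪AL a (Du x) (wf Du H Y₁ Y x), wf Du H Y₁ Y x⟫ / ⟪Du x, Y₁⟫ ^ 2))
      - (4 * ‖Y‖ ^ 2 * (∫ x in C, ‖Du x‖ ^ 2 * ⟪AL a (Du x) (gradient φ x), gradient φ x⟫) +
        4 * ∫ x in C, ⟪AL a (Du x) ((⟪Du x, Y⟫ * φ x) • gradient θ x), (⟪Du x, Y⟫ * φ x) • gradient θ x⟫) ≤ 0 := by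
    have i2 : IntegrableOn (fun x => 4 * ‖Y‖ ^ 2 * (‖Du x‖ ^ 2 * ⟪AL a (Du x) (gradient φ x), gradient φ x⟫) +
        4 * ⟪AL a (Du x) ((⟪Du x, Y⟫ * φ x) • gradient θ x), (⟪Du x, Y⟫ * φ x) • gradient θ x⟫) C :=
      (IEC.const_mul (4 * ‖Y‖ ^ 2)).add (IR.const_mul 4)
    rw [← e0, ← integral_const_mul, ← integral_const_mul, ← integral_const_mul, ← integral_add (IEC.const_mul _) (IR.const_mul 4),
      ← integral_sub (IG.const_mul (1 / 2)) i2]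
    exact hI
  have hmono : ∫ x in C, ‖Du x‖ ^ 2 * ⟪AL a (Du x) (gradient φ x), gradient φ x⟫ ≤
      ∫ x in Ω, ‖Du x‖ ^ 2 * ⟪AL a (Du x) (gradient φ x), gradient φ x⟫ := by
    refine setIntegral_mono_set IE (Eventually.of_forall fun x => ?_) (LE.le.eventuallyLE D.sub)
    exact mul_nonneg (sq_nonneg _) (S.M_nonneg x _)
  have := mul_le_mul_of_nonneg_left hmono (show 0 ≤ 4 * ‖Y‖ ^ 2 by positivity)
  linarith

end


section

variable {Ω : Set (Eu n)} {η : Eu n → Eu n} {a f : ℝ → ℝ} {u : Eu n → ℝ} {Du : Eu n → Eu n} {H : Eu n → Eu n →L[ℝ] Eu n}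

variable {C B : Set (Eu n)} {s b : ℝ} {Y₁ : Eu n}

/-- the remainder produced by the cut-off near the critical set vanishes -/
lemma Side.rem_tendsto (D : Side Ω η u Du C B s b Y₁) (S : Dat Ω η a f u Du H) (Y : Eu n) {φ : Eu n → ℝ} {Lφ : NNReal}
    (hφ : LipschitzWith Lφ φ) (hc : HasCompactSupport φ) :
    Tendsto (fun k : ℕ => ∫ x in C, ⟪AL a (Du x) ((⟪Du x, Y⟫ * φ x) • gradient (th Du (1 / ((k : ℝ) + 1))) x),
      (⟪Du x, Y⟫ * φ x) • gradient (th Du (1 / ((k : ℝ) + 1))) x⟫) atTop (𝓝 0) := by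
  obtain ⟨R, hR0, hR⟩ := S.th_en_bd Y hφ hc
  obtain ⟨L, hL0, hL⟩ := S.th_bound
  have hpos : ∀ k : ℕ, (0 : ℝ) < 1 / ((k : ℝ) + 1) := fun k => by positivity
  have ht : Tendsto (fun k : ℕ => 1 / ((k : ℝ) + 1)) atTop (𝓝 0) := tendsto_one_div_add_atTop_nhds_zero_nat
  have h0 : (0 : ℝ) = ∫ x in C, (0 : ℝ) := by simp
  rw [h0]
  have hi : Integrable ((tsupport φ).indicator fun _ => R) (volume : Measure (Eu n)) :=
    (integrableOn_const (hc.measure_lt_top.ne)).integrable_indicator hc.measurableSet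
  refine tendsto_integral_of_dominated_convergence ((tsupport φ).indicator fun _ => R)
    (fun k => ((hR _ (hpos k)).2.mono_set D.sub).aestronglyMeasurable) hi.restrict
    (fun k => (ae_restrict_iff' D.op.measurableSet).2 (Eventually.of_forall fun x hx => ?_))
    ((ae_restrict_iff' D.op.measurableSet).2 (Eventually.of_forall fun x hx => ?_))
  · by_cases h : x ∈ tsupport φ
    · rw [indicator_of_mem h]; exact (hR _ (hpos k)).1 x (D.sub hx) h
    · rw [indicator_of_notMem h, image_eq_zero_of_notMem_tsupport h]; simp
  · refine Tendsto.congr' (f₁ := fun _ => (0:ℝ)) ?_ tendsto_const_nhds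
    have hD := norm_pos_iff.2 (D.Dne x hx)
    filter_upwards [ht.eventually (gt_mem_nhds (show (0:ℝ) < ‖Du x‖ / 2 by linarith))] with k hk
    have := (hL _ (hpos k) x (D.sub hx)).1 (by have := hpos k; nlinarith)
    rw [this]; simp

lemma Side.loc_en (D : Side Ω η u Du C B s b Y₁) (S : Dat Ω η a f u Du H) (Y : Eu n) {φ : Eu n → ℝ} {Lφ : NNReal}
    (hφ : LipschitzWith Lφ φ) (hc : HasCompactSupport φ) {Z : Set (Eu n)} (hZ : IsCompact Z) (hZC : Z ⊆ C) :
    (1 / 2) * ∫ x in Z, φ x ^ 2 * (⟪AL a (Du x) (wf Du H Y₁ Y x), wf Du H Y₁ Y x⟫ / ⟪Du x, Y₁⟫ ^ 2) ≤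
      4 * ‖Y‖ ^ 2 * (∫ x in Ω, ‖Du x‖ ^ 2 * ⟪AL a (Du x) (gradient φ x), gradient φ x⟫) := by
  have hpos : ∀ k : ℕ, (0 : ℝ) < 1 / ((k : ℝ) + 1) := fun k => by positivity
  have ht : Tendsto (fun k : ℕ => 1 / ((k : ℝ) + 1)) atTop (𝓝 0) := tendsto_one_div_add_atTop_nhds_zero_nat
  obtain ⟨m, hm, hmZ⟩ := hZ.exists_forall_le' (f := fun x => ‖Du x‖) (a := 0)
    ((S.hDuc.mono ((hZC.trans D.sub).trans subset_closure)).norm) (fun x hx => norm_pos_iff.2 (D.Dne x (hZC hx)))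
  have h1 := (tendsto_const_nhds (x := 4 * ‖Y‖ ^ 2 * (∫ x in Ω, ‖Du x‖ ^ 2 * ⟪AL a (Du x) (gradient φ x), gradient φ x⟫))).add
    ((D.rem_tendsto S Y hφ hc).const_mul 4)
  rw [mul_zero, add_zero] at h1
  refine ge_of_tendsto h1 ?_
  filter_upwards [ht.eventually (gt_mem_nhds (show (0:ℝ) < m / 2 by linarith))] with k hk
  obtain ⟨i1, i2⟩ := D.ineq S Y hφ hc (hpos k)
  refine le_trans ?_ i2
  refine mul_le_mul_of_nonneg_left ?_ (by norm_num)
  calc ∫ x in Z, φ x ^ 2 * (⟪AL a (Du x) (wf Du H Y₁ Y x), wf Du H Y₁ Y x⟫ / ⟪Du x, Y₁⟫ ^ 2)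
      = ∫ x in Z, (φ x * th Du (1 / ((k : ℝ) + 1)) x) ^ 2 * (⟪AL a (Du x) (wf Du H Y₁ Y x), wf Du H Y₁ Y x⟫ / ⟪Du x, Y₁⟫ ^ 2) := by
        refine setIntegral_congr_fun hZ.measurableSet fun x hx => ?_
        have h2 := hmZ x hx
        have h3 := hpos k
        rw [th_one (hpos k) (by nlinarith), mul_one]
    _ ≤ _ := setIntegral_mono_set i1 (Eventually.of_forall fun x =>
        mul_nonneg (sq_nonneg _) (div_nonneg (S.M_nonneg x _) (sq_nonneg _))) (LE.le.eventuallyLE hZC)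

/-- Liouville: the ratios of directional derivatives are locally constant -/
lemma Side.wf_zero (D : Side Ω η u Du C B s b Y₁) (S : Dat Ω η a f u Du H) (Y : Eu n) {x₀ : Eu n} (hx₀ : x₀ ∈ C) :
    wf Du H Y₁ Y x₀ = 0 := by
  by_contra hw
  set G : Eu n → ℝ := fun x => ⟪AL a (Du x) (wf Du H Y₁ Y x), wf Du H Y₁ Y x⟫ / ⟪Du x, Y₁⟫ ^ 2 with hG
  have hCcl : C ⊆ closure Ω := D.sub.trans subset_closure
  have cG : ContinuousOn G C := by
    have c1 : ContinuousOn (fun x => ⟪AL a (Du x) (wf Du H Y₁ Y x), wf Du H Y₁ Y x⟫) C :=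
      (ContinuousOn.inner (𝕜 := ℝ) (S.M_contOn.clm_apply (S.wf_cont Y₁ Y)) (S.wf_cont Y₁ Y)).mono hCcl
    have c2 : ContinuousOn (fun x => ⟪Du x, Y₁⟫) C := (ContinuousOn.inner (𝕜 := ℝ) S.hDuc continuousOn_const).mono hCcl
    exact c1.div (c2.pow 2) fun x hx => pow_ne_zero 2 (D.vC x hx).ne'
  have hG0 : 0 < G x₀ := by
    have h1 := ell_pos S.hapos S.hlam (Du x₀)
    have h2 := ell_le a (Du x₀) (wf Du H Y₁ Y x₀)
    have h3 := norm_pos_iff.2 hw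
    have h4 := D.vC x₀ hx₀
    have h5 : 0 < ⟪AL a (Du x₀) (wf Du H Y₁ Y x₀), wf Du H Y₁ Y x₀⟫ := lt_of_lt_of_le (by positivity) h2
    simp only [hG]
    positivity
  have hev : ∀ᶠ x in 𝓝 x₀, x ∈ C ∧ G x₀ / 2 < G x :=
    (D.op.eventually_mem hx₀).and ((cG.continuousAt (D.op.mem_nhds hx₀)).eventually (lt_mem_nhds (half_lt_self hG0)))
  obtain ⟨r, hr, hrb⟩ := Metric.nhds_basis_closedBall.eventually_iff.1 hev
  set Z := closedBall x₀ r with hZ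
  have hZc : IsCompact Z := isCompact_closedBall x₀ r
  have hZC : Z ⊆ C := fun x hx => (hrb hx).1
  have hvol : 0 < volume.real Z := by
    refine ENNReal.toReal_pos (measure_closedBall_pos volume x₀ hr).ne' hZc.measure_lt_top.ne
  obtain ⟨φ, φL, φc, φ0, φu, φt⟩ := S.meg'
  have hlow : ∀ᶠ j in atTop, (1 / 8) * (G x₀ / 2) * volume.real Z ≤
      4 * ‖Y‖ ^ 2 * (∫ x in Ω, ‖Du x‖ ^ 2 * ⟪AL a (Du x) (gradient (φ j) x), gradient (φ j) x⟫) := by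
    have hu := Metric.tendstoUniformlyOn_iff.1 (φu Z hZc (hZC.trans hCcl)) (1 / 2) (by norm_num)
    filter_upwards [hu] with j hj
    obtain ⟨Lj, hLj⟩ := φL j
    refine le_trans ?_ (D.loc_en S Y hLj (φc j) hZc hZC)
    have hi : IntegrableOn (fun x => φ j x ^ 2 * G x) Z :=
      ((hLj.continuous.pow 2).continuousOn.mul (cG.mono hZC)).integrableOn_compact hZc
    have hlb : ∀ x ∈ Z, (1 / 4) * (G x₀ / 2) ≤ φ j x ^ 2 * G x := by
      intro x hx
      have h1 := hj x hx
      rw [Real.dist_eq, abs_lt] at h1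
      have h2 := (hrb hx).2
      have h3 : 1 / 4 ≤ φ j x ^ 2 := by nlinarith
      exact mul_le_mul h3 h2.le (by positivity) (by positivity)
    have h4 := setIntegral_mono_on (integrableOn_const (hZc.measure_lt_top.ne)) hi hZc.measurableSet hlb
    rw [setIntegral_const, smul_eq_mul] at h4
    calc _ = 1 / 2 * (volume.real Z * (1 / 4 * (G x₀ / 2))) := by ring
      _ ≤ _ := mul_le_mul_of_nonneg_left h4 (by norm_num)
  have h5 := ge_of_tendsto (φt.const_mul (4 * ‖Y‖ ^ 2)) hlow
  rw [mul_zero] at h5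
  have : 0 < (1 / 8) * (G x₀ / 2) * volume.real Z := by positivity
  linarith

/-- the gradient has constant direction on a side -/
lemma Side.dir (D : Side Ω η u Du C B s b Y₁) (S : Dat Ω η a f u Du H) {x y : Eu n} (hx : x ∈ C) (hy : y ∈ C) :
    ⟪Du x, Y₁⟫ • Du y = ⟪Du y, Y₁⟫ • Du x := by
  have key : ∀ Y : Eu n, ⟪Du x, Y⟫ / ⟪Du x, Y₁⟫ = ⟪Du y, Y⟫ / ⟪Du y, Y₁⟫ := by
    intro Y
    have hd : ∀ z ∈ C, HasFDerivAt (fun y => ⟪Du y, Y⟫ / ⟪Du y, Y₁⟫) (0 : Eu n →L[ℝ] ℝ) z := by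
      intro z hz
      obtain ⟨h1, h2⟩ := S.sig Y (D.sub hz) (D.vC z hz).ne'
      rw [D.wf_zero S Y hz, smul_zero] at h2
      have h3 := h1.hasFDerivAt
      refine h3.congr_fderiv (ContinuousLinearMap.ext fun w => ?_)
      have := inner_gradient_left (𝕜 := ℝ) (f := fun y => ⟪Du y, Y⟫ / ⟪Du y, Y₁⟫) (x := z) (y := w)
      rw [← this, h2]; simp
    exact D.op.is_const_of_fderiv_eq_zero D.pre (fun z hz => (hd z hz).differentiableAt.differentiableWithinAt)
      (fun z hz => (hd z hz).fderiv) hx hy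
  refine ext_inner_right ℝ fun Y => ?_
  have h := key Y
  rw [div_eq_div_iff (D.vC x hx).ne' (D.vC y hy).ne'] at h
  simp only [inner_smul_left, RCLike.conj_to_real]
  linarith

end


section

variable {Ω : Set (Eu n)} {η : Eu n → Eu n} {a f : ℝ → ℝ} {u : Eu n → ℝ} {Du : Eu n → Eu n} {H : Eu n → Eu n →L[ℝ] Eu n}

variable {C B : Set (Eu n)} {s b : ℝ} {Y₁ : Eu n}

lemma Side.clC (D : Side Ω η u Du C B s b Y₁) {p : Eu n} (hp : p ∈ B) : p ∈ closure C := by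
  obtain ⟨ρ, hρ, h⟩ := D.near p hp
  have hcl : p ∈ closure Ω := frontier_subset_closure (D.Bsub hp)
  rw [Metric.mem_closure_iff] at hcl ⊢
  intro ε hε
  obtain ⟨y, hy, hd⟩ := hcl (min ε ρ) (lt_min hε hρ)
  exact ⟨y, h ⟨hy, by rw [mem_ball, dist_comm]; exact hd.trans_le (min_le_right _ _)⟩, hd.trans_le (min_le_left _ _)⟩

/-- the gradient direction is constant on a side -/
lemma Side.exists_e (D : Side Ω η u Du C B s b Y₁) (S : Dat Ω η a f u Du H) (hB : B.Nonempty) :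
    ∃ e : Eu n, ‖e‖ = 1 ∧ (∀ x ∈ C, Du x = (s * ‖Du x‖) • e) ∧ ∀ p ∈ B, η p = e := by
  obtain ⟨p₀, hp₀⟩ := hB
  obtain ⟨x₀, hx₀⟩ : C.Nonempty := closure_nonempty_iff.1 ⟨p₀, D.clC hp₀⟩
  have hn0 : 0 < ‖Du x₀‖ := norm_pos_iff.2 (D.Dne x₀ hx₀)
  have hs1 : |s| = 1 := by
    have := D.ss
    rw [← abs_mul_abs_self] at this
    nlinarith [abs_nonneg s]
  have hC : ∀ x ∈ C, Du x = (s * ‖Du x‖) • ((s / ‖Du x₀‖) • Du x₀) := by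
    intro x hx
    have hd := D.dir S hx₀ hx
    have h1 := D.vC x hx
    have h2 := D.vC x₀ hx₀
    have h3 : Du x = (⟪Du x, Y₁⟫ / ⟪Du x₀, Y₁⟫) • Du x₀ := by
      rw [div_eq_inv_mul, mul_smul, ← hd, smul_smul, inv_mul_cancel₀ h2.ne', one_smul]
    have h4 : ‖Du x‖ = (⟪Du x, Y₁⟫ / ⟪Du x₀, Y₁⟫) * ‖Du x₀‖ := by
      conv_lhs => rw [h3]
      rw [norm_smul, Real.norm_of_nonneg (by positivity)]
    rw [smul_smul, h4]
    have h5 : s * (⟪Du x, Y₁⟫ / ⟪Du x₀, Y₁⟫ * ‖Du x₀‖) * (s / ‖Du x₀‖) = ⟪Du x, Y₁⟫ / ⟪Du x₀, Y₁⟫ := by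
      have := D.ss
      field_simp
      nlinarith
    rw [h5]; exact h3
  refine ⟨(s / ‖Du x₀‖) • Du x₀, ?_, hC, fun p hp => ?_⟩
  · rw [norm_smul, Real.norm_eq_abs, abs_div, hs1, abs_of_pos hn0]; field_simp
  set e := (s / ‖Du x₀‖) • Du x₀ with he
  clear_value e
  have hcl : p ∈ closure C := D.clC hp
  have hsub : closure C ⊆ closure Ω := closure_mono D.sub
  have hDp : Du p = (s * ‖Du p‖) • e := by
    have hc : ContinuousOn (fun x => Du x - (s * ‖Du x‖) • e) (closure C) := by
      have := S.hDuc.mono hsub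
      fun_prop
    have : Set.EqOn (fun x => Du x - (s * ‖Du x‖) • e) (fun _ => 0) (closure C) := by
      refine Set.EqOn.of_subset_closure (s := C) (fun x hx => ?_) hc continuousOn_const subset_closure le_rfl
      exact sub_eq_zero.2 (hC x hx)
    exact sub_eq_zero.1 (this hcl)
  have hN := S.Du_normal (D.Bsub hp)
  have hu := S.unitη (D.Bsub hp)
  have hg := D.sg p hp
  set c := ⟪Du p, η p⟫ with hc
  clear_value c
  have hnc : ‖Du p‖ = |c| := by rw [hN, norm_smul, hu, mul_one, Real.norm_eq_abs]
  have hsc : s * |c| = c := by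
    have h1 : |s * c| = s * c := abs_of_pos hg
    rw [abs_mul, hs1, one_mul] at h1
    rw [h1, ← mul_assoc, D.ss, one_mul]
  rw [hnc, hsc, hN] at hDp
  have hc0 : c ≠ 0 := by rintro rfl; simp at hg
  exact smul_right_injective _ hc0 hDp

lemma Side.segment (D : Side Ω η u Du C B s b Y₁) (S : Dat Ω η a f u Du H) {e : Eu n}
    (he : ∀ x ∈ C, Du x = (s * ‖Du x‖) • e) {x w : Eu n} (hw : ⟪w, e⟫ = 0) {t : ℝ}
    (hseg : ∀ τ, 0 ≤ τ → τ < t → x + τ • w ∈ C) :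
    ∀ τ, 0 ≤ τ → τ < t → u (x + τ • w) = u x ∧ Du (x + τ • w) = Du x := by
  have hz : ∀ z ∈ C, ⟪Du z, w⟫ = 0 := fun z hz => by
    rw [he z hz, inner_smul_left, real_inner_comm, hw, mul_zero]
  have hHz : ∀ z ∈ C, ∀ v, ⟪H z v, w⟫ = 0 := by
    intro z hzC v
    have h1 : HasFDerivAt (fun y => ⟪Du y, w⟫) ((innerSL ℝ w).comp (H z)) z := by
      have := ((innerSL ℝ w).hasFDerivAt (x := Du z)).comp z (S.hasD2 (D.sub hzC))
      refine this.congr_of_eventuallyEq (Eventually.of_forall fun y => ?_)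
      simp [real_inner_comm]
    have h2 : HasFDerivAt (fun y => ⟪Du y, w⟫) (0 : Eu n →L[ℝ] ℝ) z := by
      refine (hasFDerivAt_const (0:ℝ) z).congr_of_eventuallyEq ?_
      filter_upwards [D.op.mem_nhds hzC] with y hy using hz y hy
    have h3 := DFunLike.congr_fun (h1.unique h2) v
    simpa [real_inner_comm] using h3
  have hHw : ∀ z ∈ C, H z w = 0 := by
    intro z hzC
    have h1 : ∀ v, ⟪H z w, v⟫ = 0 := fun v => by
      have := S.Hsymm (D.sub hzC) w v
      have h2 := hHz z hzC v
      linarith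
    exact inner_self_eq_zero.1 (h1 _)
  intro τ h0 hτ
  have hl : ∀ r : ℝ, HasDerivAt (fun r : ℝ => x + r • w) w r := fun r => by
    simpa using ((hasDerivAt_id r).smul_const w).const_add x
  have hi : ∀ r ∈ Icc 0 τ, x + r • w ∈ C := fun r hr => hseg r hr.1 (hr.2.trans_lt hτ)
  have hu' : ∀ r ∈ Icc 0 τ, HasDerivAt (fun r : ℝ => u (x + r • w)) 0 r := fun r hr => by
    have := (S.hasD1 (D.sub (hi r hr))).comp_hasDerivAt r (hl r)
    rwa [innerSL_apply_apply, hz _ (hi r hr)] at this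
  have hD' : ∀ r ∈ Icc 0 τ, HasDerivAt (fun r : ℝ => Du (x + r • w)) 0 r := fun r hr => by
    have := (S.hasD2 (D.sub (hi r hr))).comp_hasDerivAt r (hl r)
    rwa [hHw _ (hi r hr)] at this
  have c1 := constant_of_has_deriv_right_zero (fun r hr => (hu' r hr).continuousAt.continuousWithinAt)
    (fun r hr => (hu' r ⟨hr.1, hr.2.le⟩).hasDerivWithinAt) τ ⟨h0, le_rfl⟩
  have c2 := constant_of_has_deriv_right_zero (fun r hr => (hD' r hr).continuousAt.continuousWithinAt)
    (fun r hr => (hD' r ⟨hr.1, hr.2.le⟩).hasDerivWithinAt) τ ⟨h0, le_rfl⟩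
  exact ⟨by simpa using c1, by simpa using c2⟩

lemma Side.inv (D : Side Ω η u Du C B s b Y₁) (S : Dat Ω η a f u Du H) {e : Eu n}
    (he : ∀ x ∈ C, Du x = (s * ‖Du x‖) • e) {x w : Eu n} (hw : ⟪w, e⟫ = 0) (hx : x ∈ C) : x + w ∈ C := by
  by_contra hn
  obtain ⟨t, ht, -, hf, hs⟩ := exit_lemma D.op (T := 1) (w := w) zero_le_one hx (by simpa using hn)
  have hcon := D.segment S he hw hs
  have hycl : x + t • w ∈ closure C := frontier_subset_closure hf
  have hl : Tendsto (fun r : ℝ => x + r • w) (𝓝[<] t) (𝓝[Ω] (x + t • w)) := by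
    refine tendsto_nhdsWithin_iff.2 ⟨?_, ?_⟩
    · exact ((by fun_prop : Continuous fun r : ℝ => x + r • w).tendsto t).mono_left nhdsWithin_le_nhds
    · filter_upwards [Ioo_mem_nhdsLT ht] with r hr using D.sub (hs r hr.1.le hr.2)
  have hl' := hl.mono_right (nhdsWithin_mono _ (subset_closure (s := Ω)))
  have hycl' := closure_mono D.sub hycl
  have hDy : Du (x + t • w) = Du x := by
    refine tendsto_nhds_unique ((S.hDuc _ hycl').tendsto.comp hl') ?_
    refine tendsto_const_nhds.congr' ?_
    filter_upwards [Ioo_mem_nhdsLT ht] with r hr using ((hcon r hr.1.le hr.2).2).symm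
  have huy : u (x + t • w) = u x := by
    refine tendsto_nhds_unique ((S.hucl _ hycl').tendsto.comp hl') ?_
    refine tendsto_const_nhds.congr' ?_
    filter_upwards [Ioo_mem_nhdsLT ht] with r hr using ((hcon r hr.1.le hr.2).1).symm
  rw [D.op.frontier_eq] at hf
  rcases D.cl _ hycl (by rw [hDy]; exact D.Dne x hx) with h | h
  · exact hf.2 h
  obtain ⟨N, hN, hBN, h1, -⟩ := D.nbhd S
  have hev : ∀ᶠ r in 𝓝[<] t, x + r • w ∈ N := (hl.mono_right nhdsWithin_le_nhds).eventually (hN.mem_nhds (hBN h))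
  obtain ⟨r, hr1, hr2⟩ := (hev.and (Ioo_mem_nhdsLT ht)).exists
  have h2 := h1 _ hr1 (D.sub (hs r hr2.1.le hr2.2))
  rw [(hcon r hr2.1.le hr2.2).1, ← huy, D.ub _ h] at h2
  simp at h2

/-- geometry of a side -/
lemma Side.geom (D : Side Ω η u Du C B s b Y₁) (S : Dat Ω η a f u Du H) (hB : B.Nonempty) :
    ∃ (e : Eu n) (k : ℝ) (I : Set ℝ), ‖e‖ = 1 ∧ B = {x | ⟪x, e⟫ = k} ∧ OrdConnected I ∧ C = {x | ⟪x, e⟫ ∈ I} ∧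
      (∀ i ∈ I, k < i) ∧ (∃ δ > 0, Ioo k (k + δ) ⊆ I) ∧ (∀ x ∈ Ω, k < ⟪x, e⟫) ∧
      ∀ x ∈ C, Du x = (s * ‖Du x‖) • e := by
  obtain ⟨e, he1, heC, heB⟩ := D.exists_e S hB
  have hlc : Continuous fun x : Eu n => ⟪x, e⟫ := by fun_prop
  set I : Set ℝ := (fun x : Eu n => ⟪x, e⟫) '' C with hI
  have hee : ⟪e, e⟫ = 1 := by rw [real_inner_self_eq_norm_sq, he1]; norm_num
  have hCI : ∀ x : Eu n, x ∈ C ↔ ⟪x, e⟫ ∈ I := by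
    intro x
    refine ⟨fun h => ⟨x, h, rfl⟩, ?_⟩
    rintro ⟨y, hy, hxy⟩
    have := D.inv S heC (w := x - y) (by rw [inner_sub_left]; exact sub_eq_zero.2 hxy.symm) hy
    simpa using this
  have hIo : OrdConnected I := (D.pre.image _ hlc.continuousOn).ordConnected
  have hk : ∀ p ∈ B, (∀ i ∈ I, ⟪p, e⟫ < i) ∧ ∃ δ > 0, Ioo ⟪p, e⟫ (⟪p, e⟫ + δ) ⊆ I := by
    intro p hp
    have hpf := D.Bsub hp
    have hpn : ⟪p, e⟫ ∉ I := fun h => by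
      have := D.sub ((hCI p).2 h)
      rw [S.op.frontier_eq] at hpf; exact hpf.2 this
    obtain ⟨r, K, hch⟩ := exists_chart S.dom hpf
    rw [heB p hp] at hch
    obtain ⟨ρ, hρ, hnear⟩ := D.near p hp
    have hr := hch.hr
    have hK := hch.hK
    set δ : ℝ := min (min r ρ) (1 / K) with hδ
    have hδ0 : 0 < δ := by positivity
    have hd1 : δ ≤ r := (min_le_left _ _).trans (min_le_left _ _)
    have hd2 : δ ≤ ρ := (min_le_left _ _).trans (min_le_right _ _)
    have hd3 : K * δ ≤ 1 := by
      have : δ ≤ 1 / K := min_le_right _ _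
      rw [le_div_iff₀ hK] at this; linarith
    clear_value δ
    have hsub : Ioo ⟪p, e⟫ (⟪p, e⟫ + δ) ⊆ I := by
      intro i hi
      set t := i - ⟪p, e⟫ with ht
      have ht0 : 0 < t := by linarith [hi.1]
      have htδ : t < δ := by linarith [hi.2]
      have e1 : p + t • e - p = t • e := by abel
      have nt : ‖t • e‖ = t := by rw [norm_smul, he1, mul_one, Real.norm_of_nonneg ht0.le]
      have hin : p + t • e ∈ Ω := by
        refine hch.ins _ (by rw [e1, nt]; linarith) (fun h => ?_) ?_
        · have : t • e = 0 := by rw [← e1, h, sub_self]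
          rw [this, norm_zero] at nt; linarith
        · rw [e1, nt, inner_smul_left, hee]; simp only [RCLike.conj_to_real, mul_one]; nlinarith
      have hC : p + t • e ∈ C := hnear ⟨hin, by rw [mem_ball, dist_eq_norm, e1, nt]; linarith⟩
      have := (hCI _).1 hC
      rw [inner_add_left, inner_smul_left, hee] at this
      simpa [ht] using this
    refine ⟨fun i hi => ?_, δ, hδ0, hsub⟩
    by_contra! hle
    have h2 : ⟪p, e⟫ + δ / 2 ∈ I := hsub ⟨by linarith, by linarith⟩
    exact hpn (hIo.out hi h2 ⟨hle, by linarith⟩)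
  obtain ⟨p, hp⟩ := hB
  obtain ⟨hk1, δ, hδ, hk2⟩ := hk p hp
  have hBeq : B = {x | ⟪x, e⟫ = ⟪p, e⟫} := by
    ext x
    change x ∈ B ↔ ⟪x, e⟫ = ⟪p, e⟫
    constructor
    · intro hx
      obtain ⟨hx1, δ', hδ', hx2⟩ := hk x hx
      by_contra hne
      rcases lt_or_gt_of_ne hne with h | h
      · have m := lt_min hδ' (sub_pos.2 h)
        have m1 := min_le_left δ' (⟪p, e⟫ - ⟪x, e⟫)
        have m2 := min_le_right δ' (⟪p, e⟫ - ⟪x, e⟫)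
        have := hk1 _ (hx2 (a := ⟪x, e⟫ + min δ' (⟪p, e⟫ - ⟪x, e⟫) / 2) ⟨by linarith, by linarith⟩)
        linarith
      · have m := lt_min hδ (sub_pos.2 h)
        have m1 := min_le_left δ (⟪x, e⟫ - ⟪p, e⟫)
        have m2 := min_le_right δ (⟪x, e⟫ - ⟪p, e⟫)
        have := hx1 _ (hk2 (a := ⟪p, e⟫ + min δ (⟪x, e⟫ - ⟪p, e⟫) / 2) ⟨by linarith, by linarith⟩)
        linarith
    · intro hx
      have hl : ∀ y : Eu n, ⟪y, e⟫ = ⟪p, e⟫ → Tendsto (fun t : ℝ => y + t • e) (𝓝[>] 0) (𝓝[C] y) := by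
        intro y hy
        refine tendsto_nhdsWithin_iff.2 ⟨?_, ?_⟩
        · have := ((by fun_prop : Continuous fun t : ℝ => y + t • e).tendsto 0).mono_left
            (nhdsWithin_le_nhds (s := Ioi 0))
          simpa using this
        · filter_upwards [Ioo_mem_nhdsGT hδ] with t ht
          rw [hCI, inner_add_left, inner_smul_left, hee, hy]
          refine hk2 ?_
          simp only [RCLike.conj_to_real, mul_one]
          exact ⟨by linarith [ht.1], by linarith [ht.2]⟩
      have hxcl : x ∈ closure C := mem_closure_iff_nhdsWithin_neBot.2 ((hl x hx).neBot)
      have hpcl : p ∈ closure C := D.clC hp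
      have hD : ∀ y ∈ closure C, ⟪y, e⟫ = ⟪p, e⟫ → Tendsto (fun t : ℝ => Du (y + t • e)) (𝓝[>] 0) (𝓝 (Du y)) := by
        intro y hy hye
        exact (S.hDuc y (closure_mono D.sub hy)).tendsto.comp
          ((hl y hye).mono_right (nhdsWithin_mono _ (D.sub.trans subset_closure)))
      have hDx : Du x = Du p := by
        refine tendsto_nhds_unique (hD x hxcl hx) ((hD p hpcl rfl).congr' ?_)
        filter_upwards [Ioo_mem_nhdsGT hδ] with t ht
        have hw : ⟪x - p, e⟫ = 0 := by rw [inner_sub_left]; exact sub_eq_zero.2 hx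
        have hpt : p + t • e ∈ C := by
          rw [hCI, inner_add_left, inner_smul_left, hee]
          refine hk2 ?_
          simp only [RCLike.conj_to_real, mul_one]
          exact ⟨by linarith [ht.1], by linarith [ht.2]⟩
        have := (D.segment S heC (x := p + t • e) (w := x - p) hw (t := 2)
          (fun τ _ _ => D.inv S heC (by rw [inner_smul_left, hw, mul_zero]) hpt) 1 zero_le_one (by norm_num)).2
        rw [← this]; congr 1; rw [one_smul]; abel
      have hDp : Du p ≠ 0 := fun h => by
        have := D.sg p hp
        rw [h] at this; simp at this
      rcases D.cl x hxcl (by rw [hDx]; exact hDp) with h | h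
      · have := hk1 _ ((hCI x).1 h)
        rw [hx] at this; exact absurd this (lt_irrefl _)
      · exact h
  refine ⟨e, ⟪p, e⟫, I, he1, hBeq, hIo, ?_, hk1, ⟨δ, hδ, hk2⟩, ?_, heC⟩
  · ext x; exact hCI x
  · intro x hx
    by_contra! hle
    have h2 : ⟪p, e⟫ + δ / 2 ∈ I := hk2 ⟨by linarith, by linarith⟩
    obtain ⟨y, hy, hye⟩ := h2
    have hye' : ⟪y, e⟫ = ⟪p, e⟫ + δ / 2 := hye
    obtain ⟨z, hz, hze⟩ := (S.pre.image _ hlc.continuousOn).ordConnected.out (mem_image_of_mem _ hx)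
      (mem_image_of_mem _ (D.sub hy)) (show ⟪p, e⟫ ∈ Icc ⟪x, e⟫ ⟪y, e⟫ from ⟨hle, by rw [hye']; linarith⟩)
    have hzB : z ∈ B := by rw [hBeq]; exact hze
    have := D.Bsub hzB
    rw [S.op.frontier_eq] at this
    exact this.2 hz

end


section

variable {Ω : Set (Eu n)} {η : Eu n → Eu n} {a f : ℝ → ℝ} {u : Eu n → ℝ} {Du : Eu n → Eu n} {H : Eu n → Eu n →L[ℝ] Eu n}

/-- the regular set -/
def Reg (Ω : Set (Eu n)) (Du : Eu n → Eu n) : Set (Eu n) := {x | x ∈ Ω ∧ Du x ≠ 0}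

lemma Dat.Reg_open (S : Dat Ω η a f u Du H) : IsOpen (Reg Ω Du) := by
  rw [isOpen_iff_mem_nhds]
  rintro x ⟨hx, hne⟩
  have h1 := (S.hDuc.continuousAt (mem_of_superset (S.op.mem_nhds hx) subset_closure)).eventually_ne hne
  filter_upwards [h1, S.op.mem_nhds hx] with y hy hyΩ using ⟨hyΩ, hy⟩

lemma comp_eq_of_meet {D : Set (Eu n)} {x y z : Eu n} (h1 : z ∈ connectedComponentIn D x)
    (h2 : z ∈ connectedComponentIn D y) : connectedComponentIn D x = connectedComponentIn D y :=
  (connectedComponentIn_eq h1).trans (connectedComponentIn_eq h2).symm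

lemma exists_near {p : Eu n} (hp : p ∈ frontier Ω) {ρ : ℝ} (hρ : 0 < ρ) : ∃ y ∈ Ω, y ∈ ball p ρ := by
  have hcl : p ∈ closure Ω := frontier_subset_closure hp
  rw [Metric.mem_closure_iff] at hcl
  obtain ⟨y, hy, hd⟩ := hcl ρ hρ
  exact ⟨y, hy, by rwa [mem_ball, dist_comm]⟩

lemma Dat.near_comp (S : Dat Ω η a f u Du H) {p : Eu n} (hp : p ∈ frontier Ω) (h : Du p ≠ 0) :
    ∃ ρ > 0, ∃ x ∈ Reg Ω Du, Ω ∩ ball p ρ ⊆ connectedComponentIn (Reg Ω Du) x := by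
  have hcl : p ∈ closure Ω := frontier_subset_closure hp
  have h1 : ∀ᶠ y in 𝓝[closure Ω] p, Du y ≠ 0 := (S.hDuc p hcl).eventually_ne h
  obtain ⟨ε, hε, hb⟩ := Metric.mem_nhdsWithin_iff.1 h1
  obtain ⟨r, K, hch⟩ := exists_chart S.dom hp
  obtain ⟨ρ, hρ, W, hW, hWΩ, hWb, hW2⟩ := hch.lconn hε
  obtain ⟨x, hx, hxb⟩ := exists_near hp hρ
  have hWR : W ⊆ Reg Ω Du := fun y hy => ⟨hWΩ hy, hb ⟨hWb hy, subset_closure (hWΩ hy)⟩⟩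
  have hxW := hW2 ⟨hx, hxb⟩
  exact ⟨ρ, hρ, x, hWR hxW, hW2.trans (hW.subset_connectedComponentIn hxW hWR)⟩

/-- one component of the regular set is adjacent to a whole boundary component -/
lemma Dat.side_comp (S : Dat Ω η a f u Du H) {p₀ : Eu n} (hp₀ : p₀ ∈ frontier Ω) (hc : ⟪Du p₀, η p₀⟫ ≠ 0) :
    ∃ z ∈ Reg Ω Du, ∀ p ∈ connectedComponentIn (frontier Ω) p₀, ∃ ρ > 0,
      Ω ∩ ball p ρ ⊆ connectedComponentIn (Reg Ω Du) z := by
  have hne : ∀ p ∈ connectedComponentIn (frontier Ω) p₀, Du p ≠ 0 := by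
    intro p hp h
    rw [S.Du_ne_iff (connectedComponentIn_subset _ _ hp), (S.comp_const hp₀ hp).2] at h
    exact hc h
  have hp₀' := mem_connectedComponentIn hp₀
  obtain ⟨ρ₀, hρ₀, z, hz, hzs⟩ := S.near_comp hp₀ (hne p₀ hp₀')
  refine ⟨z, hz, ?_⟩
  have hop : ∀ Q : Set (Eu n) → Prop, IsOpen {p : Eu n | ∃ ρ > 0, ∃ A, Q A ∧ Ω ∩ ball p ρ ⊆ A} := by
    intro Q
    rw [Metric.isOpen_iff]
    rintro p ⟨ρ, hρ, A, hA, hs⟩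
    refine ⟨ρ / 2, by positivity, fun q hq => ⟨ρ / 2, by positivity, A, hA, fun y hy => hs ⟨hy.1, ?_⟩⟩⟩
    have h1 := hy.2
    rw [mem_ball] at hq h1 ⊢
    linarith [dist_triangle y q p]
  have o1 := hop (fun A => A = connectedComponentIn (Reg Ω Du) z)
  have o2 := hop (fun A => ∃ x, A = connectedComponentIn (Reg Ω Du) x ∧ A ≠ connectedComponentIn (Reg Ω Du) z)
  have hcov : connectedComponentIn (frontier Ω) p₀ ⊆
      {p : Eu n | ∃ ρ > 0, ∃ A, A = connectedComponentIn (Reg Ω Du) z ∧ Ω ∩ ball p ρ ⊆ A} ∪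
      {p : Eu n | ∃ ρ > 0, ∃ A, (∃ x, A = connectedComponentIn (Reg Ω Du) x ∧ A ≠ connectedComponentIn (Reg Ω Du) z) ∧
        Ω ∩ ball p ρ ⊆ A} := by
    intro p hp
    obtain ⟨ρ, hρ, x, hx, hs⟩ := S.near_comp (connectedComponentIn_subset _ _ hp) (hne p hp)
    by_cases h : connectedComponentIn (Reg Ω Du) x = connectedComponentIn (Reg Ω Du) z
    · exact Or.inl ⟨ρ, hρ, _, h, hs⟩
    · exact Or.inr ⟨ρ, hρ, _, ⟨x, rfl, h⟩, hs⟩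
  intro p hp
  rcases hcov hp with ⟨ρ, hρ, A, rfl, hs⟩ | h2
  · exact ⟨ρ, hρ, hs⟩
  exfalso
  obtain ⟨q, hq, ⟨ρ, hρ, A, hA, hs⟩, ρ', hρ', A', ⟨x, hx1, hx2⟩, hs'⟩ :=
    isPreconnected_connectedComponentIn (x := p₀) (F := frontier Ω) _ _ o1 o2 hcov ⟨p₀, hp₀', ρ₀, hρ₀, _, rfl, hzs⟩ ⟨p, hp, h2⟩
  obtain ⟨y, hy, hyb⟩ := exists_near (connectedComponentIn_subset _ _ hq) (lt_min hρ hρ')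
  have m1 := hs ⟨hy, ball_subset_ball (min_le_left _ _) hyb⟩
  have m2 := hs' ⟨hy, ball_subset_ball (min_le_right _ _) hyb⟩
  subst hA hx1
  exact hx2 (comp_eq_of_meet m2 m1)

/-- construction of a side -/
lemma Dat.mkSide (S : Dat Ω η a f u Du H) {p₀ X : Eu n} (hp₀ : p₀ ∈ frontier Ω) (hc : ⟪Du p₀, η p₀⟫ ≠ 0)
    (htr : ∀ p ∈ connectedComponentIn (frontier Ω) p₀, 0 ≤ ⟪η p, X⟫)
    (htr' : ∃ p ∈ connectedComponentIn (frontier Ω) p₀, ⟪η p, X⟫ ≠ 0) {z : Eu n}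
    (hnear : ∀ p ∈ connectedComponentIn (frontier Ω) p₀, ∃ ρ > 0,
      Ω ∩ ball p ρ ⊆ connectedComponentIn (Reg Ω Du) z)
    (hcl : ∀ x ∈ closure (connectedComponentIn (Reg Ω Du) z), Du x ≠ 0 →
      x ∈ connectedComponentIn (Reg Ω Du) z ∨ x ∈ connectedComponentIn (frontier Ω) p₀)
    {x₀ : Eu n} (hx₀ : x₀ ∈ Ω) (h0 : Du x₀ = 0) :
    ∃ s : ℝ, Side Ω η u Du (connectedComponentIn (Reg Ω Du) z) (connectedComponentIn (frontier Ω) p₀) s (u p₀)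
      (⟪Du p₀, η p₀⟫ • X) := by
  set c := ⟪Du p₀, η p₀⟫ with hcd
  set C := connectedComponentIn (Reg Ω Du) z with hC
  set B := connectedComponentIn (frontier Ω) p₀ with hB
  have hCR : C ⊆ Reg Ω Du := connectedComponentIn_subset _ _
  have hCΩ : C ⊆ Ω := fun x hx => (hCR hx).1
  have hCo : IsOpen C := S.Reg_open.connectedComponentIn
  have hCp : IsPreconnected C := isPreconnected_connectedComponentIn
  have hBf : B ⊆ frontier Ω := connectedComponentIn_subset _ _
  have hcc : ∀ p ∈ B, u p = u p₀ ∧ ⟪Du p, η p⟫ = c := fun p hp => S.comp_const hp₀ hp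
  have hDB : ∀ p ∈ B, Du p = c • η p := fun p hp => by
    have := S.Du_normal (hBf hp)
    rwa [(hcc p hp).2] at this
  have hip : ∀ p ∈ B, ⟪Du p, c • X⟫ = c ^ 2 * ⟪η p, X⟫ := fun p hp => by
    rw [hDB p hp, inner_smul_left, inner_smul_right]
    simp only [RCLike.conj_to_real]; ring
  clear_value c C B
  have hc2 : 0 < c ^ 2 := by positivity
  have hnn : ∀ x ∈ C, 0 ≤ ⟪Du x, c • X⟫ := by
    intro x hx
    have := S.nonpos hCo hCΩ (Y := -(c • X)) (fun y hy hyn => ?_) hx₀ h0 x hx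
    · rw [inner_neg_right] at this; linarith
    · by_cases hD : Du y = 0
      · rw [hD, inner_zero_left]
      · have hyB := (hcl y hy hD).resolve_left hyn
        rw [inner_neg_right, hip y hyB]
        have := mul_nonneg hc2.le (htr y hyB)
        linarith
  obtain ⟨q, hq, hqX⟩ := htr'
  have hqpos : 0 < ⟪Du q, c • X⟫ := by
    rw [hip q hq]; exact mul_pos hc2 (lt_of_le_of_ne (htr q hq) hqX.symm)
  have hqcl : q ∈ closure Ω := frontier_subset_closure (hBf hq)
  have hcont : ContinuousWithinAt (fun x => ⟪Du x, c • X⟫) (closure Ω) q :=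
    (S.hDuc q hqcl).inner (𝕜 := ℝ) continuousWithinAt_const
  have hev : ∀ᶠ x in 𝓝[closure Ω] q, 0 < ⟪Du x, c • X⟫ := hcont.eventually (lt_mem_nhds hqpos)
  obtain ⟨ε, hε, hb⟩ := Metric.mem_nhdsWithin_iff.1 hev
  obtain ⟨ρ, hρ, hs⟩ := hnear q hq
  obtain ⟨y, hy, hyb⟩ := exists_near (hBf hq) (lt_min hε hρ)
  have hyC : y ∈ C := hs ⟨hy, ball_subset_ball (min_le_right _ _) hyb⟩
  have hypos : 0 < ⟪Du y, c • X⟫ := hb ⟨ball_subset_ball (min_le_left _ _) hyb, subset_closure hy⟩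
  have hvC := S.v_smp hCo hCΩ hCp hnn hyC hypos
  refine ⟨SignType.sign c, ?_⟩
  refine { op := hCo, sub := hCΩ, pre := hCp, Dne := fun x hx => (hCR hx).2, cl := hcl, Bsub := hBf, near := hnear,
           ub := fun p hp => (hcc p hp).1, ss := ?_, sg := fun p hp => ?_, vC := hvC, vB := fun p hp => ?_ }
  · rcases lt_or_gt_of_ne hc with h | h
    · rw [sign_neg h]; norm_num
    · rw [sign_pos h]; norm_num
  · rw [(hcc p hp).2, sign_mul_self]; exact abs_pos.2 hc
  · obtain ⟨ρ, hρ, hs⟩ := hnear p hp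
    have := S.hopf hCo hCΩ hvC (hBf hp) hρ hs (by rw [(hcc p hp).2]; exact hc)
    rw [inner_smul_right] at this
    rw [hip p hp]
    exact mul_pos hc2 (lt_of_le_of_ne (htr p hp) (right_ne_zero_of_mul this).symm)

end


section

variable {Ω : Set (Eu n)} {η : Eu n → Eu n} {a f : ℝ → ℝ} {u : Eu n → ℝ} {Du : Eu n → Eu n} {H : Eu n → Eu n →L[ℝ] Eu n}

set_option maxHeartbeats 1000000 in
/-- two sides which fill the regular set: the domain is a slab -/
lemma Dat.slab (S : Dat Ω η a f u Du H) {C₁ C₂ B₁ B₂ : Set (Eu n)} {s₁ s₂ b₁ b₂ : ℝ} {Y₁ Y₂ : Eu n}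
    (D₁ : Side Ω η u Du C₁ B₁ s₁ b₁ Y₁) (D₂ : Side Ω η u Du C₂ B₂ s₂ b₂ Y₂) (hB₁ : B₁.Nonempty) (hB₂ : B₂.Nonempty)
    (hBd : Disjoint B₁ B₂) (hCd : Disjoint C₁ C₂) (hR : Reg Ω Du ⊆ C₁ ∪ C₂) :
    ∃ e : Eu n, ‖e‖ = 1 ∧ ∃ c₁ c₂ c₃ : ℝ, ∃ u₀ : ℝ → ℝ, B₁ = {x | ⟪x, e⟫ = c₁} ∧ B₂ = {x | ⟪x, e⟫ = c₂} ∧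
      frontier Ω = B₁ ∪ B₂ ∧ (∀ x ∈ Ω, u x = u₀ ⟪x, e⟫) ∧ {x ∈ Ω | gradient u x = 0} = {x | ⟪x, e⟫ = c₃} := by
  obtain ⟨e, k, I, he, hBe, hI, hCe, hkI, ⟨δ, hδ, hδI⟩, hΩk, hDe⟩ := D₁.geom S hB₁
  obtain ⟨e', k', I', he', hBe', hI', hCe', hkI', ⟨δ', hδ', hδI'⟩, hΩk', hDe'⟩ := D₂.geom S hB₂
  have hee : ⟪e, e⟫ = 1 := by rw [real_inner_self_eq_norm_sq, he]; norm_num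
  have hee' : ⟪e', e'⟫ = 1 := by rw [real_inner_self_eq_norm_sq, he']; norm_num
  have hsm : ∀ (t : ℝ) (x : Eu n), ⟪x + t • e, e⟫ = ⟪x, e⟫ + t := fun t x => by
    rw [inner_add_left, inner_smul_left, hee]; simp
  have hte : ∀ t : ℝ, ⟪t • e, e⟫ = t := fun t => by rw [inner_smul_left, hee]; simp
  have hBn : ∀ x, x ∈ B₁ → x ∈ B₂ → False := fun x h1 h2 => Set.disjoint_left.1 hBd h1 h2
  have hCn : ∀ x, x ∈ C₁ → x ∈ C₂ → False := fun x h1 h2 => Set.disjoint_left.1 hCd h1 h2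
  -- the normals are collinear
  have hcol : ⟪e', e⟫ ^ 2 = 1 := by
    by_contra hne
    set m := ⟪e', e⟫ with hm
    have hm' : ⟪e, e'⟫ = m := by rw [real_inner_comm]
    have hd : 1 - m ^ 2 ≠ 0 := fun h => hne (by linarith)
    set t : ℝ := (k' - k * m) / (1 - m ^ 2) with ht
    refine hBn (k • e + t • (e' - m • e)) ?_ ?_
    · rw [hBe]
      change ⟪k • e + t • (e' - m • e), e⟫ = k
      simp only [inner_add_left, inner_smul_left, inner_sub_left, hee, ← hm, RCLike.conj_to_real]
      ring
    · rw [hBe']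
      change ⟪k • e + t • (e' - m • e), e'⟫ = k'
      simp only [inner_add_left, inner_smul_left, inner_sub_left, hee', hm', RCLike.conj_to_real, ht]
      field_simp
      ring
  have hcol' : e' = -e := by
    have h1 : ⟪e', e⟫ = 1 ∨ ⟪e', e⟫ = -1 := by
      have h2 : (⟪e', e⟫ - 1) * (⟪e', e⟫ + 1) = 0 := by linarith
      rcases mul_eq_zero.1 h2 with h | h
      · left; linarith
      · right; linarith
    rcases h1 with h | h
    · exfalso
      have heq : e' = e := (inner_eq_one_iff_of_norm_eq_one he' he).1 h
      subst heq
      have hk : k ≠ k' := fun h => by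
        refine hBn (k • e') ?_ ?_
        · rw [hBe]; exact hte k
        · rw [hBe', ← h]; exact hte k
      rcases lt_or_gt_of_ne hk with h | h
      · have m := lt_min hδ (sub_pos.2 h)
        have m1 := min_le_left δ (k' - k)
        have m2 := min_le_right δ (k' - k)
        have hx : (k + min δ (k' - k) / 2) • e' ∈ C₁ := by
          rw [hCe]; change ⟪_, _⟫ ∈ I; rw [hte]; exact hδI ⟨by linarith, by linarith⟩
        have := hΩk' _ (D₁.sub hx)
        rw [hte] at this; linarith
      · have m := lt_min hδ' (sub_pos.2 h)
        have m1 := min_le_left δ' (k - k')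
        have m2 := min_le_right δ' (k - k')
        have hx : (k' + min δ' (k - k') / 2) • e' ∈ C₂ := by
          rw [hCe']; change ⟪_, _⟫ ∈ I'; rw [hte]; exact hδI' ⟨by linarith, by linarith⟩
        have := hΩk _ (D₂.sub hx)
        rw [hte] at this; linarith
    · have : ⟪-e', e⟫ = 1 := by rw [inner_neg_left, h, neg_neg]
      rw [← (inner_eq_one_iff_of_norm_eq_one (by rwa [norm_neg]) he).1 this, neg_neg]
  subst hcol'
  obtain ⟨K, rfl⟩ : ∃ K, k' = -K := ⟨-k', by ring⟩
  have hB2 : B₂ = {x | ⟪x, e⟫ = K} := by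
    rw [hBe']; ext x
    change ⟪x, -e⟫ = -K ↔ ⟪x, e⟫ = K
    rw [inner_neg_right, neg_inj]
  have hC1 : ∀ x, x ∈ C₁ ↔ ⟪x, e⟫ ∈ I := fun x => by rw [hCe]; rfl
  have hC2 : ∀ x, x ∈ C₂ ↔ -⟪x, e⟫ ∈ I' := fun x => by
    rw [hCe']; change ⟪x, -e⟫ ∈ I' ↔ _; rw [inner_neg_right]
  have hΩK : ∀ x ∈ Ω, ⟪x, e⟫ < K := fun x hx => by
    have := hΩk' x hx; rw [inner_neg_right] at this; linarith
  have hII : ∀ i, i ∈ I → -i ∈ I' → False := fun i h1 h2 =>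
    hCn (i • e) ((hC1 _).2 (by rwa [hte])) ((hC2 _).2 (by rwa [hte]))
  have hIK : ∀ i ∈ I, i < K := fun i hi => by
    have := hΩK (i • e) (D₁.sub ((hC1 _).2 (by rwa [hte])))
    rwa [hte] at this
  have hJk : ∀ i, -i ∈ I' → k < i := fun i hi => by
    have := hΩk (i • e) (D₂.sub ((hC2 _).2 (by rwa [hte])))
    rwa [hte] at this
  have hbdd : BddAbove I := ⟨K, fun i hi => (hIK i hi).le⟩
  have hk2 : k + δ / 2 ∈ I := hδI ⟨by linarith, by linarith⟩
  set β := sSup I with hβ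
  have hβle : ∀ i ∈ I, i ≤ β := fun i hi => le_csSup hbdd hi
  have hkβ : k < β := by linarith [hβle _ hk2]
  have hβI : ∀ t, k < t → t < β → t ∈ I := by
    intro t h1 h2
    obtain ⟨i, hi, hti⟩ := exists_lt_of_lt_csSup ⟨_, hk2⟩ h2
    have m := lt_min hδ (sub_pos.2 h1)
    have m1 := min_le_left δ (t - k)
    have m2 := min_le_right δ (t - k)
    exact hI.out (hδI (a := k + min δ (t - k) / 2) ⟨by linarith, by linarith⟩) hi ⟨by linarith, hti.le⟩
  have hβK : β ≤ K := csSup_le ⟨_, hk2⟩ fun i hi => (hIK i hi).le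
  clear_value β
  have hKI' : ∀ d > 0, ∃ t, K - d < t ∧ t < K ∧ -t ∈ I' := by
    intro d hd
    have m := lt_min hδ' hd
    have m1 := min_le_left δ' d
    have m2 := min_le_right δ' d
    exact ⟨K - min δ' d / 2, by linarith, by linarith, hδI' ⟨by linarith, by linarith⟩⟩
  have hβK' : β < K := by
    rcases hβK.lt_or_eq with h | h
    · exact h
    · exfalso
      obtain ⟨t, h1, h2, h3⟩ := hKI' (K - k) (by linarith)
      exact hII t (hβI t (by linarith) (by linarith)) h3
  have hβn : β ∉ I := by
    intro h
    have hx : β • e ∈ C₁ := (hC1 _).2 (by rwa [hte])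
    have hev : ∀ᶠ t : ℝ in 𝓝[>] 0, β • e + t • e ∈ C₁ := by
      have : Tendsto (fun t : ℝ => β • e + t • e) (𝓝[>] 0) (𝓝 (β • e)) := by
        have := ((by fun_prop : Continuous fun t : ℝ => β • e + t • e).tendsto 0).mono_left (nhdsWithin_le_nhds (s := Ioi 0))
        simpa using this
      exact this.eventually (D₁.op.mem_nhds hx)
    obtain ⟨t, ht, ht0⟩ := (hev.and self_mem_nhdsWithin).exists
    have h3 := hβle _ ((hC1 _).1 ht)
    rw [hsm, hte] at h3
    have h4 : (0:ℝ) < t := ht0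
    linarith
  have hβn' : -β ∉ I' := by
    intro h
    have hx : β • e ∈ C₂ := (hC2 _).2 (by rwa [hte])
    have hev : ∀ᶠ t : ℝ in 𝓝[<] 0, β • e + t • e ∈ C₂ := by
      have : Tendsto (fun t : ℝ => β • e + t • e) (𝓝[<] 0) (𝓝 (β • e)) := by
        have := ((by fun_prop : Continuous fun t : ℝ => β • e + t • e).tendsto 0).mono_left (nhdsWithin_le_nhds (s := Iio 0))
        simpa using this
      exact this.eventually (D₂.op.mem_nhds hx)
    obtain ⟨t, ht, ht0⟩ := (hev.and self_mem_nhdsWithin).exists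
    have h3 := (hC2 _).1 ht
    have h4 : t < 0 := ht0
    rw [hsm, hte] at h3
    exact hII _ (hβI _ (hJk _ h3) (by linarith)) h3
  have hlc : Continuous fun x : Eu n => ⟪x, e⟫ := by fun_prop
  have hβJ : ∀ t, β < t → t < K → -t ∈ I' := by
    intro t h1 h2
    by_contra hn
    obtain ⟨r, hr1, hr2, hr3⟩ := hKI' (K - t) (by linarith)
    have hnone : ∀ i, i ≤ t → -i ∉ I' := fun i hi h =>
      hn (hI'.out hr3 h ⟨by linarith, by linarith⟩)
    obtain ⟨z, hz, hze⟩ := (S.pre.image _ hlc.continuousOn).ordConnected.out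
      (mem_image_of_mem _ (D₁.sub ((hC1 ((k + δ / 2) • e)).2 (by rw [hte]; exact hk2))))
      (mem_image_of_mem _ (D₂.sub ((hC2 (r • e)).2 (by rw [hte]; exact hr3))))
      (show (β + t) / 2 ∈ Icc ⟪(k + δ / 2) • e, e⟫ ⟪r • e, e⟫ from by
        rw [hte, hte]; exact ⟨by linarith [hβle _ hk2], by linarith⟩)
    have hze' : ⟪z, e⟫ = (β + t) / 2 := hze
    obtain ⟨x, ⟨hx, hx1, hx2⟩, hne⟩ := S.crit_dense
      (O := Ω ∩ ((fun x : Eu n => ⟪x, e⟫) ⁻¹' Ioo β t)) (S.op.inter (isOpen_Ioo.preimage hlc)) inter_subset_left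
      ⟨z, hz, by rw [mem_preimage, hze']; exact ⟨by linarith, by linarith⟩⟩
    have hx1' : β < ⟪x, e⟫ := hx1
    have hx2' : ⟪x, e⟫ < t := hx2
    rcases hR ⟨hx, hne⟩ with h | h
    · linarith [hβle _ ((hC1 x).1 h)]
    · exact hnone _ hx2'.le ((hC2 x).1 h)
  have hin : ∀ x : Eu n, k < ⟪x, e⟫ → ⟪x, e⟫ < K → ⟪x, e⟫ ≠ β → x ∈ Ω := by
    intro x h1 h2 h3
    rcases lt_or_gt_of_ne h3 with h | h
    · exact D₁.sub ((hC1 x).2 (hβI _ h1 h))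
    · exact D₂.sub ((hC2 x).2 (hβJ _ h h2))
  have hinβ : ∀ x : Eu n, ⟪x, e⟫ = β → x ∈ Ω := by
    intro x hx
    by_contra hxn
    have hd0 : 0 < min (K - β) (β - k) := lt_min (by linarith) (by linarith)
    have hm1 := min_le_left (K - β) (β - k)
    have hm2 := min_le_right (K - β) (β - k)
    set d := min (K - β) (β - k) with hd
    clear_value d
    have hcl : x ∈ closure Ω := by
      rw [Metric.mem_closure_iff]
      intro ε hε
      have m := lt_min hε hd0
      have m1 := min_le_left ε d
      have m2 := min_le_right ε d
      refine ⟨x + (min ε d / 2) • e, hin _ ?_ ?_ ?_, ?_⟩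
      · rw [hsm, hx]; linarith
      · rw [hsm, hx]; linarith
      · rw [hsm, hx]; linarith
      · rw [dist_eq_norm, sub_add_cancel_left, norm_neg, norm_smul, he, mul_one, Real.norm_of_nonneg (by linarith)]
        linarith
    have hxf : x ∈ frontier Ω := by rw [S.op.frontier_eq]; exact ⟨hcl, hxn⟩
    obtain ⟨r, L, hch⟩ := exists_chart S.dom hxf
    have hr := hch.hr
    have hL := hch.hK
    have hη2 : ⟪η x, η x⟫ = 1 := by rw [real_inner_self_eq_norm_sq, hch.unit]; norm_num
    obtain ⟨v, hv1, hv2, hv3⟩ : ∃ v : Eu n, ⟪v, η x⟫ = -1 ∧ ⟪v, e⟫ ≠ 0 ∧ ‖v‖ ≤ 2 := by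
      by_cases h : ⟪η x, e⟫ = 0
      · refine ⟨e - η x, ?_, ?_, ?_⟩
        · rw [inner_sub_left, hη2, real_inner_comm, h]; norm_num
        · rw [inner_sub_left, hee, h]; norm_num
        · refine (norm_sub_le _ _).trans ?_
          rw [he, hch.unit]; norm_num
      · refine ⟨-η x, ?_, ?_, ?_⟩
        · rw [inner_neg_left, hη2]
        · rw [inner_neg_left]; exact neg_ne_zero.2 h
        · rw [norm_neg, hch.unit]; norm_num
    set t : ℝ := min (min (r / 2) (d / 4)) (1 / (4 * L)) with ht
    have ht0 : 0 < t := by positivity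
    have ht1 : t ≤ r / 2 := (min_le_left _ _).trans (min_le_left _ _)
    have ht2 : t ≤ d / 4 := (min_le_left _ _).trans (min_le_right _ _)
    have ht3 : 4 * L * t ≤ 1 := by
      have : t ≤ 1 / (4 * L) := min_le_right _ _
      rw [le_div_iff₀ (by positivity)] at this; linarith
    clear_value t
    have e1 : x + t • v - x = t • v := by abel
    have nt : ‖t • v‖ ≤ 2 * t := by
      rw [norm_smul, Real.norm_of_nonneg ht0.le]; nlinarith
    have hve : |⟪v, e⟫| ≤ 2 := by
      refine (abs_real_inner_le_norm _ _).trans ?_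
      rw [he, mul_one]; exact hv3
    have hve' := abs_le.1 hve
    have hi : ⟪x + t • v, e⟫ = β + t * ⟪v, e⟫ := by
      rw [inner_add_left, inner_smul_left, hx]; simp
    refine hch.out (x + t • v) (by rw [e1]; linarith) ?_ (hin _ ?_ ?_ ?_)
    · rw [e1, inner_smul_left, hv1]
      simp only [RCLike.conj_to_real]
      have : ‖t • v‖ ^ 2 ≤ (2 * t) ^ 2 := by gcongr
      nlinarith [mul_le_mul_of_nonneg_left this hL.le, mul_le_mul_of_nonneg_left ht3 ht0.le]
    · rw [hi]; nlinarith
    · rw [hi]; nlinarith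
    · rw [hi]; intro h
      exact (mul_ne_zero ht0.ne' hv2) (by linarith)
  have hΩ : ∀ x : Eu n, x ∈ Ω ↔ k < ⟪x, e⟫ ∧ ⟪x, e⟫ < K := by
    intro x
    refine ⟨fun h => ⟨hΩk x h, hΩK x h⟩, fun h => ?_⟩
    by_cases hx : ⟪x, e⟫ = β
    · exact hinβ x hx
    · exact hin x h.1 h.2 hx
  have hcrit : ∀ x ∈ Ω, Du x = 0 ↔ ⟪x, e⟫ = β := by
    intro x hx
    constructor
    · intro h
      by_contra hne
      rcases lt_or_gt_of_ne hne with h' | h'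
      · exact D₁.Dne x ((hC1 x).2 (hβI _ (hΩk x hx) h')) h
      · exact D₂.Dne x ((hC2 x).2 (hβJ _ h' (hΩK x hx))) h
    · intro h
      by_contra hne
      rcases hR ⟨hx, hne⟩ with h' | h'
      · exact hβn (h ▸ (hC1 x).1 h')
      · exact hβn' (h ▸ (hC2 x).1 h')
  refine ⟨e, he, k, K, β, fun t => u (t • e), hBe, hB2, ?_, ?_, ?_⟩
  · refine Subset.antisymm (fun x hx => ?_) (union_subset D₁.Bsub D₂.Bsub)
    have hcl := frontier_subset_closure hx
    have h1 : k ≤ ⟪x, e⟫ := closure_minimal (fun y hy => (hΩk y hy).le) (isClosed_le continuous_const hlc) hcl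
    have h2 : ⟪x, e⟫ ≤ K := closure_minimal (fun y hy => (hΩK y hy).le) (isClosed_le hlc continuous_const) hcl
    rw [S.op.frontier_eq] at hx
    rcases h1.eq_or_lt with h | h
    · left; rw [hBe]; exact h.symm
    · right; rw [hB2]
      rcases h2.eq_or_lt with h' | h'
      · exact h'
      · exact absurd ((hΩ x).2 ⟨h, h'⟩) hx.2
  · intro x hx
    set y := ⟪x, e⟫ • e with hy
    have hw : ⟪y - x, e⟫ = 0 := by rw [inner_sub_left, hy, hte, sub_self]
    have hpath : ∀ r : ℝ, x + r • (y - x) ∈ Ω := fun r => by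
      have : ⟪x + r • (y - x), e⟫ = ⟪x, e⟫ := by rw [inner_add_left, inner_smul_left, hw]; simp
      rw [hΩ, this]; exact (hΩ x).1 hx
    have hz : ∀ z ∈ Ω, ⟪Du z, y - x⟫ = 0 := by
      intro z hz
      by_cases h0 : Du z = 0
      · rw [h0, inner_zero_left]
      rcases hR ⟨hz, h0⟩ with h | h
      · rw [hDe z h, inner_smul_left, real_inner_comm, hw, mul_zero]
      · rw [hDe' z h, inner_smul_left, inner_neg_left, real_inner_comm, hw, neg_zero, mul_zero]
    have hl : ∀ r : ℝ, HasDerivAt (fun r : ℝ => x + r • (y - x)) (y - x) r := fun r => by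
      simpa using ((hasDerivAt_id r).smul_const (y - x)).const_add x
    have hu' : ∀ r : ℝ, HasDerivAt (fun r : ℝ => u (x + r • (y - x))) 0 r := fun r => by
      have := (S.hasD1 (hpath r)).comp_hasDerivAt r (hl r)
      rwa [innerSL_apply_apply, hz _ (hpath r)] at this
    have := is_const_of_deriv_eq_zero (fun r => (hu' r).differentiableAt) (fun r => (hu' r).deriv) 0 1
    simpa using this
  · ext x
    change (x ∈ Ω ∧ gradient u x = 0) ↔ ⟪x, e⟫ = β
    constructor
    · rintro ⟨hx, hg⟩
      rw [← S.hDu x hx] at hg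
      exact (hcrit x hx).1 hg
    · intro h
      have hx := hinβ x h
      exact ⟨hx, by rw [← S.hDu x hx]; exact (hcrit x hx).2 h⟩

end


/-- Theorem 5.3 of the paper, in `ℝⁿ`. -/
theorem gluing_theorem
    (n : ℕ) (Ω : Set (EuclideanSpace ℝ (Fin n)))
    (η : EuclideanSpace ℝ (Fin n) → EuclideanSpace ℝ (Fin n))
    (hΩ : IsCkDomainWithNormal 2 Ω η)
    (hdisc : ¬ IsPreconnected (frontier Ω))
    (a : ℝ → ℝ) (ha : C11Loc a)
    (hapos : ∀ t ≥ (0 : ℝ), 0 < a t) (hlam : ∀ t ≥ (0 : ℝ), 0 < lam1 a t)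
    (f : ℝ → ℝ) (hf : ContDiff ℝ 1 f)
    (u : EuclideanSpace ℝ (Fin n) → ℝ)
    (hu3 : ContDiffOn ℝ 3 u Ω) (hucl : ContinuousOn u (closure Ω))
    (Du : EuclideanSpace ℝ (Fin n) → EuclideanSpace ℝ (Fin n))
    (hDu : ∀ x ∈ Ω, Du x = gradient u x) (hDuc : ContinuousOn Du (closure Ω))
    (hD2u : ∃ H : EuclideanSpace ℝ (Fin n) →
        EuclideanSpace ℝ (Fin n) →L[ℝ] EuclideanSpace ℝ (Fin n),
      ContinuousOn H (closure Ω) ∧ ∀ x ∈ Ω, H x = fderiv ℝ (gradient u) x)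
    (hnc : ¬ ∃ c : ℝ, ∀ x ∈ Ω, u x = c)
    (hsol : IsWeakSolution a f Ω u) (hstab : IsStable a f Ω u)
    (hulc : ∀ p ∈ frontier Ω, ∃ V ∈ 𝓝 p, ∀ q ∈ V ∩ frontier Ω,
      u q = u p ∧ ⟪Du q, η q⟫ = ⟪Du p, η p⟫)
    (hmeg : ModerateEnergyGrowth a u Ω)
    (p₁ p₂ : EuclideanSpace ℝ (Fin n))
    (hp₁ : p₁ ∈ frontier Ω) (hp₂ : p₂ ∈ frontier Ω)
    (hne : connectedComponentIn (frontier Ω) p₁ ≠ connectedComponentIn (frontier Ω) p₂)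
    (X₁ X₂ : EuclideanSpace ℝ (Fin n)) (hX₁ : ‖X₁‖ = 1) (hX₂ : ‖X₂‖ = 1)
    (htr1 : ∀ p ∈ connectedComponentIn (frontier Ω) p₁, 0 ≤ ⟪η p, X₁⟫)
    (htr1' : ∃ p ∈ connectedComponentIn (frontier Ω) p₁, ⟪η p, X₁⟫ ≠ 0)
    (htr2 : ∀ p ∈ connectedComponentIn (frontier Ω) p₂, 0 ≤ ⟪η p, X₂⟫)
    (htr2' : ∃ p ∈ connectedComponentIn (frontier Ω) p₂, ⟪η p, X₂⟫ ≠ 0)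
    (hrest : ∀ p ∈ frontier Ω, p ∉ connectedComponentIn (frontier Ω) p₁ →
      p ∉ connectedComponentIn (frontier Ω) p₂ → ⟪Du p, η p⟫ = 0) :
    ({x ∈ Ω | gradient u x = 0}.Nonempty →
      ∀ p ∈ connectedComponentIn (frontier Ω) p₁ ∪ connectedComponentIn (frontier Ω) p₂,
        Du p ≠ 0) ∧
    (∀ Γ : Set (EuclideanSpace ℝ (Fin n)), Γ ⊆ {x ∈ Ω | gradient u x = 0} →
      ¬ IsPreconnected (Ω \ Γ) →
      ∃ e : EuclideanSpace ℝ (Fin n), ‖e‖ = 1 ∧ ∃ c₁ c₂ c₃ : ℝ, ∃ u₀ : ℝ → ℝ,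
        connectedComponentIn (frontier Ω) p₁ = {x | ⟪x, e⟫ = c₁} ∧
        connectedComponentIn (frontier Ω) p₂ = {x | ⟪x, e⟫ = c₂} ∧
        frontier Ω = connectedComponentIn (frontier Ω) p₁ ∪
          connectedComponentIn (frontier Ω) p₂ ∧
        (∀ x ∈ Ω, u x = u₀ ⟪x, e⟫) ∧
        {x ∈ Ω | gradient u x = 0} = {x | ⟪x, e⟫ = c₃}) := by
  obtain ⟨H, hHc, hH⟩ := hD2u
  have S : Dat Ω η a f u Du H :=
    { dom := hΩ, ha := ha, hapos := hapos, hlam := hlam, hf := hf, hu3 := hu3, hucl := hucl, hDu := hDu, hDuc := hDuc,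
      hHc := hHc, hH := hH, hnc := hnc, sol := hsol, stab := hstab, hulc := hulc, hmeg := hmeg }
  have hc : ∀ x₀ ∈ Ω, Du x₀ = 0 → ⟪Du p₁, η p₁⟫ ≠ 0 ∧ ⟪Du p₂, η p₂⟫ ≠ 0 := fun x₀ hx₀ h0 =>
    ⟨S.part1 hp₁ hp₂ htr2 htr2' hrest hx₀ h0,
     S.part1 hp₂ hp₁ htr1 htr1' (fun p hp h2 h1 => hrest p hp h1 h2) hx₀ h0⟩
  refine ⟨?_, ?_⟩
  · rintro ⟨x₀, hx₀, hg⟩ p hp h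
    rw [← hDu x₀ hx₀] at hg
    obtain ⟨hc1, hc2⟩ := hc x₀ hx₀ hg
    rcases hp with hp | hp
    · rw [S.Du_ne_iff (connectedComponentIn_subset _ _ hp), (S.comp_const hp₁ hp).2] at h
      exact hc1 h
    · rw [S.Du_ne_iff (connectedComponentIn_subset _ _ hp), (S.comp_const hp₂ hp).2] at h
      exact hc2 h
  intro Γ hΓ hΓd
  obtain ⟨x₀, hx₀, hg⟩ : ∃ x₀ ∈ Ω, Du x₀ = 0 := by
    by_contra! hno
    have hΓe : Γ = ∅ := by
      refine Set.eq_empty_of_forall_notMem fun x hx => ?_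
      obtain ⟨h1, h2⟩ := hΓ hx
      exact hno x h1 (by rw [hDu x h1]; exact h2)
    rw [hΓe, sdiff_empty] at hΓd
    exact hΓd S.pre
  obtain ⟨hc1, hc2⟩ := hc x₀ hx₀ hg
  obtain ⟨z₁, hz₁, hn₁⟩ := S.side_comp hp₁ hc1
  obtain ⟨z₂, hz₂, hn₂⟩ := S.side_comp hp₂ hc2
  have hmeet : ∀ (p z z' : EuclideanSpace ℝ (Fin n)) (ρ : ℝ), 0 < ρ → Ω ∩ ball p ρ ⊆ connectedComponentIn (Reg Ω Du) z →
      p ∈ closure (connectedComponentIn (Reg Ω Du) z') →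
      connectedComponentIn (Reg Ω Du) z' = connectedComponentIn (Reg Ω Du) z := by
    intro p z z' ρ hρ hs hp
    rw [Metric.mem_closure_iff] at hp
    obtain ⟨y, hy, hyd⟩ := hp ρ hρ
    refine comp_eq_of_meet hy (hs ⟨(connectedComponentIn_subset _ _ hy).1, ?_⟩)
    rwa [mem_ball, dist_comm]
  have hcases : ∀ z, ∀ y ∈ closure (connectedComponentIn (Reg Ω Du) z), Du y ≠ 0 →
      y ∈ connectedComponentIn (Reg Ω Du) z ∨
      (y ∈ connectedComponentIn (frontier Ω) p₁ ∧
        connectedComponentIn (Reg Ω Du) z = connectedComponentIn (Reg Ω Du) z₁) ∨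
      (y ∈ connectedComponentIn (frontier Ω) p₂ ∧
        connectedComponentIn (Reg Ω Du) z = connectedComponentIn (Reg Ω Du) z₂) := by
    intro z y hy hne
    by_cases hyΩ : y ∈ Ω
    · left
      have hyR : y ∈ Reg Ω Du := ⟨hyΩ, hne⟩
      have hym := mem_connectedComponentIn hyR
      obtain ⟨w, hw1, hw2⟩ := _root_.mem_closure_iff.1 hy _ (S.Reg_open.connectedComponentIn (x := y)) hym
      rw [comp_eq_of_meet hw2 hw1]; exact hym
    · right
      have hyf : y ∈ frontier Ω := by
        rw [S.op.frontier_eq]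
        exact ⟨closure_mono (fun x hx => (connectedComponentIn_subset _ _ hx).1) hy, hyΩ⟩
      by_cases h1 : y ∈ connectedComponentIn (frontier Ω) p₁
      · obtain ⟨ρ, hρ, hs⟩ := hn₁ y h1
        exact Or.inl ⟨h1, hmeet y z₁ z ρ hρ hs hy⟩
      by_cases h2 : y ∈ connectedComponentIn (frontier Ω) p₂
      · obtain ⟨ρ, hρ, hs⟩ := hn₂ y h2
        exact Or.inr ⟨h2, hmeet y z₂ z ρ hρ hs hy⟩
      exact absurd ((S.Du_ne_iff hyf).2 (hrest y hyf h1 h2)) hne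
  have hR : Reg Ω Du ⊆ connectedComponentIn (Reg Ω Du) z₁ ∪ connectedComponentIn (Reg Ω Du) z₂ := by
    intro z hz
    by_contra hno
    have hzm := mem_connectedComponentIn hz
    have := S.nonpos (S.Reg_open.connectedComponentIn (x := z))
      (fun x hx => (connectedComponentIn_subset _ _ hx).1) (Y := Du z) (fun y hy hyn => ?_) hx₀ hg z hzm
    · rw [real_inner_self_eq_norm_sq] at this
      have h2 := norm_pos_iff.2 hz.2
      nlinarith
    · by_cases h0 : Du y = 0
      · rw [h0, inner_zero_left]
      rcases hcases z y hy h0 with h | ⟨-, h⟩ | ⟨-, h⟩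
      · exact absurd h hyn
      · exact absurd (Or.inl (h ▸ hzm)) hno
      · exact absurd (Or.inr (h ▸ hzm)) hno
  have hC12 : connectedComponentIn (Reg Ω Du) z₁ ≠ connectedComponentIn (Reg Ω Du) z₂ := by
    intro h
    rw [← h, union_self] at hR
    have hpre : IsPreconnected (Reg Ω Du) := by
      rw [Subset.antisymm hR (connectedComponentIn_subset _ _)]
      exact isPreconnected_connectedComponentIn
    refine hΓd (hpre.subset_closure (fun x hx => ⟨hx.1, fun hxΓ => hx.2 ?_⟩) (fun x hx => ?_))
    · rw [hDu x hx.1]; exact (hΓ hxΓ).2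
    · rw [_root_.mem_closure_iff]
      intro o ho hxo
      obtain ⟨y, hy, hyn⟩ := S.crit_dense (ho.inter S.op) inter_subset_right ⟨x, hxo, hx.1⟩
      exact ⟨y, hy.1, hy.2, hyn⟩
  obtain ⟨s₁, D₁⟩ := S.mkSide hp₁ hc1 htr1 htr1' hn₁ (fun y hy hne => by
    rcases hcases z₁ y hy hne with h | ⟨h, -⟩ | ⟨-, h⟩
    · exact Or.inl h
    · exact Or.inr h
    · exact absurd h hC12) hx₀ hg
  obtain ⟨s₂, D₂⟩ := S.mkSide hp₂ hc2 htr2 htr2' hn₂ (fun y hy hne => by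
    rcases hcases z₂ y hy hne with h | ⟨-, h⟩ | ⟨h, -⟩
    · exact Or.inl h
    · exact absurd h.symm hC12
    · exact Or.inr h) hx₀ hg
  refine S.slab D₁ D₂ ⟨p₁, mem_connectedComponentIn hp₁⟩ ⟨p₂, mem_connectedComponentIn hp₂⟩ ?_ ?_ hR
  · exact Set.disjoint_left.2 fun x h1 h2 => hne (comp_eq_of_meet h1 h2)
  · exact Set.disjoint_left.2 fun x h1 h2 => hC12 (comp_eq_of_meet h1 h2)
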